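/- Let n ≥ 2. There exist positive constants C_mc, β, β₁, C̄ depending only on n, a positive exponent a depending only on n and f_max, and (for each ρ > 0) a positive constant K depending only on n, f_max, ρ, such that the following holds. Let Ω ⊆ ℝⁿ be a convex open set with B₁ ⊆ Ω ⊆ B_n, and let v ∈ C²(Ω) ∩ C⁰(Ω̄) be a convex function with (det D²v)^{1/n} = f in Ω, v = 0 on ∂Ω, and 1 ≤ f ≤ f_max in Ω for a constant f_max. Fix ρ > 0 and q_in ∈ (0, ρ] with ω_{f|Ω_{ρ−q_in}}(q_in) ≤ C_mc, and set Q_in := K q_in^{−a}. For x, x′ ∈ Ω_ρ with d̄ := |x − x′| > 0, set E_{d̄} := exp(β ∫_{C̄ d̄}^{q_in} ω_f(q) dq/q) (the integral interpreted as 0 if C̄ d̄ ≥ q_in). Then |D v(x) − D v(x′)|/d̄ ≤ Q_in (E_{d̄} + E_{d̄}^{β₁} ω_f(Q_in E_{d̄} d̄)) if Q_in d̄ < 1, and |D v(x) − D v(x′)|/d̄ ≤ Q_in if Q_in d̄ ≥ 1. -/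

import Mathlib

open scoped RealInnerProductSpace
open MeasureTheory
noncomputable section
set_option linter.all false

abbrev Euc (n : ℕ) := EuclideanSpace ℝ (Fin n)

/-- Hessian matrix of `u` at `x`. -/
def hessianMatrix {n : ℕ} (u : Euc n → ℝ) (x : Euc n) : Matrix (Fin n) (Fin n) ℝ :=
  Matrix.of fun i j =>
    iteratedFDeriv ℝ 2 u x ![EuclideanSpace.single i 1, EuclideanSpace.single j 1]

/-- Determinant of the Hessian of `u` at `x`. -/
def hessDet {n : ℕ} (u : Euc n → ℝ) (x : Euc n) : ℝ := (hessianMatrix u x).det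

/-- Modulus of continuity of `f` on `U` at scale `q`. -/
def modCont {n : ℕ} (f : Euc n → ℝ) (U : Set (Euc n)) (q : ℝ) : ℝ :=
  sSup {c : ℝ | ∃ x ∈ U, ∃ y ∈ U, dist x y ≤ q ∧ c = |f x - f y|}

/-- `Ω_ρ`, the points of `Ω` at distance more than `ρ` from the boundary. -/
def innerSet {n : ℕ} (Ω : Set (Euc n)) (ρ : ℝ) : Set (Euc n) :=
  {x ∈ Ω | ρ < Metric.infDist x (frontier Ω)}

open Asymptotics Filter Topology Matrix Metric

theorem mulL {a b c : ℝ} (h : b ≤ c) (ha : 0 ≤ a) : a * b ≤ a * c := mul_le_mul_of_nonneg_left h ha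

theorem mulR {a b c : ℝ} (h : b ≤ c) (ha : 0 ≤ a) : b * a ≤ c * a := mul_le_mul_of_nonneg_right h ha

/-- One-dimensional second order Peano expansion at `0`. -/
def P2 (φ : ℝ → ℝ) (a b c : ℝ) : Prop :=
  (fun t => φ t - (a + b * t + c * t ^ 2 / 2)) =o[𝓝 0] (fun t => t ^ 2)

theorem P2.of_eq {φ : ℝ → ℝ} {a b c a' b' c' : ℝ} (h : P2 φ a b c) (ha : a = a') (hb : b = b')
    (hc : c = c') : P2 φ a' b' c' := by subst ha hb hc; exact h

theorem P2.congr' {φ ψ : ℝ → ℝ} {a b c : ℝ} (h : P2 φ a b c) (e : φ =ᶠ[𝓝 0] ψ) : P2 ψ a b c := by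
  refine IsLittleO.congr' h ?_ EventuallyEq.rfl
  filter_upwards [e] with t ht
  rw [ht]

theorem P2.add {φ ψ : ℝ → ℝ} {a b c a' b' c' : ℝ} (h : P2 φ a b c) (h' : P2 ψ a' b' c') :
    P2 (fun t => φ t + ψ t) (a + a') (b + b') (c + c') := by
  refine (IsLittleO.add h h').congr_left ?_
  intro t; ring

theorem P2.const_mul {φ : ℝ → ℝ} {a b c : ℝ} (k : ℝ) (h : P2 φ a b c) :
    P2 (fun t => k * φ t) (k * a) (k * b) (k * c) := by
  refine (IsLittleO.const_mul_left h k).congr_left ?_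
  intro t; ring

theorem P2.sub {φ ψ : ℝ → ℝ} {a b c a' b' c' : ℝ} (h : P2 φ a b c) (h' : P2 ψ a' b' c') :
    P2 (fun t => φ t - ψ t) (a - a') (b - b') (c - c') := by
  refine (IsLittleO.sub h h').congr_left ?_
  intro t; ring

theorem P2.neg {φ : ℝ → ℝ} {a b c : ℝ} (h : P2 φ a b c) :
    P2 (fun t => - φ t) (-a) (-b) (-c) := by
  refine (IsLittleO.neg_left h).congr_left ?_
  intro t; ring

theorem P2_quad (a b c : ℝ) : P2 (fun t => a + b * t + c * t ^ 2 / 2) a b c := by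
  unfold P2; simp

theorem P2_const (a : ℝ) : P2 (fun _ => a) a 0 0 := by
  unfold P2; simp

theorem P2.lin {φ : ℝ → ℝ} {a b c : ℝ} (h : P2 φ a b c) :
    (fun t => φ t - a - b * t) =O[𝓝 0] (fun t => t ^ 2) := by
  have h1 : (fun t : ℝ => c * t ^ 2 / 2) =O[𝓝 0] (fun t => t ^ 2) := by
    refine ((isBigO_refl (fun t : ℝ => t ^ 2) (𝓝 0)).const_mul_left (c / 2)).congr_left ?_
    intro t; ring
  refine (h.isBigO.add h1).congr_left ?_
  intro t; ring

theorem sq_isBigO_id : (fun t : ℝ => t ^ 2) =O[𝓝 0] (fun t => t) := by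
  refine IsBigO.of_bound 1 ?_
  filter_upwards [ball_mem_nhds (0 : ℝ) one_pos] with t ht
  simp only [mem_ball, dist_zero_right, Real.norm_eq_abs] at ht
  simp only [norm_pow, Real.norm_eq_abs]
  nlinarith [abs_nonneg t]

theorem sq_isLittleO_id : (fun t : ℝ => t ^ 2) =o[𝓝 0] (fun t => t) := by
  have : (fun t : ℝ => t ^ 2) =o[𝓝 0] (fun t => t ^ 1) := isLittleO_pow_pow (by norm_num)
  simpa using this

theorem P2.bigO {φ : ℝ → ℝ} {a b c : ℝ} (h : P2 φ a b c) :
    (fun t => φ t - a) =O[𝓝 0] (fun t => t) := by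
  have h1 := h.lin.trans sq_isBigO_id
  have h2 : (fun t : ℝ => b * t) =O[𝓝 0] (fun t => t) :=
    (isBigO_refl (fun t : ℝ => t) (𝓝 0)).const_mul_left b
  refine (h1.add h2).congr_left ?_
  intro t; ring

theorem P2.val {φ : ℝ → ℝ} {a b c : ℝ} (h : P2 φ a b c) : φ 0 = a := by
  have h2 := h.bigO
  have := IsBigO.eq_zero_imp h2
  have := this.self_of_nhds
  have := this rfl
  linarith

theorem P2.comp {F φ : ℝ → ℝ} {a b c A B C : ℝ} (hF : P2 (fun s => F (a + s)) A B C)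
    (h : P2 φ a b c) : P2 (fun t => F (φ t)) A (B * b) (C * b ^ 2 + B * c) := by
  have ht : Tendsto (fun t => φ t - a) (𝓝 0) (𝓝 0) := h.bigO.trans_tendsto tendsto_id
  have h1 := (IsLittleO.comp_tendsto hF ht)
  have h2 : (fun t => (φ t - a) ^ 2) =O[𝓝 0] (fun t => t ^ 2) := h.bigO.pow 2
  have h3 := h1.trans_isBigO (by simpa [Function.comp_def] using h2)
  have h4 : (fun t => B * (φ t - (a + b * t + c * t ^ 2 / 2))) =o[𝓝 0] (fun t => t ^ 2) :=
    IsLittleO.const_mul_left h B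
  -- (φ-a)^2 - b^2 t^2 = (φ - a - bt)(φ-a+bt)
  have h5 : (fun t => (φ t - a - b * t) * (φ t - a + b * t)) =o[𝓝 0] (fun t : ℝ => t ^ 2) := by
    have e1 : (fun t : ℝ => φ t - a - b * t) =o[𝓝 0] (fun t => t) :=
      h.lin.trans_isLittleO sq_isLittleO_id
    have e2 : (fun t : ℝ => φ t - a + b * t) =O[𝓝 0] (fun t => t) :=
      h.bigO.add ((isBigO_refl (fun t : ℝ => t) (𝓝 0)).const_mul_left b)
    refine (e1.mul_isBigO e2).congr_right ?_
    intro t; ring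
  refine ((h3.add h4).add (h5.const_mul_left (C / 2))).congr_left ?_
  intro t
  simp only [Function.comp_def]
  rw [show a + (φ t - a) = φ t by ring]
  ring

theorem P2.sq {φ : ℝ → ℝ} {a b c : ℝ} (h : P2 φ a b c) :
    P2 (fun t => φ t ^ 2) (a ^ 2) (2 * a * b) (2 * b ^ 2 + 2 * a * c) := by
  have := P2.comp (F := fun s => s ^ 2) (A := a ^ 2) (B := 2 * a) (C := 2)
    ((P2_quad (a ^ 2) (2 * a) 2).congr' (by filter_upwards with t; ring)) h
  exact this

theorem P2.mul {φ ψ : ℝ → ℝ} {a b c a' b' c' : ℝ} (h : P2 φ a b c) (h' : P2 ψ a' b' c') :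
    P2 (fun t => φ t * ψ t) (a * a') (a * b' + a' * b) (a * c' + 2 * b * b' + a' * c) := by
  have := (((h.add h').sq.sub (h.sub h').sq).const_mul (1 / 4))
  refine (this.congr' (by filter_upwards with t; ring)).of_eq ?_ ?_ ?_ <;> ring

/-- From derivatives. -/
theorem P2_of_deriv {φ φ' : ℝ → ℝ} {c : ℝ} (h : ∀ᶠ t in 𝓝 0, HasDerivAt φ (φ' t) t)
    (h' : HasDerivAt φ' c 0) : P2 φ (φ 0) (φ' 0) c := by
  rw [P2, isLittleO_iff]
  intro ε hε
  have h2 := (hasDerivAt_iff_isLittleO_nhds_zero.1 h')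
  rw [isLittleO_iff] at h2
  have h3 := h2 hε
  obtain ⟨r, hr, hb⟩ := Metric.eventually_nhds_iff_ball.1 (h.and h3)
  filter_upwards [ball_mem_nhds (0 : ℝ) hr] with t ht
  have hseg : ∀ s ∈ segment ℝ 0 t, s ∈ ball (0 : ℝ) r ∧ ‖s‖ ≤ ‖t‖ := by
    intro s hs
    have h0 : (0 : ℝ) ∈ closedBall (0 : ℝ) ‖t‖ := by simp
    have h1 : t ∈ closedBall (0 : ℝ) ‖t‖ := by simp
    have := (convex_closedBall (0 : ℝ) ‖t‖).segment_subset h0 h1 hs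
    simp only [mem_closedBall, dist_zero_right] at this
    simp only [mem_ball, dist_zero_right] at ht ⊢
    exact ⟨lt_of_le_of_lt this ht, this⟩
  have key := (convex_segment (0 : ℝ) t).norm_image_sub_le_of_norm_hasDerivWithin_le
    (f := fun s => φ s - (φ 0 + φ' 0 * s + c * s ^ 2 / 2)) (f' := fun s => φ' s - (φ' 0 + c * s))
    (C := ε * ‖t‖) (x := 0) (y := t) ?_ ?_ (left_mem_segment ℝ 0 t) (right_mem_segment ℝ 0 t)
  · simp only [sub_zero, norm_pow, mul_zero, add_zero, ne_eq, OfNat.ofNat_ne_zero,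
      not_false_eq_true, zero_pow, zero_div, sub_self] at key ⊢
    calc _ ≤ _ := key
      _ = _ := by ring
  · intro s hs
    have hd := (hb s (hseg s hs).1).1
    have := hd.sub (((hasDerivAt_id s).const_mul (φ' 0)).const_add (φ 0) |>.add
      ((((hasDerivAt_id s).pow 2).const_mul c).div_const 2))
    refine (this.congr_deriv ?_).hasDerivWithinAt
    simp; ring
  · intro s hs
    have := (hb s (hseg s hs).1).2
    simp only [zero_add, smul_eq_mul] at this
    calc ‖φ' s - (φ' 0 + c * s)‖ = ‖φ' s - φ' 0 - s * c‖ := by congr 1; ring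
      _ ≤ ε * ‖s‖ := this
      _ ≤ _ := by gcongr; exact (hseg s hs).2

theorem P2_log {a : ℝ} (ha : 0 < a) :
    P2 (fun s => Real.log (a + s)) (Real.log a) a⁻¹ (-(a ^ 2)⁻¹) := by
  have h := P2_of_deriv (φ := fun s => Real.log (a + s)) (φ' := fun s => (a + s)⁻¹)
    (c := -(a ^ 2)⁻¹) ?_ ?_
  · simpa using h
  · filter_upwards [ball_mem_nhds (0 : ℝ) ha] with t ht
    simp only [mem_ball, dist_zero_right, Real.norm_eq_abs] at ht
    have : a + t ≠ 0 := by have := (abs_lt.1 ht).1; linarith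
    simpa using ((hasDerivAt_id t).const_add a).log this
  · have := ((hasDerivAt_id (0 : ℝ)).const_add a).inv (by simpa using ha.ne')
    refine this.congr_deriv ?_
    simp [neg_div]

theorem P2.log {φ : ℝ → ℝ} {a b c : ℝ} (h : P2 φ a b c) (ha : 0 < a) :
    P2 (fun t => Real.log (φ t)) (Real.log a) (a⁻¹ * b) (-(a ^ 2)⁻¹ * b ^ 2 + a⁻¹ * c) :=
  P2.comp (P2_log ha) h

theorem P2_inv {a : ℝ} (ha : a ≠ 0) :
    P2 (fun s => (a + s)⁻¹) a⁻¹ (-(a ^ 2)⁻¹) (2 * (a ^ 3)⁻¹) := by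
  have h := P2_of_deriv (φ := fun s => (a + s)⁻¹) (φ' := fun s => -((a + s) ^ 2)⁻¹)
    (c := 2 * (a ^ 3)⁻¹) ?_ ?_
  · simpa using h
  · filter_upwards [ball_mem_nhds (0 : ℝ) (abs_pos.2 ha)] with t ht
    simp only [mem_ball, dist_zero_right, Real.norm_eq_abs] at ht
    have : a + t ≠ 0 := by
      intro h0
      have : t = -a := by linarith
      rw [this, abs_neg] at ht; exact lt_irrefl _ ht
    have := ((hasDerivAt_id t).const_add a).inv this
    refine this.congr_deriv ?_
    simp [neg_div]
  · have := (((((hasDerivAt_id (0 : ℝ)).const_add a)).pow 2).inv (by simpa using ha)).neg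
    refine this.congr_deriv ?_
    simp
    field_simp

theorem P2.inv {φ : ℝ → ℝ} {a b c : ℝ} (h : P2 φ a b c) (ha : a ≠ 0) :
    P2 (fun t => (φ t)⁻¹) a⁻¹ (-(a ^ 2)⁻¹ * b) (2 * (a ^ 3)⁻¹ * b ^ 2 + -(a ^ 2)⁻¹ * c) :=
  P2.comp (P2_inv ha) h

/-- Second order necessary condition at a local max. -/
theorem P2.max {φ : ℝ → ℝ} {a b c : ℝ} (h : P2 φ a b c) (hm : ∀ᶠ t in 𝓝 0, φ t ≤ a) :
    b = 0 ∧ c ≤ 0 := by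
  have hb : b = 0 := by
    have hd : HasDerivAt φ b 0 := by
      rw [hasDerivAt_iff_isLittleO_nhds_zero]
      have := h.lin.trans_isLittleO sq_isLittleO_id
      refine this.congr_left ?_
      intro t; simp [h.val]; ring
    have hl : IsLocalMax φ 0 := by
      filter_upwards [hm] with t ht; rw [h.val]; exact ht
    exact hl.hasDerivAt_eq_zero hd
  refine ⟨hb, ?_⟩
  by_contra hc
  push Not at hc
  subst hb
  rw [P2, isLittleO_iff] at h
  have h1 := h (show (0 : ℝ) < c / 4 by positivity)
  obtain ⟨r, hr, hb⟩ := Metric.eventually_nhds_iff_ball.1 (h1.and hm)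
  have := hb (r / 2) (by simp [abs_of_pos hr]; linarith)
  obtain ⟨h2, h3⟩ := this
  simp only [norm_pow, Real.norm_eq_abs, sq_abs] at h2
  have := (abs_le.1 h2).1
  nlinarith [mul_pos hc (pow_pos hr 2)]

theorem P2.min {φ : ℝ → ℝ} {a b c : ℝ} (h : P2 φ a b c) (hm : ∀ᶠ t in 𝓝 0, a ≤ φ t) :
    b = 0 ∧ 0 ≤ c := by
  have := h.neg.max (by filter_upwards [hm] with t ht; linarith)
  constructor <;> linarith [this.1, this.2]

abbrev Mat (n : ℕ) := Matrix (Fin n) (Fin n) ℝ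

/-- quadratic form of a matrix -/
def qf {n : ℕ} (H : Mat n) (v : Euc n) : ℝ := v.ofLp ⬝ᵥ (H *ᵥ v.ofLp)

/-- matrix acting on Euclidean vectors -/
def app {n : ℕ} (L : Mat n) (v : Euc n) : Euc n := WithLp.toLp 2 (L *ᵥ v.ofLp)

variable {n : ℕ}
theorem inner_eq_dot (v w : Euc n) : ⟪v, w⟫ = v.ofLp ⬝ᵥ w.ofLp := by
  rw [EuclideanSpace.inner_eq_star_dotProduct, dotProduct_comm]; simp

theorem normsq_eq_dot (v : Euc n) : ‖v‖ ^ 2 = v.ofLp ⬝ᵥ v.ofLp := by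
  rw [← real_inner_self_eq_norm_sq, inner_eq_dot]

theorem qf_eq_inner (H : Mat n) (v : Euc n) : qf H v = ⟪v, app H v⟫ := by
  rw [inner_eq_dot]; rfl

theorem app_add (L : Mat n) (v w : Euc n) : app L (v + w) = app L v + app L w := by
  unfold app; rw [WithLp.ofLp_add, mulVec_add, WithLp.toLp_add]
theorem app_sub (L : Mat n) (v w : Euc n) : app L (v - w) = app L v - app L w := by
  unfold app; rw [WithLp.ofLp_sub, mulVec_sub, WithLp.toLp_sub]
theorem app_smul (L : Mat n) (t : ℝ) (v : Euc n) : app L (t • v) = t • app L v := by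
  unfold app; rw [WithLp.ofLp_smul, mulVec_smul, WithLp.toLp_smul]
theorem app_zero (L : Mat n) : app L 0 = 0 := by
  unfold app; simp
theorem app_neg (L : Mat n) (v : Euc n) : app L (-v) = - app L v := by
  unfold app; rw [WithLp.ofLp_neg, mulVec_neg, WithLp.toLp_neg]
theorem app_one (v : Euc n) : app 1 v = v := by unfold app; simp
theorem app_mul (L M : Mat n) (v : Euc n) : app (L * M) v = app L (app M v) := by
  unfold app; simp [mulVec_mulVec]
theorem app_add_mat (L M : Mat n) (v : Euc n) : app (L + M) v = app L v + app M v := by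
  unfold app; rw [add_mulVec, WithLp.toLp_add]
theorem app_smul_mat (t : ℝ) (L : Mat n) (v : Euc n) : app (t • L) v = t • app L v := by
  unfold app; rw [smul_mulVec, WithLp.toLp_smul]
theorem inner_app (L : Mat n) (v w : Euc n) : ⟪v, app L w⟫ = ⟪app Lᵀ v, w⟫ := by
  rw [inner_eq_dot, inner_eq_dot]; unfold app
  simp only [dotProduct_mulVec, mulVec_transpose]

/-- linear map version -/
def appL (L : Mat n) : Euc n →ₗ[ℝ] Euc n where
  toFun := app L
  map_add' := app_add L
  map_smul' := app_smul L

theorem app_cont (L : Mat n) : Continuous (app L) := (appL L).continuous_of_finiteDimensional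

theorem qf_add (H K : Mat n) (v : Euc n) : qf (H + K) v = qf H v + qf K v := by
  unfold qf; rw [add_mulVec, dotProduct_add]
theorem qf_sub (H K : Mat n) (v : Euc n) : qf (H - K) v = qf H v - qf K v := by
  unfold qf; rw [sub_mulVec, dotProduct_sub]
theorem qf_smul (t : ℝ) (H : Mat n) (v : Euc n) : qf (t • H) v = t * qf H v := by
  unfold qf; rw [smul_mulVec, dotProduct_smul, smul_eq_mul]
theorem qf_one (v : Euc n) : qf 1 v = ‖v‖ ^ 2 := by
  unfold qf; rw [one_mulVec, normsq_eq_dot]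
theorem qf_zero_mat (v : Euc n) : qf (0 : Mat n) v = 0 := by
  unfold qf; simp
theorem qf_smul_vec (H : Mat n) (t : ℝ) (v : Euc n) : qf H (t • v) = t ^ 2 * qf H v := by
  rw [qf_eq_inner, app_smul, inner_smul_left, inner_smul_right, qf_eq_inner]; simp; ring
theorem qf_neg_vec (H : Mat n) (v : Euc n) : qf H (-v) = qf H v := by
  rw [qf_eq_inner, app_neg, inner_neg_neg, qf_eq_inner]
theorem qf_zero (H : Mat n) : qf H 0 = 0 := by
  rw [qf_eq_inner, inner_zero_left]
theorem qf_conj (L H : Mat n) (v : Euc n) : qf (Lᵀ * H * L) v = qf H (app L v) := by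
  rw [qf_eq_inner, qf_eq_inner, app_mul, app_mul, inner_app, transpose_transpose]
theorem qf_vec (v w : Euc n) : qf (vecMulVec v.ofLp v.ofLp) w = ⟪v, w⟫ ^ 2 := by
  rw [inner_eq_dot]
  unfold qf; rw [vecMulVec_mulVec]; simp [dotProduct_comm w.ofLp]; ring

theorem qf_cont (H : Mat n) : Continuous (qf H) := by
  have : qf H = fun v => ⟪v, app H v⟫ := by funext v; exact qf_eq_inner H v
  rw [this]; exact continuous_id.inner (app_cont H)

theorem herm_iff (H : Mat n) : H.IsHermitian ↔ Hᵀ = H := by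
  rw [Matrix.IsHermitian, conjTranspose_eq_transpose_of_trivial]

theorem posDef_iff_qf (H : Mat n) : H.PosDef ↔ Hᵀ = H ∧ ∀ v : Euc n, v ≠ 0 → 0 < qf H v := by
  rw [posDef_iff_dotProduct_mulVec, herm_iff]
  refine and_congr Iff.rfl ⟨fun h v hv => ?_, fun h x hx => ?_⟩
  · have := h (x := v.ofLp) (by simpa using hv); simpa [qf] using this
  · have := h (WithLp.toLp 2 x) (by simpa using hx); simpa [qf] using this

theorem posSemidef_iff_qf (H : Mat n) : H.PosSemidef ↔ Hᵀ = H ∧ ∀ v : Euc n, 0 ≤ qf H v := by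
  rw [posSemidef_iff_dotProduct_mulVec, herm_iff]
  refine and_congr Iff.rfl ⟨fun h v => ?_, fun h x => ?_⟩
  · have := h v.ofLp; simpa [qf] using this
  · have := h (WithLp.toLp 2 x); simpa [qf] using this

theorem spec {H : Mat n} (h : Hᵀ = H) : ∃ (U : Mat n) (d : Fin n → ℝ), Uᵀ * U = 1 ∧ U * Uᵀ = 1 ∧
    H = U * diagonal d * Uᵀ := by
  have hh := (herm_iff H).2 h
  refine ⟨hh.eigenvectorUnitary, hh.eigenvalues, ?_, ?_, ?_⟩
  · have := Unitary.coe_star_mul_self hh.eigenvectorUnitary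
    simpa [star_eq_conjTranspose, conjTranspose_eq_transpose_of_trivial] using this
  · have := Unitary.coe_mul_star_self hh.eigenvectorUnitary
    simpa [star_eq_conjTranspose, conjTranspose_eq_transpose_of_trivial] using this
  · have := hh.spectral_theorem
    simpa [Unitary.conjStarAlgAut_apply, star_eq_conjTranspose,
      conjTranspose_eq_transpose_of_trivial] using this

theorem qf_diagonal (d : Fin n → ℝ) (v : Euc n) : qf (diagonal d) v = ∑ i, d i * v i ^ 2 := by
  unfold qf
  simp only [dotProduct, mulVec_diagonal]
  refine Finset.sum_congr rfl fun i _ => by ring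

theorem norm_app_orth {U : Mat n} (h : Uᵀ * U = 1) (v : Euc n) : ‖app U v‖ = ‖v‖ := by
  have : ‖app U v‖ ^ 2 = ‖v‖ ^ 2 := by
    rw [← real_inner_self_eq_norm_sq, inner_app, ← app_mul, h, app_one, real_inner_self_eq_norm_sq]
  exact (sq_eq_sq₀ (norm_nonneg _) (norm_nonneg _)).1 this

/-- spectral data for quadratic-form bounds -/
theorem spec_bounds {H U : Mat n} {d : Fin n → ℝ} (h1 : Uᵀ * U = 1)
    (hH : H = U * diagonal d * Uᵀ) (i : Fin n) :
    ∃ v : Euc n, ‖v‖ = 1 ∧ qf H v = d i := by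
  refine ⟨app U (EuclideanSpace.single i 1), ?_, ?_⟩
  · rw [norm_app_orth h1]; simp
  · have : qf H (app U (EuclideanSpace.single i 1)) = qf (Uᵀ * H * U) (EuclideanSpace.single i 1) := by
      rw [qf_conj]
    rw [this, hH]
    have : Uᵀ * (U * diagonal d * Uᵀ) * U = diagonal d := by
      calc _ = (Uᵀ * U) * diagonal d * (Uᵀ * U) := by simp only [Matrix.mul_assoc]
        _ = _ := by rw [h1]; simp
    rw [this, qf_diagonal]
    simp

theorem det_spec {H U : Mat n} {d : Fin n → ℝ} (h1 : Uᵀ * U = 1)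
    (hH : H = U * diagonal d * Uᵀ) : H.det = ∏ i, d i := by
  rw [hH, det_mul_comm, ← Matrix.mul_assoc, h1, Matrix.one_mul, det_diagonal]

theorem qf_spec {H U : Mat n} {d : Fin n → ℝ}
    (hH : H = U * diagonal d * Uᵀ) (v : Euc n) : qf H v = ∑ i, d i * (app Uᵀ v) i ^ 2 := by
  have := qf_conj Uᵀ (diagonal d) v
  rw [transpose_transpose, ← hH] at this
  rw [this, qf_diagonal]

theorem factor_psd {C : Mat n} (h : C.PosSemidef) : ∃ B : Mat n, C = Bᵀ * B := by
  obtain ⟨U, d, h1, h2, hC⟩ := spec ((posSemidef_iff_qf C).1 h).1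
  have hd : ∀ i, 0 ≤ d i := fun i => by
    obtain ⟨v, _, hv⟩ := spec_bounds h1 hC i
    rw [← hv]; exact ((posSemidef_iff_qf C).1 h).2 v
  refine ⟨diagonal (fun i => Real.sqrt (d i)) * Uᵀ, ?_⟩
  rw [transpose_mul, transpose_transpose, diagonal_transpose, hC, Matrix.mul_assoc, Matrix.mul_assoc,
    ← Matrix.mul_assoc (diagonal _) (diagonal _), diagonal_mul_diagonal]
  congr 3
  funext i; rw [Real.mul_self_sqrt (hd i)]

theorem factor_pd {C : Mat n} (h : C.PosDef) : ∃ B : Mat n, C = Bᵀ * B ∧ IsUnit B := by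
  obtain ⟨B, hB⟩ := factor_psd h.posSemidef
  refine ⟨B, hB, ?_⟩
  rw [isUnit_iff_isUnit_det, isUnit_iff_ne_zero]
  intro h0
  have := h.det_pos
  rw [hB, det_mul, h0, mul_zero] at this
  exact lt_irrefl _ this

theorem trace_mul_nonneg {C Z : Mat n} (hC : C.PosSemidef) (hZ : ∀ v : Euc n, 0 ≤ qf Z v) :
    0 ≤ (C * Z).trace := by
  obtain ⟨B, rfl⟩ := factor_psd hC
  have : (Bᵀ * B * Z).trace = (B * Z * Bᵀ).trace := by
    rw [Matrix.mul_assoc, trace_mul_comm]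
  rw [this, trace]
  refine Finset.sum_nonneg fun i _ => ?_
  have := hZ (WithLp.toLp 2 (B i))
  have e : (B * Z * Bᵀ).diag i = qf Z (WithLp.toLp 2 (B i)) := by
    simp [qf, diag, mul_apply, dotProduct, mulVec, Finset.sum_mul, Finset.mul_sum]
    rw [Finset.sum_comm]
    refine Finset.sum_congr rfl fun j _ => Finset.sum_congr rfl fun k _ => by ring
  rw [e]; exact this

theorem trace_mul_mono {C X Y : Mat n} (hC : C.PosSemidef) (h : ∀ v : Euc n, qf X v ≤ qf Y v) :
    (C * X).trace ≤ (C * Y).trace := by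
  have := trace_mul_nonneg hC (Z := Y - X) (fun v => by rw [qf_sub]; linarith [h v])
  rw [Matrix.mul_sub, trace_sub] at this
  linarith

theorem amgm_pd {A : Mat n} (hA : A.PosDef) {f : ℝ} (hf : 0 < f) (hdet : A.det = f ^ n) :
    n * f ≤ A.trace := by
  rcases Nat.eq_zero_or_pos n with rfl | hn
  · simp [trace]
  obtain ⟨U, d, h1, h2, hA'⟩ := spec ((posDef_iff_qf A).1 hA).1
  have hd : ∀ i, 0 < d i := fun i => by
    obtain ⟨v, hv1, hv⟩ := spec_bounds h1 hA' i
    rw [← hv]; exact ((posDef_iff_qf A).1 hA).2 v (by intro h; rw [h] at hv1; simp at hv1)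
  have htr : A.trace = ∑ i, d i := by
    rw [hA', trace_mul_comm, ← Matrix.mul_assoc, h1, Matrix.one_mul, trace_diagonal]
  have hdet' := det_spec h1 hA'
  have hn' : (0 : ℝ) < n := by exact_mod_cast hn
  have := Real.geom_mean_le_arith_mean Finset.univ (fun _ => (1 : ℝ)) d (fun _ _ => zero_le_one)
    (by simpa using hn') (fun i _ => (hd i).le)
  simp only [Real.rpow_one, Finset.sum_const, Finset.card_univ, Fintype.card_fin, nsmul_eq_mul,
    mul_one, one_mul] at this
  rw [← hdet', hdet, ← htr, Real.pow_rpow_inv_natCast hf.le hn.ne', le_div_iff₀ hn'] at this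
  linarith

theorem amgm_trace {C A : Mat n} (hC : C.PosDef) (hA : A.PosDef) {c f : ℝ} (hc : 0 < c)
    (hf : 0 < f) (hdc : C.det = c ^ n) (hda : A.det = f ^ n) : n * (c * f) ≤ (C * A).trace := by
  obtain ⟨B, rfl, hu⟩ := factor_pd hC
  have e : (Bᵀ * B * A).trace = (B * A * Bᵀ).trace := by rw [Matrix.mul_assoc, trace_mul_comm]
  rw [e]
  have hpd : (B * A * Bᵀ).PosDef := by
    rw [posDef_iff_qf]
    have hA' := (posDef_iff_qf A).1 hA
    constructor
    · rw [transpose_mul, transpose_mul, hA'.1, transpose_transpose, Matrix.mul_assoc]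
    · intro v hv
      have := qf_conj Bᵀ A v
      rw [transpose_transpose] at this
      rw [this]
      refine hA'.2 _ ?_
      intro h0
      apply hv
      have hBt : IsUnit Bᵀ := (isUnit_transpose B).2 hu
      have h1 : app (Bᵀ)⁻¹ (app Bᵀ v) = v := by
        rw [← app_mul, nonsing_inv_mul _ ((isUnit_iff_isUnit_det _).1 hBt), app_one]
      rw [← h1, h0, app_zero]
  refine amgm_pd hpd (mul_pos hc hf) ?_
  rw [det_mul, det_mul, mul_right_comm, ← det_mul, det_mul_comm, hdc, hda, mul_pow]

theorem exists_root {A : Mat n} (hn : n ≠ 0) (hA : A.PosDef) : ∃ c : ℝ, 0 < c ∧ A.det = c ^ n :=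
  ⟨A.det ^ ((n : ℝ)⁻¹), Real.rpow_pos_of_pos hA.det_pos _,
    (Real.rpow_inv_natCast_pow hA.det_pos.le hn).symm⟩

theorem det_mono {A B : Mat n} (hA : A.PosDef) (hB : B.PosDef) (h : ∀ v : Euc n, qf A v ≤ qf B v) :
    A.det ≤ B.det := by
  rcases Nat.eq_zero_or_pos n with rfl | hn
  · simp
  obtain ⟨a, ha, ha'⟩ := exists_root hn.ne' hA
  obtain ⟨b, hb, hb'⟩ := exists_root hn.ne' hB
  have h1 := amgm_trace hB.inv hA (inv_pos.2 hb) ha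
    (by rw [det_nonsing_inv, Ring.inverse_eq_inv', hb', inv_pow]) ha'
  have h2 := trace_mul_mono hB.inv.posSemidef h
  rw [nonsing_inv_mul _ ((isUnit_iff_isUnit_det _).1 hB.isUnit), trace_one, Fintype.card_fin] at h2
  have hn' : (0 : ℝ) < n := by exact_mod_cast hn
  have h3 : b⁻¹ * a ≤ 1 := by
    by_contra hcon
    push Not at hcon
    nlinarith
  have h4 : a ≤ b := by
    rw [inv_mul_le_iff₀ hb] at h3; linarith
  rw [ha', hb']
  exact pow_le_pow_left₀ ha.le h4 n

/-- upper bound for a quadratic form from a lower bound and the determinant -/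
theorem qf_le_of_det {A : Mat n} (hA : Aᵀ = A) {m : ℝ} (hm : 0 < m)
    (h : ∀ v : Euc n, m * ‖v‖ ^ 2 ≤ qf A v) (v : Euc n) :
    m ^ (n - 1) * qf A v ≤ A.det * ‖v‖ ^ 2 := by
  obtain ⟨U, d, h1, h2, hA'⟩ := spec hA
  have hd : ∀ i, m ≤ d i := fun i => by
    obtain ⟨v, hv1, hv⟩ := spec_bounds h1 hA' i
    have := h v
    rw [← hv]; rw [hv1] at this; linarith
  have hdet := det_spec h1 hA'
  have hk : ∀ i, m ^ (n - 1) * d i ≤ A.det := by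
    intro i
    rw [hdet, ← Finset.prod_erase_mul _ _ (Finset.mem_univ i)]
    refine mulR ?_ (hm.le.trans (hd i))
    have : m ^ (n - 1) = ∏ j ∈ Finset.univ.erase i, m := by
      rw [Finset.prod_const, Finset.card_erase_of_mem (Finset.mem_univ i), Finset.card_univ,
        Fintype.card_fin]
    rw [this]
    exact Finset.prod_le_prod (fun _ _ => hm.le) (fun j _ => hd j)
  have hnorm : ‖v‖ ^ 2 = ∑ i, (app Uᵀ v) i ^ 2 := by
    rw [← norm_app_orth (U := Uᵀ) (by rw [transpose_transpose, h2]) v, EuclideanSpace.norm_sq_eq]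
    simp
  rw [qf_spec hA', hnorm, Finset.mul_sum, Finset.mul_sum]
  refine Finset.sum_le_sum fun i _ => ?_
  have := hk i
  nlinarith [sq_nonneg ((app Uᵀ v) i)]

theorem inv_factor {B : Mat n} (hu : IsUnit B) : (Bᵀ * B)⁻¹ = B⁻¹ * B⁻¹ᵀ := by
  rw [Matrix.mul_inv_rev, transpose_nonsing_inv]

theorem cauchy_inv {A : Mat n} (hA : A.PosDef) (v w : Euc n) :
    ⟪v, w⟫ ^ 2 ≤ qf A v * qf A⁻¹ w := by
  obtain ⟨B, rfl, hu⟩ := factor_pd hA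
  have e1 : qf (Bᵀ * B) v = ‖app B v‖ ^ 2 := by
    have := qf_conj B 1 v
    rw [Matrix.mul_one, qf_one] at this; exact this
  have e2 : qf (Bᵀ * B)⁻¹ w = ‖app B⁻¹ᵀ w‖ ^ 2 := by
    have := qf_conj B⁻¹ᵀ 1 w
    rw [Matrix.mul_one, qf_one, transpose_transpose] at this; rw [inv_factor hu]; exact this
  have e3 : ⟪v, w⟫ = ⟪app B v, app B⁻¹ᵀ w⟫ := by
    rw [inner_app, transpose_transpose, ← app_mul, nonsing_inv_mul _ ((isUnit_iff_isUnit_det _).1 hu),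
      app_one]
  rw [e1, e2, e3, ← mul_pow]
  exact sq_le_sq' (by linarith [neg_abs_le ⟪app B v, app B⁻¹ᵀ w⟫, abs_real_inner_le_norm (app B v) (app B⁻¹ᵀ w)]) (real_inner_le_norm _ _)

theorem trace_vec (C : Mat n) (v : Euc n) : (C * vecMulVec v.ofLp v.ofLp).trace = qf C v := by
  rw [mul_vecMulVec, trace_vecMulVec, dotProduct_comm]; rfl

/-- normalise a positive definite matrix to the identity -/
theorem exists_normalise {M : Mat n} (hM : M.PosDef) : ∃ R : Mat n, IsUnit R ∧ Rᵀ * M * R = 1 := by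
  obtain ⟨B, rfl, hu⟩ := factor_pd hM
  have hd := (isUnit_iff_isUnit_det _).1 hu
  refine ⟨B⁻¹, (isUnit_nonsing_inv_iff).2 hu, ?_⟩
  calc _ = (B * B⁻¹)ᵀ * (B * B⁻¹) := by rw [transpose_mul]; simp only [Matrix.mul_assoc]
    _ = 1 := by rw [mul_nonsing_inv _ hd]; simp

theorem app_inv_app {L : Mat n} (h : IsUnit L) (v : Euc n) : app L⁻¹ (app L v) = v := by
  rw [← app_mul, nonsing_inv_mul _ ((isUnit_iff_isUnit_det _).1 h), app_one]
theorem app_app_inv {L : Mat n} (h : IsUnit L) (v : Euc n) : app L (app L⁻¹ v) = v := by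
  rw [← app_mul, mul_nonsing_inv _ ((isUnit_iff_isUnit_det _).1 h), app_one]

theorem posDef_of_lower {B : Mat n} (hB : Bᵀ = B) {m : ℝ} (hm : 0 < m)
    (h : ∀ v : Euc n, m * ‖v‖ ^ 2 ≤ qf B v) : B.PosDef :=
  (posDef_iff_qf B).2 ⟨hB, fun v hv => lt_of_lt_of_le
    (mul_pos hm (pow_pos (norm_pos_iff.2 hv) 2)) (h v)⟩

theorem posDef_conj {H L : Mat n} (hH : H.PosDef) (hL : IsUnit L) : (Lᵀ * H * L).PosDef := by
  have h' := (posDef_iff_qf H).1 hH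
  refine (posDef_iff_qf _).2 ⟨?_, fun v hv => ?_⟩
  · rw [transpose_mul, transpose_mul, h'.1, transpose_transpose, Matrix.mul_assoc]
  · rw [qf_conj]
    refine h'.2 _ fun h0 => hv ?_
    rw [← app_inv_app hL v, h0, app_zero]

/-- linewise second order Peano expansion -/
def Pea {n : ℕ} (u : Euc n → ℝ) (p g : Euc n) (H : Mat n) : Prop :=
  ∀ v : Euc n, P2 (fun t => u (p + t • v)) (u p) ⟪g, v⟫ (qf H v)

structure Sol {n : ℕ} (U : Set (Euc n)) (u f : Euc n → ℝ) : Prop where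
  isOpen : IsOpen U
  cvx : ConvexOn ℝ U u
  fpos : ∀ p ∈ U, 0 < f p
  pea : ∀ p ∈ U, ∃ g H, Pea u p g H ∧ H.PosDef ∧ H.det = f p ^ n

theorem line_tendsto (p v : Euc n) : Tendsto (fun t : ℝ => p + t • v) (𝓝 0) (𝓝 p) := by
  have : Continuous (fun t : ℝ => p + t • v) := by fun_prop
  simpa using this.tendsto 0

theorem Pea.congr' {u w : Euc n → ℝ} {p g : Euc n} {H : Mat n} (h : Pea u p g H)
    (e : u =ᶠ[𝓝 p] w) : Pea w p g H := by
  intro v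
  have := (h v).congr' ((line_tendsto p v).eventually e)
  rwa [e.self_of_nhds] at this

theorem Pea.comp_affine {u : Euc n → ℝ} {L : Mat n} {b p g : Euc n} {H : Mat n}
    (h : Pea u (app L p + b) g H) : Pea (fun x => u (app L x + b)) p (app Lᵀ g) (Lᵀ * H * L) := by
  intro v
  have := h (app L v)
  rw [← qf_conj, inner_app] at this
  refine this.congr' (Eventually.of_forall fun t => ?_)
  simp only [app_add, app_smul]
  congr 1; abel

theorem Pea.add {u w : Euc n → ℝ} {p g g' : Euc n} {H H' : Mat n} (h : Pea u p g H)
    (h' : Pea w p g' H') : Pea (fun x => u x + w x) p (g + g') (H + H') := by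
  intro v
  refine ((h v).add (h' v)).of_eq rfl ?_ ?_
  · rw [inner_add_left]
  · rw [qf_add]

theorem Pea.const_mul {u : Euc n → ℝ} {p g : Euc n} {H : Mat n} (k : ℝ) (h : Pea u p g H) :
    Pea (fun x => k * u x) p (k • g) (k • H) := by
  intro v
  refine ((h v).const_mul k).of_eq rfl ?_ ?_
  · rw [inner_smul_left]; simp
  · rw [qf_smul]

theorem Pea_affine (q : Euc n) (k : ℝ) (p : Euc n) : Pea (fun x => ⟪q, x⟫ + k) p q 0 := by
  intro v
  refine (P2_quad (⟪q, p⟫ + k) ⟪q, v⟫ (qf 0 v)).congr' (Eventually.of_forall fun t => ?_)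
  simp only [inner_add_right, inner_smul_right, qf_zero_mat]; ring

theorem Pea_normsq (z p : Euc n) (k : ℝ) :
    Pea (fun x => k / 2 * ‖x - z‖ ^ 2) p (k • (p - z)) (k • 1) := by
  intro v
  refine (P2_quad (k / 2 * ‖p - z‖ ^ 2) ⟪k • (p - z), v⟫ (qf (k • 1) v)).congr'
    (Eventually.of_forall fun t => ?_)
  simp only
  rw [qf_smul, qf_one, show p + t • v - z = (p - z) + t • v by abel, norm_add_sq_real,
    inner_smul_left, inner_smul_right, norm_smul]
  simp only [Real.norm_eq_abs, mul_pow, sq_abs]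
  simp; ring

theorem Sol.affine {U : Set (Euc n)} {u f : Euc n → ℝ} (h : Sol U u f) (hn : n ≠ 0) {L : Mat n} (hL : IsUnit L)
    (b q : Euc n) (k : ℝ) {c d : ℝ} (hc : 0 < c) (hd : 0 < d) (hdd : d ^ n = L.det ^ 2) :
    Sol {x | app L x + b ∈ U} (fun x => c * u (app L x + b) + (⟪q, x⟫ + k))
      (fun x => c * d * f (app L x + b)) := by
  have hcont : Continuous (fun x => app L x + b) := (app_cont L).add continuous_const
  refine ⟨h.isOpen.preimage hcont, ⟨?_, ?_⟩, ?_, ?_⟩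
  · intro x hx y hy s t hs ht hst
    have := h.cvx.1 hx hy hs ht hst
    simp only [Set.mem_setOf_eq]
    convert this using 1
    rw [app_add, app_smul, app_smul, smul_add, smul_add, add_add_add_comm, ← add_smul, hst, one_smul]
  · intro x hx y hy s t hs ht hst
    have := h.cvx.2 hx hy hs ht hst
    have e : s • (app L x + b) + t • (app L y + b) = app L (s • x + t • y) + b := by
      rw [app_add, app_smul, app_smul, smul_add, smul_add, add_add_add_comm, ← add_smul, hst, one_smul]
    rw [e] at this
    simp only [smul_eq_mul, inner_add_right, inner_smul_right] at this ⊢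
    have hk : k = s * k + t * k := by rw [← add_mul, hst, one_mul]
    nlinarith [mulL this hc.le]
  · intro p hp; exact mul_pos (mul_pos hc hd) (h.fpos _ hp)
  · intro p hp
    obtain ⟨g, H, h1, h2, h3⟩ := h.pea _ hp
    refine ⟨_, _, ((h1.comp_affine.const_mul c).add (Pea_affine q k p)), ?_, ?_⟩
    · rw [add_zero]; exact (posDef_conj h2 hL).smul hc
    · rw [add_zero, det_smul, det_mul, det_mul, det_transpose, h3, Fintype.card_fin, mul_pow, mul_pow, hdd]
      ring

theorem Sol.mono {U V : Set (Euc n)} {u f : Euc n → ℝ} (h : Sol U u f) (hV : IsOpen V)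
    (hc : Convex ℝ V) (hs : V ⊆ U) : Sol V u f :=
  ⟨hV, h.cvx.subset hs hc, fun p hp => h.fpos p (hs hp), fun p hp => h.pea p (hs hp)⟩

theorem Sol.cont {U : Set (Euc n)} {u f : Euc n → ℝ} (h : Sol U u f) : ContinuousOn u U :=
  h.cvx.continuousOn h.isOpen

/-- second order condition when a function touches from below -/
theorem Sol.touch {U : Set (Euc n)} {u f : Euc n → ℝ} (h : Sol U u f) {p : Euc n} (hp : p ∈ U)
    {b : Euc n → ℝ} (hm : ∀ᶠ x in 𝓝 p, u p - b p ≤ u x - b x) :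
    ∃ H : Mat n, H.PosDef ∧ H.det = f p ^ n ∧ ∀ v a₁ a₂, P2 (fun t => b (p + t • v)) (b p) a₁ a₂ →
      a₂ ≤ qf H v := by
  obtain ⟨g, H, h1, h2, h3⟩ := h.pea p hp
  refine ⟨H, h2, h3, fun v a₁ a₂ hb => ?_⟩
  have := ((h1 v).sub hb).min ((line_tendsto p v).eventually hm)
  linarith [this.2]

theorem Sol.touch' {U : Set (Euc n)} {u f : Euc n → ℝ} (h : Sol U u f) {p : Euc n} (hp : p ∈ U)
    {b : Euc n → ℝ} (hm : ∀ᶠ x in 𝓝 p, u x - b x ≤ u p - b p) :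
    ∃ H : Mat n, H.PosDef ∧ H.det = f p ^ n ∧ ∀ v a₁ a₂, P2 (fun t => b (p + t • v)) (b p) a₁ a₂ →
      qf H v ≤ a₂ := by
  obtain ⟨g, H, h1, h2, h3⟩ := h.pea p hp
  refine ⟨H, h2, h3, fun v a₁ a₂ hb => ?_⟩
  have := ((h1 v).sub hb).max ((line_tendsto p v).eventually hm)
  linarith [this.2]

theorem cmp_min {S : Set (Euc n)} {u b : Euc n → ℝ} (hS : IsOpen S) (hb : Bornology.IsBounded S)
    (hu : ContinuousOn u (closure S)) (hbc : ContinuousOn b (closure S))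
    (hf : ∀ x ∈ frontier S, b x ≤ u x)
    (hi : ∀ p ∈ S, u p < b p → (∀ᶠ x in 𝓝 p, u p - b p ≤ u x - b x) → False) :
    ∀ x ∈ closure S, b x ≤ u x := by
  intro x hx
  have hc : IsCompact (closure S) := hb.isCompact_closure
  obtain ⟨p, hp, hpm⟩ := hc.exists_isMinOn ⟨x, hx⟩ (hu.sub hbc)
  by_contra hcon
  push Not at hcon
  have h1 := hpm hx
  simp only [Set.mem_setOf_eq, Pi.sub_apply] at h1
  have hpS : p ∈ S := by
    by_contra hpn
    have : p ∈ frontier S := by rw [hS.frontier_eq]; exact ⟨hp, hpn⟩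
    have := hf p this
    linarith
  refine hi p hpS (by linarith) ?_
  filter_upwards [hS.mem_nhds hpS] with y hy
  exact hpm (subset_closure hy)

/-- A section-like domain: solution vanishing on the boundary. -/
structure Sec (S : Set (Euc n)) (u f : Euc n → ℝ) : Prop extends Sol S u f where
  bdd : Bornology.IsBounded S
  contc : ContinuousOn u (closure S)
  zero : ∀ x ∈ frontier S, u x = 0

theorem Sec.lower {S : Set (Euc n)} {u f : Euc n → ℝ} (h : Sec S u f) {R f1 : ℝ}
    (hR : S ⊆ ball 0 R) (hf : ∀ x ∈ S, f x < f1) (hn : n ≠ 0) :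
    ∀ x ∈ closure S, f1 / 2 * ‖x‖ ^ 2 - f1 / 2 * R ^ 2 ≤ u x := by
  have hcl : ∀ x ∈ closure S, ‖x‖ ≤ R := fun x hx => by
    have := closure_mono hR hx
    have := closure_ball_subset_closedBall this
    simpa using this
  rcases S.eq_empty_or_nonempty with he | ⟨x0, hx0⟩
  · intro x hx; rw [he] at hx; simp at hx
  have hf1 : 0 < f1 := lt_trans (h.fpos x0 hx0) (hf x0 hx0)
  refine cmp_min h.isOpen h.bdd h.contc (by fun_prop) ?_ ?_
  · intro x hx
    rw [h.zero x hx]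
    have := hcl x (frontier_subset_closure hx)
    nlinarith [norm_nonneg x, pow_le_pow_left₀ (norm_nonneg x) this 2]
  · intro p hp _ hm
    obtain ⟨H, h1, h2, h3⟩ := h.touch (b := fun x => f1 / 2 * ‖x‖ ^ 2 - f1 / 2 * R ^ 2) hp hm
    have hq : ∀ v, qf (f1 • (1 : Mat n)) v ≤ qf H v := by
      intro v
      refine h3 v ⟪f1 • p, v⟫ _ ?_
      have := (Pea_normsq 0 p f1 v).sub (P2_const (f1 / 2 * R ^ 2))
      simp only [sub_zero] at this
      exact this
    have := det_mono (PosDef.one.smul hf1) h1 hq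
    rw [h2, det_smul, det_one, Fintype.card_fin, mul_one] at this
    have := lt_of_le_of_lt this (pow_lt_pow_left₀ (hf p hp) (h.fpos p hp).le hn)
    exact lt_irrefl _ this

theorem Sec.nonpos {S : Set (Euc n)} {u f : Euc n → ℝ} (h : Sec S u f) (hn : n ≠ 0) :
    ∀ x ∈ closure S, u x ≤ 0 := by
  have := cmp_min (u := fun _ => (0 : ℝ)) (b := u) h.isOpen h.bdd continuousOn_const h.contc
    (fun x hx => (h.zero x hx).le) ?_
  · exact this
  · intro p hp _ hm
    obtain ⟨H, h1, h2, h3⟩ := h.touch' (b := fun _ => (0 : ℝ)) hp (by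
      filter_upwards [hm] with x hx; simp at hx ⊢; linarith)
    have : Nontrivial (Euc n) := by
      have : Nonempty (Fin n) := ⟨⟨0, Nat.pos_of_ne_zero hn⟩⟩
      infer_instance
    obtain ⟨v, hv⟩ := exists_ne (0 : Euc n)
    have := ((posDef_iff_qf H).1 h1).2 v hv
    have := h3 v _ _ (P2_const 0)
    linarith

theorem Sec.upper {S : Set (Euc n)} {u f : Euc n → ℝ} (h : Sec S u f) {f0 : ℝ} (hf0 : 0 < f0)
    (hB : ball 0 1 ⊆ S) (hf : ∀ x ∈ S, f0 < f x) (hn : n ≠ 0) :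
    ∀ x ∈ ball (0 : Euc n) 1, u x ≤ f0 / 2 * ‖x‖ ^ 2 - f0 / 2 := by
  have hcb : closure (ball (0 : Euc n) 1) ⊆ closure S := closure_mono hB
  have := cmp_min (S := ball (0 : Euc n) 1) (u := fun x => f0 / 2 * ‖x‖ ^ 2 - f0 / 2) (b := u)
    isOpen_ball isBounded_ball (by fun_prop) (h.contc.mono hcb) ?_ ?_
  · intro x hx; exact this x (subset_closure hx)
  · intro x hx
    have h1 := h.nonpos hn x (hcb (frontier_subset_closure hx))
    have h2 : ‖x‖ = 1 := by
      rw [frontier_ball (0 : Euc n) one_ne_zero] at hx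
      simpa using hx
    simp only [h2]; linarith
  · intro p hp _ hm
    obtain ⟨H, h1, h2, h3⟩ := h.touch' (b := fun x => f0 / 2 * ‖x‖ ^ 2 - f0 / 2) (hB hp) (by
      filter_upwards [hm] with x hx; linarith)
    have hq : ∀ v, qf H v ≤ qf (f0 • (1 : Mat n)) v := by
      intro v
      refine h3 v ⟪f0 • p, v⟫ _ ?_
      have := (Pea_normsq 0 p f0 v).sub (P2_const (f0 / 2))
      simp only [sub_zero] at this
      exact this
    have := det_mono h1 (PosDef.one.smul hf0) hq
    rw [h2, det_smul, det_one, Fintype.card_fin, mul_one] at this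
    have := lt_of_le_of_lt this (pow_lt_pow_left₀ (hf p (hB hp)) hf0.le hn)
    exact lt_irrefl _ this

theorem P2_rpow {a : ℝ} (ha : 0 < a) (r : ℝ) :
    P2 (fun s => (a + s) ^ r) (a ^ r) (r * a ^ (r - 1)) (r * (r - 1) * a ^ (r - 2)) := by
  have h := P2_of_deriv (φ := fun s => (a + s) ^ r) (φ' := fun s => r * (a + s) ^ (r - 1))
    (c := r * (r - 1) * a ^ (r - 2)) ?_ ?_
  · simpa using h
  · filter_upwards [ball_mem_nhds (0 : ℝ) ha] with t ht
    simp only [mem_ball, dist_zero_right, Real.norm_eq_abs] at ht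
    have : a + t ≠ 0 := by have := (abs_lt.1 ht).1; linarith
    have := ((hasDerivAt_id t).const_add a).rpow_const (p := r) (Or.inl this)
    refine this.congr_deriv ?_
    simp
  · have := (((hasDerivAt_id (0 : ℝ)).const_add a).rpow_const (p := r - 1) (Or.inl (by simpa using ha.ne'))).const_mul r
    refine this.congr_deriv ?_
    simp only [id, add_zero]
    rw [show r - 1 - 1 = r - 2 by ring]; ring

theorem P2.rpow {φ : ℝ → ℝ} {a b c : ℝ} (h : P2 φ a b c) (ha : 0 < a) (r : ℝ) :
    P2 (fun t => φ t ^ r) (a ^ r) (r * a ^ (r - 1) * b)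
      (r * (r - 1) * a ^ (r - 2) * b ^ 2 + r * a ^ (r - 1) * c) :=
  P2.comp (F := fun s => s ^ r) (P2_rpow ha r) h

theorem barrier_alg {α t X Y V R c1 R' P T : ℝ} (hα0 : 0 < α) (ht0 : 0 < t) (hT0 : 0 < T) (hV : 0 ≤ V)
    (hR0 : 0 ≤ R) (hYa : |Y| ≤ R * V) (hk : 4 * α ^ 2 * R ^ 2 + c1 ≤ α * (1 - α) * (R' - P ^ 2)) :
    T * t ^ 2 * V ^ 2 + c1 * T * X ^ 2 ≤
      T * t ^ 2 * (2 * V ^ 2) + 2 * (α * (T * t) * -X) * (2 * Y) +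
        (P ^ 2 - R') * (α * (α - 1) * T * (-X) ^ 2 + α * (T * t) * 0) := by
  have h5 : 4 * α * t * (X * Y) ≤ t ^ 2 * V ^ 2 + 4 * α ^ 2 * R ^ 2 * X ^ 2 := by
    have : X * Y ≤ |X| * (R * V) := by
      calc X * Y ≤ |X * Y| := le_abs_self _
        _ = |X| * |Y| := abs_mul _ _
        _ ≤ _ := mulL hYa (abs_nonneg _)
    have h6 := mulL this (show 0 ≤ 4 * α * t by positivity)
    have h7 := sq_nonneg (t * V - 2 * α * R * |X|)
    have h8 : |X| ^ 2 = X ^ 2 := sq_abs X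
    have h9 : (t * V - 2 * α * R * |X|) ^ 2 = t ^ 2 * V ^ 2 + 4 * α ^ 2 * R ^ 2 * X ^ 2
      - 4 * α * t * (|X| * (R * V)) := by rw [← h8]; ring
    linarith
  have hmain : t ^ 2 * V ^ 2 + c1 * X ^ 2 ≤
      t ^ 2 * (2 * V ^ 2) - 4 * α * t * (X * Y) + α * (1 - α) * (R' - P ^ 2) * X ^ 2 := by
    have := mulR hk (sq_nonneg X)
    linarith
  have := mulL hmain hT0.le
  have e : T * (t ^ 2 * (2 * V ^ 2) - 4 * α * t * (X * Y) + α * (1 - α) * (R' - P ^ 2) * X ^ 2) =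
    T * t ^ 2 * (2 * V ^ 2) + 2 * (α * (T * t) * -X) * (2 * Y) +
        (P ^ 2 - R') * (α * (α - 1) * T * (-X) ^ 2 + α * (T * t) * 0) := by ring
  linarith

set_option maxHeartbeats 1000000 in
/-- Boundary barrier. -/
theorem Sec.barrier (hn : 2 ≤ n) {R : ℝ} (hR : 1 ≤ R) : ∃ C : ℝ, 0 < C ∧
    ∀ (S : Set (Euc n)) (u f : Euc n → ℝ) (f1 c : ℝ) (ν : Euc n), Sec S u f →
      S ⊆ ball 0 R → (∀ x ∈ S, f x < f1) → ‖ν‖ = 1 → (∀ x ∈ S, ⟪ν, x⟫ < c) →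
      ∀ z ∈ S, -(C * f1 * (c - ⟪ν, z⟫) ^ ((n : ℝ)⁻¹)) ≤ u z := by
  have hn0 : n ≠ 0 := by omega
  set α : ℝ := (n : ℝ)⁻¹ with hα
  have hnr : (2 : ℝ) ≤ n := by exact_mod_cast hn
  have hα0 : 0 < α := by positivity
  have hα1 : α ≤ 1 / 2 := by
    rw [hα, inv_le_comm₀ (by positivity) (by norm_num)]; simpa using hnr
  have hαn : α * n = 1 := by rw [hα]; field_simp
  -- choice of the radius
  set c1 : ℝ := 2 * R with hc1
  set R' : ℝ := R ^ 2 + (4 * α ^ 2 * R ^ 2 + c1) / (α * (1 - α)) with hR'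
  have hα2 : 0 < α * (1 - α) := by nlinarith
  have hR2 : R ^ 2 ≤ R' := by
    rw [hR']; have : 0 ≤ (4 * α ^ 2 * R ^ 2 + c1) / (α * (1 - α)) := by positivity
    linarith
  have hR'0 : 0 < R' := by nlinarith
  refine ⟨R', hR'0, ?_⟩
  intro S u f f1 c ν h hSR hf hν hc z hz
  have hf1 : 0 < f1 := lt_trans (h.fpos z hz) (hf z hz)
  have hcl : ∀ x ∈ closure S, ‖x‖ ≤ R := fun x hx => by
    have := closure_ball_subset_closedBall (closure_mono hSR hx)
    simpa using this
  -- slab constant: WLOG c ≤ R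
  set c' := min c R with hc'
  have hcS : ∀ x ∈ S, ⟪ν, x⟫ < c' := by
    intro x hx
    refine lt_min (hc x hx) ?_
    have h1 : ‖x‖ < R := by simpa using hSR hx
    have h2 := real_inner_le_norm ν x
    rw [hν, one_mul] at h2
    linarith
  have hccl : ∀ x ∈ closure S, ⟪ν, x⟫ ≤ c' := by
    intro x hx
    have : closure S ⊆ {x : Euc n | ⟪ν, x⟫ ≤ c'} := by
      refine closure_minimal (fun x hx => (hcS x hx).le) (isClosed_le (by fun_prop) (by fun_prop))
    exact this hx
  have key := cmp_min (S := S) (u := u)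
    (b := fun x => f1 * ((c' - ⟪ν, x⟫) ^ α * (‖x‖ ^ 2 - R'))) h.isOpen h.bdd h.contc ?_ ?_ ?_
  · have h1 := key z (subset_closure hz)
    have h2 : (c' - ⟪ν, z⟫) ^ α ≤ (c - ⟪ν, z⟫) ^ α := by
      refine Real.rpow_le_rpow (by linarith [hcS z hz]) ?_ hα0.le
      linarith [min_le_left c R]
    have h3 : 0 ≤ (c' - ⟪ν, z⟫) ^ α := Real.rpow_nonneg (by linarith [hcS z hz]) _
    refine le_trans ?_ h1
    have h4 : -R' ≤ ‖z‖ ^ 2 - R' := by nlinarith [norm_nonneg z]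
    have h5 : (c' - ⟪ν, z⟫) ^ α * (-R') ≤ (c' - ⟪ν, z⟫) ^ α * (‖z‖ ^ 2 - R') :=
      mulL h4 h3
    have h6 : (c' - ⟪ν, z⟫) ^ α * R' ≤ (c - ⟪ν, z⟫) ^ α * R' := mulR h2 hR'0.le
    nlinarith [mulL h5 hf1.le, mulL h6 hf1.le]
  · refine ContinuousOn.mul continuousOn_const (ContinuousOn.mul ?_ (by fun_prop))
    refine ContinuousOn.rpow_const (by fun_prop) (fun x _ => Or.inr hα0.le)
  · intro x hx
    rw [h.zero x hx]
    have h1 := hcl x (frontier_subset_closure hx)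
    have h2 := hccl x (frontier_subset_closure hx)
    have h3 : 0 ≤ (c' - ⟪ν, x⟫) ^ α := Real.rpow_nonneg (by linarith) _
    have h4 : ‖x‖ ^ 2 - R' ≤ 0 := by nlinarith [norm_nonneg x, pow_le_pow_left₀ (norm_nonneg x) h1 2]
    have := mul_nonneg h3 (neg_nonneg.2 h4)
    nlinarith [mul_nonneg hf1.le this]
  · intro p hp _ hm
    obtain ⟨H, h1, h2, h3⟩ := h.touch
      (b := fun x => f1 * ((c' - ⟪ν, x⟫) ^ α * (‖x‖ ^ 2 - R'))) hp hm
    set t : ℝ := c' - ⟪ν, p⟫ with ht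
    have ht0 : 0 < t := by linarith [hcS p hp]
    have hpR : ‖p‖ < R := by simpa using hSR hp
    have ht2 : t ≤ 2 * R := by
      have e1 := abs_real_inner_le_norm ν p
      rw [hν, one_mul] at e1
      have := (abs_le.1 e1).1
      linarith [min_le_right c R]
    have hH : ∀ v : Euc n, f1 * (t ^ α * ‖v‖ ^ 2 + c1 * t ^ (α - 2) * ⟪ν, v⟫ ^ 2) ≤ qf H v := by
      intro v
      have q1 : P2 (fun s => c' - ⟪ν, p + s • v⟫) t (-⟪ν, v⟫) 0 := by
        refine (P2_quad t (-⟪ν, v⟫) 0).congr' (Eventually.of_forall fun s => ?_)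
        simp only [inner_add_right, inner_smul_right, ht]; ring
      have q2 : P2 (fun s => ‖p + s • v‖ ^ 2 - R') (‖p‖ ^ 2 - R') (2 * ⟪p, v⟫) (2 * ‖v‖ ^ 2) := by
        refine (P2_quad _ _ _).congr' (Eventually.of_forall fun s => ?_)
        simp only [norm_add_sq_real, inner_smul_right, norm_smul, Real.norm_eq_abs, mul_pow, sq_abs]
        ring
      have q3 := h3 v _ _ (((q1.rpow ht0 α).mul q2).const_mul f1)
      refine le_trans ?_ q3
      refine mulL ?_ hf1.le
      set X := ⟪ν, v⟫ with hX
      set Y := ⟪p, v⟫ with hY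
      have hY2 : Y ^ 2 ≤ R ^ 2 * ‖v‖ ^ 2 := by
        have e1 := abs_real_inner_le_norm p v
        have e2 : |Y| ≤ R * ‖v‖ := e1.trans (mulR hpR.le (norm_nonneg v))
        rw [← mul_pow, ← sq_abs Y]
        exact pow_le_pow_left₀ (abs_nonneg _) e2 2
      set T := t ^ (α - 2) with hT
      have hT0 : 0 < T := Real.rpow_pos_of_pos ht0 _
      have e1 : t ^ (α - 1) = T * t := by
        rw [hT, show α - 1 = (α - 2) + 1 by ring, Real.rpow_add_one ht0.ne']
      have e0 : t ^ α = T * t ^ 2 := by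
        rw [hT, show t ^ 2 = t ^ (2 : ℝ) by norm_cast, ← Real.rpow_add ht0]; congr 1; ring
      rw [e0, e1]
      have hP : ‖p‖ ^ 2 ≤ R ^ 2 := pow_le_pow_left₀ (norm_nonneg p) hpR.le 2
      have hk : 4 * α ^ 2 * R ^ 2 + c1 ≤ α * (1 - α) * (R' - ‖p‖ ^ 2) := by
        have : α * (1 - α) * (R' - R ^ 2) = 4 * α ^ 2 * R ^ 2 + c1 := by
          rw [hR', add_sub_cancel_left, mul_div_cancel₀ _ hα2.ne']
        have h12 := mulL hP hα2.le
        linarith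
      have hYa : |Y| ≤ R * ‖v‖ := (abs_real_inner_le_norm p v).trans
        (mulR hpR.le (norm_nonneg v))
      have := barrier_alg (X := X) hα0 ht0 hT0 (norm_nonneg v) (by linarith) hYa hk
      linarith
    have hm0 : 0 < f1 * t ^ α := mul_pos hf1 (Real.rpow_pos_of_pos ht0 _)
    have hq := qf_le_of_det ((posDef_iff_qf H).1 h1).1 hm0 (fun v => by
      have := hH v
      have h5 : 0 ≤ c1 * t ^ (α - 2) * ⟪ν, v⟫ ^ 2 := by positivity
      nlinarith) ν
    rw [h2, hν] at hq
    have hν2 := hH ν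
    rw [real_inner_self_eq_norm_sq, hν] at hν2
    have h6 : (f1 * t ^ α) ^ (n - 1) * (f1 * (c1 * t ^ (α - 2))) ≤ f p ^ n := by
      refine le_trans (mulL ?_ (by positivity)) (hq.trans (by simp))
      refine le_trans ?_ hν2
      have : 0 ≤ t ^ α := Real.rpow_nonneg ht0.le _
      nlinarith
    have h7 : (f1 * t ^ α) ^ (n - 1) * (f1 * (c1 * t ^ (α - 2))) = f1 ^ n * (c1 / t) := by
      have e1 : t ^ (α - 2) = t ^ α / t ^ 2 := by
        rw [Real.rpow_sub ht0]; norm_cast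
      have e2 : (t ^ α) ^ n = t := by
        rw [← Real.rpow_natCast, ← Real.rpow_mul ht0.le, hαn, Real.rpow_one]
      have e3 : n - 1 + 1 = n := by omega
      calc _ = (f1 * t ^ α) ^ (n - 1 + 1) * (c1 / t ^ 2) := by rw [e1, pow_succ]; ring
        _ = f1 ^ n * (c1 / t) := by rw [e3, mul_pow, e2]; field_simp
    have h8 : 1 ≤ c1 / t := by rw [le_div_iff₀ ht0]; linarith
    have h9 : f p ^ n < f1 ^ n := pow_lt_pow_left₀ (hf p hp) (h.fpos p hp).le hn0
    have h10 : 0 < f1 ^ n := by positivity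
    nlinarith

theorem pog_exp {φW φρ φη φz φD : ℝ → ℝ} {W W1 W2 ρ ρ1 ρ2 η η1 η2 z z1 z2 D D1 D2 : ℝ} (p γ : ℝ)
    (hW : P2 φW W W1 W2) (hρ : P2 φρ ρ ρ1 ρ2) (hη : P2 φη η η1 η2) (hz : P2 φz z z1 z2)
    (hD : P2 φD D D1 D2) (W0 : 0 < W) (ρ0 : 0 < ρ) (η0 : 0 < η)
    (N m : ℝ) (hN : N = D / ρ) (hmm : m = D1 / ρ - N * ρ1 / ρ) :
    P2 (fun t => Real.log (φW t) - 2 * Real.log (φρ t) + p * Real.log (φη t) + φz t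
        + γ / 2 * (φD t * (φρ t)⁻¹) ^ 2)
      (Real.log W - 2 * Real.log ρ + p * Real.log η + z + γ / 2 * (D * ρ⁻¹) ^ 2)
      (W1 / W - 2 * (ρ1 / ρ) + p * (η1 / η) + z1 + γ * (N * m))
      ((W2 / W - (W1 / W) ^ 2) - 2 * (ρ2 / ρ - (ρ1 / ρ) ^ 2) + p * (η2 / η - (η1 / η) ^ 2) + z2
        + γ * (m ^ 2 + N * (D2 / ρ - 2 * m * (ρ1 / ρ) - N * ρ2 / ρ))) := by
  have h1 := ((((hW.log W0).sub ((hρ.log ρ0).const_mul 2)).add ((hη.log η0).const_mul p)).add hz).add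
    (((hD.mul (hρ.inv ρ0.ne')).sq).const_mul (γ / 2))
  refine h1.of_eq rfl ?_ ?_
  · subst hN hmm; field_simp; ring
  · subst hN hmm; field_simp; ring

theorem one_add_pow_lower {a s : ℝ} (ha : 0 ≤ a) (ha1 : a ≤ 1) (hs : |s| ≤ 1 / 2) :
    1 + a * s - s ^ 2 ≤ (1 + s) ^ a := by
  obtain ⟨h1, h2⟩ := abs_le.1 hs
  have hp : 0 < 1 + s := by linarith
  have hb : (1 + s) ^ (1 - a) ≤ 1 + (1 - a) * s :=
    rpow_one_add_le_one_add_mul_self (by linarith) (by linarith) (by linarith)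
  have e : (1 + s) ^ a * (1 + s) ^ (1 - a) = 1 + s := by
    rw [← Real.rpow_add hp]; simp
  have hpos : 0 < (1 + s) ^ a := Real.rpow_pos_of_pos hp _
  have hd : 0 < 1 + (1 - a) * s := by nlinarith
  have h3 : 1 + s ≤ (1 + s) ^ a * (1 + (1 - a) * s) := by
    have := mulL hb hpos.le
    linarith
  by_contra hc
  push Not at hc
  have h4 : (1 + s) ^ a * (1 + (1 - a) * s) < (1 + a * s - s ^ 2) * (1 + (1 - a) * s) :=
    mul_lt_mul_of_pos_right hc hd
  have h5 : (1 + a * s - s ^ 2) * (1 + (1 - a) * s) = 1 + s + s ^ 2 * (a * (1 - a) - 1 - (1 - a) * s) := by ring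
  have h6 : a * (1 - a) - 1 - (1 - a) * s ≤ 0 := by nlinarith
  nlinarith [mul_nonneg (sq_nonneg s) (neg_nonneg.2 h6)]

theorem qf_le_trace {B : Mat n} (hB : B.PosSemidef) (v : Euc n) : qf B v ≤ B.trace * ‖v‖ ^ 2 := by
  have := trace_mul_mono (X := vecMulVec v.ofLp v.ofLp) (Y := ‖v‖ ^ 2 • (1 : Mat n)) hB (fun w => by
    rw [qf_vec, qf_smul, qf_one, ← mul_pow, ← sq_abs]
    exact pow_le_pow_left₀ (abs_nonneg _) (abs_real_inner_le_norm v w) 2)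
  rw [trace_vec] at this
  simpa [mul_comm] using this

theorem app_vecMulVec (a d ξ : Euc n) : app (vecMulVec a.ofLp d.ofLp) ξ = ⟪d, ξ⟫ • a := by
  unfold app
  ext i
  simp only [vecMulVec_mulVec, inner_eq_dot]
  simp [mul_comm]

theorem lower_of_trace_inv {A : Mat n} (hA : A.PosDef) {X : ℝ} (hX : 0 < X) (hX1 : A⁻¹.trace ≤ X)
    (v : Euc n) : X⁻¹ * ‖v‖ ^ 2 ≤ qf A v := by
  have h1 := cauchy_inv hA v v
  have h2 := qf_le_trace hA.inv.posSemidef v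
  have h0 : 0 ≤ qf A v := ((posSemidef_iff_qf A).1 hA.posSemidef).2 v
  rw [real_inner_self_eq_norm_sq] at h1
  have h3 : qf A⁻¹ v ≤ X * ‖v‖ ^ 2 := h2.trans (mulR hX1 (sq_nonneg _))
  have h4 : (‖v‖ ^ 2) ^ 2 ≤ qf A v * (X * ‖v‖ ^ 2) := h1.trans (mulL h3 h0)
  rw [inv_mul_le_iff₀ hX]
  rcases (sq_nonneg ‖v‖).eq_or_lt with h | h
  · rw [← h]; positivity
  · nlinarith

/-- final step: bound on `q` -/
theorem pog_q {A : Mat n} (hn : n ≠ 0) (hA : A.PosDef) {f X Y : ℝ} (hX : 0 < X) (hdet : A.det = f ^ n)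
    (hX1 : A⁻¹.trace ≤ X) (q : Euc n) (hY : qf A⁻¹ q ≤ Y) : ‖q‖ ^ 2 ≤ f ^ n * X ^ (n - 1) * Y := by
  have h0 := qf_le_of_det ((posDef_iff_qf A).1 hA).1 (inv_pos.2 hX) (lower_of_trace_inv hA hX hX1) q
  have h1 := cauchy_inv hA q q
  rw [real_inner_self_eq_norm_sq] at h1
  have hB : 0 ≤ qf A⁻¹ q := ((posSemidef_iff_qf A⁻¹).1 hA.inv.posSemidef).2 q
  have hXp : 0 < X ^ (n - 1) := by positivity
  have hd : 0 < f ^ n := hdet ▸ hA.det_pos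
  rw [inv_pow, inv_mul_le_iff₀ hXp, hdet] at h0
  have h2 : (‖q‖ ^ 2) ^ 2 ≤ X ^ (n - 1) * (f ^ n * ‖q‖ ^ 2) * Y :=
    h1.trans (mul_le_mul h0 hY hB (by positivity))
  rcases (sq_nonneg ‖q‖).eq_or_lt with h | h
  · rw [← h]; have : 0 ≤ Y := hB.trans hY
    positivity
  · nlinarith

theorem det_one_add_vec (a d : Euc n) : (1 + vecMulVec a.ofLp d.ofLp : Mat n).det = 1 + ⟪d, a⟫ := by
  rw [vecMulVec_eq (Fin 1), det_one_add_mul_comm]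
  simp [inner_eq_dot]

/-- matrix step -/
theorem pog_mat {A Ap Am : Mat n} (hn : 2 ≤ n) (hA : A.PosDef) (hAp : Ap.PosDef) (hAm : Am.PosDef)
    {f fp fm : ℝ} (f0 : 0 < f) (fp0 : 0 < fp) (fm0 : 0 < fm) (hf : A.det = f ^ n)
    (hfp : Ap.det = fp ^ n) (hfm : Am.det = fm ^ n) (a d : Euc n) {s kp km w P g1 g2 : ℝ}
    (hs : s = ⟪d, a⟫) (hs1 : |s| ≤ 1 / 2) (hkp : 0 ≤ kp) (hkm : 0 ≤ km) (q : Euc n)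
    (h : ∀ ξ : Euc n, kp * qf Ap (ξ + ⟪d, ξ⟫ • a) + km * qf Am (ξ - ⟪d, ξ⟫ • a) - w * qf A ξ ≤
      P * qf A ξ - g1 * ‖ξ‖ ^ 2 - g2 * ⟪q, ξ⟫ ^ 2) :
    g1 * A⁻¹.trace + g2 * qf A⁻¹ q ≤ n * ((P + w) - kp * (fp / f * (1 + 2 / n * s - s ^ 2))
      - km * (fm / f * (1 - 2 / n * s - s ^ 2))) := by
  have hn0 : n ≠ 0 := by omega
  have hnr : (2 : ℝ) ≤ n := by exact_mod_cast hn
  have hC := hA.inv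
  have hdC : (A⁻¹).det = (f⁻¹) ^ n := by rw [det_nonsing_inv, hf, Ring.inverse_eq_inv', inv_pow]
  obtain ⟨hs2, hs3⟩ := abs_le.1 hs1
  have aux : ∀ (B : Mat n) (a' : Euc n) (s' fB : ℝ), B.PosDef → 0 < fB → B.det = fB ^ n → s' = ⟪d, a'⟫ →
      |s'| ≤ 1 / 2 → n * (fB / f * (1 + 2 / n * s' - s' ^ 2)) ≤
        (A⁻¹ * ((1 + vecMulVec a'.ofLp d.ofLp : Mat n)ᵀ * B * (1 + vecMulVec a'.ofLp d.ofLp))).trace := by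
    intro B a' s' fB hB fB0 hfB hs' hs1'
    obtain ⟨h1, h2⟩ := abs_le.1 hs1'
    have hsp : 0 < 1 + s' := by linarith
    have hdet := det_one_add_vec a' d
    rw [← hs'] at hdet
    have hunit : IsUnit (1 + vecMulVec a'.ofLp d.ofLp : Mat n) := by
      rw [isUnit_iff_isUnit_det, hdet]; exact isUnit_iff_ne_zero.2 hsp.ne'
    set σ := (1 + s') ^ (2 / (n : ℝ)) with hσ
    have hσ0 : 0 < σ := Real.rpow_pos_of_pos hsp _
    have hσn : σ ^ n = (1 + s') ^ 2 := by
      rw [hσ, ← Real.rpow_natCast, ← Real.rpow_mul hsp.le]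
      rw [div_mul_cancel₀ _ (by positivity)]; norm_cast
    have h3 := amgm_trace hC (posDef_conj hB hunit) (inv_pos.2 f0) (mul_pos hσ0 fB0) hdC (by
      rw [det_mul, det_mul, det_transpose, hdet, hfB, mul_pow, hσn]; ring)
    refine le_trans ?_ h3
    refine mulL ?_ (by positivity)
    have h4 := one_add_pow_lower (a := 2 / (n : ℝ)) (by positivity) (by
      rw [div_le_one (by positivity)]; exact hnr) hs1'
    rw [← hσ] at h4
    rw [div_eq_mul_inv]
    have := mulL h4 (show 0 ≤ fB * f⁻¹ by positivity)
    linarith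
  have h1 := aux Ap a s fp hAp fp0 hfp hs hs1
  have h2 := aux Am (-a) (-s) fm hAm fm0 hfm (by rw [inner_neg_right, hs]) (by rwa [abs_neg])
  have h3 := trace_mul_mono (C := A⁻¹)
    (X := kp • ((1 + vecMulVec a.ofLp d.ofLp : Mat n)ᵀ * Ap * (1 + vecMulVec a.ofLp d.ofLp)) +
      km • ((1 + vecMulVec (-a).ofLp d.ofLp : Mat n)ᵀ * Am * (1 + vecMulVec (-a).ofLp d.ofLp)))
    (Y := (P + w) • A - g1 • (1 : Mat n) - g2 • vecMulVec q.ofLp q.ofLp) hC.posSemidef (fun ξ => by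
      have := h ξ
      simp only [qf_add, qf_sub, qf_smul, qf_conj, qf_one, qf_vec, app_add_mat, app_one, app_vecMulVec]
      simp only [smul_neg, ← sub_eq_add_neg]
      linarith)
  generalize (1 + vecMulVec a.ofLp d.ofLp : Mat n)ᵀ * Ap * (1 + vecMulVec a.ofLp d.ofLp) = Xp at h1 h3
  generalize (1 + vecMulVec (-a).ofLp d.ofLp : Mat n)ᵀ * Am * (1 + vecMulVec (-a).ofLp d.ofLp) = Xm at h2 h3
  have hAA : A⁻¹ * A = 1 := nonsing_inv_mul A (by rw [hf]; exact isUnit_iff_ne_zero.2 (by positivity))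
  simp only [mul_add, mul_sub, mul_smul_comm, trace_add, trace_sub, trace_smul, hAA, mul_one,
    trace_one, Fintype.card_fin, smul_eq_mul, trace_vec] at h3
  have h1' := mulL h1 hkp
  have h2' := mulL h2 hkm
  ring_nf at h3 h1' h2' ⊢
  linarith

theorem P2.hasDerivAt {φ : ℝ → ℝ} {a b c : ℝ} (h : P2 φ a b c) : HasDerivAt φ b 0 := by
  rw [hasDerivAt_iff_isLittleO_nhds_zero]
  have h1 := h.lin.trans_isLittleO sq_isLittleO_id
  refine h1.congr_left (fun t => ?_)
  simp [h.val]; ring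

theorem Pea.norm_le {u : Euc n → ℝ} {p g : Euc n} {H : Mat n} (h : Pea u p g H) {G : ℝ} (hG : 0 ≤ G)
    (hl : ∀ᶠ x in 𝓝 p, |u x - u p| ≤ G * ‖x - p‖) (v : Euc n) : |⟪g, v⟫| ≤ G * ‖v‖ := by
  refine (h v).hasDerivAt.le_of_lip' (by positivity) ?_
  filter_upwards [(line_tendsto p v).eventually hl] with t ht
  simp only [Real.norm_eq_abs, sub_zero, zero_smul, add_zero]
  simp only [add_sub_cancel_left, norm_smul, Real.norm_eq_abs] at ht
  linarith

/-- tangent plane inequality -/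
theorem Pea.tangent {U : Set (Euc n)} {u : Euc n → ℝ} (hc : ConvexOn ℝ U u) {p g : Euc n} {H : Mat n}
    (h : Pea u p g H) (hp : p ∈ U) {z : Euc n} (hz : z ∈ U) : u p + ⟪g, z - p⟫ ≤ u z := by
  have hd := (h (z - p)).hasDerivAt
  have hs := hd.tendsto_slope_zero_right
  have : ⟪g, z - p⟫ ≤ u z - u p := by
    refine le_of_tendsto hs ?_
    filter_upwards [Ioo_mem_nhdsGT (show (0:ℝ) < 1 by norm_num)] with t ht
    have h1 := hc.2 hp hz (show (0:ℝ) ≤ 1 - t by linarith [ht.2]) ht.1.le (by ring)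
    have e : (1 - t) • p + t • z = p + t • (z - p) := by rw [sub_smul, smul_sub, one_smul]; abel
    rw [e] at h1
    simp only [smul_eq_mul, zero_add, zero_smul, add_zero] at h1 ⊢
    rw [inv_mul_le_iff₀ ht.1]; linarith
  linarith

theorem P2_norm {y : Euc n} (hy : y ≠ 0) (τ : Euc n) :
    ∃ c, P2 (fun t => ‖y + t • τ‖) ‖y‖ (⟪y, τ⟫ / ‖y‖) c := by
  have hr : 0 < ‖y‖ := norm_pos_iff.2 hy
  have q2 : P2 (fun s => ‖y + s • τ‖ ^ 2) (‖y‖ ^ 2) (2 * ⟪y, τ⟫) (2 * ‖τ‖ ^ 2) := by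
    refine (P2_quad _ _ _).congr' (Eventually.of_forall fun s => ?_)
    simp only [norm_add_sq_real, inner_smul_right, norm_smul, Real.norm_eq_abs, mul_pow, sq_abs]
    ring
  have h := q2.rpow (by positivity) (1 / 2)
  have e : ∀ z : Euc n, (‖z‖ ^ 2) ^ (1 / 2 : ℝ) = ‖z‖ := fun z => by
    rw [← Real.sqrt_eq_rpow, Real.sqrt_sq (norm_nonneg _)]
  have e2 : (‖y‖ ^ 2) ^ (1 / 2 - 1 : ℝ) = ‖y‖⁻¹ := by
    rw [Real.rpow_sub (by positivity), e, Real.rpow_one]; field_simp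
  refine ⟨_, (h.congr' (Eventually.of_forall fun t => e _)).of_eq (e y) ?_ rfl⟩
  rw [e2]; field_simp

theorem pog_alg {a γ2 γ N m p e Q G V c X Y Z W ρ η w1 : ℝ} (hp : 4 ≤ p) (hγ2 : γ2 * (16 * G ^ 2) = 1) (hγ20 : 0 < γ2)
    (hN : γ2 * N ^ 2 ≤ 1 / 4) (hmQ : |m - Q| ≤ 4 * G * |a|) (hG : 0 < G) (ha : a = p * e + c) (hc : c ^ 2 ≤ γ / 4 * V)
    (hV : 0 ≤ γ * V)
    (hb : w1 - 2 * a + a + γ2 * (N * m) = 0)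
    (h : ((X + Y - 2 * Z) / W - w1 ^ 2) - 2 * (0 / ρ - a ^ 2) + p * (-Z / η - e ^ 2) + γ * V
        + γ2 * (m ^ 2 + N * ((X - Y) / ρ - 2 * m * a - N * 0 / ρ)) ≤ 0) :
    (1 / W + γ2 * N / ρ) * X + (1 / W - γ2 * N / ρ) * Y - 2 / W * Z ≤
      p / η * Z - γ / 2 * V - γ2 / 4 * Q ^ 2 := by
  have hw : w1 = a - γ2 * (N * m) := by linarith
  have e1 : (1 / W + γ2 * N / ρ) * X + (1 / W - γ2 * N / ρ) * Y - 2 / W * Z =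
    (X + Y - 2 * Z) / W + γ2 * N * ((X - Y) / ρ) := by ring
  rw [e1]
  have e2 : p / η * Z = - (p * (-Z / η)) := by ring
  rw [e2]
  simp only [zero_div, mul_zero, zero_sub, sub_zero] at h
  rw [hw] at h
  have hm2 : Q ^ 2 / 2 - 16 * G ^ 2 * a ^ 2 ≤ m ^ 2 := by
    have h1 : (m - Q) ^ 2 ≤ 16 * G ^ 2 * a ^ 2 := by
      rw [← sq_abs (m - Q)]
      calc |m - Q| ^ 2 ≤ (4 * G * |a|) ^ 2 := pow_le_pow_left₀ (abs_nonneg _) hmQ 2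
        _ = 16 * G ^ 2 * a ^ 2 := by rw [mul_pow, sq_abs]; ring
    nlinarith [sq_nonneg (2 * m - Q)]
  have hm3 : γ2 * (Q ^ 2 / 2) - a ^ 2 ≤ γ2 * m ^ 2 := by
    have := mulL hm2 hγ20.le
    have e3 : γ2 * (16 * G ^ 2 * a ^ 2) = a ^ 2 := by rw [← mul_assoc, hγ2, one_mul]
    linarith
  have hm4 : γ2 * (N * m) * (γ2 * (N * m)) ≤ 1 / 4 * (γ2 * m ^ 2) := by
    have := mulR hN (show 0 ≤ γ2 * m ^ 2 by positivity)
    linarith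
  have ha2 : p * e ^ 2 ≤ a ^ 2 / 2 + γ / 8 * V := by
    have h1 : (p * e) ^ 2 / 2 - c ^ 2 ≤ a ^ 2 := by rw [ha]; nlinarith [sq_nonneg (p * e + 2 * c)]
    have h2 : 4 * (p * e ^ 2) ≤ (p * e) ^ 2 := by
      have : 4 * (p * e ^ 2) ≤ p * (p * e ^ 2) := mulR hp (by positivity)
      linarith
    linarith
  have hm0 : 0 ≤ γ2 * m ^ 2 := by positivity
  generalize (X + Y - 2 * Z) / W = A1 at *
  generalize (X - Y) / ρ = A2 at *
  generalize -Z / η = A3 at *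
  have e4 : A1 + γ2 * N * A2 ≤ (a - γ2 * (N * m)) ^ 2 - 2 * a ^ 2 - p * (A3 - e ^ 2) - γ * V
     - γ2 * m ^ 2 + 2 * γ2 * N * m * a := by linarith
  have e5 : (a - γ2 * (N * m)) ^ 2 = a ^ 2 - 2 * γ2 * N * m * a + γ2 * (N * m) * (γ2 * (N * m)) := by ring
  linarith

/-- second difference -/
def sd (u : Euc n → ℝ) (x y : Euc n) : ℝ := u (x + y) + u (x - y) - 2 * u x

/-- the auxiliary function -/
def pogF (u : Euc n → ℝ) (h p γ γ2 : ℝ) (z : Euc n × Euc n) : ℝ :=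
  Real.log (sd u z.1 z.2) - 2 * Real.log (h + ‖z.2‖) + p * Real.log (- u z.1) + γ / 2 * ‖z.1‖ ^ 2
    + γ2 / 2 * ((u (z.1 + z.2) - u (z.1 - z.2)) * (h + ‖z.2‖)⁻¹) ^ 2

/-- first order condition in `y` -/
theorem pog_foc {u : Euc n → ℝ} {x y gp gm : Euc n} {Ap Am : Mat n} {h p γ γ2 G W ρ : ℝ}
    (hGp : 0 < G) (hγ2 : γ2 = 1 / (16 * G ^ 2)) (hh : 0 < h) (hy : y ≠ 0)
    (hW : W = sd u x y) (hρ : ρ = h + ‖y‖) (W0 : 0 < W) (η0 : 0 < - u x)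
    (hp : Pea u (x + y) gp Ap) (hm : Pea u (x - y) gm Am)
    (hgp : ∀ v, |⟪gp, v⟫| ≤ G * ‖v‖) (hgm : ∀ v, |⟪gm, v⟫| ≤ G * ‖v‖)
    (hD : |u (x + y) - u (x - y)| ≤ 2 * G * ‖y‖)
    (hmax : ∀ᶠ z in 𝓝 (x, y), pogF u h p γ γ2 z ≤ pogF u h p γ γ2 (x, y)) (τ : Euc n) :
    |⟪gp - gm, τ⟫ - 2 * W * ⟪y, τ⟫ / (‖y‖ * ρ)| ≤ W / (2 * ρ) * ‖τ‖ := by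
  have hr : 0 < ‖y‖ := norm_pos_iff.2 hy
  have ρ0 : 0 < ρ := by rw [hρ]; positivity
  obtain ⟨cc, hcc⟩ := P2_norm hy τ
  have e1 : P2 (fun t => u (x + (y + t • τ))) (u (x + y)) ⟪gp, τ⟫ (qf Ap τ) :=
    (hp τ).congr' (Eventually.of_forall fun t => by simp only [add_assoc])
  have e2 : P2 (fun t => u (x - (y + t • τ))) (u (x - y)) (-⟪gm, τ⟫) (qf Am τ) :=
    ((hm (-τ)).of_eq rfl (by rw [inner_neg_right]) (by rw [qf_neg_vec])).congr'
      (Eventually.of_forall fun t => by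
        simp only; congr 1; rw [smul_neg]; abel)
  have hPW : P2 (fun t => sd u x (y + t • τ)) W ⟪gp - gm, τ⟫ (qf Ap τ + qf Am τ) :=
    ((e1.add e2).sub (P2_const (2 * u x))).of_eq (by rw [hW]; rfl)
      (by rw [inner_sub_left]; ring) (by ring)
  have hPρ : P2 (fun t => h + ‖y + t • τ‖) ρ (⟪y, τ⟫ / ‖y‖) cc :=
    ((P2_const h).add hcc).of_eq hρ.symm (by ring) (by ring)
  set N := (u (x + y) - u (x - y)) / ρ with hN
  have hex := pog_exp p γ2 hPW hPρ (P2_const (- u x)) (P2_const (γ / 2 * ‖x‖ ^ 2)) (e1.sub e2) W0 ρ0 η0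
    N _ hN rfl
  have hpath : Tendsto (fun t : ℝ => (x, y + t • τ)) (𝓝 0) (𝓝 (x, y)) :=
    tendsto_const_nhds.prodMk_nhds (line_tendsto y τ)
  have hfin := (hex.max (by
    filter_upwards [hpath.eventually hmax] with t ht
    simp only [pogF] at ht
    rw [← hW, ← hρ] at ht
    exact ht)).1
  have hNb : |N| ≤ 2 * G := by
    rw [hN, abs_div, abs_of_pos ρ0, div_le_iff₀ ρ0]
    refine hD.trans ?_
    have : ‖y‖ ≤ ρ := by rw [hρ]; linarith
    nlinarith
  set m := (⟪gp, τ⟫ - -⟪gm, τ⟫) / ρ - N * (⟪y, τ⟫ / ‖y‖) / ρ with hmdef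
  have hmb : |m| ≤ 4 * G * ‖τ‖ / ρ := by
    have : m = (⟪gp, τ⟫ + ⟪gm, τ⟫ - N * (⟪y, τ⟫ / ‖y‖)) / ρ := by rw [hmdef]; ring
    rw [this, abs_div, abs_of_pos ρ0]
    refine div_le_div_of_nonneg_right ?_ ρ0.le
    have h1 : |⟪y, τ⟫ / ‖y‖| ≤ ‖τ‖ := by
      rw [abs_div, abs_of_pos hr, div_le_iff₀ hr, mul_comm]; exact abs_real_inner_le_norm y τ
    have h2 : |N * (⟪y, τ⟫ / ‖y‖)| ≤ 2 * G * ‖τ‖ := by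
      rw [abs_mul]; exact mul_le_mul hNb h1 (abs_nonneg _) (by positivity)
    have h3 := abs_sub (⟪gp, τ⟫ + ⟪gm, τ⟫) (N * (⟪y, τ⟫ / ‖y‖))
    have h4 := abs_add_le ⟪gp, τ⟫ ⟪gm, τ⟫
    linarith [hgp τ, hgm τ]
  have hkey : ⟪gp - gm, τ⟫ - 2 * W * ⟪y, τ⟫ / (‖y‖ * ρ) = - (W * (γ2 * (N * m))) := by
    have h1 : ⟪gp - gm, τ⟫ / W - 2 * (⟪y, τ⟫ / ‖y‖ / ρ) + γ2 * (N * m) = 0 := by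
      simp only [zero_div, mul_zero, add_zero] at hfin; exact hfin
    generalize γ2 * (N * m) = K at *
    field_simp at h1 ⊢
    linarith
  rw [hkey, abs_neg, abs_mul, abs_of_pos W0, abs_mul, abs_mul]
  have hγ0 : 0 < γ2 := by rw [hγ2]; positivity
  rw [abs_of_pos hγ0]
  have h5 : |N| * |m| ≤ 2 * G * (4 * G * ‖τ‖ / ρ) := mul_le_mul hNb hmb (abs_nonneg _) (by positivity)
  calc W * (γ2 * (|N| * |m|)) ≤ W * (γ2 * (2 * G * (4 * G * ‖τ‖ / ρ))) := by gcongr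
    _ = W / (2 * ρ) * ‖τ‖ := by rw [hγ2]; field_simp; ring

/-- second order condition -/
theorem pog_soc {u : Euc n → ℝ} {x y g gp gm d : Euc n} {A Ap Am : Mat n} {h p γ γ2 G W ρ N R : ℝ}
    (hGp : 0 < G) (hγ2 : γ2 = 1 / (16 * G ^ 2)) (hR : 0 < R) (hγ : γ = 1 / (4 * R ^ 2)) (hp4 : 4 ≤ p)
    (hh : 0 < h) (hy : y ≠ 0) (hx : ‖x‖ ≤ R)
    (hW : W = sd u x y) (hρ : ρ = h + ‖y‖) (W0 : 0 < W) (η0 : 0 < - u x)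
    (hp : Pea u (x + y) gp Ap) (hm : Pea u (x - y) gm Am) (h0 : Pea u x g A)
    (hgp : ∀ v, |⟪gp, v⟫| ≤ G * ‖v‖) (hgm : ∀ v, |⟪gm, v⟫| ≤ G * ‖v‖)
    (hD : |u (x + y) - u (x - y)| ≤ 2 * G * ‖y‖) (hN : N = (u (x + y) - u (x - y)) / ρ)
    (hd : d = (p / (- u x)) • (-g) + γ • x)
    (hmax : ∀ᶠ z in 𝓝 (x, y), pogF u h p γ γ2 z ≤ pogF u h p γ γ2 (x, y)) (ξ : Euc n) :
    (1 / W + γ2 * N / ρ) * qf Ap (ξ + ⟪d, ξ⟫ • ((ρ / ‖y‖) • y)) +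
      (1 / W - γ2 * N / ρ) * qf Am (ξ - ⟪d, ξ⟫ • ((ρ / ‖y‖) • y)) - 2 / W * qf A ξ ≤
      p / (- u x) * qf A ξ - γ / 2 * ‖ξ‖ ^ 2 - γ2 / 4 * ⟪ρ⁻¹ • (gp - gm), ξ⟫ ^ 2 := by
  have hr : 0 < ‖y‖ := norm_pos_iff.2 hy
  have ρ0 : 0 < ρ := by rw [hρ]; positivity
  have hγ20 : 0 < γ2 := by rw [hγ2]; positivity
  have hγ0 : 0 < γ := by rw [hγ]; positivity
  set η := - u x with hη
  set a := ⟪d, ξ⟫ with ha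
  have ha' : a = p * (-⟪g, ξ⟫ / η) + γ * ⟪x, ξ⟫ := by
    rw [ha, hd, inner_add_left, inner_smul_left, inner_smul_left, inner_neg_left]; simp; ring
  set σ := a • ((ρ / ‖y‖) • y) with hσ
  have hσ' : σ = (ρ * a / ‖y‖) • y := by rw [hσ, smul_smul]; congr 1; ring
  set β := ρ * a / ‖y‖ with hβ
  have e1 : P2 (fun t => u ((x + t • ξ) + (y + t • σ))) (u (x + y)) ⟪gp, ξ + σ⟫ (qf Ap (ξ + σ)) :=
    (hp (ξ + σ)).congr' (Eventually.of_forall fun t => by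
      simp only; congr 1; rw [smul_add]; abel)
  have e2 : P2 (fun t => u ((x + t • ξ) - (y + t • σ))) (u (x - y)) ⟪gm, ξ - σ⟫ (qf Am (ξ - σ)) :=
    (hm (ξ - σ)).congr' (Eventually.of_forall fun t => by
      simp only; congr 1; rw [smul_sub]; abel)
  have hPW : P2 (fun t => sd u (x + t • ξ) (y + t • σ)) W (⟪gp, ξ + σ⟫ + ⟪gm, ξ - σ⟫ - 2 * ⟪g, ξ⟫)
      (qf Ap (ξ + σ) + qf Am (ξ - σ) - 2 * qf A ξ) :=
    ((e1.add e2).sub ((h0 ξ).const_mul 2)).of_eq (by rw [hW]; rfl) rfl rfl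
  have hPρ : P2 (fun t => h + ‖y + t • σ‖) ρ (ρ * a) 0 := by
    refine (P2_quad ρ (ρ * a) 0).congr' ?_
    have : ∀ᶠ t : ℝ in 𝓝 0, 0 < 1 + t * β := by
      have : Tendsto (fun t : ℝ => 1 + t * β) (𝓝 0) (𝓝 1) := by
        have : Continuous (fun t : ℝ => 1 + t * β) := by fun_prop
        simpa using this.tendsto 0
      exact this.eventually (lt_mem_nhds one_pos)
    filter_upwards [this] with t ht
    have e : y + t • σ = (1 + t * β) • y := by rw [hσ', add_smul, one_smul, smul_smul]
    rw [e, norm_smul, Real.norm_eq_abs, abs_of_pos ht, hρ, hβ, hρ]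
    field_simp; ring
  have hPη : P2 (fun t => - u (x + t • ξ)) η (-⟪g, ξ⟫) (-qf A ξ) := (h0 ξ).neg
  have hPz : P2 (fun t => γ / 2 * ‖x + t • ξ‖ ^ 2) (γ / 2 * ‖x‖ ^ 2) (γ * ⟪x, ξ⟫) (γ * ‖ξ‖ ^ 2) := by
    refine (P2_quad _ _ _).congr' (Eventually.of_forall fun s => ?_)
    simp only [norm_add_sq_real, inner_smul_right, norm_smul, Real.norm_eq_abs, mul_pow, sq_abs]
    ring
  have hex := pog_exp p γ2 hPW hPρ hPη hPz (e1.sub e2) W0 ρ0 η0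
    N _ hN rfl
  have hpath : Tendsto (fun t : ℝ => (x + t • ξ, y + t • σ)) (𝓝 0) (𝓝 (x, y)) :=
    (line_tendsto x ξ).prodMk_nhds (line_tendsto y σ)
  have hfin := (hex.max (by
    filter_upwards [hpath.eventually hmax] with t ht
    simp only [pogF] at ht
    rw [← hW, ← hρ] at ht
    exact ht))
  have hNb : |N| ≤ 2 * G := by
    rw [hN, abs_div, abs_of_pos ρ0, div_le_iff₀ ρ0]
    refine hD.trans ?_
    have : ‖y‖ ≤ ρ := by rw [hρ]; linarith
    nlinarith
  have hρa : ρ * a / ρ = a := by field_simp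
  set m := (⟪gp, ξ + σ⟫ - ⟪gm, ξ - σ⟫) / ρ - N * (ρ * a) / ρ with hmdef
  rw [hρa] at hfin
  have hNb2 : N ^ 2 ≤ 4 * G ^ 2 := by
    rw [← sq_abs]; calc |N| ^ 2 ≤ (2 * G) ^ 2 := pow_le_pow_left₀ (abs_nonneg _) hNb 2
      _ = _ := by ring
  refine pog_alg (G := G) (e := -⟪g, ξ⟫ / η) (c := γ * ⟪x, ξ⟫) (m := m)
    (w1 := (⟪gp, ξ + σ⟫ + ⟪gm, ξ - σ⟫ - 2 * ⟪g, ξ⟫) / W) (a := a) hp4 ?_ hγ20 ?_ ?_ hGp ha' ?_ (by positivity) ?_ hfin.2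
  · rw [hγ2]; field_simp
  · calc γ2 * N ^ 2 ≤ γ2 * (4 * G ^ 2) := by gcongr
      _ = 1 / 4 := by rw [hγ2]; field_simp; ring
  · have e : m - ⟪ρ⁻¹ • (gp - gm), ξ⟫ = a * ((⟪gp, y⟫ + ⟪gm, y⟫) / ‖y‖ - N) := by
      rw [hmdef, inner_add_right, inner_sub_right, inner_smul_left, inner_sub_left, hσ', inner_smul_right,
        inner_smul_right, hβ]
      simp only [conj_trivial]
      field_simp; ring
    rw [e, abs_mul, mul_comm]
    refine mulR ?_ (abs_nonneg _)
    have h1 : |(⟪gp, y⟫ + ⟪gm, y⟫) / ‖y‖| ≤ 2 * G := by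
      rw [abs_div, abs_of_pos hr, div_le_iff₀ hr]
      have := abs_add_le ⟪gp, y⟫ ⟪gm, y⟫
      linarith [hgp y, hgm y]
    have := abs_sub ((⟪gp, y⟫ + ⟪gm, y⟫) / ‖y‖) N
    linarith
  · have h1 := abs_real_inner_le_norm x ξ
    have h2 : ⟪x, ξ⟫ ^ 2 ≤ R ^ 2 * ‖ξ‖ ^ 2 := by
      rw [← sq_abs, ← mul_pow]
      exact pow_le_pow_left₀ (abs_nonneg _) (h1.trans (mulR hx (norm_nonneg _))) 2
    calc (γ * ⟪x, ξ⟫) ^ 2 = γ ^ 2 * ⟪x, ξ⟫ ^ 2 := by ring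
      _ ≤ γ ^ 2 * (R ^ 2 * ‖ξ‖ ^ 2) := by gcongr
      _ = γ * (γ * R ^ 2) * ‖ξ‖ ^ 2 := by ring
      _ = γ / 4 * ‖ξ‖ ^ 2 := by rw [show γ * R ^ 2 = 1 / 4 by rw [hγ]; field_simp]; ring
  · have := hfin.1
    rw [ha'] at this ⊢; linarith

set_option maxHeartbeats 1000000 in
theorem pog_num {N' W s ε kp km Fp Fm η G R p ρ k γN : ℝ} (hN' : 2 ≤ N') (W0 : 0 < W) (ρ0 : 0 < ρ) (η0 : 0 < η) (hG : 1 ≤ G) (hR : 1 ≤ R)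
    (hWρ : ρ ^ 2 ≤ W) (hεW : ε ≤ W) (hε0 : 0 ≤ ε) (hs1 : |s| ≤ 1 / 2) (hp : 0 < p)
    (hs : |s| ≤ ρ * k / η) (hk : k = (p + 1) * G) (hkp : kp = 1 / W + γN / ρ) (hkm : km = 1 / W - γN / ρ)
    (hγN : |γN| ≤ 1 / (8 * G)) (hkp0 : 0 ≤ kp) (hkm0 : 0 ≤ km) (hFp : 1 - 2 * ε ≤ Fp) (hFm : 1 - 2 * ε ≤ Fm)
    (hη : η ≤ 2 * G * R) :
    (p / η + 2 / W) - kp * (Fp * (1 + 2 / N' * s - s ^ 2)) - km * (Fm * (1 - 2 / N' * s - s ^ 2)) ≤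
      (2 * p * G * R + 2 * k ^ 2 + 32 * G ^ 2 * R ^ 2 + 2 * (p + 1) * G * R) / η ^ 2 := by
  obtain ⟨h1, h2⟩ := abs_le.1 hs1
  have h2N : 2 / N' ≤ 1 := by rw [div_le_one (by linarith)]; exact hN'
  have h2N0 : 0 ≤ 2 / N' := by positivity
  have hs2 : |2 / N' * s| ≤ 1 / 2 := by
    rw [abs_mul, abs_of_nonneg h2N0]
    calc 2 / N' * |s| ≤ 1 * |s| := by gcongr
      _ ≤ 1 / 2 := by linarith
  obtain ⟨h3, h4⟩ := abs_le.1 hs2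
  have hss : s ^ 2 ≤ 1 / 4 := by
    have := sq_le_sq' (by linarith : -(1 / 2) ≤ s) h2
    linarith
  have ep : 0 ≤ 1 + 2 / N' * s - s ^ 2 := by linarith
  have em : 0 ≤ 1 - 2 / N' * s - s ^ 2 := by linarith
  have ep2 : 1 + 2 / N' * s - s ^ 2 ≤ 2 := by linarith [sq_nonneg s]
  have em2 : 1 - 2 / N' * s - s ^ 2 ≤ 2 := by linarith [sq_nonneg s]
  have a1 : kp * (1 + 2 / N' * s - s ^ 2) - 4 * ε * kp ≤ kp * (Fp * (1 + 2 / N' * s - s ^ 2)) := by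
    have := mulL (mulR hFp ep) hkp0
    have h5 : kp * ε * (1 + 2 / N' * s - s ^ 2) ≤ kp * ε * 2 := mulL ep2 (by positivity)
    linarith
  have a2 : km * (1 - 2 / N' * s - s ^ 2) - 4 * ε * km ≤ km * (Fm * (1 - 2 / N' * s - s ^ 2)) := by
    have := mulL (mulR hFm em) hkm0
    have h5 : km * ε * (1 - 2 / N' * s - s ^ 2) ≤ km * ε * 2 := mulL em2 (by positivity)
    linarith
  have hsum : kp + km = 2 / W := by rw [hkp, hkm]; ring
  have hdiff : kp - km = 2 * (γN / ρ) := by rw [hkp, hkm]; ring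
  have a3 : kp * (1 + 2 / N' * s - s ^ 2) + km * (1 - 2 / N' * s - s ^ 2) =
      2 / W * (1 - s ^ 2) + 2 * (γN / ρ) * (2 / N' * s) := by rw [← hsum, ← hdiff]; ring
  have hk0 : 0 < k := by rw [hk]; positivity
  have b1 : 2 / W * s ^ 2 ≤ 2 * k ^ 2 / η ^ 2 := by
    have : s ^ 2 ≤ (ρ * k / η) ^ 2 := by rw [← sq_abs]; exact pow_le_pow_left₀ (abs_nonneg _) hs 2
    calc 2 / W * s ^ 2 ≤ 2 / W * (ρ * k / η) ^ 2 := by gcongr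
      _ = (ρ ^ 2 / W) * (2 * k ^ 2 / η ^ 2) := by ring
      _ ≤ 1 * (2 * k ^ 2 / η ^ 2) := by
        gcongr; rw [div_le_one W0]; exact hWρ
      _ = _ := one_mul _
  have b2 : 4 * ε * (kp + km) ≤ 8 := by
    rw [hsum]
    calc 4 * ε * (2 / W) = 8 * (ε / W) := by ring
      _ ≤ 8 * 1 := by gcongr; rw [div_le_one W0]; exact hεW
      _ = 8 := by norm_num
  have b3 : -(2 * (γN / ρ) * (2 / N' * s)) ≤ (p + 1) / η := by
    calc -(2 * (γN / ρ) * (2 / N' * s)) ≤ |2 * (γN / ρ) * (2 / N' * s)| := neg_le_abs _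
      _ = 2 * (|γN| / ρ) * (2 / N' * |s|) := by
        rw [abs_mul, abs_mul, abs_mul, abs_div, abs_of_pos ρ0, abs_of_nonneg h2N0]; norm_num
      _ ≤ 2 * (1 / (8 * G) / ρ) * (1 * (ρ * k / η)) := by gcongr
      _ = (p + 1) / η * (1 / 4) := by rw [hk]; field_simp; ring
      _ ≤ (p + 1) / η := by
        have : 0 ≤ (p + 1) / η := by positivity
        linarith
  have c1 : ∀ c : ℝ, 0 ≤ c → c / η ≤ c * (2 * G * R) / η ^ 2 := by
    intro c hc
    have e1 : c / η = c * η / η ^ 2 := by field_simp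
    rw [e1]
    exact div_le_div_of_nonneg_right (mulL hη hc) (by positivity)
  have c2 : (8 : ℝ) ≤ 32 * G ^ 2 * R ^ 2 / η ^ 2 := by
    rw [le_div_iff₀ (by positivity)]
    have := pow_le_pow_left₀ η0.le hη 2
    have e2 : (2 * G * R) ^ 2 = 4 * G ^ 2 * R ^ 2 := by ring
    linarith
  have c3 := c1 p hp.le
  have c4 := c1 (p + 1) (by linarith)
  have e : (2 * p * G * R + 2 * k ^ 2 + 32 * G ^ 2 * R ^ 2 + 2 * (p + 1) * G * R) / η ^ 2 =
    p * (2 * G * R) / η ^ 2 + 2 * k ^ 2 / η ^ 2 + 32 * G ^ 2 * R ^ 2 / η ^ 2 + (p + 1) * (2 * G * R) / η ^ 2 := by ring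
  rw [e]
  linarith

def pogX (n : ℕ) (R G : ℝ) : ℝ :=
  n * (2 * (n + 4) * G * R + 2 * ((n + 4 + 1) * G) ^ 2 + 32 * G ^ 2 * R ^ 2 + 2 * (n + 4 + 1) * G * R)

def pogC (n : ℕ) (R G : ℝ) : ℝ :=
  2 ^ n * (8 * R ^ 2 * pogX n R G) ^ (n - 1) * (64 * G ^ 2 * pogX n R G)

theorem pog_end (hn : 2 ≤ n) {R G η Λ F : ℝ} (hR : 1 ≤ R) (hG : 1 ≤ G) {A : Mat n} (hA : A.PosDef)
    (hdA : A.det = F ^ n) (hF : 0 < F) (hF2 : F ≤ 2) (hη0 : 0 < η) {q : Euc n} (hΛ : 0 ≤ Λ) (hqn : Λ ≤ ‖q‖)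
    (hmn : 1 / (4 * R ^ 2) / 2 * A⁻¹.trace + 1 / (16 * G ^ 2) / 4 * qf A⁻¹ q ≤ pogX n R G / η ^ 2) :
    Λ ^ 2 * η ^ (2 * n) ≤ pogC n R G := by
  have hG0 : 0 < G := by linarith
  have hR0 : 0 < R := by linarith
  have hX0 : 0 < pogX n R G := by unfold pogX; positivity
  have hB0 : 0 ≤ qf A⁻¹ q := ((posSemidef_iff_qf A⁻¹).1 hA.inv.posSemidef).2 q
  have hT0 : 0 ≤ A⁻¹.trace := hA.inv.posSemidef.trace_nonneg
  generalize hT : A⁻¹.trace = T at *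
  generalize hQ : qf A⁻¹ q = Q at *
  generalize hX : pogX n R G = X at *
  have m1 : 0 ≤ 1 / (16 * G ^ 2) / 4 * Q := by positivity
  have m2 : 0 ≤ 1 / (4 * R ^ 2) / 2 * T := by positivity
  have t1 : T ≤ 8 * R ^ 2 * X / η ^ 2 := by
    have h3 : T = 8 * R ^ 2 * (1 / (4 * R ^ 2) / 2 * T) := by field_simp; ring
    rw [h3, mul_div_assoc]
    exact mulL (by linarith) (by positivity)
  have t2 : Q ≤ 64 * G ^ 2 * X / η ^ 2 := by
    have h3 : Q = 64 * G ^ 2 * (1 / (16 * G ^ 2) / 4 * Q) := by field_simp; ring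
    rw [h3, mul_div_assoc]
    exact mulL (by linarith) (by positivity)
  rw [← hT] at t1
  rw [← hQ] at t2
  have hq2 := pog_q (by omega) hA (by positivity) hdA t1 q t2
  have hf2 : F ^ n ≤ 2 ^ n := pow_le_pow_left₀ hF.le hF2 n
  have hq3 : Λ ^ 2 ≤ ‖q‖ ^ 2 := pow_le_pow_left₀ hΛ hqn 2
  have k1 : Λ ^ 2 ≤ 2 ^ n * (8 * R ^ 2 * X / η ^ 2) ^ (n - 1) * (64 * G ^ 2 * X / η ^ 2) := by
    refine hq3.trans (hq2.trans ?_)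
    refine mulR (mulR hf2 (by positivity)) (by positivity)
  have k2 := mulR k1 (show 0 ≤ η ^ (2 * n) by positivity)
  refine k2.trans (le_of_eq ?_)
  have e3 : η ^ (2 * n) = (η ^ 2) ^ (n - 1) * η ^ 2 := by
    rw [← pow_succ, show n - 1 + 1 = n by omega, pow_mul]
  have e4 : (η ^ 2) ^ (n - 1) ≠ 0 := by positivity
  have e5 : η ^ 2 ≠ 0 := by positivity
  rw [e3, pogC, hX, div_pow]
  generalize (η ^ 2) ^ (n - 1) = Y at *
  generalize η ^ 2 = Z at *
  field_simp

set_option maxHeartbeats 1000000 in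
theorem pog_point {S : Set (Euc n)} {u f : Euc n → ℝ} (hn : 2 ≤ n) {R G h : ℝ} (hR : 1 ≤ R) (hG : 1 ≤ G)
    (hh : 0 < h) (hh1 : h ^ 2 ≤ 1 / 2)
    (hS : Sec S u f) (hSR : S ⊆ ball 0 R) (hl : ∀ x ∈ S, ∀ y ∈ S, |u x - u y| ≤ G * ‖x - y‖)
    (hf : ∀ x ∈ S, |f x - 1| ≤ h ^ 2) {x y : Euc n} (hx : x ∈ S) (hxp : x + y ∈ S) (hxm : x - y ∈ S)
    (hy : y ≠ 0) (hη0 : 0 < - u x) (hη : - u x ≤ 2 * G * R) (hyη : ‖y‖ ≤ - u x / (8 * (n + 4 + 1) * G))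
    (hW : (h + ‖y‖) ^ 2 ≤ sd u x y)
    (hmax : ∀ᶠ z in 𝓝 (x, y), pogF u h (n + 4) (1 / (4 * R ^ 2)) (1 / (16 * G ^ 2)) z ≤
      pogF u h (n + 4) (1 / (4 * R ^ 2)) (1 / (16 * G ^ 2)) (x, y)) :
    (sd u x y / (h + ‖y‖) ^ 2) ^ 2 * (- u x) ^ (2 * n) ≤ pogC n R G := by
  have hnr : (2 : ℝ) ≤ n := by exact_mod_cast hn
  have hG0 : 0 < G := by linarith
  have hR0 : 0 < R := by linarith
  obtain ⟨g, A, h0, hA, hdA⟩ := hS.pea x hx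
  obtain ⟨gp, Ap, hp, hAp, hdAp⟩ := hS.pea _ hxp
  obtain ⟨gm, Am, hm, hAm, hdAm⟩ := hS.pea _ hxm
  have hgl : ∀ z ∈ S, ∀ g' A', Pea u z g' A' → ∀ v, |⟪g', v⟫| ≤ G * ‖v‖ := fun z hz g' A' hz' =>
    hz'.norm_le hG0.le (by
      filter_upwards [hS.isOpen.mem_nhds hz] with w hw using hl w hw z hz)
  have hg := hgl x hx g A h0
  have hgp := hgl _ hxp gp Ap hp
  have hgm := hgl _ hxm gm Am hm
  set p : ℝ := n + 4 with hpdef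
  set η := - u x with hηdef
  set r := ‖y‖ with hrdef
  have hr : 0 < r := norm_pos_iff.2 hy
  set ρ := h + r with hρ
  have ρ0 : 0 < ρ := by positivity
  set W := sd u x y with hWdef
  have W0 : 0 < W := lt_of_lt_of_le (by positivity) hW
  set γ2 : ℝ := 1 / (16 * G ^ 2) with hγ2
  set γ : ℝ := 1 / (4 * R ^ 2) with hγ
  have hD : |u (x + y) - u (x - y)| ≤ 2 * G * r := by
    refine (hl _ hxp _ hxm).trans ?_
    rw [show x + y - (x - y) = (2 : ℝ) • y by rw [two_smul]; abel, norm_smul]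
    simp [hrdef]; linarith
  have hWG : W ≤ 2 * G * r := by
    have h1 := hl _ hxp _ hx
    have h2 := hl _ hxm _ hx
    rw [add_sub_cancel_left] at h1
    rw [sub_sub_cancel_left, norm_neg] at h2
    rw [hWdef, sd]
    linarith [le_abs_self (u (x + y) - u x), le_abs_self (u (x - y) - u x)]
  -- FOC
  have foc := pog_foc hG0 hγ2 hh hy hWdef hρ W0 hη0 hp hm hgp hgm hD hmax
  have hconv : W ≤ ⟪gp - gm, y⟫ := by
    have t1 := hp.tangent hS.cvx hxp hx
    have t2 := hm.tangent hS.cvx hxm hx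
    rw [show x - (x + y) = -y by abel, inner_neg_right] at t1
    rw [show x - (x - y) = y by abel] at t2
    rw [inner_sub_left, hWdef, sd]; linarith
  have focy := foc y
  rw [real_inner_self_eq_norm_sq] at focy
  have e1 : 2 * W * r ^ 2 / (r * ρ) = 2 * (W * r / ρ) := by field_simp
  have e2 : W / (2 * ρ) * r = (W * r / ρ) / 2 := by field_simp
  rw [e1, e2] at focy
  obtain ⟨fy1, fy2⟩ := abs_le.1 focy
  have hρr : ρ ≤ 5 / 2 * r := by
    have h1 : W ≤ 5 / 2 * (W * r / ρ) := by linarith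
    have h2 : W * ρ ≤ W * (5 / 2 * r) := by
      have := mulR h1 ρ0.le
      rw [mul_assoc (5/2 : ℝ), div_mul_cancel₀ _ ρ0.ne'] at this
      linarith
    exact le_of_mul_le_mul_left h2 W0
  set q := ρ⁻¹ • (gp - gm) with hq
  have hqn : W / ρ ^ 2 ≤ ‖q‖ := by
    have h1 : W * r / ρ ≤ ‖gp - gm‖ * r := by
      have := real_inner_le_norm (gp - gm) y
      have h3 : 0 ≤ W * r / ρ := by positivity
      linarith
    have h2 : W / ρ ≤ ‖gp - gm‖ := by
      refine le_of_mul_le_mul_right ?_ hr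
      rw [div_mul_eq_mul_div]; exact h1
    rw [hq, norm_smul, norm_inv, Real.norm_eq_abs, abs_of_pos ρ0, inv_mul_eq_div, pow_two, ← div_div]
    exact div_le_div_of_nonneg_right h2 ρ0.le
  -- SOC
  set N := (u (x + y) - u (x - y)) / ρ with hN
  set d := (p / η) • (-g) + γ • x with hd
  have hxR : ‖x‖ ≤ R := by have := hSR hx; simp at this; exact this.le
  have soc := pog_soc hG0 hγ2 hR0 hγ (by rw [hpdef]; linarith : (4:ℝ) ≤ p) hh hy hxR hWdef hρ W0 hη0 hp hm h0 hgp hgm hD hN hd hmax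
  set s := ⟪d, (ρ / r) • y⟫ with hs
  set k := (p + 1) * G with hk
  have hsb : |s| ≤ ρ * k / η := by
    rw [hs, inner_smul_right, hd, inner_add_left, inner_smul_left, inner_smul_left, inner_neg_left]
    simp only [conj_trivial]
    rw [abs_mul, abs_of_pos (show 0 < ρ / r by positivity)]
    have h1 : |p / η * -⟪g, y⟫| ≤ p / η * (G * r) := by
      rw [abs_mul, abs_neg, abs_of_pos (by positivity)]
      exact mulL (hg y) (by positivity)
    have h2 : |γ * ⟪x, y⟫| ≤ G * r / η := by
      rw [abs_mul, abs_of_pos (by positivity)]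
      calc γ * |⟪x, y⟫| ≤ γ * (R * r) := by
            gcongr; exact (abs_real_inner_le_norm x y).trans (mulR hxR hr.le)
        _ = r / (4 * R) := by rw [hγ]; field_simp
        _ ≤ G * r / η := by
            rw [div_le_div_iff₀ (by positivity) hη0]; nlinarith [mulL hη hr.le, mul_pos (mul_pos hG0 hr) hR0]
    calc ρ / r * |p / η * -⟪g, y⟫ + γ * ⟪x, y⟫| ≤ ρ / r * (p / η * (G * r) + G * r / η) := by
          gcongr; exact (abs_add_le _ _).trans (add_le_add h1 h2)
      _ = ρ * k / η := by rw [hk]; field_simp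
  have hk0 : 0 < k := by positivity
  have hs1 : |s| ≤ 1 / 2 := by
    refine hsb.trans ?_
    have h8 : r * (8 * k) ≤ η := by
      have := hyη
      rw [le_div_iff₀ (by positivity)] at this
      rw [hk, hpdef]; linarith
    rw [div_le_iff₀ hη0]
    nlinarith [mulR hρr hk0.le]
  have hNb : |N| ≤ 2 * G := by
    rw [hN, abs_div, abs_of_pos ρ0, div_le_iff₀ ρ0]
    refine hD.trans ?_
    nlinarith
  have hγN : |γ2 * N| ≤ 1 / (8 * G) := by
    rw [abs_mul, abs_of_pos (by positivity)]
    calc γ2 * |N| ≤ γ2 * (2 * G) := by gcongr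
      _ = 1 / (8 * G) := by rw [hγ2]; field_simp; ring
  have hkk : |γ2 * N / ρ| ≤ 1 / W := by
    rw [abs_div, abs_of_pos ρ0, div_le_div_iff₀ ρ0 W0]
    calc |γ2 * N| * W ≤ 1 / (8 * G) * (2 * G * r) := by gcongr
      _ = r / 4 := by field_simp; ring
      _ ≤ 1 * ρ := by rw [hρ]; linarith
  obtain ⟨hk1, hk2⟩ := abs_le.1 hkk
  have fpos := hS.fpos
  have hε2 : h ^ 2 ≤ W := le_trans (pow_le_pow_left₀ hh.le (by linarith) 2) hW
  have hfr : ∀ z ∈ S, 1 - 2 * h ^ 2 ≤ f z / f x := by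
    intro z hz
    rw [le_div_iff₀ (fpos x hx)]
    obtain ⟨a1, a2⟩ := abs_le.1 (hf z hz)
    obtain ⟨b1, b2⟩ := abs_le.1 (hf x hx)
    nlinarith [sq_nonneg h]
  have mat := pog_mat hn hA hAp hAm (fpos x hx) (fpos _ hxp) (fpos _ hxm) hdA hdAp hdAm ((ρ / r) • y) d hs hs1
    (kp := 1 / W + γ2 * N / ρ) (km := 1 / W - γ2 * N / ρ) (by linarith) (by linarith) q soc
  have num := pog_num (γN := γ2 * N) (N' := (n : ℝ)) (p := p) hnr W0 ρ0 hη0 hG hR hW hε2 (sq_nonneg h) hs1 (by positivity) hsb hk rfl rfl hγN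
    (by linarith) (by linarith) (hfr _ hxp) (hfr _ hxm) hη
  have hX0 : 0 < pogX n R G := by unfold pogX; positivity
  have hmn : γ / 2 * A⁻¹.trace + γ2 / 4 * qf A⁻¹ q ≤ pogX n R G / η ^ 2 := by
    refine mat.trans ((mulL num (by positivity)).trans (le_of_eq ?_))
    rw [pogX, hk, hpdef]; ring
  exact pog_end hn hR hG hA hdA (fpos x hx) (by have := (abs_le.1 (hf x hx)).2; linarith) hη0 (by positivity) hqn hmn

theorem exists_frontier_seg {S : Set (Euc n)} (hS : IsOpen S) {x z : Euc n} (hx : x ∈ S) (hz : z ∉ S) :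
    ∃ w ∈ frontier S, w ∈ segment ℝ x z := by
  have hp : IsPreconnected (segment ℝ x z) := (convex_segment x z).isPreconnected
  by_contra hcon
  push Not at hcon
  have hcon' : ∀ w ∈ segment ℝ x z, w ∉ frontier S := fun w h1 h2 => hcon w h2 h1
  have h1 := hp S (closure S)ᶜ hS isClosed_closure.isOpen_compl (fun w hw => by
    by_cases h : w ∈ closure S
    · left
      by_contra h'
      exact hcon' w hw (by rw [frontier, hS.interior_eq]; exact ⟨h, h'⟩)
    · right; exact h) ⟨x, left_mem_segment ℝ x z, hx⟩ ⟨z, right_mem_segment ℝ x z, fun h => by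
      exact hcon' z (right_mem_segment ℝ x z) (by rw [frontier, hS.interior_eq]; exact ⟨h, hz⟩)⟩
  obtain ⟨w, _, h2, h3⟩ := h1
  exact h3 (subset_closure h2)

theorem norm_seg_le {x z w : Euc n} (h : w ∈ segment ℝ x z) : ‖w - x‖ ≤ ‖z - x‖ := by
  obtain ⟨a, b, ha, hb, hab, rfl⟩ := h
  have : a • x + b • z - x = b • (z - x) := by
    have : a = 1 - b := by linarith
    rw [this, sub_smul, one_smul, smul_sub]; abel
  rw [this, norm_smul, Real.norm_eq_abs, abs_of_nonneg hb]
  have : b ≤ 1 := by linarith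
  nlinarith [norm_nonneg (z - x)]

theorem lip_closure {S : Set (Euc n)} {u : Euc n → ℝ} {G : ℝ} (hc : ContinuousOn u (closure S))
    (hl : ∀ x ∈ S, ∀ y ∈ S, |u x - u y| ≤ G * ‖x - y‖) :
    ∀ x ∈ closure S, ∀ y ∈ closure S, |u x - u y| ≤ G * ‖x - y‖ := by
  have h1 : ∀ x ∈ S, ∀ y ∈ closure S, |u x - u y| ≤ G * ‖x - y‖ := by
    intro x hx
    refine fun y hy => le_on_closure (s := S) (f := fun y => |u x - u y|) (g := fun y => G * ‖x - y‖)
      (fun y hy => hl x hx y hy) ((continuousOn_const.sub hc).abs) (by fun_prop) hy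
  intro x hx y hy
  exact le_on_closure (s := S) (f := fun x => |u x - u y|) (g := fun x => G * ‖x - y‖)
      (fun x hx => h1 x hx y hy) ((hc.sub continuousOn_const).abs) (by fun_prop) hx

theorem Sec.ball_sub {S : Set (Euc n)} {u f : Euc n → ℝ} {G : ℝ} (hS : Sec S u f) (hG : 0 < G)
    (hl : ∀ x ∈ S, ∀ y ∈ S, |u x - u y| ≤ G * ‖x - y‖) {x z : Euc n} (hx : x ∈ S)
    (hz : ‖z - x‖ < - u x / G) : z ∈ S := by
  by_contra hzS
  obtain ⟨w, hw, hws⟩ := exists_frontier_seg hS.isOpen hx hzS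
  have h1 := lip_closure hS.contc hl x (subset_closure hx) w (frontier_subset_closure hw)
  rw [hS.zero w hw, sub_zero] at h1
  have h2 := norm_seg_le hws
  rw [norm_sub_rev] at h1
  have h3 : ‖w - x‖ < -u x / G := lt_of_le_of_lt h2 hz
  rw [lt_div_iff₀ hG] at h3
  have := neg_le_abs (u x)
  linarith

def pogK (n : ℕ) (R G : ℝ) : ℝ :=
  3 * ((2 * G * R) ^ (n + 4) + 16 * (n + 4 + 1) * G ^ 2 * (2 * G * R) ^ (n + 3) + (pogC n R G + 1) * (2 * G * R) ^ 4)

/-- exponential form of the auxiliary function -/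
def pogE (u : Euc n → ℝ) (h γ γ2 : ℝ) (z : Euc n × Euc n) : ℝ :=
  sd u z.1 z.2 / (h + ‖z.2‖) ^ 2 * (- u z.1) ^ (n + 4) * Real.exp (γ / 2 * ‖z.1‖ ^ 2
    + γ2 / 2 * ((u (z.1 + z.2) - u (z.1 - z.2)) * (h + ‖z.2‖)⁻¹) ^ 2)

theorem pogE_log {u : Euc n → ℝ} {h γ γ2 : ℝ} (hh : 0 < h) {z : Euc n × Euc n} (h1 : 0 < sd u z.1 z.2)
    (h2 : 0 < - u z.1) : Real.log (pogE u h γ γ2 z) = pogF u h (n + 4) γ γ2 z := by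
  have : 0 < h + ‖z.2‖ := by positivity
  rw [pogE, pogF, Real.log_mul (by positivity) (by positivity), Real.log_mul (by positivity) (by positivity),
    Real.log_div h1.ne' (by positivity), Real.log_exp, Real.log_pow, Real.log_pow]
  push_cast; ring

theorem pogE_bound {u : Euc n → ℝ} {h γ γ2 R G Λ : ℝ} (hh : 0 < h) (hR : 1 ≤ R) (hG : 1 ≤ G)
    (hγ : γ = 1 / (4 * R ^ 2)) (hγ2 : γ2 = 1 / (16 * G ^ 2)) {x y : Euc n} (hx : ‖x‖ ≤ R) (hη : 0 ≤ - u x)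
    (hD : |u (x + y) - u (x - y)| ≤ 2 * G * ‖y‖) (hΛ : sd u x y / (h + ‖y‖) ^ 2 * (- u x) ^ (n + 4) ≤ Λ) (hΛ0 : 0 ≤ Λ) :
    pogE u h γ γ2 (x, y) ≤ 3 * Λ := by
  have h0 : 0 < h + ‖y‖ := by positivity
  rw [pogE]
  have e1 : γ / 2 * ‖x‖ ^ 2 ≤ 1 / 8 := by
    have : ‖x‖ ^ 2 ≤ R ^ 2 := pow_le_pow_left₀ (norm_nonneg _) hx 2
    calc γ / 2 * ‖x‖ ^ 2 ≤ γ / 2 * R ^ 2 := by rw [hγ]; gcongr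
      _ = 1 / 8 := by rw [hγ]; field_simp; norm_num
  have e2 : γ2 / 2 * ((u (x + y) - u (x - y)) * (h + ‖y‖)⁻¹) ^ 2 ≤ 1 / 8 := by
    have : |(u (x + y) - u (x - y)) * (h + ‖y‖)⁻¹| ≤ 2 * G := by
      rw [abs_mul, abs_of_pos (inv_pos.2 h0), ← div_eq_mul_inv, div_le_iff₀ h0]
      refine hD.trans ?_
      gcongr; linarith
    have : ((u (x + y) - u (x - y)) * (h + ‖y‖)⁻¹) ^ 2 ≤ (2 * G) ^ 2 := by
      rw [← sq_abs]; exact pow_le_pow_left₀ (abs_nonneg _) this 2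
    calc γ2 / 2 * ((u (x + y) - u (x - y)) * (h + ‖y‖)⁻¹) ^ 2 ≤ γ2 / 2 * (2 * G) ^ 2 := by rw [hγ2]; gcongr
      _ = 1 / 8 := by rw [hγ2]; field_simp; norm_num
  have e3 : Real.exp (γ / 2 * ‖x‖ ^ 2 + γ2 / 2 * ((u (x + y) - u (x - y)) * (h + ‖y‖)⁻¹) ^ 2) ≤ 3 := by
    refine (Real.exp_le_exp.2 (show _ ≤ (1 : ℝ) by linarith)).trans ?_
    linarith [Real.exp_one_lt_d9]
  refine (mulR hΛ (Real.exp_pos _).le).trans ?_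
  rw [mul_comm]
  exact mulR e3 hΛ0

set_option maxHeartbeats 800000 in
theorem pog_global {S : Set (Euc n)} {u f : Euc n → ℝ} (hn : 2 ≤ n) {R G h : ℝ} (hR : 1 ≤ R) (hG : 1 ≤ G)
    (hh : 0 < h) (hh1 : h ^ 2 ≤ 1 / 2)
    (hS : Sec S u f) (hSR : S ⊆ ball 0 R) (hl : ∀ x ∈ S, ∀ y ∈ S, |u x - u y| ≤ G * ‖x - y‖)
    (hf : ∀ x ∈ S, |f x - 1| ≤ h ^ 2) (hηM : ∀ x ∈ S, - u x ≤ 2 * G * R) {x y : Euc n} (hx : x ∈ S)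
    (hy : ‖y‖ ≤ - u x / (8 * (n + 4 + 1) * G)) :
    sd u x y * (- u x) ^ (n + 4) ≤ pogK n R G * (h + ‖y‖) ^ 2 := by
  have hnr : (2 : ℝ) ≤ n := by exact_mod_cast hn
  have hn0 : n ≠ 0 := by omega
  have hG0 : 0 < G := by linarith
  have hR0 : 0 < R := by linarith
  have hlc := lip_closure hS.contc hl
  have hnp := hS.nonpos hn0
  have hclR : ∀ x ∈ closure S, ‖x‖ ≤ R := fun x hx => by
    have := closure_ball_subset_closedBall (closure_mono hSR hx)
    simpa using this
  have hcS : ∀ x ∈ closure S, u x < 0 → x ∈ S := by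
    intro x hx hu
    by_contra h'
    have := hS.zero x (by rw [frontier, hS.isOpen.interior_eq]; exact ⟨hx, h'⟩)
    linarith
  have hηc : ∀ x ∈ closure S, - u x ≤ 2 * G * R := by
    intro x hx
    by_cases h : u x < 0
    · exact hηM x (hcS x hx h)
    · push Not at h
      have : 0 ≤ 2 * G * R := by positivity
      linarith
  set c : ℝ := 8 * (n + 4 + 1) * G with hc
  have hc0 : 0 < c := by positivity
  have hcG : 2 * G ≤ c := by rw [hc]; nlinarith
  -- points of the domain
  have hpt : ∀ x ∈ closure S, ∀ y : Euc n, ‖y‖ ≤ - u x / c → 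
      (x + y ∈ closure S ∧ x - y ∈ closure S) ∧ (u x < 0 → x + y ∈ S ∧ x - y ∈ S) := by
    intro x hx y hy
    have key : u x < 0 → x + y ∈ S ∧ x - y ∈ S := by
      intro hu
      have hxS := hcS x hx hu
      have : ‖y‖ < - u x / G := by
        refine lt_of_le_of_lt hy ?_
        apply div_lt_div_of_pos_left (by linarith) hG0 (by linarith)
      exact ⟨hS.ball_sub hG0 hl hxS (by simpa using this), hS.ball_sub hG0 hl hxS (by simpa using this)⟩
    refine ⟨?_, key⟩
    by_cases hu : u x < 0
    · exact ⟨subset_closure (key hu).1, subset_closure (key hu).2⟩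
    · have h0 : u x = 0 := le_antisymm (hnp x hx) (not_lt.1 hu)
      rw [h0] at hy
      have : y = 0 := by
        rw [← norm_le_zero_iff]; simpa using hy
      rw [this]; simpa using hx
  set γ : ℝ := 1 / (4 * R ^ 2) with hγ
  set γ2 : ℝ := 1 / (16 * G ^ 2) with hγ2
  set D : Set (Euc n × Euc n) := {z | z.1 ∈ closure S ∧ ‖z.2‖ ≤ - u z.1 / c} with hD
  have hDu : ContinuousOn (fun z : Euc n × Euc n => u z.1) (closure S ×ˢ Set.univ) :=
    hS.contc.comp continuous_fst.continuousOn (fun z hz => hz.1)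
  have hDc : IsClosed D := by
    have : D = (closure S ×ˢ Set.univ) ∩ {z | ‖z.2‖ + u z.1 / c ≤ 0} := by
      ext z; simp only [hD, Set.mem_setOf_eq, Set.mem_inter_iff, Set.mem_prod, Set.mem_univ, and_true, neg_div]
      constructor
      · rintro ⟨h1, h2⟩; exact ⟨h1, by linarith⟩
      · rintro ⟨h1, h2⟩; exact ⟨h1, by linarith⟩
    rw [this]
    exact ContinuousOn.preimage_isClosed_of_isClosed (f := fun z : Euc n × Euc n => ‖z.2‖ + u z.1 / c)
      ((by fun_prop : Continuous fun z : Euc n × Euc n => ‖z.2‖).continuousOn.add (hDu.div_const c))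
      (isClosed_closure.prod isClosed_univ) isClosed_Iic
  have hDb : D ⊆ closedBall 0 R ×ˢ closedBall 0 (2 * G * R / c) := by
    rintro z ⟨h1, h2⟩
    refine ⟨by simpa using hclR _ h1, ?_⟩
    simp only [mem_closedBall, dist_zero_right]
    exact h2.trans (div_le_div_of_nonneg_right (hηc _ h1) hc0.le)
  have hDk : IsCompact D := ((isCompact_closedBall _ _).prod (isCompact_closedBall _ _)).of_isClosed_subset hDc hDb
  have hc1 : ContinuousOn (fun z : Euc n × Euc n => u (z.1 + z.2)) D :=
    hS.contc.comp (by fun_prop) (fun z hz => (hpt z.1 hz.1 z.2 hz.2).1.1)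
  have hc2 : ContinuousOn (fun z : Euc n × Euc n => u (z.1 - z.2)) D :=
    hS.contc.comp (by fun_prop) (fun z hz => (hpt z.1 hz.1 z.2 hz.2).1.2)
  have hc3 : ContinuousOn (fun z : Euc n × Euc n => u z.1) D := hDu.mono (fun z hz => ⟨hz.1, trivial⟩)
  have hρp : ∀ z : Euc n × Euc n, 0 < h + ‖z.2‖ := fun z => by positivity
  have hc4 : ContinuousOn (fun z : Euc n × Euc n => sd u z.1 z.2) D := (hc1.add hc2).sub (hc3.const_mul 2)
  have hc5 : ContinuousOn (pogE u h γ γ2) D := by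
    have hr : ContinuousOn (fun z : Euc n × Euc n => h + ‖z.2‖) D := by fun_prop
    refine ((hc4.div (hr.pow 2) (fun z _ => (pow_pos (hρp z) 2).ne')).mul (hc3.neg.pow _)).mul ?_
    refine Real.continuous_exp.comp_continuousOn ?_
    refine ContinuousOn.add (by fun_prop) (continuousOn_const.mul (((hc1.sub hc2).mul ?_).pow 2))
    exact hr.inv₀ (fun z _ => (hρp z).ne')
  obtain ⟨⟨x0, y0⟩, hz0, hmax⟩ := hDk.exists_isMaxOn ⟨(x, y), subset_closure hx, hy⟩ hc5
  have hmx : ∀ z ∈ D, pogE u h γ γ2 z ≤ pogE u h γ γ2 (x0, y0) := isMaxOn_iff.1 hmax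
  have hzl : ∀ x ∈ closure S, ∀ y : Euc n, ‖y‖ ≤ - u x / c →
      |u (x + y) - u (x - y)| ≤ 2 * G * ‖y‖ ∧ sd u x y ≤ 2 * G * ‖y‖ := by
    intro x hx y hy
    obtain ⟨⟨h1, h2⟩, -⟩ := hpt x hx y hy
    have a1 := hlc _ h1 _ h2
    have a2 := (abs_le.1 (hlc _ h1 _ hx)).2
    have a3 := (abs_le.1 (hlc _ h2 _ hx)).2
    have e1 : x + y - (x - y) = (2 : ℝ) • y := by rw [two_smul]; abel
    have e2 : x + y - x = y := by abel
    have e3 : x - y - x = - y := by abel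
    rw [e1, norm_smul] at a1
    rw [e2] at a2
    rw [e3, norm_neg] at a3
    constructor
    · refine a1.trans (le_of_eq ?_); norm_num; ring
    · rw [sd]; linarith
  have hpC : 0 < pogC n R G := by
    have : 0 < pogX n R G := by unfold pogX; positivity
    unfold pogC; positivity
  have hGR : 0 < 2 * G * R := by positivity
  -- bound of the maximum
  have hbd : pogE u h γ γ2 (x0, y0) ≤ pogK n R G := by
    obtain ⟨hx0, hy0⟩ := hz0
    simp only at hx0 hy0
    have t1 : 0 ≤ (2 * G * R) ^ (n + 4) := by positivity
    have t2 : 0 ≤ 16 * (n + 4 + 1) * G ^ 2 * (2 * G * R) ^ (n + 3) := by positivity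
    have t3 : 0 ≤ (pogC n R G + 1) * (2 * G * R) ^ 4 := by positivity
    rw [pogK]
    have hη0 : 0 ≤ - u x0 := by linarith [hnp x0 hx0]
    refine pogE_bound hh hR hG hγ hγ2 (hclR x0 hx0) hη0 (hzl x0 hx0 y0 hy0).1 ?_ (by linarith)
    have hρ0 : 0 < h + ‖y0‖ := by positivity
    have hηle := hηc x0 hx0
    by_cases hu : u x0 < 0
    swap
    · have h0 : u x0 = 0 := le_antisymm (hnp x0 hx0) (not_lt.1 hu)
      rw [h0]; simp; linarith
    by_cases hy00 : y0 = 0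
    · have : sd u x0 y0 = 0 := by rw [sd, hy00]; simp; ring
      rw [this]; simp; linarith
    by_cases hW : sd u x0 y0 < (h + ‖y0‖) ^ 2
    · have a1 : sd u x0 y0 / (h + ‖y0‖) ^ 2 ≤ 1 := by rw [div_le_one (by positivity)]; exact hW.le
      have a2 : (- u x0) ^ (n + 4) ≤ (2 * G * R) ^ (n + 4) := pow_le_pow_left₀ hη0 hηle _
      have a3 := mulR a1 (show 0 ≤ (- u x0) ^ (n + 4) by positivity)
      linarith
    push Not at hW
    rcases hy0.eq_or_lt with hye | hyl
    · have hyp : 0 < ‖y0‖ := norm_pos_iff.2 hy00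
      have a1 : sd u x0 y0 / (h + ‖y0‖) ^ 2 ≤ 2 * G * c / (- u x0) := by
        calc sd u x0 y0 / (h + ‖y0‖) ^ 2 ≤ 2 * G * ‖y0‖ / ‖y0‖ ^ 2 := by
              apply div_le_div₀ (by positivity) (hzl x0 hx0 y0 hy0).2 (by positivity)
              exact pow_le_pow_left₀ hyp.le (by linarith) 2
          _ = 2 * G / ‖y0‖ := by field_simp
          _ = _ := by rw [hye, div_div_eq_mul_div]
      have a2 := mulR a1 (show 0 ≤ (- u x0) ^ (n + 4) by positivity)
      have a3 : 2 * G * c / (- u x0) * (- u x0) ^ (n + 4) = 2 * G * c * (- u x0) ^ (n + 3) := by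
        rw [pow_succ (- u x0) (n + 3)]
        have h9 : - u x0 ≠ 0 := by linarith
        generalize - u x0 = w at h9 ⊢
        field_simp
      have a4 : 2 * G * c * (- u x0) ^ (n + 3) ≤ 2 * G * c * (2 * G * R) ^ (n + 3) := by gcongr
      have a5 : 2 * G * c * (2 * G * R) ^ (n + 3) = 16 * (n + 4 + 1) * G ^ 2 * (2 * G * R) ^ (n + 3) := by rw [hc]; ring
      linarith
    · -- interior
      have hx0S := hcS x0 hx0 hu
      obtain ⟨-, h2⟩ := hpt x0 hx0 y0 hy0
      obtain ⟨hp, hm⟩ := h2 hu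
      have nS : ∀ z ∈ S, S ∈ 𝓝 z := fun z hz => hS.isOpen.mem_nhds hz
      have hct : ∀ z ∈ S, ContinuousAt u z := fun z hz => hS.cont.continuousAt (nS z hz)
      have k1 : Tendsto (fun z : Euc n × Euc n => u z.1) (𝓝 (x0, y0)) (𝓝 (u x0)) :=
        (hct x0 hx0S).tendsto.comp continuousAt_fst
      have k2 : Tendsto (fun z : Euc n × Euc n => u (z.1 + z.2)) (𝓝 (x0, y0)) (𝓝 (u (x0 + y0))) :=
        (hct _ hp).tendsto.comp (continuous_add.tendsto (x0, y0))
      have k3 : Tendsto (fun z : Euc n × Euc n => u (z.1 - z.2)) (𝓝 (x0, y0)) (𝓝 (u (x0 - y0))) :=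
        (hct _ hm).tendsto.comp (continuous_sub.tendsto (x0, y0))
      have k4 : Tendsto (fun z : Euc n × Euc n => sd u z.1 z.2) (𝓝 (x0, y0)) (𝓝 (sd u x0 y0)) :=
        (k2.add k3).sub (k1.const_mul 2)
      have hW0 : 0 < sd u x0 y0 := lt_of_lt_of_le (by positivity) hW
      have hη1 : 0 < - u x0 := by linarith
      have ev1 : ∀ᶠ z : Euc n × Euc n in 𝓝 (x0, y0), z.1 ∈ S := continuousAt_fst.eventually (nS x0 hx0S)
      have ev2 : ∀ᶠ z : Euc n × Euc n in 𝓝 (x0, y0), ‖z.2‖ < - u z.1 / c :=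
        (continuous_snd.norm.tendsto (x0, y0)).eventually_lt (k1.neg.div_const c) hyl
      have ev3 := k4.eventually (lt_mem_nhds hW0)
      have ev4 := k1.neg.eventually (lt_mem_nhds hη1)
      have hloc : ∀ᶠ z in 𝓝 (x0, y0), pogF u h (n + 4) γ γ2 z ≤ pogF u h (n + 4) γ γ2 (x0, y0) := by
        filter_upwards [ev1, ev2, ev3, ev4] with z h1 h2 h3 h4
        rw [← pogE_log hh h3 h4, ← pogE_log (z := (x0, y0)) hh hW0 hη1]
        have hpz := hρp z
        refine Real.log_le_log (by unfold pogE; positivity) (hmx z ⟨subset_closure h1, h2.le⟩)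
      have fin := pog_point hn hR hG hh hh1 hS hSR hl hf hx0S hp hm hy00 hη1 hηle hy0 hW hloc
      set Λ := sd u x0 y0 / (h + ‖y0‖) ^ 2 with hΛ
      have b1 : (Λ * (- u x0) ^ n) ^ 2 ≤ pogC n R G := by
        rw [mul_pow, ← pow_mul, mul_comm n 2]; exact fin
      have b2 : Λ * (- u x0) ^ n ≤ pogC n R G + 1 := by
        have : 0 ≤ (Λ * (- u x0) ^ n - 1) ^ 2 := sq_nonneg _
        have : 0 ≤ (Λ * (- u x0) ^ n) ^ 2 := sq_nonneg _
        linarith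
      calc Λ * (- u x0) ^ (n + 4) = Λ * (- u x0) ^ n * (- u x0) ^ 4 := by rw [pow_add]; ring
        _ ≤ (pogC n R G + 1) * (2 * G * R) ^ 4 := by gcongr
        _ ≤ _ := by linarith
  -- conclusion
  have hxy : pogE u h γ γ2 (x, y) ≤ pogK n R G := (hmx (x, y) ⟨subset_closure hx, hy⟩).trans hbd
  have hρ0 : 0 < h + ‖y‖ := by positivity
  have hsd : 0 ≤ sd u x y := by
    obtain ⟨-, h2⟩ := hpt x (subset_closure hx) y hy
    by_cases hu : u x < 0
    · obtain ⟨h3, h4⟩ := h2 hu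
      have := hS.cvx.2 h3 h4 (by norm_num : (0:ℝ) ≤ 1 / 2) (by norm_num : (0:ℝ) ≤ 1 / 2) (by norm_num)
      have e : (1 / 2 : ℝ) • (x + y) + (1 / 2 : ℝ) • (x - y) = x := by
        rw [← smul_add, show x + y + (x - y) = (2 : ℝ) • x by rw [two_smul]; abel, smul_smul]; norm_num
      rw [e] at this
      simp only [smul_eq_mul] at this
      rw [sd]; linarith
    · have h0 : u x = 0 := le_antisymm (hnp x (subset_closure hx)) (not_lt.1 hu)
      rw [h0] at hy
      have : y = 0 := by
        rw [← norm_le_zero_iff]; simpa using hy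
      rw [sd, this]; simp; linarith
  have hη0 : 0 ≤ - u x := by linarith [hnp x (subset_closure hx)]
  rw [pogE] at hxy
  have he : 1 ≤ Real.exp (γ / 2 * ‖x‖ ^ 2 + γ2 / 2 * ((u (x + y) - u (x - y)) * (h + ‖y‖)⁻¹) ^ 2) := by
    apply Real.one_le_exp; rw [hγ, hγ2]; positivity
  have h5 : sd u x y / (h + ‖y‖) ^ 2 * (- u x) ^ (n + 4) ≤ pogK n R G := by
    refine le_trans ?_ hxy
    exact le_mul_of_one_le_right (by positivity) he
  rw [div_mul_eq_mul_div, div_le_iff₀ (by positivity)] at h5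
  exact h5

theorem nsq_line (a v : Euc n) (t : ℝ) : ‖a + t • v‖ ^ 2 = ‖a‖ ^ 2 + 2 * ⟪a, v⟫ * t + 2 * ‖v‖ ^ 2 * t ^ 2 / 2 := by
  rw [norm_add_sq_real, inner_smul_right, norm_smul, mul_pow, Real.norm_eq_abs, sq_abs]; ring

theorem P2_nsq (a v : Euc n) : P2 (fun t => ‖a + t • v‖ ^ 2) (‖a‖ ^ 2) (2 * ⟪a, v⟫) (2 * ‖v‖ ^ 2) :=
  (P2_quad _ _ _).congr' (Eventually.of_forall fun t => (nsq_line a v t).symm)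

theorem il_mat (hn : n ≠ 0) {A B : Mat n} (hA : A.PosDef) (hB : B.PosDef) {fA fB : ℝ} (hfA : 0 < fA) (hfB : 0 < fB)
    (hdA : A.det = fA ^ n) (hdB : B.det = fB ^ n) {e : Euc n} (he : ‖e‖ = 1) {K M δ : ℝ} (hK : 0 ≤ K) (hM : 0 ≤ M)
    (hδ : 0 ≤ δ) (hB2 : ∀ ξ : Euc n, 1 / 2 * ‖ξ‖ ^ 2 ≤ qf B ξ) (hBe : qf B e ≤ 2)
    (h : ∀ ξ : Euc n, qf A ξ ≤ qf B (ξ - (2 * ⟪e, ξ⟫) • e) - 2 * K * δ * ⟪e, ξ⟫ ^ 2 + 4 * M * δ * ‖ξ‖ ^ 2) :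
    n * (fA / fB) ≤ n - K * δ + 8 * M * n * δ := by
  set R : Mat n := 1 - (2 : ℝ) • vecMulVec e.ofLp e.ofLp with hR
  have hee : ⟪e, e⟫ = 1 := by rw [real_inner_self_eq_norm_sq, he]; norm_num
  have happ : ∀ ξ, app R ξ = ξ - (2 * ⟪e, ξ⟫) • e := by
    intro ξ
    have : R = 1 + (-2 : ℝ) • vecMulVec e.ofLp e.ofLp := by rw [hR, neg_smul]; abel
    rw [this, app_add_mat, app_smul_mat, app_one, app_vecMulVec, smul_smul, neg_mul, neg_smul]; abel
  have hvv : vecMulVec e.ofLp e.ofLp * vecMulVec e.ofLp e.ofLp = vecMulVec e.ofLp e.ofLp := by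
    rw [vecMulVec_mul_vecMulVec, ← inner_eq_dot, hee, one_smul]
  have hRR : R * R = 1 := by
    rw [hR, sub_mul, mul_sub, mul_sub, mul_smul_comm, smul_mul_assoc, smul_mul_assoc, mul_smul_comm, hvv]
    simp only [one_mul, mul_one, smul_smul]
    module
  have hRd : R.det * R.det = 1 := by rw [← det_mul, hRR, det_one]
  have hRu : IsUnit R := IsUnit.of_mul_eq_one R hRR
  set B' := Rᵀ * B * R with hB'
  have hB'p : B'.PosDef := posDef_conj hB hRu
  have hdB' : B'.det = fB ^ n := by
    rw [hB', det_mul, det_mul, det_transpose, hdB]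
    linear_combination fB ^ n * hRd
  have hq : ∀ ξ, qf B' ξ = qf B (ξ - (2 * ⟪e, ξ⟫) • e) := fun ξ => by rw [hB', qf_conj, happ]
  have hnorm : ∀ ξ : Euc n, ‖ξ - (2 * ⟪e, ξ⟫) • e‖ ^ 2 = ‖ξ‖ ^ 2 := by
    intro ξ
    rw [norm_sub_sq_real, inner_smul_right, norm_smul, mul_pow, he, real_inner_comm, Real.norm_eq_abs, sq_abs]; ring
  have hCp : B'⁻¹.PosDef := hB'p.inv
  have hu : IsUnit B'.det := by rw [hdB']; exact (pow_pos hfB n).ne'.isUnit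
  have hdC : B'⁻¹.det = (fB⁻¹) ^ n := by
    rw [det_nonsing_inv, hdB', Ring.inverse_eq_inv', inv_pow]
  have h1 := amgm_trace hCp hA (inv_pos.2 hfB) hfA hdC hdA
  have h2 : (B'⁻¹ * A).trace ≤ (B'⁻¹ * (B' + (-(2 * K * δ)) • vecMulVec e.ofLp e.ofLp + (4 * M * δ) • 1)).trace :=
    trace_mul_mono hCp.posSemidef (fun ξ => by
      rw [qf_add, qf_add, qf_smul, qf_smul, qf_vec, qf_one, hq]
      have := h ξ
      linarith)
  have h3 : (B'⁻¹ * (B' + (-(2 * K * δ)) • vecMulVec e.ofLp e.ofLp + (4 * M * δ) • 1)).trace =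
      n - 2 * K * δ * qf B'⁻¹ e + 4 * M * δ * B'⁻¹.trace := by
    rw [mul_add, mul_add, trace_add, trace_add, mul_smul_comm, mul_smul_comm, trace_smul, trace_smul, trace_vec,
      nonsing_inv_mul _ hu, mul_one, trace_one]
    simp; ring
  have h4 : 1 / 2 * B'⁻¹.trace ≤ n := by
    have := trace_mul_mono (C := B'⁻¹) (X := (1 / 2 : ℝ) • 1) (Y := B') hCp.posSemidef (fun ξ => by
      rw [qf_smul, qf_one, hq, ← hnorm ξ]; exact hB2 _)
    rw [mul_smul_comm, trace_smul, mul_one, nonsing_inv_mul _ hu, trace_one] at this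
    simpa using this
  have h5 : 1 / 2 ≤ qf B'⁻¹ e := by
    have h6 := cauchy_inv hB'p e e
    rw [hee, hq, hee] at h6
    have : e - (2 * 1 : ℝ) • e = - e := by module
    rw [this, qf_neg_vec] at h6
    have h7 : 0 ≤ qf B'⁻¹ e := ((posSemidef_iff_qf _).1 hCp.posSemidef).2 e
    have h8 := mulR hBe h7
    linarith
  have h6 : n * (fA / fB) = n * (fB⁻¹ * fA) := by rw [div_eq_mul_inv]; ring
  rw [h6]
  have h7 := mulL h5 (show 0 ≤ 2 * K * δ by positivity)
  have h8 := mulL h4 (show 0 ≤ 8 * M * δ by positivity)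
  linarith

theorem pow_upper {n : ℕ} {δ : ℝ} (h0 : 0 ≤ δ) (h : n * δ ≤ 1 / 4) (hn : n ≠ 0) : (1 + δ) ^ n ≤ 4 / 3 := by
  have hn1 : (1 : ℝ) ≤ n := by exact_mod_cast Nat.one_le_iff_ne_zero.2 hn
  have h1 : δ ≤ 1 / 4 := by nlinarith
  have h2 := one_add_mul_le_pow (a := -δ) (by linarith) n
  have h3 : (1 + δ) ^ n * (1 + -δ) ^ n ≤ 1 := by
    rw [← mul_pow]; exact pow_le_one₀ (by nlinarith) (by nlinarith)
  have h4 : 3 / 4 ≤ (1 + -δ) ^ n := by linarith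
  have h5 : 0 < (1 + δ) ^ n := by positivity
  nlinarith

theorem psi_quad {s d : ℝ} (hd : 0 < d) :
    s - s ^ 2 / 4 - (d - d ^ 2 / 4) ≤ (1 - d / 2) / (2 * d) * (s ^ 2 - d ^ 2) := by
  have : (1 - d / 2) / (2 * d) * (s ^ 2 - d ^ 2) - (s - s ^ 2 / 4 - (d - d ^ 2 / 4)) = (s - d) ^ 2 / (2 * d) := by
    field_simp; ring
  have h2 : 0 ≤ (s - d) ^ 2 / (2 * d) := by positivity
  linarith

def ilPhi (u : Euc n → ℝ) (K M δ : ℝ) (x0 : Euc n) (p : Euc n × Euc n) : ℝ :=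
  (u p.1 - ‖p.1‖ ^ 2 / 2) - (u p.2 - ‖p.2‖ ^ 2 / 2) -
    δ * (K * (‖p.1 - p.2‖ - ‖p.1 - p.2‖ ^ 2 / 4) + M * (‖p.1 - x0‖ ^ 2 + ‖p.2 - x0‖ ^ 2))

theorem il_point (hn : n ≠ 0) {U : Set (Euc n)} {u f : Euc n → ℝ} (h : Sol U u f) {x y x0 : Euc n} (hx : x ∈ U) (hy : y ∈ U)
    {K M δ d : ℝ} (hK : 0 ≤ K) (hM : 0 ≤ M) (hδ : 0 ≤ δ) (hd : 0 < d) (hdd : ‖x - y‖ = d)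
    (hmax : ∀ᶠ p in 𝓝 (x, y), ilPhi u K M δ x0 p ≤ ilPhi u K M δ x0 (x, y))
    (hτ : n * (δ * (K / d + 2 * M)) ≤ 1 / 4) (hδ1 : n * δ ≤ 1 / 4) (hf : f y ≤ 1 + δ) :
    n * (f x / f y) ≤ n - K * δ + 8 * M * n * δ := by
  obtain ⟨g, A, hA, hAp, hAd⟩ := h.pea x hx
  obtain ⟨g', B, hB, hBp, hBd⟩ := h.pea y hy
  have hn1 : (1 : ℝ) ≤ n := by exact_mod_cast Nat.one_le_iff_ne_zero.2 hn
  set τ := δ * (K / d + 2 * M) with hτd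
  have hτ0 : 0 ≤ τ := by positivity
  have hτ1 : τ ≤ 1 / 4 := by exact le_trans (le_mul_of_one_le_left hτ0 hn1) hτ
  -- lower bound on B
  have hBl : ∀ ξ : Euc n, (1 - τ) * ‖ξ‖ ^ 2 ≤ qf B ξ := by
    intro ξ
    have hline : Tendsto (fun t : ℝ => (x, y + t • ξ)) (𝓝 0) (𝓝 (x, y)) :=
      (tendsto_const_nhds).prodMk_nhds (line_tendsto y ξ)
    have hP := ((((hB ξ).sub ((P2_nsq y ξ).const_mul (1 / 2))).add
      ((P2_nsq (x - y) (-ξ)).const_mul (δ * K * ((1 - d / 2) / (2 * d))))).add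
      ((P2_nsq (y - x0) ξ).const_mul (δ * M))).min (by
        filter_upwards [hline.eventually hmax] with t ht
        simp only [ilPhi] at ht
        have h1 := psi_quad (s := ‖x - (y + t • ξ)‖) hd
        rw [hdd] at ht
        have h2 := mulL h1 (show 0 ≤ δ * K by positivity)
        have e1 : x - y + t • -ξ = x - (y + t • ξ) := by rw [smul_neg]; abel
        have e2 : y - x0 + t • ξ = y + t • ξ - x0 := by abel
        rw [e1, e2, hdd]
        linarith)
    have h3 := hP.2
    rw [norm_neg] at h3
    have h4 : δ * K * ((1 - d / 2) / (2 * d)) * (2 * ‖ξ‖ ^ 2) ≤ δ * (K / d) * ‖ξ‖ ^ 2 := by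
      have : δ * (K / d) * ‖ξ‖ ^ 2 - δ * K * ((1 - d / 2) / (2 * d)) * (2 * ‖ξ‖ ^ 2) = δ * K / 2 * ‖ξ‖ ^ 2 := by
        field_simp; ring
      have h2 : 0 ≤ δ * K / 2 * ‖ξ‖ ^ 2 := by positivity
      linarith
    rw [hτd]; linarith
  have hBl2 : ∀ ξ : Euc n, 1 / 2 * ‖ξ‖ ^ 2 ≤ qf B ξ := fun ξ => by
    have := hBl ξ
    have h2 : 0 ≤ ‖ξ‖ ^ 2 := by positivity
    nlinarith
  set e : Euc n := d⁻¹ • (x - y) with he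
  have hen : ‖e‖ = 1 := by
    rw [he, norm_smul, hdd, norm_inv, Real.norm_of_nonneg hd.le, inv_mul_cancel₀ hd.ne']
  have hxy : x - y = d • e := by rw [he, smul_smul, mul_inv_cancel₀ hd.ne', one_smul]
  have hBe : qf B e ≤ 2 := by
    have h1 := qf_le_of_det ((posDef_iff_qf B).1 hBp).1 (show 0 < 1 - τ by linarith) hBl e
    rw [hen, hBd] at h1
    have h2 : f y ^ n ≤ 4 / 3 := (pow_le_pow_left₀ (h.fpos y hy).le hf n).trans (pow_upper hδ hδ1 hn)
    have h3 : 3 / 4 ≤ (1 - τ) ^ (n - 1) := by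
      have h4 := one_add_mul_le_pow (a := -τ) (by linarith) n
      have h5 : (1 - τ) ^ n ≤ (1 - τ) ^ (n - 1) := pow_le_pow_of_le_one (by linarith) (by linarith) (by omega)
      rw [← sub_eq_add_neg 1 τ] at h4
      linarith
    have h6 : 0 ≤ qf B e := (by positivity : (0 : ℝ) ≤ 1 / 2 * ‖e‖ ^ 2).trans (hBl2 e)
    nlinarith
  refine il_mat hn hAp hBp (h.fpos x hx) (h.fpos y hy) hAd hBd hen hK hM hδ hBl2 hBe ?_
  intro ξ
  set c := ⟪e, ξ⟫ with hc
  set ζ := ξ - (2 * c) • e with hζ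
  have hnorm : ‖ζ‖ ^ 2 = ‖ξ‖ ^ 2 := by
    rw [hζ, norm_sub_sq_real, inner_smul_right, norm_smul, mul_pow, hen, real_inner_comm, Real.norm_eq_abs, sq_abs]; ring
  have hline : Tendsto (fun t : ℝ => (x + t • ξ, y + t • ζ)) (𝓝 0) (𝓝 (x, y)) :=
    (line_tendsto x ξ).prodMk_nhds (line_tendsto y ζ)
  have hpos : ∀ᶠ t : ℝ in 𝓝 0, 0 < d + 2 * c * t := by
    have : Continuous fun t : ℝ => d + 2 * c * t := by fun_prop
    have h2 := this.tendsto 0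
    simp only [mul_zero, add_zero] at h2
    exact h2.eventually (lt_mem_nhds hd)
  have hP := ((((hA ξ).sub ((P2_nsq x ξ).const_mul (1 / 2))).sub
      ((hB ζ).sub ((P2_nsq y ζ).const_mul (1 / 2)))).sub
      (((P2_quad (d - d ^ 2 / 4) (2 * c - d * c) (-2 * c ^ 2)).const_mul (δ * K)).add
      (((P2_nsq (x - x0) ξ).add (P2_nsq (y - x0) ζ)).const_mul (δ * M)))).max (by
        filter_upwards [hline.eventually hmax, hpos] with t ht htp
        simp only [ilPhi] at ht
        have e0 : x + t • ξ - (y + t • ζ) = (d + 2 * c * t) • e := by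
          have : x + t • ξ - (y + t • ζ) = (x - y) + t • (ξ - ζ) := by rw [smul_sub t ξ ζ]; abel
          rw [this, hxy, hζ]; module
        have e1 : ‖x + t • ξ - (y + t • ζ)‖ = d + 2 * c * t := by
          rw [e0, norm_smul, hen, mul_one, Real.norm_of_nonneg htp.le]
        have e2 : y - x0 + t • ζ = y + t • ζ - x0 := by abel
        have e3 : x - x0 + t • ξ = x + t • ξ - x0 := by abel
        rw [e1, hdd] at ht
        rw [e2, e3]
        linarith)
  have h3 := hP.2
  rw [hnorm] at h3
  linarith

theorem sq_small {a b : ℝ} (h : 48 * (a ^ 2 + b ^ 2) < 2) : a < 1 / 4 := by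
  nlinarith [sq_nonneg b, sq_nonneg (a - 1 / 4)]

theorem il_dist {u f : Euc n → ℝ} {δ σ r d : ℝ} {x y : Euc n} (hS : Sol (ball 0 1) u f) (hδ : 0 < δ) (hσ : 0 < σ)
    (hxn : ‖x‖ ≤ 3 / 4) (hyn : ‖y‖ ≤ 3 / 4)
    (hub : ∀ x y : Euc n, ‖x‖ < 1 → ‖y‖ < 1 → (u x - ‖x‖ ^ 2 / 2) - (u y - ‖y‖ ^ 2 / 2) ≤ 2 * δ)
    (hdd : d = ‖x - y‖) (hdpos : 0 < d) (hrr : r ^ 2 = δ) (hr0 : 0 < r) (hrs3 : r ≤ 1 / 9312) (h : d < r)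
    (hwl : δ * σ < (u x - ‖x‖ ^ 2 / 2) - (u y - ‖y‖ ^ 2 / 2)) : σ * r / 3 ≤ d := by
    have hd0 := hdpos.le
    have hball : ∀ x : Euc n, ‖x‖ < 1 → x ∈ ball (0 : Euc n) 1 := fun x hx => by simpa using hx
    set e : Euc n := d⁻¹ • (x - y) with he
    have hen : ‖e‖ = 1 := by
      rw [he, norm_smul, ← hdd, norm_inv, Real.norm_of_nonneg hd0, inv_mul_cancel₀ hdpos.ne']
    have hxe : x = y + d • e := by rw [he, smul_smul, mul_inv_cancel₀ hdpos.ne', one_smul]; abel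
    set z := y + r • e with hz
    have hzn : ‖z‖ < 1 := by
      have : ‖z‖ ≤ ‖y‖ + ‖r • e‖ := norm_add_le _ _
      rw [norm_smul, hen, Real.norm_of_nonneg hr0.le] at this
      linarith
    have hcv := hS.cvx.2 (hball y (by linarith)) (hball z hzn) (show 0 ≤ 1 - d / r by
      rw [sub_nonneg, div_le_one hr0]; exact h.le) (show 0 ≤ d / r by positivity) (by ring)
    have hxz : (1 - d / r) • y + (d / r) • z = x := by
      rw [hz, hxe, smul_add, smul_smul, div_mul_cancel₀ _ hr0.ne']; module
    rw [hxz, smul_eq_mul, smul_eq_mul] at hcv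
    have h1 := hub z y hzn (by linarith)
    have nz : ‖z‖ ^ 2 = ‖y‖ ^ 2 + 2 * r * ⟪y, e⟫ + r ^ 2 := by
      rw [hz, nsq_line, hen]; ring
    have nx : ‖x‖ ^ 2 = ‖y‖ ^ 2 + 2 * d * ⟪y, e⟫ + d ^ 2 := by
      rw [hxe, nsq_line, hen]; ring
    have h2 : u x - u y ≤ d / r * (u z - u y) := by linarith
    have h3 : d / r * (u z - u y) ≤ d / r * (r * ⟪y, e⟫ + 5 / 2 * r ^ 2) :=
      mulL (by rw [nz] at h1; rw [hrr]; rw [hrr] at h1; linarith) (by positivity)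
    have h4 : d / r * (r * ⟪y, e⟫ + 5 / 2 * r ^ 2) = d * ⟪y, e⟫ + 5 / 2 * r * d := by
      field_simp
    rw [nx, ← hrr] at hwl
    have h5 : r ^ 2 * σ < 5 / 2 * r * d := by have := sq_nonneg d; linarith
    have h6 : r * σ < 5 / 2 * d := by
      by_contra hc
      push Not at hc
      have := mulL hc hr0.le
      linarith
    linarith

set_option maxHeartbeats 1000000 in
theorem ishii (hn : n ≠ 0) : ∀ σ : ℝ, 0 < σ → σ ≤ 1 → ∃ δ0 : ℝ, 0 < δ0 ∧ ∀ (u f : Euc n → ℝ) (δ : ℝ), 0 < δ → δ ≤ δ0 →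
    Sol (ball 0 1) u f → (∀ x ∈ ball (0 : Euc n) 1, |u x - ‖x‖ ^ 2 / 2| ≤ δ) →
    (∀ x ∈ ball (0 : Euc n) 1, |f x - 1| ≤ δ) →
    ∀ x ∈ closedBall (0 : Euc n) (1 / 2), ∀ y ∈ closedBall (0 : Euc n) (1 / 2),
      (u x - ‖x‖ ^ 2 / 2) - (u y - ‖y‖ ^ 2 / 2) ≤ δ * (388 * n * ‖x - y‖ + σ) := by
  intro σ hσ hσ1
  have hn1 : (1 : ℝ) ≤ n := by exact_mod_cast Nat.one_le_iff_ne_zero.2 hn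
  set K : ℝ := 388 * n with hK
  have hK1 : 388 ≤ K := by rw [hK]; linarith
  refine ⟨(σ / (24 * n * K)) ^ 2, by positivity, ?_⟩
  intro u f δ hδ hδ0 hS hu hf x1 hx1 x0 hx0
  have hx1' : ‖x1‖ ≤ 1 / 2 := by simpa using hx1
  have hx0' : ‖x0‖ ≤ 1 / 2 := by simpa using hx0
  have hball : ∀ x : Euc n, ‖x‖ < 1 → x ∈ ball (0 : Euc n) 1 := fun x hx => by simpa using hx
  have hub : ∀ x y : Euc n, ‖x‖ < 1 → ‖y‖ < 1 → (u x - ‖x‖ ^ 2 / 2) - (u y - ‖y‖ ^ 2 / 2) ≤ 2 * δ := fun x y hx hy => by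
    have h1 := abs_le.1 (hu x (hball x hx))
    have h2 := abs_le.1 (hu y (hball y hy))
    linarith
  by_contra hcon
  push Not at hcon
  set r := Real.sqrt δ with hr
  have hr0 : 0 < r := Real.sqrt_pos.2 hδ
  have hrr : r ^ 2 = δ := Real.sq_sqrt hδ.le
  have hrs : r ≤ σ / (24 * n * K) := by
    rw [hr]; exact Real.sqrt_le_iff.2 ⟨by positivity, hδ0⟩
  have hrs2 : r * (24 * n * K) ≤ σ := (le_div_iff₀ (by positivity)).1 hrs
  have hrs3 : r ≤ 1 / 9312 := by
    have : 9312 ≤ 24 * n * K := by have := mul_le_mul hn1 hK1 (by norm_num) (by positivity); linarith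
    have := mulL this hr0.le; linarith
  have hd1 : ‖x1 - x0‖ < 1 / 4 := by
    by_contra hc
    push Not at hc
    have := hub x1 x0 (by linarith) (by linarith)
    have h2 : (2 : ℝ) ≤ K * ‖x1 - x0‖ := by have := mul_le_mul hK1 hc (by norm_num) (by positivity); linarith
    have h3 := mulL h2 hδ.le; have h4 : 0 < δ * σ := mul_pos hδ hσ; linarith
  set Cb := closedBall x0 (1 / 4) with hCb
  have hCs : ∀ p ∈ Cb, ‖p‖ ≤ 3 / 4 := fun p hp => by
    have h1 : ‖p - x0‖ ≤ 1 / 4 := by simpa [hCb, dist_eq_norm] using hp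
    have h2 : ‖p‖ ≤ ‖p - x0‖ + ‖x0‖ := by simpa using norm_add_le (p - x0) x0
    linarith
  have hCc : IsCompact Cb := isCompact_closedBall _ _
  have hcu : ContinuousOn u Cb := hS.cont.mono fun p hp => hball p (by linarith [hCs p hp])
  have hcont : ContinuousOn (ilPhi u K 48 δ x0) (Cb ×ˢ Cb) := by
    unfold ilPhi
    have c1 : ContinuousOn (fun p : Euc n × Euc n => u p.1) (Cb ×ˢ Cb) := hcu.comp continuousOn_fst fun p hp => hp.1
    have c2 : ContinuousOn (fun p : Euc n × Euc n => u p.2) (Cb ×ˢ Cb) := hcu.comp continuousOn_snd fun p hp => hp.2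
    refine ContinuousOn.sub (ContinuousOn.sub (c1.sub ?_) (c2.sub ?_)) ?_ <;> fun_prop
  have h10 : (x1, x0) ∈ Cb ×ˢ Cb := by
    refine ⟨?_, ?_⟩
    · simp only [hCb, mem_closedBall, dist_eq_norm]; linarith
    · simp [hCb]
  obtain ⟨⟨x, y⟩, ⟨hxC, hyC⟩, hmax⟩ := (hCc.prod hCc).exists_isMaxOn ⟨_, h10⟩ hcont
  rw [isMaxOn_iff] at hmax
  have hval : δ * σ < ilPhi u K 48 δ x0 (x, y) := by
    refine lt_of_lt_of_le ?_ (hmax _ h10)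
    simp only [ilPhi, sub_self, norm_zero]
    have h1 : 0 ≤ (K / 4 - 48) * ‖x1 - x0‖ ^ 2 := mul_nonneg (by linarith) (by positivity)
    have h2 := mul_nonneg hδ.le h1
    linarith
  have hxn := hCs x hxC
  have hyn := hCs y hyC
  have hw := hub x y (by linarith) (by linarith)
  set d := ‖x - y‖ with hdd
  have hd0 : 0 ≤ d := norm_nonneg _
  have hd2 : d ≤ 1 / 2 := by
    have h1 : ‖x - x0‖ ≤ 1 / 4 := by simpa [hCb, dist_eq_norm] using hxC
    have h2 : ‖y - x0‖ ≤ 1 / 4 := by simpa [hCb, dist_eq_norm] using hyC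
    have h3 : d ≤ ‖x - x0‖ + ‖y - x0‖ := by
      rw [hdd, show x - y = (x - x0) - (y - x0) by abel]; exact norm_sub_le _ _
    linarith
  simp only [ilPhi] at hval
  rw [← hdd] at hval
  have hψ : 0 ≤ d - d ^ 2 / 4 := by have := mul_nonneg hd0 (show 0 ≤ 1 / 2 - d by linarith); have := sq_nonneg d; linarith
  have hKψ : 0 ≤ K * (d - d ^ 2 / 4) := by positivity
  have hin : 48 * (‖x - x0‖ ^ 2 + ‖y - x0‖ ^ 2) < 2 := by
    by_contra hc
    push Not at hc
    have : δ * 2 ≤ δ * (K * (d - d ^ 2 / 4) + 48 * (‖x - x0‖ ^ 2 + ‖y - x0‖ ^ 2)) :=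
      mulL (by linarith) hδ.le
    have : 0 < δ * σ := by positivity
    linarith
  have hxi : ‖x - x0‖ < 1 / 4 := sq_small hin
  have hyi : ‖y - x0‖ < 1 / 4 := sq_small (by linarith : 48 * (‖y - x0‖ ^ 2 + ‖x - x0‖ ^ 2) < 2)
  have hwl : δ * σ < (u x - ‖x‖ ^ 2 / 2) - (u y - ‖y‖ ^ 2 / 2) := by
    have : 0 ≤ δ * (K * (d - d ^ 2 / 4) + 48 * (‖x - x0‖ ^ 2 + ‖y - x0‖ ^ 2)) := by positivity
    linarith
  have hdpos : 0 < d := by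
    rcases hd0.lt_or_eq with h | h
    · exact h
    · exfalso
      have : x = y := by rw [← sub_eq_zero, ← norm_eq_zero, ← hdd, ← h]
      rw [this] at hwl
      have : 0 < δ * σ := by positivity
      linarith
  have hdl : σ * r / 3 ≤ d := by
    rcases le_or_gt r d with h | h
    · have := mulR hσ1 hr0.le; linarith
    exact il_dist hS hδ hσ hxn hyn hub hdd hdpos hrr hr0 hrs3 h hwl
  have hlocal : ∀ᶠ p in 𝓝 (x, y), ilPhi u K 48 δ x0 p ≤ ilPhi u K 48 δ x0 (x, y) := by
    have hx' : ∀ᶠ a in 𝓝 x, a ∈ Cb := by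
      filter_upwards [isOpen_ball.mem_nhds (show x ∈ ball x0 (1 / 4) by simpa [dist_eq_norm] using hxi)] with a ha
      exact ball_subset_closedBall ha
    have hy' : ∀ᶠ a in 𝓝 y, a ∈ Cb := by
      filter_upwards [isOpen_ball.mem_nhds (show y ∈ ball x0 (1 / 4) by simpa [dist_eq_norm] using hyi)] with a ha
      exact ball_subset_closedBall ha
    rw [nhds_prod_eq]
    filter_upwards [hx'.prod_mk hy'] with p hp
    exact hmax p ⟨hp.1, hp.2⟩
  have hτ : n * (δ * (K / d + 2 * 48)) ≤ 1 / 4 := by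
    have h1 : δ * (K / d) ≤ 3 * K * r / σ := by
      rw [← hrr, ← mul_div_assoc, div_le_div_iff₀ hdpos hσ]
      have h5 : σ * r ≤ 3 * d := by linarith
      have h6 := mulL h5 (show 0 ≤ r * K by positivity)
      linarith
    have h2 : n * (3 * K * r / σ) ≤ 1 / 8 := by
      rw [← mul_div_assoc, div_le_iff₀ hσ]; linarith
    have h3 : n * (δ * (2 * 48)) ≤ 1 / 8 := by
      rw [← hrr]
      have : n * r ≤ 1 / 9312 := by
        have h7 : n * r * 9312 ≤ r * (24 * n * K) := by
          have := mulL hK1 (show 0 ≤ n * r * 24 by positivity)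
          linarith
        linarith
      have h8 := mul_le_mul this hrs3 hr0.le (by norm_num)
      linarith
    have h4 := mulL h1 (show (0 : ℝ) ≤ n by positivity)
    linarith
  have hδ1 : n * δ ≤ 1 / 4 := by
    have : 0 ≤ δ * (K / d) := by positivity
    have h9 := mul_nonneg (Nat.cast_nonneg (α := ℝ) n) this; have h10 := mul_nonneg (Nat.cast_nonneg (α := ℝ) n) hδ.le; linarith
  have hfy := abs_le.1 (hf y (hball y (by linarith)))
  have hfx := abs_le.1 (hf x (hball x (by linarith)))
  have hfin := il_point hn hS (hball x (by linarith)) (hball y (by linarith)) (by positivity) (by norm_num) hδ.le hdpos hdd.symm hlocal hτ hδ1 (by linarith)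
  have hfyp := hS.fpos y (hball y (by linarith))
  have hq : 1 - 2 * δ ≤ f x / f y := by
    rw [le_div_iff₀ hfyp]
    have : δ ≤ 1 / 4 := by exact le_trans (le_mul_of_one_le_left hδ.le hn1) hδ1
    have h9 := mulL hfy.2 (show 0 ≤ 1 - 2 * δ by linarith); have := sq_nonneg δ; linarith
  have := mulL hq (show (0 : ℝ) ≤ n by positivity)
  rw [hK] at hfin
  have := mul_pos hδ (show (0 : ℝ) < n by linarith); linarith

abbrev MPo (n : ℕ) := MvPolynomial (Fin n) ℝ

def ev (p : MPo n) (x : Euc n) : ℝ := MvPolynomial.eval x.ofLp p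
def pd (i : Fin n) (p : MPo n) : MPo n := MvPolynomial.pderiv i p
def lap (p : MPo n) : MPo n := ∑ i, pd i (pd i p)

theorem ev_add (p q : MPo n) (x : Euc n) : ev (p + q) x = ev p x + ev q x := by simp [ev]
theorem ev_sub (p q : MPo n) (x : Euc n) : ev (p - q) x = ev p x - ev q x := by simp [ev]
theorem ev_mul (p q : MPo n) (x : Euc n) : ev (p * q) x = ev p x * ev q x := by simp [ev]
theorem ev_sum (p : Fin n → MPo n) (x : Euc n) : ev (∑ i, p i) x = ∑ i, ev (p i) x := by simp [ev, MvPolynomial.eval_sum]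
theorem ev_C (a : ℝ) (x : Euc n) : ev (MvPolynomial.C a) x = a := by simp [ev]
theorem ev_X (i : Fin n) (x : Euc n) : ev (MvPolynomial.X i) x = x i := by simp [ev]
theorem ev_zero (x : Euc n) : ev (0 : MPo n) x = 0 := by simp [ev]
theorem ev_one (x : Euc n) : ev (1 : MPo n) x = 1 := by simp [ev]

theorem pd_add (i : Fin n) (p q : MPo n) : pd i (p + q) = pd i p + pd i q := by simp [pd]
theorem pd_sub (i : Fin n) (p q : MPo n) : pd i (p - q) = pd i p - pd i q := by simp [pd]
theorem pd_mul (i : Fin n) (p q : MPo n) : pd i (p * q) = pd i p * q + p * pd i q := by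
  simp [pd, MvPolynomial.pderiv_mul]; ring
theorem pd_C (i : Fin n) (a : ℝ) : pd i (MvPolynomial.C a : MPo n) = 0 := by simp [pd]
theorem pd_sum (i : Fin n) (p : Fin n → MPo n) : pd i (∑ j, p j) = ∑ j, pd i (p j) := by simp [pd]
theorem pd_X (i j : Fin n) : pd i (MvPolynomial.X j : MPo n) = if i = j then 1 else 0 := by
  classical
  rw [pd, MvPolynomial.pderiv_X, Pi.single_apply]
  simp [eq_comm]

theorem pd_comm (i j : Fin n) (p : MPo n) : pd i (pd j p) = pd j (pd i p) := by
  have h : ⁅MvPolynomial.pderiv (R := ℝ) i, MvPolynomial.pderiv j⁆ = (0 : Derivation ℝ (MPo n) (MPo n)) := by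
    apply MvPolynomial.derivation_ext
    intro k
    classical
    rw [Derivation.commutator_apply, MvPolynomial.pderiv_X, MvPolynomial.pderiv_X, Pi.single_apply, Pi.single_apply]
    split_ifs <;> simp
  have := congrArg (fun D => D p) h
  simp only [Derivation.commutator_apply, Derivation.coe_zero, Pi.zero_apply] at this
  exact sub_eq_zero.1 this

theorem lap_sub (p q : MPo n) : lap (p - q) = lap p - lap q := by
  simp [lap, pd_sub, Finset.sum_sub_distrib]
theorem lap_add (p q : MPo n) : lap (p + q) = lap p + lap q := by
  simp [lap, pd_add, Finset.sum_add_distrib]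
theorem lap_pd (i : Fin n) (p : MPo n) : lap (pd i p) = pd i (lap p) := by
  rw [lap, lap, pd_sum]
  refine Finset.sum_congr rfl fun j _ => ?_
  rw [pd_comm j i p, pd_comm j i]
theorem lap_mul (p q : MPo n) : lap (p * q) = lap p * q + 2 * ∑ i, pd i p * pd i q + p * lap q := by
  simp only [lap, pd_mul, pd_add, Finset.sum_add_distrib]
  rw [← Finset.sum_mul, ← Finset.mul_sum]; ring

theorem pd_C_mul (i : Fin n) (a : ℝ) (p : MPo n) : pd i (MvPolynomial.C a * p) = MvPolynomial.C a * pd i p := by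
  rw [pd_mul, pd_C]; ring
theorem lap_C_mul (a : ℝ) (p : MPo n) : lap (MvPolynomial.C a * p) = MvPolynomial.C a * lap p := by
  simp only [lap, pd_C_mul, Finset.mul_sum]

theorem ev_hasDeriv (p : MPo n) (x v : Euc n) (t : ℝ) :
    HasDerivAt (fun s : ℝ => ev p (x + s • v)) (∑ i, v i * ev (pd i p) (x + t • v)) t := by
  induction p using MvPolynomial.induction_on with
  | C a =>
    simp only [ev_C, pd_C, ev_zero, mul_zero, Finset.sum_const_zero]
    exact hasDerivAt_const _ _
  | add p q hp hq =>
    simp only [ev_add, pd_add, mul_add, Finset.sum_add_distrib]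
    exact hp.add hq
  | mul_X p i hp =>
    simp only [ev_mul, pd_mul, ev_add, ev_X, pd_X]
    have h2 : HasDerivAt (fun s : ℝ => (x + s • v) i) (v i) t := by
      simp only [PiLp.add_apply, PiLp.smul_apply, smul_eq_mul]
      simpa using ((hasDerivAt_id t).mul_const (v i)).const_add (x i)
    refine (hp.mul h2).congr_deriv ?_
    simp only [mul_add, Finset.sum_add_distrib, Finset.sum_mul]
    congr 1
    · exact Finset.sum_congr rfl fun j _ => by ring
    · rw [Finset.sum_eq_single i]
      · simp [ev_one]; ring
      · intro j _ hj; simp [hj, ev_zero]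
      · simp

theorem ev_cont (p : MPo n) : Continuous (ev p) := by
  unfold ev
  have : Continuous fun y : Fin n → ℝ => MvPolynomial.eval y p := MvPolynomial.continuous_eval p
  exact this.comp (PiLp.continuous_ofLp 2 _)

/-- Hessian of a polynomial -/
def phess (p : MPo n) (x : Euc n) : Mat n := fun i j => ev (pd j (pd i p)) x
def pgrad (p : MPo n) (x : Euc n) : Euc n := WithLp.toLp 2 fun i => ev (pd i p) x

theorem phess_symm (p : MPo n) (x : Euc n) : (phess p x)ᵀ = phess p x := by
  ext i j; simp only [transpose_apply, phess]; rw [pd_comm]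

theorem phess_trace (p : MPo n) (x : Euc n) : (phess p x).trace = ev (lap p) x := by
  simp [trace, phess, lap, ev_sum]

theorem qf_eq_sum (H : Mat n) (v : Euc n) : qf H v = ∑ i, ∑ j, v i * v j * H i j := by
  simp only [qf, dotProduct, mulVec, Finset.mul_sum]
  exact Finset.sum_congr rfl fun i _ => Finset.sum_congr rfl fun j _ => by ring

theorem pgrad_inner (p : MPo n) (x v : Euc n) : ⟪pgrad p x, v⟫ = ∑ i, v i * ev (pd i p) x := by
  rw [inner_eq_dot]; simp only [dotProduct, pgrad]
  exact Finset.sum_congr rfl fun i _ => by ring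

theorem ev_hasDeriv2 (p : MPo n) (x v : Euc n) (t : ℝ) :
    HasDerivAt (fun s : ℝ => ∑ i, v i * ev (pd i p) (x + s • v)) (qf (phess p (x + t • v)) v) t := by
  rw [qf_eq_sum]
  refine (HasDerivAt.fun_sum fun i _ => (ev_hasDeriv (pd i p) x v t).const_mul (v i)).congr_deriv ?_
  simp only [Finset.mul_sum, phess]
  exact Finset.sum_congr rfl fun i _ => Finset.sum_congr rfl fun j _ => by ring

theorem poly_pea (p : MPo n) (x : Euc n) : Pea (ev p) x (pgrad p x) (phess p x) := by
  intro v
  have h := P2_of_deriv (φ := fun t => ev p (x + t • v)) (φ' := fun s => ∑ i, v i * ev (pd i p) (x + s • v))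
    (c := qf (phess p x) v) (Eventually.of_forall fun t => ev_hasDeriv p x v t)
    (by simpa using ev_hasDeriv2 p x v 0)
  simpa [pgrad_inner] using h

/-- `|x - z|²` as a polynomial -/
def nsqP (z : Euc n) : MPo n := ∑ i, (MvPolynomial.X i - MvPolynomial.C (z i)) * (MvPolynomial.X i - MvPolynomial.C (z i))

theorem ev_nsqP (z x : Euc n) : ev (nsqP z) x = ‖x - z‖ ^ 2 := by
  rw [EuclideanSpace.norm_sq_eq, nsqP, ev_sum]
  refine Finset.sum_congr rfl fun i _ => ?_
  rw [ev_mul, ev_sub, ev_X, ev_C, Real.norm_eq_abs, sq_abs]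
  simp; ring

theorem pd_nsqP (z : Euc n) (i : Fin n) : pd i (nsqP z) = 2 * (MvPolynomial.X i - MvPolynomial.C (z i)) := by
  rw [nsqP, pd_sum, Finset.sum_eq_single i]
  · rw [pd_mul, pd_sub, pd_X, pd_C]; simp; ring
  · intro j _ hj
    rw [pd_mul, pd_sub, pd_X, pd_C, if_neg (fun h => hj h.symm)]; simp
  · simp

theorem lap_nsqP (z : Euc n) : lap (nsqP z) = MvPolynomial.C (2 * n : ℝ) := by
  have : ∀ i : Fin n, pd i (pd i (nsqP z)) = MvPolynomial.C 2 := by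
    intro i
    rw [pd_nsqP, show (2 : MPo n) = MvPolynomial.C 2 from (map_ofNat MvPolynomial.C 2).symm, pd_mul, pd_C, pd_sub, pd_X, pd_C]; simp
  rw [lap, Finset.sum_congr rfl fun i _ => this i]
  simp [mul_comm]

/-- weak maximum principle -/
theorem poly_max (hn : n ≠ 0) {p : MPo n} {z : Euc n} {r m : ℝ}
    (hs : ∀ x, ‖x - z‖ = r → ev p x ≤ m) (hl : ∀ x, ‖x - z‖ < r → 0 ≤ ev (lap p) x) :
    ∀ x, ‖x - z‖ ≤ r → ev p x ≤ m := by
  intro x hx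
  refine le_of_forall_pos_le_add fun ε hε => ?_
  have hr : 0 ≤ r := (norm_nonneg _).trans hx
  set η := ε / (r ^ 2 + 1) with hη
  have hη0 : 0 < η := by positivity
  have hηr : η * r ^ 2 ≤ ε := by
    rw [hη, div_mul_eq_mul_div, div_le_iff₀ (by positivity)]; nlinarith
  set q := p + MvPolynomial.C η * nsqP z with hq
  have hqe : ∀ y, ev q y = ev p y + η * ‖y - z‖ ^ 2 := fun y => by rw [hq, ev_add, ev_mul, ev_C, ev_nsqP]
  have hql : ∀ y, ev (lap q) y = ev (lap p) y + η * (2 * n) := fun y => by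
    rw [hq, lap_add, lap_C_mul, lap_nsqP, ev_add, ev_mul, ev_C, ev_C]
  obtain ⟨y, hy, hmax⟩ := (isCompact_closedBall z r).exists_isMaxOn ⟨x, by simpa [dist_eq_norm] using hx⟩ (ev_cont q).continuousOn
  rw [isMaxOn_iff] at hmax
  have hxy := hmax x (by simpa [dist_eq_norm] using hx)
  have hy' : ‖y - z‖ ≤ r := by simpa [dist_eq_norm] using hy
  rcases hy'.lt_or_eq with h | h
  · exfalso
    have hsum : ev (lap q) y ≤ 0 := by
      rw [← phess_trace, trace]
      refine Finset.sum_nonpos fun i _ => ?_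
      have h1 := (poly_pea q y (EuclideanSpace.single i 1)).max (by
        have : ∀ᶠ w in 𝓝 y, w ∈ closedBall z r := by
          filter_upwards [isOpen_ball.mem_nhds (show y ∈ ball z r by simpa [dist_eq_norm] using h)] with a ha
          exact ball_subset_closedBall ha
        filter_upwards [(line_tendsto y (EuclideanSpace.single i 1)).eventually this] with t ht
        exact hmax _ ht)
      have h2 := h1.2
      rw [qf_eq_sum, Finset.sum_eq_single i, Finset.sum_eq_single i] at h2
      · simpa using h2
      · intro j _ hj; simp [hj]
      · simp
      · intro j _ hj; simp [hj]
      · simp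
    rw [hql] at hsum
    have h3 := hl y h
    have : 0 < η * (2 * n) := by
      have : (0 : ℝ) < n := by exact_mod_cast Nat.pos_of_ne_zero hn
      positivity
    linarith
  · have := hs y h
    rw [hqe, hqe, h] at hxy
    have : 0 ≤ η * ‖x - z‖ ^ 2 := by positivity
    linarith

theorem ev_lap_sq {p : MPo n} (x : Euc n) : ev (lap (p * p)) x = 2 * ev p x * ev (lap p) x + 2 * ∑ i, ev (pd i p) x ^ 2 := by
  rw [lap_mul, ev_add, ev_add, ev_mul, ev_mul, ev_mul, ev_sum, show ev (2 : MPo n) x = 2 by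
    rw [show (2 : MPo n) = MvPolynomial.C 2 from (map_ofNat MvPolynomial.C 2).symm, ev_C]]
  have : ∑ i, ev (pd i p * pd i p) x = ∑ i, ev (pd i p) x ^ 2 := Finset.sum_congr rfl fun i _ => by rw [ev_mul]; ring
  rw [this]; ring

theorem bern_calc {h : MPo n} (hh : lap h = 0) (x0 x : Euc n) (i : Fin n) {r : ℝ} (hx : ‖x - x0‖ < r) :
    0 ≤ ev (lap ((MvPolynomial.C (r ^ 2) - nsqP x0) * (MvPolynomial.C (r ^ 2) - nsqP x0) * (pd i h * pd i h) +
      MvPolynomial.C ((2 * n + 12) * r ^ 2) * (h * h))) x := by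
  set η : MPo n := MvPolynomial.C (r ^ 2) - nsqP x0 with hη
  set g := pd i h with hg
  have hgl : lap g = 0 := by rw [hg, lap_pd, hh]; simp [pd]
  have hlη : lap η = MvPolynomial.C (-(2 * n : ℝ)) := by
    rw [hη, lap_sub, lap_nsqP]; simp [lap, pd_C, pd]
  have hpη : ∀ j, ev (pd j η) x = -2 * (x - x0) j := fun j => by
    rw [hη, pd_sub, pd_C, pd_nsqP, ev_sub, ev_zero, ev_mul, ev_sub, ev_X, ev_C, show ev (2 : MPo n) x = 2 by
      rw [show (2 : MPo n) = MvPolynomial.C 2 from (map_ofNat MvPolynomial.C 2).symm, ev_C]]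
    simp
  set e := r ^ 2 - ‖x - x0‖ ^ 2 with he
  have hee : ev η x = e := by rw [hη, ev_sub, ev_C, ev_nsqP]
  have hy : ‖x - x0‖ ^ 2 = ∑ j, (x - x0) j ^ 2 := by
    rw [EuclideanSpace.norm_sq_eq]; simp
  have e1 : ev (lap (η * η)) x = -(4 * n * e) + 8 * ‖x - x0‖ ^ 2 := by
    rw [ev_lap_sq, hee, hlη, ev_C, hy, Finset.mul_sum, Finset.mul_sum]
    simp only [hpη]
    rw [show (∑ j, 2 * (-2 * (x - x0) j) ^ 2) = ∑ j, 8 * (x - x0) j ^ 2 from Finset.sum_congr rfl fun j _ => by ring]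
    ring
  set G := ev g x with hG
  have e2 : ev (lap (g * g)) x = 2 * ∑ j, ev (pd j g) x ^ 2 := by
    rw [ev_lap_sq, hgl, ev_zero]; ring
  have e3 : ev (lap (h * h)) x = 2 * ∑ j, ev (pd j h) x ^ 2 := by
    rw [ev_lap_sq, hh, ev_zero]; ring
  have e4 : G ^ 2 ≤ ∑ j, ev (pd j h) x ^ 2 :=
    Finset.single_le_sum (f := fun j => ev (pd j h) x ^ 2) (fun j _ => sq_nonneg _) (Finset.mem_univ i)
  rw [lap_add, lap_C_mul, ev_add, ev_mul _ (lap (h * h)), ev_C, e3, lap_mul, ev_add, ev_add, ev_mul (lap (η * η)), ev_mul 2, ev_mul (η * η) (lap (g * g)), ev_sum, e1, ev_mul g g, ev_mul η η, hee, e2,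
    show ev (2 : MPo n) x = 2 by
      rw [show (2 : MPo n) = MvPolynomial.C 2 from (map_ofNat MvPolynomial.C 2).symm, ev_C]]
  have e5 : ∀ j, ev (pd j (η * η) * pd j (g * g)) x = -8 * e * G * (x - x0) j * ev (pd j g) x := fun j => by
    rw [ev_mul, pd_mul, pd_mul, ev_add, ev_add, ev_mul, ev_mul, ev_mul, ev_mul, hpη, hee]; ring
  simp only [e5]
  have e6 : 0 ≤ ∑ j, 2 * (e * ev (pd j g) x - 4 * G * (x - x0) j) ^ 2 := Finset.sum_nonneg fun j _ => by positivity
  have e7 : ∑ j, 2 * (e * ev (pd j g) x - 4 * G * (x - x0) j) ^ 2 =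
      2 * ∑ j, -8 * e * G * (x - x0) j * ev (pd j g) x + e * e * (2 * ∑ j, ev (pd j g) x ^ 2) + 32 * G ^ 2 * ‖x - x0‖ ^ 2 := by
    rw [hy, Finset.mul_sum, Finset.mul_sum, Finset.mul_sum, Finset.mul_sum, ← Finset.sum_add_distrib, ← Finset.sum_add_distrib]
    exact Finset.sum_congr rfl fun j _ => by ring
  have hr : ‖x - x0‖ ^ 2 ≤ r ^ 2 := pow_le_pow_left₀ (norm_nonneg _) hx.le 2
  have h8 : 0 ≤ (n : ℝ) * ‖x - x0‖ ^ 2 * G ^ 2 := by positivity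
  have h9 : 0 ≤ (r ^ 2 - ‖x - x0‖ ^ 2) * G ^ 2 := mul_nonneg (by linarith) (sq_nonneg _)
  have h10 := mulL e4 (show 0 ≤ 2 * (2 * (n : ℝ) + 12) * r ^ 2 by positivity)
  have h11 : (n : ℝ) * e * G ^ 2 = n * r ^ 2 * G ^ 2 - n * ‖x - x0‖ ^ 2 * G ^ 2 := by rw [he]; ring
  nlinarith

theorem bern (hn : n ≠ 0) {h : MPo n} (hh : lap h = 0) {x0 : Euc n} {r M : ℝ} (hr : 0 < r)
    (hM : ∀ x, ‖x - x0‖ ≤ r → |ev h x| ≤ M) (i : Fin n) :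
    |ev (pd i h) x0| ≤ (2 * n + 12) / r * M := by
  have hM0 : 0 ≤ M := (abs_nonneg _).trans (hM x0 (by simpa using hr.le))
  have hmp := poly_max hn (m := (2 * n + 12) * r ^ 2 * M ^ 2) (z := x0) (r := r) (p := (MvPolynomial.C (r ^ 2) - nsqP x0) * (MvPolynomial.C (r ^ 2) - nsqP x0) * (pd i h * pd i h) +
      MvPolynomial.C ((2 * n + 12) * r ^ 2) * (h * h)) (fun x hx => by
        rw [ev_add, ev_mul, ev_mul, ev_mul, ev_mul, ev_mul, ev_sub, ev_nsqP, ev_C, ev_C, hx]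
        have h1 : ev h x * ev h x ≤ M ^ 2 := by
          rw [← sq, ← sq_abs]; exact pow_le_pow_left₀ (abs_nonneg _) (hM x hx.le) 2
        have := mulL h1 (show 0 ≤ (2 * (n : ℝ) + 12) * r ^ 2 by positivity)
        linarith) (fun x hx => bern_calc hh x0 x i hx) x0 (by simpa using hr.le)
  rw [ev_add, ev_mul, ev_mul, ev_mul, ev_mul, ev_mul, ev_sub, ev_nsqP, ev_C, ev_C, sub_self, norm_zero] at hmp
  have h1 : 0 ≤ (2 * (n : ℝ) + 12) * r ^ 2 * (ev h x0 * ev h x0) := by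
    have := mul_self_nonneg (ev h x0)
    positivity
  rw [← abs_of_nonneg (show 0 ≤ (2 * (n : ℝ) + 12) / r * M by positivity)]
  apply sq_le_sq.1
  have h2 : r ^ 4 * ev (pd i h) x0 ^ 2 ≤ r ^ 2 * ((2 * n + 12) * M ^ 2) := by nlinarith
  have h3 : r ^ 2 * ev (pd i h) x0 ^ 2 ≤ (2 * n + 12) * M ^ 2 := by
    have : 0 < r ^ 2 := by positivity
    by_contra hc
    push Not at hc
    have := mul_lt_mul_of_pos_left hc this
    nlinarith
  have h4 : ((2 * (n : ℝ) + 12) / r * M) ^ 2 = (2 * n + 12) ^ 2 * M ^ 2 / r ^ 2 := by field_simp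
  rw [h4, le_div_iff₀ (by positivity)]
  have h5 : (2 * (n : ℝ) + 12) * M ^ 2 ≤ (2 * n + 12) ^ 2 * M ^ 2 := by
    apply mulR _ (sq_nonneg M)
    have : (0 : ℝ) ≤ n := by positivity
    nlinarith
  linarith

theorem deg_pd (i : Fin n) (p : MPo n) : (pd i p).totalDegree ≤ p.totalDegree - 1 := by
  rw [MvPolynomial.totalDegree]
  refine Finset.sup_le fun m hm => ?_
  rw [MvPolynomial.mem_support_iff, pd, MvPolynomial.coeff_pderiv] at hm
  have h1 : MvPolynomial.coeff (m + Finsupp.single i 1) p ≠ 0 := fun h => hm (by rw [h]; simp)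
  have h2 := MvPolynomial.le_totalDegree (MvPolynomial.mem_support_iff.2 h1)
  rw [Finsupp.sum_add_index' (by simp) (by intros; rfl), Finsupp.sum_single_index rfl] at h2
  omega

theorem deg_lap (p : MPo n) : (lap p).totalDegree ≤ p.totalDegree - 2 := by
  rw [lap]
  refine MvPolynomial.totalDegree_finsetSum_le fun i _ => ?_
  have h1 := deg_pd i (pd i p)
  have h2 := deg_pd i p
  omega

theorem deg_nsqP : (nsqP (0 : Euc n)).totalDegree ≤ 2 := by
  rw [nsqP]
  refine MvPolynomial.totalDegree_finsetSum_le fun i _ => ?_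
  refine (MvPolynomial.totalDegree_mul _ _).trans ?_
  have : (MvPolynomial.X i - MvPolynomial.C ((0 : Euc n) i) : MPo n).totalDegree ≤ 1 := by
    refine (MvPolynomial.totalDegree_sub _ _).trans ?_
    simp
  omega

theorem poly_zero_of_ball {q : MPo n} {r : ℝ} (hr : 0 < r) (h : ∀ x : Euc n, ‖x‖ < r → ev q x = 0) : q = 0 := by
  refine MvPolynomial.funext_set (fun _ => Set.Ioo 0 (r / (n + 1))) (fun _ => Set.Ioo_infinite (by positivity)) ?_
  intro x hx
  rw [map_zero]
  refine h (WithLp.toLp 2 x) ?_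
  have hx' : ∀ i, 0 < x i ∧ x i < r / (n + 1) := fun i => hx i trivial
  have h1 : ‖(WithLp.toLp 2 x : Euc n)‖ ≤ ∑ i : Fin n, ‖x i‖ := by
    have := EuclideanSpace.norm_sq_eq (WithLp.toLp 2 x : Euc n)
    rw [← sq_le_sq₀ (norm_nonneg _) (Finset.sum_nonneg fun i _ => norm_nonneg _), this]
    exact Finset.sum_sq_le_sq_sum_of_nonneg (fun i _ => norm_nonneg _)
  have h2 : ∑ i : Fin n, ‖x i‖ ≤ n * (r / (n + 1)) := by
    have := Finset.sum_le_card_nsmul Finset.univ (fun i : Fin n => ‖x i‖) (r / (n + 1)) (fun i _ => by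
      rw [Real.norm_of_nonneg (hx' i).1.le]; exact (hx' i).2.le)
    simpa using this
  have h3 : n * (r / (n + 1)) < r := by
    rw [← mul_div_assoc, div_lt_iff₀ (by positivity)]; nlinarith
  linarith

theorem harm_repl (hn : n ≠ 0) (p : MPo n) {r : ℝ} (hr : 0 < r) :
    ∃ h : MPo n, lap h = 0 ∧ ∀ x : Euc n, ‖x‖ = r → ev h x = ev p x := by
  set m := p.totalDegree with hm
  set ζ : MPo n := MvPolynomial.C (r ^ 2) - nsqP 0 with hζ
  have hζd : ζ.totalDegree ≤ 2 := by
    refine (MvPolynomial.totalDegree_sub _ _).trans ?_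
    exact max_le (by rw [MvPolynomial.totalDegree_C]; norm_num) deg_nsqP
  let T : MPo n →ₗ[ℝ] MPo n :=
    { toFun := fun q => lap (ζ * q)
      map_add' := fun a b => by rw [mul_add, lap_add]
      map_smul' := fun c a => by
        rw [MvPolynomial.smul_eq_C_mul, RingHom.id_apply, MvPolynomial.smul_eq_C_mul,
          show ζ * (MvPolynomial.C c * a) = MvPolynomial.C c * (ζ * a) by ring, lap_C_mul] }
  have hT : ∀ q ∈ MvPolynomial.restrictTotalDegree (Fin n) ℝ m, T q ∈ MvPolynomial.restrictTotalDegree (Fin n) ℝ m := by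
    intro q hq
    rw [MvPolynomial.mem_restrictTotalDegree] at hq ⊢
    have h1 := deg_lap (ζ * q)
    have h2 := MvPolynomial.totalDegree_mul ζ q
    show (lap (ζ * q)).totalDegree ≤ m
    omega
  have hinj : Function.Injective (T.restrict hT) := by
    rw [injective_iff_map_eq_zero]
    intro q hq
    have hq' : lap (ζ * q.1) = 0 := congrArg Subtype.val hq
    have hev : ∀ x : Euc n, ev (ζ * q.1) x = (r ^ 2 - ‖x‖ ^ 2) * ev q.1 x := fun x => by
      rw [ev_mul, hζ, ev_sub, ev_C, ev_nsqP, sub_zero]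
    have hle : ∀ x : Euc n, ‖x - 0‖ ≤ r → ev (ζ * q.1) x ≤ 0 := poly_max hn (fun x hx => by
      rw [sub_zero] at hx; rw [hev, hx]; simp) (fun x hx => by rw [hq', ev_zero])
    have hge : ∀ x : Euc n, ‖x - 0‖ ≤ r → ev (MvPolynomial.C (-1) * (ζ * q.1)) x ≤ 0 := poly_max hn (fun x hx => by
      rw [sub_zero] at hx; rw [ev_mul, hev, hx]; simp) (fun x hx => by rw [lap_C_mul, hq', mul_zero, ev_zero])
    apply Subtype.ext
    refine poly_zero_of_ball hr fun x hx => ?_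
    have h1 := hle x (by rw [sub_zero]; exact hx.le)
    have h2 := hge x (by rw [sub_zero]; exact hx.le)
    rw [ev_mul, ev_C] at h2
    have h3 : ev (ζ * q.1) x = 0 := by linarith
    rw [hev] at h3
    rcases mul_eq_zero.1 h3 with h4 | h4
    · nlinarith [norm_nonneg x]
    · exact h4
  have hsurj := LinearMap.surjective_of_injective hinj
  obtain ⟨q, hq⟩ := hsurj ⟨lap p, by
    rw [MvPolynomial.mem_restrictTotalDegree]
    have := deg_lap p
    omega⟩
  have hq' : lap (ζ * q.1) = lap p := congrArg Subtype.val hq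
  refine ⟨p - ζ * q.1, by rw [lap_sub, hq', sub_self], fun x hx => ?_⟩
  rw [ev_sub, ev_mul, hζ, ev_sub, ev_C, ev_nsqP, sub_zero, hx]; ring

def hC (n : ℕ) : ℝ := 8 * (2 * n + 12)

theorem hC_pos : 0 < hC n := by unfold hC; positivity

theorem bern8 (hn : n ≠ 0) {h : MPo n} (hh : lap h = 0) {ρ M : ℝ}
    (hM : ∀ x, ‖x‖ ≤ ρ → |ev h x| ≤ M) (i : Fin n) :
    ∀ x, ‖x‖ ≤ ρ - 1 / 8 → |ev (pd i h) x| ≤ hC n * M := by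
  intro x hx
  have := bern hn hh (x0 := x) (r := 1 / 8) (M := M) (by norm_num) (fun y hy => hM y (by
    have := norm_add_le (y - x) x
    rw [sub_add_cancel] at this
    linarith)) i
  refine this.trans (le_of_eq ?_)
  unfold hC; ring

theorem lap_pd0 {h : MPo n} (hh : lap h = 0) (i : Fin n) : lap (pd i h) = 0 := by
  rw [lap_pd, hh]; simp [pd]

theorem coord_le (v : Euc n) (i : Fin n) : |v i| ≤ ‖v‖ := by
  have := PiLp.norm_apply_le v i
  simpa using this

theorem taylor_1d {φ φ1 φ2 : ℝ → ℝ} {B : ℝ} (h1 : ∀ t, HasDerivAt φ (φ1 t) t) (h2 : ∀ t, HasDerivAt φ1 (φ2 t) t)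
    (hB : ∀ t ∈ Set.Icc (0 : ℝ) 1, |φ2 t - φ2 0| ≤ B) : |φ 1 - φ 0 - φ1 0 - φ2 0 / 2| ≤ B := by
  have hB0 : 0 ≤ B := (abs_nonneg _).trans (hB 0 (by simp))
  have a1 : ∀ t ∈ Set.Icc (0 : ℝ) 1, |φ1 t - φ1 0 - t * φ2 0| ≤ B := by
    intro t ht
    have := norm_image_sub_le_of_norm_deriv_le_segment' (f := fun s => φ1 s - s * φ2 0) (f' := fun s => φ2 s - 1 * φ2 0) (C := B) (a := 0) (b := 1)
      (fun s _ => ((h2 s).sub ((hasDerivAt_id s).mul_const (φ2 0))).hasDerivWithinAt)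
      (fun s hs => by rw [one_mul]; exact hB s (Set.Ico_subset_Icc_self hs)) t ht
    simp only [zero_mul, sub_zero, Real.norm_eq_abs] at this
    rw [show φ1 t - φ1 0 - t * φ2 0 = φ1 t - t * φ2 0 - φ1 0 by ring]
    exact this.trans (mul_le_of_le_one_right hB0 ht.2)
  have := norm_image_sub_le_of_norm_deriv_le_segment_01' (f := fun s => φ s - s * φ1 0 - s ^ 2 * (φ2 0 / 2)) (f' := fun s => φ1 s - 1 * φ1 0 - (2 : ℕ) * s ^ (2 - 1) * (φ2 0 / 2)) (C := B)
      (fun s _ => (((h1 s).sub ((hasDerivAt_id s).mul_const (φ1 0))).sub ((hasDerivAt_pow 2 s).mul_const _)).hasDerivWithinAt)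
      (fun s hs => by
        have := a1 s (Set.Ico_subset_Icc_self hs)
        rw [Real.norm_eq_abs, show φ1 s - 1 * φ1 0 - (2 : ℕ) * s ^ (2 - 1) * (φ2 0 / 2) = φ1 s - φ1 0 - s * φ2 0 by push_cast; ring]
        exact this)
  rw [Real.norm_eq_abs] at this
  rw [show φ 1 - φ 0 - φ1 0 - φ2 0 / 2 = φ 1 - 1 * φ1 0 - 1 ^ 2 * (φ2 0 / 2) - (φ 0 - 0 * φ1 0 - 0 ^ 2 * (φ2 0 / 2)) by ring]
  exact this

theorem qf_ent_le {H : Mat n} {B : ℝ} (hB : ∀ i j, |H i j| ≤ B) (v : Euc n) : |qf H v| ≤ n ^ 2 * B * ‖v‖ ^ 2 := by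
  rw [qf_eq_sum]
  have : ∀ i j, |v i * v j * H i j| ≤ ‖v‖ * ‖v‖ * B := fun i j => by
    rw [abs_mul, abs_mul]
    exact mul_le_mul (mul_le_mul (coord_le v i) (coord_le v j) (abs_nonneg _) (norm_nonneg _)) (hB i j) (abs_nonneg _) (by positivity)
  calc _ ≤ ∑ i : Fin n, ∑ j : Fin n, |v i * v j * H i j| :=
        (Finset.abs_sum_le_sum_abs _ _).trans (Finset.sum_le_sum fun i _ => Finset.abs_sum_le_sum_abs _ _)
    _ ≤ ∑ i : Fin n, ∑ j : Fin n, ‖v‖ * ‖v‖ * B := Finset.sum_le_sum fun i _ => Finset.sum_le_sum fun j _ => this i j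
    _ = _ := by simp; ring

theorem harm_taylor (hn : n ≠ 0) {h : MPo n} (hh : lap h = 0) {M : ℝ} (hM : ∀ x : Euc n, ‖x‖ ≤ 1 / 2 → |ev h x| ≤ M) :
    (∀ v, |qf (phess h 0) v| ≤ n ^ 2 * (hC n ^ 2 * M) * ‖v‖ ^ 2) ∧
    ∀ x, ‖x‖ ≤ 1 / 8 → |ev h x - ev h 0 - ⟪pgrad h 0, x⟫ - qf (phess h 0) x / 2| ≤ n ^ 3 * (hC n ^ 3 * M) * ‖x‖ ^ 3 := by
  have hM0 : 0 ≤ M := (abs_nonneg _).trans (hM 0 (by simp))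
  have hc := hC_pos (n := n)
  have b1 : ∀ i, ∀ x, ‖x‖ ≤ 3 / 8 → |ev (pd i h) x| ≤ hC n * M := fun i x hx =>
    bern8 hn hh hM i x (by linarith)
  have b2 : ∀ i j, ∀ x, ‖x‖ ≤ 2 / 8 → |ev (pd i (pd j h)) x| ≤ hC n * (hC n * M) := fun i j x hx =>
    bern8 hn (lap_pd0 hh j) (b1 j) i x (by linarith)
  have b3 : ∀ i j k, ∀ x, ‖x‖ ≤ 1 / 8 → |ev (pd k (pd i (pd j h))) x| ≤ hC n * (hC n * (hC n * M)) := fun i j k x hx =>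
    bern8 hn (lap_pd0 (lap_pd0 hh j) i) (b2 i j) k x (by linarith)
  refine ⟨fun v => qf_ent_le (fun i j => ?_) v, fun x hx => ?_⟩
  · have := b2 j i 0 (by rw [norm_zero]; norm_num)
    have e : hC n ^ 2 * M = hC n * (hC n * M) := by ring
    rw [e]; exact this
  · have ent : ∀ t ∈ Set.Icc (0 : ℝ) 1, ∀ i j, |phess h (0 + t • x) i j - phess h (0 + (0 : ℝ) • x) i j| ≤ n * (‖x‖ * (hC n * (hC n * (hC n * M)))) := by
      intro t ht i j
      have := norm_image_sub_le_of_norm_deriv_le_segment' (f := fun s => ev (pd j (pd i h)) (0 + s • x)) (f' := fun s => ∑ k, x k * ev (pd k (pd j (pd i h))) (0 + s • x)) (C := n * (‖x‖ * (hC n * (hC n * (hC n * M))))) (a := 0) (b := 1)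
        (fun s _ => (ev_hasDeriv _ _ _ _).hasDerivWithinAt) (fun s hs => by
          have hsx : ‖(0 : Euc n) + s • x‖ ≤ 1 / 8 := by
            rw [zero_add, norm_smul, Real.norm_of_nonneg hs.1]
            exact (mul_le_of_le_one_left (norm_nonneg _) hs.2.le).trans hx
          refine (Finset.abs_sum_le_sum_abs _ _).trans ?_
          refine (Finset.sum_le_card_nsmul _ _ (‖x‖ * (hC n * (hC n * (hC n * M)))) fun k _ => ?_).trans (by simp)
          rw [abs_mul]
          exact mul_le_mul (coord_le x k) (b3 j i k _ hsx) (abs_nonneg _) (norm_nonneg _)) t ht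
      refine le_trans (show _ ≤ _ from this) ?_
      rw [sub_zero]
      exact mul_le_of_le_one_right (by positivity) ht.2
    have := taylor_1d (φ := fun t => ev h (0 + t • x)) (φ1 := fun s => ∑ i, x i * ev (pd i h) (0 + s • x)) (φ2 := fun s => qf (phess h (0 + s • x)) x)
      (B := n ^ 2 * (n * (‖x‖ * (hC n * (hC n * (hC n * M))))) * ‖x‖ ^ 2)
      (fun t => ev_hasDeriv h 0 x t) (fun t => ev_hasDeriv2 h 0 x t) (fun t ht => by
        rw [← qf_sub]; exact qf_ent_le (fun i j => ent t ht i j) x)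
    simp only [zero_smul, add_zero, zero_add, one_smul] at this
    rw [pgrad_inner]
    refine this.trans (le_of_eq ?_); ring
theorem stone_w {W : Euc n → ℝ} {r κ : ℝ} (hκ : 0 < κ) (hW : ContinuousOn W (closedBall 0 r)) :
    ∃ p : MPo n, ∀ x ∈ closedBall (0 : Euc n) r, |ev p x - W x| ≤ κ := by
  set S := closedBall (0 : Euc n) r with hS
  haveI : CompactSpace S := isCompact_iff_compactSpace.1 (isCompact_closedBall 0 r)
  let c : Fin n → C(S, ℝ) := fun i => ⟨fun x => x.1 i, by fun_prop⟩
  let Φ : MPo n →ₐ[ℝ] C(S, ℝ) := MvPolynomial.aeval c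
  have hΦ : ∀ p (x : S), Φ p x = ev p x.1 := by
    intro p x
    induction p using MvPolynomial.induction_on with
    | C a => rw [ev_C]; simp [Φ]
    | add p q hp hq => rw [map_add, ev_add, ContinuousMap.add_apply, hp, hq]
    | mul_X p i hp => rw [map_mul, ev_mul, ContinuousMap.mul_apply, hp, ev_X]; simp [Φ, c]
  have hd := ContinuousMap.subalgebra_topologicalClosure_eq_top_of_separatesPoints Φ.range (by
    intro x y hxy
    have : ∃ i, x.1 i ≠ y.1 i := by
      by_contra hc
      push Not at hc
      exact hxy (Subtype.ext (by ext i; exact hc i))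
    obtain ⟨i, hi⟩ := this
    refine ⟨c i, ⟨c i, ⟨MvPolynomial.X i, by simp [Φ]⟩, rfl⟩, hi⟩)
  let w : C(S, ℝ) := ⟨fun x => W x.1, continuousOn_iff_continuous_restrict.1 hW⟩
  have hw : w ∈ Φ.range.topologicalClosure := by rw [hd]; trivial
  obtain ⟨q, hq, hqd⟩ := Metric.mem_closure_iff.1 hw κ hκ
  obtain ⟨p, rfl⟩ := hq
  refine ⟨p, fun x hx => ?_⟩
  have h1 := (ContinuousMap.dist_apply_le_dist (f := w) (g := Φ p) ⟨x, hx⟩).trans hqd.le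
  rw [Real.dist_eq, abs_sub_comm] at h1
  have h2 := hΦ p ⟨x, hx⟩
  rw [h2] at h1
  exact h1

/-- almost Lipschitz class -/
structure ALip (K σ : ℝ) (W : Euc n → ℝ) : Prop where
  cont : ContinuousOn W (closedBall 0 (1 / 2))
  bdd : ∀ x ∈ closedBall (0 : Euc n) (1 / 2), |W x| ≤ 2
  lip : ∀ x ∈ closedBall (0 : Euc n) (1 / 2), ∀ y ∈ closedBall (0 : Euc n) (1 / 2), W x - W y ≤ K * ‖x - y‖ + σ

theorem alip_finite {K σ : ℝ} (hK : 0 < K) (hσ : 0 < σ) :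
    ∃ S : Set (MPo n), S.Finite ∧ ∀ W : Euc n → ℝ, ALip K σ W → ∃ p ∈ S, ∀ x ∈ closedBall (0 : Euc n) (1 / 2), |ev p x - W x| ≤ 6 * σ := by
  obtain ⟨t, htS, htf, ht⟩ := _root_.finite_cover_balls_of_compact (isCompact_closedBall (0 : Euc n) (1 / 2)) (e := σ / K) (by positivity)
  haveI : Finite t := htf
  haveI : Fintype t := Fintype.ofFinite t
  let pat : (Euc n → ℝ) → (t → ℤ) := fun W z => ⌊W z.1 / σ⌋
  have key : ∀ g : t → ℤ, ∃ p : MPo n, ∀ W, ALip K σ W → pat W = g → ∀ x ∈ closedBall (0 : Euc n) (1 / 2), |ev p x - W x| ≤ 6 * σ := by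
    intro g
    by_cases hg : ∃ W, ALip K σ W ∧ pat W = g
    · obtain ⟨V, hV, hVg⟩ := hg
      obtain ⟨p, hp⟩ := stone_w hσ hV.cont
      refine ⟨p, fun W hW hWg x hx => ?_⟩
      have hx' := ht hx
      simp only [Set.mem_iUnion, mem_ball, exists_prop] at hx'
      obtain ⟨z, hz, hxz⟩ := hx'
      have hzB := htS hz
      have e1 : ⌊W z / σ⌋ = ⌊V z / σ⌋ := congrFun (hWg.trans hVg.symm) ⟨z, hz⟩
      have e2 := Int.abs_sub_lt_one_of_floor_eq_floor e1
      rw [← sub_div, abs_div, abs_of_pos hσ, div_lt_one hσ, abs_lt] at e2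
      have d1 : K * ‖x - z‖ ≤ σ := by
        rw [dist_eq_norm, lt_div_iff₀ hK] at hxz; linarith
      have d2 : K * ‖z - x‖ ≤ σ := by rw [norm_sub_rev]; exact d1
      have a1 := hW.lip x hx z hzB
      have a2 := hW.lip z hzB x hx
      have a3 := hV.lip x hx z hzB
      have a4 := hV.lip z hzB x hx
      have a5 := abs_le.1 (hp x hx)
      rw [abs_le]; constructor <;> linarith
    · exact ⟨0, fun W hW hWg => absurd ⟨W, hW, hWg⟩ hg⟩
  choose P hP using key
  refine ⟨P '' Set.Icc (fun _ => ⌊-2 / σ⌋) (fun _ => ⌊2 / σ⌋), (Set.finite_Icc _ _).image _, fun W hW => ?_⟩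
  refine ⟨P (pat W), ⟨pat W, ⟨fun z => ?_, fun z => ?_⟩, rfl⟩, hP _ W hW rfl⟩
  · have := (abs_le.1 (hW.bdd z.1 (htS z.2))).1
    exact Int.floor_mono (by gcongr)
  · have := (abs_le.1 (hW.bdd z.1 (htS z.2))).2
    exact Int.floor_mono (by gcongr)

theorem phess_bdd (h : MPo n) (r : ℝ) : ∃ B : ℝ, ∀ x ∈ closedBall (0 : Euc n) r, ∀ v, |qf (phess h x) v| ≤ B * ‖v‖ ^ 2 := by
  have : ∀ i j, ∃ b, ∀ x ∈ closedBall (0 : Euc n) r, |phess h x i j| ≤ b := fun i j => by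
    obtain ⟨b, hb⟩ := (isCompact_closedBall (0 : Euc n) r).exists_bound_of_continuousOn (f := fun x => ev (pd j (pd i h)) x) (ev_cont _).continuousOn
    exact ⟨b, hb⟩
  choose b hb using this
  refine ⟨n ^ 2 * ∑ i, ∑ j, |b i j|, fun x hx v => qf_ent_le (fun i j => ?_) v⟩
  refine (hb i j x hx).trans ((le_abs_self _).trans ?_)
  exact (Finset.single_le_sum (f := fun j => |b i j|) (fun _ _ => abs_nonneg _) (Finset.mem_univ j)).trans
    (Finset.single_le_sum (f := fun i => ∑ j, |b i j|) (fun _ _ => Finset.sum_nonneg fun _ _ => abs_nonneg _) (Finset.mem_univ i))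

theorem harm_approx (hn : n ≠ 0) {K σ : ℝ} (hK : 0 < K) (hσ : 0 < σ) :
    ∃ B : ℝ, 0 ≤ B ∧ ∀ W : Euc n → ℝ, ALip K σ W → ∃ h : MPo n, lap h = 0 ∧
      (∀ x, ‖x‖ = 1 / 2 → |ev h x - W x| ≤ 6 * σ) ∧
      ∀ x, ‖x‖ ≤ 1 / 2 → ∀ v, |qf (phess h x) v| ≤ B * ‖v‖ ^ 2 := by
  obtain ⟨S, hS, hSW⟩ := alip_finite (n := n) hK hσ
  choose h hh1 hh2 using fun p : MPo n => harm_repl hn p (r := 1 / 2) (by norm_num)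
  choose b hb using fun p : MPo n => phess_bdd (h p) (1 / 2)
  obtain ⟨B, hB⟩ := (hS.image b).bddAbove
  refine ⟨max B 0, le_max_right _ _, fun W hW => ?_⟩
  obtain ⟨p, hp, hpW⟩ := hSW W hW
  refine ⟨h p, hh1 p, fun x hx => ?_, fun x hx v => ?_⟩
  · rw [hh2 p x hx]; exact hpW x (by simp [hx])
  · refine (hb p x (by simpa using hx) v).trans ?_
    have := hB ⟨p, hp, rfl⟩
    exact mulR (this.trans (le_max_left _ _)) (by positivity)
theorem exp_le_one_add {x : ℝ} (hx : |x| ≤ 1 / 2) : Real.exp (x - 2 * x ^ 2) ≤ 1 + x := by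
  have h := abs_le.1 hx
  have hp : 0 < 1 + x := by linarith
  rw [← Real.le_log_iff_exp_le hp]
  refine le_trans ?_ (Real.one_sub_inv_le_log_of_pos hp)
  rw [show 1 - (1 + x)⁻¹ = x / (1 + x) by field_simp; ring, le_div_iff₀ hp]
  nlinarith [sq_nonneg x]

theorem one_add_spec {N U : Mat n} {d : Fin n → ℝ} (h2 : U * Uᵀ = 1) (hN : N = U * diagonal d * Uᵀ) :
    1 + N = U * diagonal (fun i => 1 + d i) * Uᵀ := by
  have : diagonal (fun i => 1 + d i) = (1 : Mat n) + diagonal d := by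
    rw [← diagonal_one, diagonal_add]
  rw [this, Matrix.mul_add, Matrix.add_mul, Matrix.mul_one, h2, hN]

theorem det_lower {N : Mat n} (hN : Nᵀ = N) {b : ℝ} (hb : b ≤ 1 / 2) (h : ∀ v : Euc n, |qf N v| ≤ b * ‖v‖ ^ 2) :
    Real.exp (N.trace - 2 * n * b ^ 2) ≤ (1 + N).det := by
  obtain ⟨U, d, h1, h2, hd⟩ := spec hN
  have hdb : ∀ i, |d i| ≤ b := fun i => by
    obtain ⟨v, hv1, hv⟩ := spec_bounds h1 hd i
    have := h v
    rw [hv, hv1] at this; simpa using this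
  rw [det_spec h1 (one_add_spec h2 hd)]
  have ht : N.trace = ∑ i, d i := by
    rw [hd, trace_mul_comm, ← Matrix.mul_assoc, h1, Matrix.one_mul, trace_diagonal]
  have hsum : N.trace - 2 * n * b ^ 2 ≤ ∑ i, (d i - 2 * d i ^ 2) := by
    rw [Finset.sum_sub_distrib, ht]
    have : ∑ i, 2 * d i ^ 2 ≤ ∑ i : Fin n, 2 * b ^ 2 := Finset.sum_le_sum fun i _ => by
      have := pow_le_pow_left₀ (abs_nonneg _) (hdb i) 2
      rw [sq_abs] at this; linarith
    simp at this
    linarith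
  refine (Real.exp_le_exp.2 hsum).trans ?_
  rw [Real.exp_sum]
  exact Finset.prod_le_prod (fun i _ => (Real.exp_pos _).le) fun i _ => exp_le_one_add ((hdb i).trans hb)

theorem one_add_pd {N : Mat n} (hN : Nᵀ = N) {b : ℝ} (hb : b ≤ 1 / 2) (h : ∀ v : Euc n, |qf N v| ≤ b * ‖v‖ ^ 2) :
    (1 + N).PosDef := by
  refine posDef_of_lower (m := 1 / 2) (by simp [hN]) (by norm_num) fun v => ?_
  rw [qf_add, qf_one]
  have := (abs_le.1 (h v)).1
  have h2 := mulR hb (sq_nonneg ‖v‖)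
  linarith

theorem harm_upper (hn : n ≠ 0) {u f : Euc n → ℝ} {δ σ : ℝ} (hδ : 0 < δ) (hσ : 0 < σ)
    (hs : Sol (ball 0 1) u f) (hf : ∀ x ∈ ball (0 : Euc n) 1, |f x - 1| ≤ σ / 2 * δ)
    {h : MPo n} (hh : lap h = 0) (hsph : ∀ x : Euc n, ‖x‖ = 1 / 2 → |ev h x - (u x - ‖x‖ ^ 2 / 2) / δ| ≤ 6 * σ) :
    ∀ x : Euc n, ‖x‖ ≤ 1 / 2 → u x - ‖x‖ ^ 2 / 2 ≤ δ * (ev h x + 7 * σ) := by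
  have hsub : closedBall (0 : Euc n) (1 / 2) ⊆ ball 0 1 := closedBall_subset_ball (by norm_num)
  set b : Euc n → ℝ := fun x => δ * ev h x + (1 / 2 - σ * δ) * ‖x‖ ^ 2 with hb
  have hbc : Continuous b := ((ev_cont h).const_mul δ).add (continuous_const.mul (continuous_norm.pow 2))
  obtain ⟨p, hp, hpm⟩ := (isCompact_closedBall (0 : Euc n) (1 / 2)).exists_isMaxOn ⟨0, by simp⟩
    ((hs.cont.mono hsub).sub hbc.continuousOn)
  rw [isMaxOn_iff] at hpm
  have hbpea : ∀ q : Euc n, Pea b q (δ • pgrad h q + (1 - 2 * σ * δ) • (q - 0)) (δ • phess h q + (1 - 2 * σ * δ) • 1) := by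
    intro q
    refine (((poly_pea h q).const_mul δ).add (Pea_normsq 0 q (1 - 2 * σ * δ))).congr' (Eventually.of_forall fun x => ?_)
    simp only [hb, sub_zero]; ring
  by_cases hpi : ‖p‖ < 1 / 2
  · exfalso
    have hpb : p ∈ ball (0 : Euc n) (1 / 2) := by simpa using hpi
    obtain ⟨H, h1, h2, h3⟩ := hs.touch' (hsub hp) (b := b) (by
      filter_upwards [isOpen_ball.mem_nhds hpb] with x hx
      exact hpm x (ball_subset_closedBall hx))
    have h4 : ∀ v, qf H v ≤ qf (δ • phess h p + (1 - 2 * σ * δ) • 1) v := fun v => h3 v _ _ (hbpea p v)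
    have h5 := trace_mul_mono (PosSemidef.one (n := Fin n) (R := ℝ)) h4
    have hfp := (abs_le.1 (hf p (hsub hp))).1
    have h6 := amgm_pd h1 (hs.fpos p (hsub hp)) h2
    rw [Matrix.one_mul, Matrix.one_mul, trace_add, trace_smul, trace_smul, phess_trace, hh, ev_zero, trace_one] at h5
    simp only [smul_eq_mul, mul_zero, zero_add, Fintype.card_fin] at h5
    have hn1 : (0 : ℝ) < n := by exact_mod_cast Nat.pos_of_ne_zero hn
    have h7 : (n : ℝ) * f p ≤ n * (1 - 2 * σ * δ) := by linarith
    have h8 := le_of_mul_le_mul_left h7 hn1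
    have := mul_pos hσ hδ
    linarith
  · intro x hx
    have hp' : ‖p‖ = 1 / 2 := le_antisymm (by simpa using hp) (not_lt.1 hpi)
    have h1 := hpm x (by simpa using hx)
    have h2 := (abs_le.1 (hsph p hp')).1
    simp only [hb, Pi.sub_apply] at h1
    have h3 : (u p - ‖p‖ ^ 2 / 2) ≤ δ * (ev h p + 6 * σ) := by
      have : (u p - ‖p‖ ^ 2 / 2) / δ ≤ ev h p + 6 * σ := by linarith
      rw [div_le_iff₀ hδ] at this; linarith
    have h4 : 0 ≤ σ * δ * ‖x‖ ^ 2 := by positivity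
    rw [hp'] at h1 h3
    have := mul_pos hσ hδ
    linarith

theorem harm_lower (hn : n ≠ 0) {u f : Euc n → ℝ} {δ σ B : ℝ} (hδ : 0 < δ) (hσ : 0 < σ) (hB : 0 ≤ B)
    (hδB : δ * (B + 2 * σ) ≤ 1 / 2) (hδB2 : δ * (B + 2 * σ) ^ 2 ≤ σ / 2)
    (hs : Sol (ball 0 1) u f) (hf : ∀ x ∈ ball (0 : Euc n) 1, |f x - 1| ≤ σ / 2 * δ)
    {h : MPo n} (hh : lap h = 0) (hsph : ∀ x : Euc n, ‖x‖ = 1 / 2 → |ev h x - (u x - ‖x‖ ^ 2 / 2) / δ| ≤ 6 * σ)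
    (hBh : ∀ x : Euc n, ‖x‖ ≤ 1 / 2 → ∀ v, |qf (phess h x) v| ≤ B * ‖v‖ ^ 2) :
    ∀ x : Euc n, ‖x‖ ≤ 1 / 2 → δ * (ev h x - 7 * σ) ≤ u x - ‖x‖ ^ 2 / 2 := by
  have hsub : closedBall (0 : Euc n) (1 / 2) ⊆ ball 0 1 := closedBall_subset_ball (by norm_num)
  set b : Euc n → ℝ := fun x => δ * ev h x + (1 / 2 + σ * δ) * ‖x‖ ^ 2 with hb
  have hbc : Continuous b := ((ev_cont h).const_mul δ).add (continuous_const.mul (continuous_norm.pow 2))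
  obtain ⟨p, hp, hpm⟩ := (isCompact_closedBall (0 : Euc n) (1 / 2)).exists_isMinOn ⟨0, by simp⟩
    ((hs.cont.mono hsub).sub hbc.continuousOn)
  rw [isMinOn_iff] at hpm
  have hbpea : ∀ q : Euc n, Pea b q (δ • pgrad h q + (1 + 2 * σ * δ) • (q - 0)) (δ • phess h q + (1 + 2 * σ * δ) • 1) := by
    intro q
    refine (((poly_pea h q).const_mul δ).add (Pea_normsq 0 q (1 + 2 * σ * δ))).congr' (Eventually.of_forall fun x => ?_)
    simp only [hb, sub_zero]; ring
  by_cases hpi : ‖p‖ < 1 / 2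
  · exfalso
    have hpb : p ∈ ball (0 : Euc n) (1 / 2) := by simpa using hpi
    obtain ⟨H, h1, h2, h3⟩ := hs.touch (hsub hp) (b := b) (by
      filter_upwards [isOpen_ball.mem_nhds hpb] with x hx
      exact hpm x (ball_subset_closedBall hx))
    set N : Mat n := δ • phess h p + (2 * σ * δ) • 1 with hN
    have hNs : Nᵀ = N := by simp [hN, phess_symm]
    have hNb : ∀ v : Euc n, |qf N v| ≤ δ * (B + 2 * σ) * ‖v‖ ^ 2 := fun v => by
      have h9 := mulL (hBh p hpi.le v) hδ.le
      rw [hN, qf_add, qf_smul, qf_smul, qf_one]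
      refine (abs_add_le _ _).trans ?_
      rw [abs_mul, abs_of_pos hδ, abs_of_nonneg (show 0 ≤ 2 * σ * δ * ‖v‖ ^ 2 by positivity)]
      linarith
    have h4 : ∀ v, qf (1 + N) v ≤ qf H v := fun v => by
      have := h3 v _ _ (hbpea p v)
      refine le_trans (le_of_eq ?_) this
      rw [hN, qf_add, qf_add, qf_add, qf_smul, qf_smul, qf_smul, qf_one]; ring
    have h5 := det_mono (one_add_pd hNs hδB hNb) h1 h4
    have h6 := (det_lower hNs hδB hNb).trans h5
    have htr : N.trace = 2 * σ * δ * n := by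
      rw [hN, trace_add, trace_smul, trace_smul, phess_trace, hh, ev_zero, trace_one]; simp
    have hfp := (abs_le.1 (hf p (hsub hp))).2
    have h7 : f p ^ n ≤ Real.exp (n * (σ / 2 * δ)) := by
      rw [mul_comm, Real.exp_mul, Real.rpow_natCast]
      refine pow_le_pow_left₀ (hs.fpos p (hsub hp)).le ?_ n
      have := Real.add_one_le_exp (σ / 2 * δ); linarith
    rw [h2] at h6
    have h8 := Real.exp_le_exp.1 (h6.trans h7)
    rw [htr] at h8
    have hn1 : (0 : ℝ) < n := by exact_mod_cast Nat.pos_of_ne_zero hn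
    have h9 : (n : ℝ) * (2 * σ * δ - 2 * (δ * (B + 2 * σ)) ^ 2) ≤ n * (σ / 2 * δ) := by linarith
    have h10 := le_of_mul_le_mul_left h9 hn1
    have h11 := mulL hδB2 hδ.le
    have := mul_pos hσ hδ
    nlinarith
  · intro x hx
    have hp' : ‖p‖ = 1 / 2 := le_antisymm (by simpa using hp) (not_lt.1 hpi)
    have h1 := hpm x (by simpa using hx)
    have h2 := (abs_le.1 (hsph p hp')).2
    simp only [hb, Pi.sub_apply] at h1
    have h3 : δ * (ev h p - 6 * σ) ≤ (u p - ‖p‖ ^ 2 / 2) := by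
      have : ev h p - 6 * σ ≤ (u p - ‖p‖ ^ 2 / 2) / δ := by linarith
      rw [le_div_iff₀ hδ] at this; linarith
    have h4 : 0 ≤ σ * δ * ‖x‖ ^ 2 := by positivity
    rw [hp'] at h1 h3
    have := mul_pos hσ hδ
    linarith

theorem det_norm (hn : n ≠ 0) {H : Mat n} (hH : Hᵀ = H) (htr : H.trace = 0) {b δ : ℝ} (hδ : 0 < δ) (hb : 0 ≤ b)
    (hbH : ∀ v : Euc n, |qf H v| ≤ b * ‖v‖ ^ 2) (h1 : δ * b ≤ 1 / 2) (h2 : 8 * δ * b ^ 2 ≤ 1) (hδ1 : δ ≤ 1) :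
    ∃ M : Mat n, M.PosDef ∧ M.det = 1 ∧ (∀ v : Euc n, |qf M v - (‖v‖ ^ 2 + δ * qf H v)| ≤ 8 * δ ^ 2 * b ^ 2 * ‖v‖ ^ 2) := by
  have hs : (δ • H)ᵀ = δ • H := by simp [hH]
  have hb' : ∀ v : Euc n, |qf (δ • H) v| ≤ δ * b * ‖v‖ ^ 2 := fun v => by
    rw [qf_smul, abs_mul, abs_of_pos hδ, mul_assoc]
    exact mulL (hbH v) hδ.le
  have hpd := one_add_pd hs h1 hb'
  have hdl := det_lower hs h1 hb'
  obtain ⟨c, hc, hcd⟩ := exists_root hn hpd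
  have hn1 : (0 : ℝ) < n := by exact_mod_cast Nat.pos_of_ne_zero hn
  have hc1 : c ≤ 1 := by
    have := amgm_pd hpd hc hcd
    rw [trace_add, trace_one, trace_smul, htr] at this
    simp at this
    rw [← mul_one (n : ℝ)] at this
    exact le_of_mul_le_mul_left (by simpa using this) hn1
  have hc2 : 1 - 2 * (δ * b) ^ 2 ≤ c := by
    rw [trace_smul, htr, smul_zero, hcd] at hdl
    have h3 : Real.exp (-(2 * (δ * b) ^ 2)) ^ n ≤ c ^ n := by
      rw [← Real.rpow_natCast, ← Real.exp_mul]
      refine le_trans (le_of_eq ?_) hdl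
      congr 1; ring
    have h4 := le_of_pow_le_pow_left₀ hn hc.le h3
    have := Real.add_one_le_exp (-(2 * (δ * b) ^ 2))
    linarith
  have hci : c⁻¹ - 1 ≤ 4 * (δ * b) ^ 2 := by
    have h5 : (δ * b) ^ 2 ≤ 1 / 8 := by nlinarith [mul_nonneg hδ.le hb]
    rw [sub_le_iff_le_add, inv_le_comm₀ hc (by positivity), inv_le_iff_one_le_mul₀ (by positivity)]
    nlinarith [sq_nonneg (δ * b)]
  have hci0 : 1 ≤ c⁻¹ := (one_le_inv₀ hc).2 hc1
  refine ⟨c⁻¹ • (1 + δ • H), ?_, ?_, fun v => ?_⟩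
  · exact hpd.smul (inv_pos.2 hc)
  · rw [det_smul, hcd, Fintype.card_fin, inv_pow, inv_mul_cancel₀ (by positivity)]
  · rw [qf_smul, qf_add, qf_one, qf_smul, show c⁻¹ * (‖v‖ ^ 2 + δ * qf H v) - (‖v‖ ^ 2 + δ * qf H v) = (c⁻¹ - 1) * (‖v‖ ^ 2 + δ * qf H v) by ring, abs_mul,
      abs_of_nonneg (by linarith : 0 ≤ c⁻¹ - 1)]
    have h6 : |‖v‖ ^ 2 + δ * qf H v| ≤ 2 * ‖v‖ ^ 2 := by
      have h7 := hb' v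
      rw [qf_smul] at h7
      have h8 := mulR h1 (sq_nonneg ‖v‖)
      have h9 := abs_le.1 h7
      have h10 := sq_nonneg ‖v‖
      rw [abs_le]; constructor <;> linarith
    refine (mul_le_mul hci h6 (abs_nonneg _) (by positivity)).trans (le_of_eq (by ring))

set_option maxHeartbeats 800000 in
theorem improve (hn : n ≠ 0) : ∃ ε0 δ0 μ C : ℝ, 0 < ε0 ∧ ε0 ≤ 1 ∧ 0 < δ0 ∧ δ0 ≤ 1 ∧ 0 < μ ∧ μ ≤ 1 / 16 ∧ 0 < C ∧ C * δ0 ≤ 1 / 4 ∧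
    ∀ (u f : Euc n → ℝ) (δ : ℝ), 0 < δ → δ ≤ δ0 → Sol (ball 0 1) u f →
      (∀ x ∈ ball (0 : Euc n) 1, |u x - ‖x‖ ^ 2 / 2| ≤ δ) →
      (∀ x ∈ ball (0 : Euc n) 1, |f x - 1| ≤ ε0 * δ) →
      ∃ M : Mat n, M.PosDef ∧ M.det = 1 ∧ (∀ v : Euc n, |qf M v - ‖v‖ ^ 2| ≤ C * δ * ‖v‖ ^ 2) ∧
        ∃ (q : Euc n) (k : ℝ), ∀ x ∈ ball (0 : Euc n) (2 * μ), |u x - (⟪q, x⟫ + k) - qf M x / 2| ≤ δ / 2 * μ ^ 2 := by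
  have hn1 : (1 : ℝ) ≤ n := by exact_mod_cast Nat.one_le_iff_ne_zero.2 hn
  have hc96 : (1 : ℝ) ≤ hC n := by unfold hC; linarith
  set b : ℝ := n ^ 2 * (hC n ^ 2 * 2) with hb
  set C3 : ℝ := n ^ 3 * (hC n ^ 3 * 2) with hC3
  have hb0 : 0 < b := by positivity
  have hC31 : 1 ≤ C3 := by
    have h1 : (1 : ℝ) ≤ n ^ 3 := one_le_pow₀ hn1
    have h2 : (1 : ℝ) ≤ hC n ^ 3 := one_le_pow₀ hc96
    rw [hC3]; nlinarith
  set μ : ℝ := 1 / (64 * C3) with hμ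
  have hμ0 : 0 < μ := by positivity
  have hμC : μ * C3 = 1 / 64 := by rw [hμ]; field_simp
  have hμ1 : μ ≤ 1 / 64 := by nlinarith
  set σ : ℝ := μ ^ 2 / 56 with hσ
  have hσ0 : 0 < σ := by positivity
  have hσ1 : σ ≤ 1 / 7 := by rw [hσ]; nlinarith
  obtain ⟨δI, hδI, hI⟩ := ishii hn σ hσ0 (by linarith)
  obtain ⟨B, hB0, hBW⟩ := harm_approx hn (K := 388 * n) (by positivity) hσ0
  set T : ℝ := 1 + B + 2 * σ + b with hT
  have hT1 : 1 ≤ T := by rw [hT]; linarith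
  set δ0 : ℝ := min δI (σ / (64 * T ^ 2)) with hδ0
  have hδ0p : 0 < δ0 := lt_min hδI (by positivity)
  have hδ0T : ∀ δ, 0 < δ → δ ≤ δ0 → δ * T ^ 2 ≤ σ / 64 := fun δ h0 h => by
    have := h.trans (min_le_right _ _)
    rw [le_div_iff₀ (by positivity)] at this
    linarith
  have hTs : T ≤ T ^ 2 := by nlinarith
  have hδT : ∀ δ, 0 < δ → δ ≤ δ0 → δ * T ≤ σ / 64 := fun δ h0 h =>
    (mulL hTs h0.le).trans (hδ0T δ h0 h)
  have hδ1 : ∀ δ, 0 < δ → δ ≤ δ0 → δ ≤ 1 / 64 := fun δ h0 h => by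
    have := mulL hT1 h0.le
    have := hδT δ h0 h
    linarith
  refine ⟨σ / 2, δ0, μ, b + 1, by positivity, by linarith, hδ0p, (hδ1 δ0 hδ0p le_rfl).trans (by norm_num), hμ0, hμ1.trans (by norm_num), by positivity, ?_, ?_⟩
  · have h1 := hδT δ0 hδ0p le_rfl
    have h2 : (b + 1) * δ0 ≤ T * δ0 := mulR (by rw [hT]; linarith) hδ0p.le
    linarith
  intro u f δ hδ hδδ hs hu hf
  have hsub : closedBall (0 : Euc n) (1 / 2) ⊆ ball 0 1 := closedBall_subset_ball (by norm_num)
  have hT2 := hδ0T δ hδ hδδ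
  have hT3 := hδT δ hδ hδδ
  have hδ64 := hδ1 δ hδ hδδ
  have hIu := hI u f δ hδ (hδδ.trans (min_le_left _ _)) hs hu (fun x hx => (hf x hx).trans (by nlinarith))
  have hAL : ALip (388 * n) σ (fun x => (u x - ‖x‖ ^ 2 / 2) / δ) := by
    refine ⟨?_, fun x hx => ?_, fun x hx y hy => ?_⟩
    · exact ((hs.cont.mono hsub).sub (by fun_prop)).div_const δ
    · rw [abs_div, abs_of_pos hδ, div_le_iff₀ hδ]
      have := hu x (hsub hx); linarith
    · rw [← sub_div, div_le_iff₀ hδ]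
      have := hIu x hx y hy; linarith
  obtain ⟨h, hh, hsph, hBh⟩ := hBW _ hAL
  have hup := harm_upper hn hδ hσ0 hs hf hh hsph
  have hBT : B + 2 * σ ≤ T := by rw [hT]; linarith
  have hBT0 : 0 ≤ B + 2 * σ := by linarith
  have hlo := harm_lower hn hδ hσ0 hB0 (by
    have := mulL hBT hδ.le; linarith) (by
    have := mulL (pow_le_pow_left₀ hBT0 hBT 2) hδ.le; linarith) hs hf hh hsph hBh
  have hM2 : ∀ x : Euc n, ‖x‖ ≤ 1 / 2 → |ev h x| ≤ 2 := fun x hx => by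
    have h1 := hup x hx
    have h2 := hlo x hx
    have h3 := abs_le.1 (hu x (hsub (by simpa using hx)))
    rw [abs_le]; constructor
    · have : δ * (-1) ≤ δ * (ev h x + 7 * σ) := by linarith
      have := le_of_mul_le_mul_left this hδ
      linarith
    · have : δ * (ev h x - 7 * σ) ≤ δ * 1 := by linarith
      have := le_of_mul_le_mul_left this hδ
      linarith
  obtain ⟨hH2, hTay⟩ := harm_taylor hn hh hM2
  rw [← hb] at hH2
  rw [← hC3] at hTay
  have hbT : b ≤ T := by rw [hT]; linarith
  have hb2 : δ * b ^ 2 ≤ σ / 64 := (mulL (pow_le_pow_left₀ hb0.le hbT 2) hδ.le).trans hT2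
  obtain ⟨M, hMp, hMd, hMq⟩ := det_norm hn (phess_symm h 0) (by rw [phess_trace, hh, ev_zero]) hδ hb0.le hH2
    ((mulL hbT hδ.le).trans (by linarith)) (by linarith) (by linarith)
  refine ⟨M, hMp, hMd, fun v => ?_, δ • pgrad h 0, δ * ev h 0, fun x hx => ?_⟩
  · have h1 := abs_le.1 (hMq v)
    have h2 := abs_le.1 (hH2 v)
    have h3 := mulL h2.1 hδ.le
    have h4 := mulL h2.2 hδ.le
    have h5 : 8 * δ ^ 2 * b ^ 2 * ‖v‖ ^ 2 ≤ δ * ‖v‖ ^ 2 := by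
      have : 8 * δ ^ 2 * b ^ 2 * ‖v‖ ^ 2 = 8 * (δ * b ^ 2) * (δ * ‖v‖ ^ 2) := by ring
      rw [this]
      exact mul_le_of_le_one_left (by positivity) (by linarith)
    rw [abs_le]; constructor <;> linarith
  · have hx2 : ‖x‖ < 2 * μ := by simpa using hx
    have hx8 : ‖x‖ ≤ 1 / 8 := by linarith
    have h1 := hup x (by linarith)
    have h2 := hlo x (by linarith)
    have h3 := abs_le.1 (hTay x hx8)
    have h4 := abs_le.1 (hMq x)
    have hx3 : ‖x‖ ^ 3 ≤ 8 * μ ^ 3 := by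
      have := pow_le_pow_left₀ (norm_nonneg x) hx2.le 3
      linarith [show (2 * μ) ^ 3 = 8 * μ ^ 3 by ring]
    have hxx : ‖x‖ ^ 2 ≤ 4 * μ ^ 2 := by
      have := pow_le_pow_left₀ (norm_nonneg x) hx2.le 2
      linarith [show (2 * μ) ^ 2 = 4 * μ ^ 2 by ring]
    have h5 : C3 * ‖x‖ ^ 3 ≤ μ ^ 2 / 8 := by
      refine (mulL hx3 (by linarith)).trans (le_of_eq ?_)
      rw [show C3 * (8 * μ ^ 3) = 8 * μ ^ 2 * (μ * C3) by ring, hμC]; ring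
    have h6 : 8 * δ ^ 2 * b ^ 2 * ‖x‖ ^ 2 ≤ δ * (μ ^ 2 / 8) := by
      have : 8 * δ ^ 2 * b ^ 2 * ‖x‖ ^ 2 = (8 * δ) * (δ * b ^ 2) * ‖x‖ ^ 2 := by ring
      rw [this]
      have h7 : 8 * δ * (δ * b ^ 2) ≤ 8 * δ * (1 / 448) := mulL (by linarith) (by linarith)
      refine (mul_le_mul h7 hxx (by positivity) (by positivity)).trans ?_
      linarith [mul_pos hδ (pow_pos hμ0 2)]
    have h8 := mulL (h3.1) hδ.le
    have h9 := mulL (h3.2) hδ.le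
    have h10 := mulL h5 hδ.le
    have h11 : δ * (7 * σ) = δ * (μ ^ 2 / 8) := by rw [hσ]; ring
    rw [inner_smul_left]
    simp only [conj_trivial]
    rw [abs_le]; constructor <;> linarith
/-- constants of the improvement of flatness -/
structure Imp (n : ℕ) (ε0 δ0 μ C : ℝ) : Prop where
  e0 : 0 < ε0
  e1 : ε0 ≤ 1
  d0 : 0 < δ0
  d1 : δ0 ≤ 1
  m0 : 0 < μ
  m1 : μ ≤ 1 / 16
  c0 : 0 < C
  cd : C * δ0 ≤ 1 / 4
  imp : ∀ (u f : Euc n → ℝ) (δ : ℝ), 0 < δ → δ ≤ δ0 → Sol (ball 0 1) u f →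
      (∀ x ∈ ball (0 : Euc n) 1, |u x - ‖x‖ ^ 2 / 2| ≤ δ) →
      (∀ x ∈ ball (0 : Euc n) 1, |f x - 1| ≤ ε0 * δ) →
      ∃ M : Mat n, M.PosDef ∧ M.det = 1 ∧ (∀ v : Euc n, |qf M v - ‖v‖ ^ 2| ≤ C * δ * ‖v‖ ^ 2) ∧
        ∃ (q : Euc n) (k : ℝ), ∀ x ∈ ball (0 : Euc n) (2 * μ), |u x - (⟪q, x⟫ + k) - qf M x / 2| ≤ δ / 2 * μ ^ 2

/-- `u` is `δ`-flat around `x0` in the ellipsoid of `N` of size `r` -/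
structure Flat (U : Set (Euc n)) (u f : Euc n → ℝ) (x0 : Euc n) (N : Mat n) (r δ : ℝ) : Prop where
  rpos : 0 < r
  pd : N.PosDef
  det : N.det = f x0 ^ n
  sub : ∀ y, qf N y < r ^ 2 → x0 + y ∈ U
  est : ∃ (q : Euc n) (k : ℝ), ∀ y, qf N y < r ^ 2 → |u (x0 + y) - (⟪q, y⟫ + k) - qf N y / 2| ≤ δ * r ^ 2

theorem Flat.step {ε0 δ0 μ C : ℝ} (I : Imp n ε0 δ0 μ C) (hn : n ≠ 0) {U : Set (Euc n)} {u f : Euc n → ℝ} {x0 : Euc n} {N : Mat n} {r δ : ℝ}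
    (hs : Sol U u f) (F : Flat U u f x0 N r δ) (hδ : 0 < δ) (hδ0 : δ ≤ δ0)
    (hf : ∀ y, qf N y < r ^ 2 → |f (x0 + y) - f x0| ≤ ε0 * δ * f x0) :
    ∃ N' : Mat n, Flat U u f x0 N' (μ * r) (δ / 2) ∧ ∀ v, |qf N' v - qf N v| ≤ C * δ * qf N v := by
  have hr := F.rpos
  have hf0 : 0 < f x0 := hs.fpos x0 (by simpa using F.sub 0 (by rw [qf_zero]; positivity))
  obtain ⟨R, hR, hRN⟩ := exists_normalise F.pd
  obtain ⟨q, k, hest⟩ := F.est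
  set L : Mat n := r • R with hL
  have hRd : IsUnit R.det := (isUnit_iff_isUnit_det _).1 hR
  have hR0 : R.det ≠ 0 := hRd.ne_zero
  have hLu : IsUnit L := by
    rw [isUnit_iff_isUnit_det, hL, det_smul, isUnit_iff_ne_zero]
    exact mul_ne_zero (pow_ne_zero _ hr.ne') hR0
  have hdR : f x0 ^ n * R.det ^ 2 = 1 := by
    have := congrArg Matrix.det hRN
    rw [det_mul, det_mul, det_transpose, det_one, F.det] at this
    linarith [this]
  have appL : ∀ v, app L v = r • app R v := fun v => by
    simp only [hL, app, smul_mulVec]; rfl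
  have hqL : ∀ v, qf N (app L v) = r ^ 2 * ‖v‖ ^ 2 := fun v => by
    rw [appL, qf_smul_vec, ← qf_conj, hRN, qf_one]
  have hsol := hs.affine hn hLu x0 (-(1 / r ^ 2) • app Lᵀ q) (-(k / r ^ 2)) (c := 1 / r ^ 2) (d := r ^ 2 / f x0) (by positivity) (by positivity) (by
    rw [hL, det_smul, Fintype.card_fin, div_pow, div_eq_iff (by positivity)]
    rw [mul_pow, ← pow_mul, ← pow_mul, mul_comm 2 n]
    linear_combination (-(r ^ (n * 2))) * hdR)
  have hball : ball (0 : Euc n) 1 ⊆ {x | app L x + x0 ∈ U} := by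
    intro ξ hξ
    have h1 : ‖ξ‖ < 1 := by simpa using hξ
    rw [Set.mem_setOf_eq, add_comm]
    refine F.sub _ ?_
    rw [hqL]
    have : ‖ξ‖ ^ 2 < 1 := by nlinarith [norm_nonneg ξ]
    nlinarith [pow_pos hr 2]
  have hqlt : ∀ ξ ∈ ball (0 : Euc n) 1, qf N (app L ξ) < r ^ 2 := by
    intro ξ hξ
    have h1 : ‖ξ‖ < 1 := by simpa using hξ
    rw [hqL]
    have : ‖ξ‖ ^ 2 < 1 := by nlinarith [norm_nonneg ξ]
    nlinarith [pow_pos hr 2]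
  have hsol' := hsol.mono isOpen_ball (convex_ball 0 1) hball
  have ueq : ∀ ξ, (1 / r ^ 2 * u (app L ξ + x0) + (⟪-(1 / r ^ 2) • app Lᵀ q, ξ⟫ + -(k / r ^ 2))) = 1 / r ^ 2 * (u (x0 + app L ξ) - (⟪q, app L ξ⟫ + k)) := fun ξ => by
    rw [inner_smul_left, ← inner_app, add_comm x0]; simp; ring
  obtain ⟨M, hMp, hMd, hMq, q', k', hM⟩ := I.imp _ _ δ hδ hδ0 hsol' (fun ξ hξ => by
    have h1 := hest _ (hqlt ξ hξ)
    simp only [ueq]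
    rw [hqL] at h1
    have : 1 / r ^ 2 * (u (x0 + app L ξ) - (⟪q, app L ξ⟫ + k)) - ‖ξ‖ ^ 2 / 2 = 1 / r ^ 2 * (u (x0 + app L ξ) - (⟪q, app L ξ⟫ + k) - r ^ 2 * ‖ξ‖ ^ 2 / 2) := by
      field_simp
    rw [this, abs_mul, abs_of_pos (by positivity), one_div, inv_mul_le_iff₀ (by positivity)]
    linarith) (fun ξ hξ => by
    have h1 := hf _ (hqlt ξ hξ)
    have : 1 / r ^ 2 * (r ^ 2 / f x0) * f (app L ξ + x0) - 1 = (1 / f x0) * (f (x0 + app L ξ) - f x0) := by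
      rw [add_comm x0]; field_simp
    rw [this, abs_mul, abs_of_pos (by positivity), one_div, inv_mul_le_iff₀ (by positivity)]
    linarith)
  have hRi : ∀ v, app R (app R⁻¹ v) = v := fun v => app_app_inv hR v
  have hCd : C * δ ≤ 1 / 4 := (mulL hδ0 I.c0.le).trans I.cd
  have hqN : ∀ v, qf N v = ‖app R⁻¹ v‖ ^ 2 := fun v => by
    rw [← qf_one, ← hRN, qf_conj, hRi]
  refine ⟨(R⁻¹)ᵀ * M * R⁻¹, ⟨mul_pos I.m0 hr, ?_, ?_, ?_, ?_⟩, ?_⟩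
  · exact posDef_conj hMp ((isUnit_nonsing_inv_iff).2 hR)
  · rw [det_mul, det_mul, det_transpose, hMd, det_nonsing_inv, Ring.inverse_eq_inv']
    field_simp
    linarith
  all_goals
    have hin : ∀ y, qf ((R⁻¹)ᵀ * M * R⁻¹) y < (μ * r) ^ 2 → ∃ ξ ∈ ball (0 : Euc n) (2 * μ), app L ξ = y ∧ qf M ξ * r ^ 2 = qf ((R⁻¹)ᵀ * M * R⁻¹) y := by
      intro y hy
      have e1 : app L (r⁻¹ • app R⁻¹ y) = y := by
        rw [appL, app_smul, hRi, smul_smul, mul_inv_cancel₀ hr.ne', one_smul]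
      have e2 : qf M (r⁻¹ • app R⁻¹ y) * r ^ 2 = qf ((R⁻¹)ᵀ * M * R⁻¹) y := by
        rw [qf_conj, qf_smul_vec]; field_simp
      refine ⟨r⁻¹ • app R⁻¹ y, ?_, e1, e2⟩
      set ξ := r⁻¹ • app R⁻¹ y
      have h1 := (abs_le.1 (hMq ξ)).1
      have h2 := mulR hCd (sq_nonneg ‖ξ‖)
      rw [← e2, mul_pow] at hy
      have h3 := lt_of_mul_lt_mul_right hy (sq_nonneg r)
      rw [mem_ball_zero_iff]
      refine lt_of_pow_lt_pow_left₀ 2 (by linarith [I.m0]) ?_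
      nlinarith [pow_pos I.m0 2]
  · intro y hy
    obtain ⟨ξ, hξ, hy1, _⟩ := hin y hy
    rw [← hy1]
    exact F.sub _ (hqlt ξ (ball_subset_ball (by linarith [I.m1]) hξ))
  · refine ⟨q + r ^ 2 • app (L⁻¹)ᵀ q', k + r ^ 2 * k', fun y hy => ?_⟩
    obtain ⟨ξ, hξ, hy1, hy2⟩ := hin y hy
    have h1 := hM ξ hξ
    simp only [ueq] at h1
    have h2 : ⟪app (L⁻¹)ᵀ q', y⟫ = ⟪q', ξ⟫ := by
      rw [← inner_app, ← hy1, app_inv_app hLu]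
    rw [inner_add_left, inner_smul_left, h2, ← hy2, conj_trivial]
    have : u (x0 + y) - (⟪q, y⟫ + r ^ 2 * ⟪q', ξ⟫ + (k + r ^ 2 * k')) - qf M ξ * r ^ 2 / 2 =
       r ^ 2 * (1 / r ^ 2 * (u (x0 + app L ξ) - (⟪q, app L ξ⟫ + k)) - (⟪q', ξ⟫ + k') - qf M ξ / 2) := by
      rw [hy1]; field_simp; ring
    rw [this, abs_mul, abs_of_pos (by positivity)]
    refine (mulL h1 (by positivity)).trans (le_of_eq (by ring))
  · intro v
    rw [qf_conj, hqN]
    exact hMq _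
theorem inv_lower {B : Mat n} (hB : B.PosDef) {T : ℝ} (hT : 0 < T) (h : ∀ v, qf B v ≤ T * ‖v‖ ^ 2) (v : Euc n) :
    T⁻¹ * ‖v‖ ^ 2 ≤ qf B⁻¹ v := by
  have h1 := cauchy_inv hB v v
  rw [real_inner_self_eq_norm_sq] at h1
  rcases eq_or_ne v 0 with rfl | hv
  · simp [qf_zero]
  have hp : 0 < ‖v‖ ^ 2 := by positivity
  have h0 : 0 ≤ qf B⁻¹ v := ((posSemidef_iff_qf _).1 hB.inv.posSemidef).2 v
  have h2 := h1.trans (mulR (h v) h0)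
  rw [inv_mul_le_iff₀ hT]
  refine le_of_mul_le_mul_left ?_ hp
  calc ‖v‖ ^ 2 * ‖v‖ ^ 2 = (‖v‖ ^ 2) ^ 2 := by ring
    _ ≤ _ := h2
    _ = _ := by ring

theorem inv_upper {B : Mat n} (hB : B.PosDef) {m : ℝ} (hm : 0 < m) (h : ∀ v, m * ‖v‖ ^ 2 ≤ qf B v) (v : Euc n) :
    qf B⁻¹ v ≤ m⁻¹ * ‖v‖ ^ 2 := by
  set w := app B⁻¹ v with hw
  have hu : IsUnit B := (isUnit_iff_isUnit_det _).2 (isUnit_iff_ne_zero.2 hB.det_pos.ne')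
  have e1 : app B w = v := app_app_inv hu v
  have e2 : qf B w = ⟪w, v⟫ := by rw [qf_eq_inner, e1]
  have e3 : qf B⁻¹ v = ⟪v, w⟫ := by rw [qf_eq_inner]
  have h1 := h w
  have h2 := real_inner_le_norm w v
  rw [e3, real_inner_comm]
  have h3 : m * ‖w‖ ≤ ‖v‖ := by
    rcases eq_or_ne w 0 with h0 | h0
    · rw [h0]; simp
    · refine le_of_mul_le_mul_left ?_ (norm_pos_iff.2 h0)
      calc ‖w‖ * (m * ‖w‖) = m * ‖w‖ ^ 2 := by ring
        _ ≤ ‖w‖ * ‖v‖ := by linarith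
  rw [inv_mul_eq_div, le_div_iff₀ hm]
  calc ⟪w, v⟫ * m ≤ ‖w‖ * ‖v‖ * m := mulR h2 hm.le
    _ = (m * ‖w‖) * ‖v‖ := by ring
    _ ≤ ‖v‖ * ‖v‖ := mulR h3 (norm_nonneg _)
    _ = _ := by ring

theorem pd_lower {B : Mat n} (hB : B.PosDef) {T m : ℝ} (hT : 0 < T) (hm : 0 < m) (h : ∀ v, qf B v ≤ T * ‖v‖ ^ 2)
    (hd : m ≤ B.det) (v : Euc n) : m / T ^ (n - 1) * ‖v‖ ^ 2 ≤ qf B v := by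
  have h1 := qf_le_of_det ((posDef_iff_qf _).1 hB.inv).1 (inv_pos.2 hT) (inv_lower hB hT h) v
  rw [det_nonsing_inv, Ring.inverse_eq_inv'] at h1
  have h2 := cauchy_inv hB v v
  rw [real_inner_self_eq_norm_sq] at h2
  rcases eq_or_ne v 0 with rfl | hv
  · simp [qf_zero]
  have hp : 0 < ‖v‖ ^ 2 := by positivity
  have h0 : 0 ≤ qf B v := ((posSemidef_iff_qf _).1 hB.posSemidef).2 v
  have h3 : qf B⁻¹ v ≤ T ^ (n - 1) * m⁻¹ * ‖v‖ ^ 2 := by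
    have : B.det⁻¹ * ‖v‖ ^ 2 ≤ m⁻¹ * ‖v‖ ^ 2 := by gcongr
    have h4 := h1.trans this
    rw [inv_pow, inv_mul_le_iff₀ (by positivity)] at h4
    linarith
  have h5 := h2.trans (mulL h3 h0)
  rw [div_mul_eq_mul_div, div_le_iff₀ (by positivity)]
  refine le_of_mul_le_mul_left ?_ (mul_pos hp (inv_pos.2 hm))
  calc ‖v‖ ^ 2 * m⁻¹ * (m * ‖v‖ ^ 2) = (‖v‖ ^ 2) ^ 2 := by field_simp
    _ ≤ _ := h5
    _ = _ := by ring

theorem trace_le {C : Mat n} {k : ℝ} (h : ∀ v, qf C v ≤ k * ‖v‖ ^ 2) : C.trace ≤ n * k := by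
  have := trace_mul_mono (C := 1) (X := C) (Y := k • 1) PosSemidef.one (fun v => by rw [qf_smul, qf_one]; exact h v)
  rw [Matrix.one_mul, Matrix.one_mul, trace_smul, trace_one, Fintype.card_fin, smul_eq_mul] at this
  linarith

set_option maxHeartbeats 800000 in
theorem hopf_alg (hn : n ≠ 0) {T ρ : ℝ} (hT : 0 < T) (hρ : 0 < ρ) : ∃ α b0 : ℝ, 0 < α ∧ 0 < b0 ∧
    ∀ (A Ap Am : Mat n) (f fp fm ε : ℝ) (z : Euc n) (b e : ℝ), A.PosDef → Ap.PosDef → Am.PosDef →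
      A.det = f ^ n → Ap.det = fp ^ n → Am.det = fm ^ n → |f - 1| ≤ ε → |fp - 1| ≤ ε → |fm - 1| ≤ ε → ε ≤ 1 / 2 →
      ρ ≤ ‖z‖ → 0 < b → b ≤ b0 → 0 < e → e ≤ 1 →
      (∀ ξ, qf Ap ξ + qf Am ξ - 2 * qf A ξ + 2 * b * (e * (4 * α ^ 2 * ⟪z, ξ⟫ ^ 2 - 2 * α * ‖ξ‖ ^ 2)) ≤ 0) →
      (∀ ξ, qf Ap ξ + qf Am ξ ≤ 2 * T * ‖ξ‖ ^ 2) → b * e ≤ 2 * n * ε := by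
  set l : ℝ := (1 / 2) ^ n / T ^ (n - 1) with hl
  have hl0 : 0 < l := by positivity
  set K1 : ℝ := n * (l / 2)⁻¹ with hK1
  have hK10 : 0 ≤ K1 := by positivity
  set La : ℝ := 2 ^ n / (l / 2) ^ (n - 1) with hLa
  have hLa0 : 0 < La := by positivity
  set α : ℝ := La * (K1 + 1) / ρ ^ 2 + 1 with hα
  have hα1 : 1 ≤ α := by rw [hα]; have : 0 ≤ La * (K1 + 1) / ρ ^ 2 := by positivity
                         linarith
  refine ⟨α, l / (4 * α), by linarith, by positivity, ?_⟩
  intro A Ap Am f fp fm ε z b e hA hAp hAm hf hfp hfm hf1 hfp1 hfm1 hε hz hb hb0 he he1 h1 h2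
  have hf1' := abs_le.1 hf1
  have hfp1' := abs_le.1 hfp1
  have hfm1' := abs_le.1 hfm1
  have hn' : (0 : ℝ) < n := by exact_mod_cast Nat.pos_of_ne_zero hn
  set B : Mat n := (1 / 2 : ℝ) • (Ap + Am) with hB
  have qB : ∀ v, qf B v = (qf Ap v + qf Am v) / 2 := fun v => by rw [hB, qf_smul, qf_add]; ring
  have pA := (posDef_iff_qf _).1 hA
  have pAp := (posDef_iff_qf _).1 hAp
  have pAm := (posDef_iff_qf _).1 hAm
  have hBpd : B.PosDef := (posDef_iff_qf _).2 ⟨by rw [hB, transpose_smul, transpose_add, pAp.1, pAm.1], fun v hv => by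
    rw [qB]; linarith [pAp.2 v hv, pAm.2 v hv]⟩
  have hBT : ∀ v, qf B v ≤ T * ‖v‖ ^ 2 := fun v => by rw [qB]; linarith [h2 v]
  -- determinant of B
  have hBd : (1 / 2 : ℝ) ^ n ≤ B.det := by
    obtain ⟨c, hc, hcd⟩ := exists_root hn hBpd
    have hci : B⁻¹.det = (c⁻¹) ^ n := by rw [det_nonsing_inv, Ring.inverse_eq_inv', hcd, inv_pow]
    have t1 := amgm_trace hBpd.inv hAp (inv_pos.2 hc) (by linarith : 0 < fp) hci hfp
    have t2 := amgm_trace hBpd.inv hAm (inv_pos.2 hc) (by linarith : 0 < fm) hci hfm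
    have t3 : (B⁻¹ * B).trace = (1 / 2) * ((B⁻¹ * Ap).trace + (B⁻¹ * Am).trace) := by
      conv_lhs => rw [hB]
      rw [Matrix.mul_smul, Matrix.mul_add, trace_smul, trace_add, smul_eq_mul]
    rw [nonsing_inv_mul _ (isUnit_iff_ne_zero.2 hBpd.det_pos.ne'), trace_one, Fintype.card_fin] at t3
    have t4 : c⁻¹ * (1 / 2) ≤ 1 := by
      have a1 : c⁻¹ * (1 / 2) ≤ c⁻¹ * fp := by gcongr; linarith
      have a2 : c⁻¹ * (1 / 2) ≤ c⁻¹ * fm := by gcongr; linarith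
      have a3 := mulL a1 hn'.le
      have a4 := mulL a2 hn'.le
      refine le_of_mul_le_mul_left ?_ hn'
      linarith
    rw [inv_mul_le_iff₀ hc, mul_one] at t4
    rw [hcd]; gcongr
  have hBl := pd_lower hBpd hT (by positivity) hBT hBd
  -- lower bound of A
  have hAB : ∀ ξ, qf B ξ + b * (e * (4 * α ^ 2 * ⟪z, ξ⟫ ^ 2 - 2 * α * ‖ξ‖ ^ 2)) ≤ qf A ξ := fun ξ => by
    rw [qB]; linarith [h1 ξ]
  have hbe : b * e * (4 * α) ≤ l := by
    have : b * e ≤ b := by nlinarith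
    calc b * e * (4 * α) ≤ l / (4 * α) * (4 * α) := by gcongr; linarith
      _ = l := by field_simp
  have hAl : ∀ ξ, l / 2 * ‖ξ‖ ^ 2 ≤ qf A ξ := fun ξ => by
    have a1 := hAB ξ
    have a2 := hBl ξ
    rw [← hl] at a2
    have a3 : 0 ≤ b * (e * (4 * α ^ 2 * ⟪z, ξ⟫ ^ 2)) := by positivity
    have a4 := mulR hbe (sq_nonneg ‖ξ‖)
    linarith
  have hAu : ∀ ξ, qf A ξ ≤ La * ‖ξ‖ ^ 2 := fun ξ => by
    have a1 := qf_le_of_det pA.1 (by positivity) hAl ξ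
    have a2 : A.det ≤ 2 ^ n := by rw [hf]; exact pow_le_pow_left₀ (by linarith) (by linarith) n
    rw [hLa, div_mul_eq_mul_div, le_div_iff₀ (by positivity)]
    calc qf A ξ * (l / 2) ^ (n - 1) = (l / 2) ^ (n - 1) * qf A ξ := by ring
      _ ≤ _ := a1
      _ ≤ _ := by gcongr
  have hCl := inv_lower hA hLa0 hAu z
  have hCu := trace_le (inv_upper hA (by positivity) hAl)
  rw [← hK1] at hCu
  have hci : A⁻¹.det = (f⁻¹) ^ n := by rw [det_nonsing_inv, Ring.inverse_eq_inv', hf, inv_pow]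
  have f0 : 0 < f := by linarith
  have t1 := amgm_trace hA.inv hAp (inv_pos.2 f0) (by linarith : 0 < fp) hci hfp
  have t2 := amgm_trace hA.inv hAm (inv_pos.2 f0) (by linarith : 0 < fm) hci hfm
  have t3 := trace_mul_mono (C := A⁻¹) hA.inv.posSemidef
    (X := (1 / 2 : ℝ) • (Ap + Am) + (b * e) • ((4 * α ^ 2) • vecMulVec z.ofLp z.ofLp - (2 * α) • 1)) (Y := A) (fun ξ => by
      have := hAB ξ
      rw [hB] at this
      rw [qf_add, qf_smul (b * e), qf_sub, qf_smul (4 * α ^ 2), qf_smul (2 * α), qf_vec, qf_one]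
      linarith)
  rw [nonsing_inv_mul _ (isUnit_iff_ne_zero.2 hA.det_pos.ne'), trace_one, Fintype.card_fin, Matrix.mul_add, Matrix.mul_smul,
    Matrix.mul_add, Matrix.mul_smul, Matrix.mul_sub, Matrix.mul_smul, Matrix.mul_smul, Matrix.mul_one, trace_add,
    trace_smul, trace_add, trace_smul, trace_sub, trace_smul, trace_smul, trace_vec] at t3
  simp only [smul_eq_mul] at t3
  have hq : K1 + 1 ≤ α * qf A⁻¹ z := by
    have a1 : La⁻¹ * ρ ^ 2 ≤ qf A⁻¹ z := le_trans (by gcongr) hCl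
    calc K1 + 1 = La * (K1 + 1) / ρ ^ 2 * (La⁻¹ * ρ ^ 2) := by field_simp
      _ ≤ α * (La⁻¹ * ρ ^ 2) := by gcongr; rw [hα]; linarith
      _ ≤ _ := by gcongr
  have hX : 1 ≤ 4 * α ^ 2 * qf A⁻¹ z - 2 * α * A⁻¹.trace := by
    have a1 := mulL hq (by linarith : 0 ≤ 4 * α)
    have a2 := mulL hCu (by linarith : 0 ≤ 2 * α)
    have a3 : 0 ≤ α * K1 := by positivity
    nlinarith
  have hX2 := mulL hX (by positivity : 0 ≤ b * e)
  have ht : ∀ g : ℝ, |g - 1| ≤ ε → n * (1 - 2 * ε) ≤ n * (f⁻¹ * g) := fun g hg => by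
    have := abs_le.1 hg
    gcongr
    rw [inv_mul_eq_div, le_div_iff₀ f0]
    nlinarith [abs_nonneg (f - 1)]
  have := ht fp hfp1
  have := ht fm hfm1
  linarith
theorem P2_normsq (z ξ : Euc n) : P2 (fun t : ℝ => ‖z + t • ξ‖ ^ 2) (‖z‖ ^ 2) (2 * ⟪z, ξ⟫) (2 * ‖ξ‖ ^ 2) := by
  refine (P2_quad (‖z‖ ^ 2) (2 * ⟪z, ξ⟫) (2 * ‖ξ‖ ^ 2)).congr' (Eventually.of_forall fun t => ?_)
  simp only
  rw [norm_add_sq_real, inner_smul_right, norm_smul, mul_pow, Real.norm_eq_abs, sq_abs]; ring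

theorem P2_exp (a : ℝ) : P2 (fun s => Real.exp (a + s)) (Real.exp a) (Real.exp a) (Real.exp a) := by
  have h := P2_of_deriv (φ := fun s => Real.exp (a + s)) (φ' := fun s => Real.exp (a + s)) (c := Real.exp a) ?_ ?_
  · simpa using h
  · refine Eventually.of_forall fun t => ?_
    have := ((hasDerivAt_id t).const_add a).exp
    simpa using this
  · have := ((hasDerivAt_id (0 : ℝ)).const_add a).exp
    simpa using this

/-- Hopf type auxiliary function -/
def hopF (u : Euc n → ℝ) (xs : Euc n) (t s b α : ℝ) (p : Euc n × Euc n) : ℝ :=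
  sd u p.1 p.2 - t * ‖p.2‖ ^ 2 - t / s ^ 2 * (‖p.2‖ ^ 2 - s ^ 2) ^ 2 + 2 * b * Real.exp (-α * ‖p.1 - xs‖ ^ 2)

theorem hopf_max {U : Set (Euc n)} {u f : Euc n → ℝ} {xs x y : Euc n} {t s b α : ℝ} (hu : Sol U u f) (ht : 0 < t) (hs : 0 < s)
    (hx : x ∈ U) (hp : x + y ∈ U) (hm : x - y ∈ U) (hy : ‖y‖ ≤ 2 * s)
    (hmax : ∀ᶠ p in 𝓝 (x, y), hopF u xs t s b α p ≤ hopF u xs t s b α (x, y)) :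
    ∃ A Ap Am : Mat n, A.PosDef ∧ Ap.PosDef ∧ Am.PosDef ∧ A.det = f x ^ n ∧ Ap.det = f (x + y) ^ n ∧ Am.det = f (x - y) ^ n ∧
      (∀ ξ, qf Ap ξ + qf Am ξ - 2 * qf A ξ + 2 * b * (Real.exp (-α * ‖x - xs‖ ^ 2) * (4 * α ^ 2 * ⟪x - xs, ξ⟫ ^ 2 - 2 * α * ‖ξ‖ ^ 2)) ≤ 0) ∧
      (∀ ξ, qf Ap ξ + qf Am ξ ≤ 2 * (23 * t) * ‖ξ‖ ^ 2) := by
  obtain ⟨g, A, hA, hA1, hA2⟩ := hu.pea x hx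
  obtain ⟨gp, Ap, hAp, hAp1, hAp2⟩ := hu.pea _ hp
  obtain ⟨gm, Am, hAm, hAm1, hAm2⟩ := hu.pea _ hm
  refine ⟨A, Ap, Am, hA1, hAp1, hAm1, hA2, hAp2, hAm2, fun ξ => ?_, fun ξ => ?_⟩
  · have hl : Tendsto (fun τ : ℝ => (x + τ • ξ, y)) (𝓝 0) (𝓝 (x, y)) :=
      (line_tendsto x ξ).prodMk_nhds tendsto_const_nhds
    have e1 := P2.comp (F := Real.exp) (P2_exp _) ((P2_normsq (x - xs) ξ).const_mul (-α))
    have e2 := (((hAp ξ).add (hAm ξ)).sub ((hA ξ).const_mul 2)).add ((P2_const (-(t * ‖y‖ ^ 2) - t / s ^ 2 * (‖y‖ ^ 2 - s ^ 2) ^ 2)).add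
      (e1.const_mul (2 * b)))
    have e3 := (e2.congr' (ψ := fun τ => hopF u xs t s b α (x + τ • ξ, y)) (Eventually.of_forall fun τ => by
      simp only [hopF, sd]
      rw [show x + τ • ξ + y = x + y + τ • ξ by abel, show x + τ • ξ - y = x - y + τ • ξ by abel,
        show x + τ • ξ - xs = x - xs + τ • ξ by abel]; ring)).max ?_
    · have := e3.2
      linarith
    · filter_upwards [hl.eventually hmax] with τ hτ
      refine hτ.trans (le_of_eq ?_)
      simp only [hopF, sd]; ring
  · have hl : Tendsto (fun τ : ℝ => (x, y + τ • ξ)) (𝓝 0) (𝓝 (x, y)) :=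
      tendsto_const_nhds.prodMk_nhds (line_tendsto y ξ)
    have e0 := (P2_normsq y ξ).sub (P2_const (s ^ 2))
    have e2 := (((hAp ξ).add (hAm (-ξ))).sub (P2_const (2 * u x))).sub (((P2_normsq y ξ).const_mul t).add
      (e0.sq.const_mul (t / s ^ 2)))
    have e3 := (e2.congr' (ψ := fun τ => hopF u xs t s b α (x, y + τ • ξ) - 2 * b * Real.exp (-α * ‖x - xs‖ ^ 2)) (Eventually.of_forall fun τ => by
      simp only [hopF, sd]
      rw [show x + (y + τ • ξ) = x + y + τ • ξ by abel, show x - (y + τ • ξ) = x - y + τ • -ξ by rw [smul_neg]; abel]; ring)).max ?_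
    · have h3 := e3.2
      rw [qf_neg_vec] at h3
      have hi : ⟪y, ξ⟫ ^ 2 ≤ 4 * s ^ 2 * ‖ξ‖ ^ 2 := by
        have := pow_le_pow_left₀ (abs_nonneg _) (abs_real_inner_le_norm y ξ) 2
        rw [sq_abs, mul_pow] at this
        refine this.trans ?_
        have := pow_le_pow_left₀ (norm_nonneg _) hy 2
        calc ‖y‖ ^ 2 * ‖ξ‖ ^ 2 ≤ (2 * s) ^ 2 * ‖ξ‖ ^ 2 := by gcongr
          _ = _ := by ring
      have hj : ‖y‖ ^ 2 ≤ 4 * s ^ 2 := by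
        have := pow_le_pow_left₀ (norm_nonneg _) hy 2
        linarith
      have hk : 2 * (2 * ⟪y, ξ⟫) ^ 2 + 2 * (‖y‖ ^ 2 - s ^ 2) * (2 * ‖ξ‖ ^ 2 - 0) ≤ 44 * s ^ 2 * ‖ξ‖ ^ 2 := by
        have := mulR hj (sq_nonneg ‖ξ‖)
        linarith
      have hk2 := mulL hk (by positivity : 0 ≤ t / s ^ 2)
      have hk3 : t / s ^ 2 * (44 * s ^ 2 * ‖ξ‖ ^ 2) = 44 * t * ‖ξ‖ ^ 2 := by field_simp
      simp only [sub_zero] at h3 hk2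
      linarith
    · filter_upwards [hl.eventually hmax] with τ hτ
      simp only [hopF, sd] at hτ ⊢
      linarith

/-- limits of solutions with right hand side tending to `1` -/
def Lim (r : ℝ) (w : Euc n → ℝ) : Prop := ∀ ε : ℝ, 0 < ε → ∃ u f, Sol (ball 0 r) u f ∧
  (∀ x ∈ ball (0 : Euc n) r, |f x - 1| ≤ ε) ∧ ∀ x ∈ ball (0 : Euc n) r, |u x - w x| ≤ ε

theorem sd_close {u w : Euc n → ℝ} {r ε : ℝ} (h : ∀ x ∈ ball (0 : Euc n) r, |u x - w x| ≤ ε) {x y : Euc n}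
    (hxy : ‖x‖ + ‖y‖ < r) : |sd u x y - sd w x y| ≤ 4 * ε := by
  have h1 := abs_le.1 (h (x + y) (by rw [mem_ball_zero_iff]; exact lt_of_le_of_lt (norm_add_le _ _) hxy))
  have h2 := abs_le.1 (h (x - y) (by rw [mem_ball_zero_iff]; exact lt_of_le_of_lt (norm_sub_le _ _) hxy))
  have h3 := abs_le.1 (h x (by rw [mem_ball_zero_iff]; linarith [norm_nonneg y]))
  rw [abs_le]; simp only [sd]
  constructor <;> linarith [h1.1, h1.2, h2.1, h2.2, h3.1, h3.2]

set_option maxHeartbeats 800000 in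
theorem hopf (hn : n ≠ 0) {T τ ρ : ℝ} (hT : 1 ≤ T) (hτ : 0 < τ) (hτ1 : τ ≤ 1) (hρ : 0 < ρ) (hρ1 : ρ ≤ 1 / 8) :
    ∃ c : ℝ, 0 < c ∧ ∀ (w : Euc n → ℝ) (t : ℝ) (xs : Euc n), Lim 2 w → 1 ≤ t → t ≤ T → ‖xs‖ < 1 / 8 →
      (∀ x y : Euc n, ‖x‖ + ‖y‖ < 2 → sd w x y ≤ t * ‖y‖ ^ 2) →
      (∀ x y : Euc n, ‖x - xs‖ ≤ ρ → ‖y‖ ≤ ρ → sd w x y ≤ (t - τ) * ‖y‖ ^ 2) →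
      ∀ x y : Euc n, ‖x‖ < 1 / 8 → ‖y‖ < ρ / 4 → sd w x y ≤ (t - c) * ‖y‖ ^ 2 := by
  obtain ⟨α, b0, hα, hb0, key⟩ := hopf_alg (n := n) hn (T := 23 * T) (ρ := ρ) (by linarith) hρ
  set cb : ℝ := min b0 (τ / 8) with hcb
  have hcb0 : 0 < cb := lt_min hb0 (by linarith)
  set d : ℝ := Real.exp (-α * (1 / 4) ^ 2) - Real.exp (-α * (1 / 2) ^ 2) with hd
  have hd0 : 0 < d := by
    rw [hd, sub_pos, Real.exp_lt_exp]; nlinarith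
  have hd1 : d ≤ 1 := by
    have h1 : Real.exp (-α * (1 / 4) ^ 2) ≤ 1 := Real.exp_le_one_iff.2 (by nlinarith)
    have h2 := Real.exp_pos (-α * (1 / 2) ^ 2)
    rw [hd]; linarith
  have hem : ∀ a b : ℝ, 0 ≤ a → a ≤ b → Real.exp (-α * b ^ 2) ≤ Real.exp (-α * a ^ 2) := fun a b h0 hab => by
    rw [Real.exp_le_exp, neg_mul, neg_mul, neg_le_neg_iff]
    gcongr
  have hem1 : ∀ a : ℝ, Real.exp (-α * a ^ 2) ≤ 1 := fun a => by
    rw [Real.exp_le_one_iff, neg_mul, neg_nonpos]; positivity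
  have hcτ : cb * d ≤ τ := by
    have : cb ≤ τ / 8 := min_le_right _ _
    nlinarith
  have h4alg : ∀ a s : ℝ, 0 < s → a ≤ s ^ 2 / 2 → s ^ 2 / 4 ≤ (a - s ^ 2) ^ 2 / s ^ 2 := fun a s hs h => by
    rw [le_div_iff₀ (by positivity)]
    nlinarith
  refine ⟨cb * d, by positivity, ?_⟩
  intro w t xs hw ht1 htT hxs hw1 hw2 x1 y1 hx1 hy1
  rcases eq_or_ne y1 0 with rfl | hy0
  · simp [sd]; linarith
  by_cases hin : ‖x1 - xs‖ ≤ ρ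
  · refine (hw2 x1 y1 hin (by linarith)).trans ?_
    gcongr
  push Not at hin
  by_contra hcon
  push Not at hcon
  set s := ‖y1‖ with hs
  have hs0 : 0 < s := norm_pos_iff.2 hy0
  set b := cb * s ^ 2 with hb
  have hbp : 0 < b := by positivity
  have hs1 : s ^ 2 ≤ 1 := pow_le_one₀ hs0.le (by linarith)
  have hbb0 : b ≤ b0 := by
    calc b ≤ cb * 1 := by rw [hb]; gcongr
      _ ≤ b0 := by rw [mul_one]; exact min_le_left _ _
  have hbτ : b ≤ τ / 8 * s ^ 2 := by rw [hb]; gcongr; exact min_le_right _ _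
  set e1 := Real.exp (-α * (1 / 2) ^ 2) with he1
  have he10 : 0 < e1 := Real.exp_pos _
  have hn' : (0 : ℝ) < n := by exact_mod_cast Nat.pos_of_ne_zero hn
  obtain ⟨ε, hε, hε1, hε2, hε3⟩ : ∃ ε : ℝ, 0 < ε ∧ ε ≤ 1 / 2 ∧ 8 * ε < b * d ∧ 2 * n * ε < b * e1 := by
    refine ⟨min (1 / 2) (min (b * d / 16) (b * e1 / (4 * n))), by positivity, min_le_left _ _, ?_, ?_⟩
    · have : min (1 / 2) (min (b * d / 16) (b * e1 / (4 * n))) ≤ b * d / 16 := (min_le_right _ _).trans (min_le_left _ _)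
      have : 0 < b * d := by positivity
      linarith
    · have : min (1 / 2) (min (b * d / 16) (b * e1 / (4 * n))) ≤ b * e1 / (4 * n) := (min_le_right _ _).trans (min_le_right _ _)
      rw [le_div_iff₀ (by positivity)] at this
      have : 0 < b * e1 := by positivity
      linarith
  obtain ⟨u, f, hu, hf, huw⟩ := hw ε hε
  set K : Set (Euc n × Euc n) := {p | ρ ≤ ‖p.1 - xs‖ ∧ ‖p.1 - xs‖ ≤ 1 / 2 ∧ ‖p.2‖ ≤ 2 * s} with hK
  have hKin : ∀ p ∈ K, ‖p.1‖ + ‖p.2‖ < 2 := by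
    intro p hp
    have h1 := norm_add_le (p.1 - xs) xs
    rw [sub_add_cancel] at h1
    linarith [hp.2.1, hp.2.2]
  have hmem : ∀ p ∈ K, p.1 ∈ ball (0 : Euc n) 2 ∧ p.1 + p.2 ∈ ball (0 : Euc n) 2 ∧ p.1 - p.2 ∈ ball (0 : Euc n) 2 := by
    intro p hp
    have := hKin p hp
    simp only [mem_ball_zero_iff]
    exact ⟨by linarith [norm_nonneg p.2], (norm_add_le _ _).trans_lt this, (norm_sub_le _ _).trans_lt this⟩
  have n1 : Continuous (fun p : Euc n × Euc n => ‖p.1 - xs‖) := by fun_prop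
  have n2 : Continuous (fun p : Euc n × Euc n => ‖p.2‖) := by fun_prop
  have hKc : IsCompact K := by
    have hcl : IsClosed K := by
      exact (isClosed_le continuous_const n1).inter ((isClosed_le n1 continuous_const).inter (isClosed_le n2 continuous_const))
    refine ((isCompact_closedBall xs (1 / 2)).prod (isCompact_closedBall (0 : Euc n) (2 * s))).of_isClosed_subset hcl ?_
    intro p hp
    exact ⟨by simpa [dist_eq_norm] using hp.2.1, by simpa using hp.2.2⟩
  have hcont : ContinuousOn (hopF u xs t s b α) K := by
    unfold hopF sd
    have c1 : ContinuousOn (fun p : Euc n × Euc n => u (p.1 + p.2)) K :=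
      hu.cont.comp (by fun_prop) fun p hp => (hmem p hp).2.1
    have c2 : ContinuousOn (fun p : Euc n × Euc n => u (p.1 - p.2)) K :=
      hu.cont.comp (by fun_prop) fun p hp => (hmem p hp).2.2
    have c3 : ContinuousOn (fun p : Euc n × Euc n => u p.1) K :=
      hu.cont.comp (by fun_prop) fun p hp => (hmem p hp).1
    have c4 : Continuous (fun p : Euc n × Euc n => t * ‖p.2‖ ^ 2) := by fun_prop
    have c5 : Continuous (fun p : Euc n × Euc n => t / s ^ 2 * (‖p.2‖ ^ 2 - s ^ 2) ^ 2) := by fun_prop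
    have c6 : Continuous (fun p : Euc n × Euc n => 2 * b * Real.exp (-α * ‖p.1 - xs‖ ^ 2)) := by fun_prop
    exact ((((c1.add c2).sub (continuousOn_const.mul c3)).sub c4.continuousOn).sub c5.continuousOn).add c6.continuousOn
  have hx1s : ‖x1 - xs‖ ≤ 1 / 4 := by linarith [norm_sub_le x1 xs]
  have hp1 : (x1, y1) ∈ K := ⟨hin.le, by simp only; linarith, by simp only; linarith⟩
  obtain ⟨p, hp, hpm⟩ := hKc.exists_isMaxOn ⟨_, hp1⟩ hcont
  have hval : hopF u xs t s b α (x1, y1) ≤ hopF u xs t s b α p := isMaxOn_iff.1 hpm _ hp1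
  have hlow : 2 * b * e1 + 4 * ε < hopF u xs t s b α (x1, y1) := by
    have h1 := (abs_le.1 (sd_close huw (hKin _ hp1))).1
    simp only [hopF]
    rw [← hs]
    have h2 : Real.exp (-α * (1 / 4) ^ 2) ≤ Real.exp (-α * ‖x1 - xs‖ ^ 2) := hem _ _ (norm_nonneg _) hx1s
    have h3 := mulL h2 (by positivity : 0 ≤ 2 * b)
    have h4 : (t - cb * d) * s ^ 2 = t * s ^ 2 - b * d := by rw [hb]; ring
    rw [h4] at hcon
    have h5 : 2 * b * Real.exp (-α * (1 / 4) ^ 2) = 2 * b * e1 + 2 * (b * d) := by rw [hd]; ring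
    simp only [sub_self, ne_eq, OfNat.ofNat_ne_zero, not_false_eq_true, zero_pow, mul_zero, sub_zero] at h1 ⊢
    linarith
  have hu1 := (abs_le.1 (sd_close huw (hKin _ hp))).2
  have hu2 := hw1 p.1 p.2 (hKin p hp)
  have hbe1 : 0 < b * e1 := by positivity
  have hsq : 0 ≤ t / s ^ 2 * (‖p.2‖ ^ 2 - s ^ 2) ^ 2 := by positivity
  have hexp1 : 2 * b * Real.exp (-α * ‖p.1 - xs‖ ^ 2) ≤ 2 * b := by
    have := mulL (hem1 ‖p.1 - xs‖) (by positivity : 0 ≤ 2 * b)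
    rwa [mul_one] at this
  have hgt := hlow.trans_le hval
  simp only [hopF] at hgt
  -- not on the boundary
  have hb1 : ‖p.1 - xs‖ < 1 / 2 := by
    refine lt_of_le_of_ne hp.2.1 fun he => ?_
    rw [he, ← he1] at hgt
    linarith
  have hb2 : ‖p.2‖ < 2 * s := by
    refine lt_of_le_of_ne hp.2.2 fun he => ?_
    have h1 : t / s ^ 2 * (‖p.2‖ ^ 2 - s ^ 2) ^ 2 = t * (9 * s ^ 2) := by rw [he]; field_simp; ring
    have h2 : 1 * (9 * s ^ 2) ≤ t * (9 * s ^ 2) := by gcongr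
    have h3 : τ / 8 * s ^ 2 ≤ 1 * s ^ 2 := by gcongr; linarith
    linarith
  have hb3 : ρ < ‖p.1 - xs‖ := by
    refine lt_of_le_of_ne hp.1 fun he => ?_
    have h1 := hw2 p.1 p.2 he.symm.le (by linarith)
    have h2 : 1 * ((‖p.2‖ ^ 2 - s ^ 2) ^ 2 / s ^ 2) ≤ t / s ^ 2 * (‖p.2‖ ^ 2 - s ^ 2) ^ 2 := by
      rw [div_mul_eq_mul_div, mul_div_assoc]; gcongr
    have h3 : 2 * b ≤ τ * ‖p.2‖ ^ 2 + (‖p.2‖ ^ 2 - s ^ 2) ^ 2 / s ^ 2 := by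
      rcases le_total (s ^ 2 / 2) (‖p.2‖ ^ 2) with hc | hc
      · have := mulL hc hτ.le
        have : 0 ≤ (‖p.2‖ ^ 2 - s ^ 2) ^ 2 / s ^ 2 := by positivity
        linarith
      · have h4 : s ^ 2 / 4 ≤ (‖p.2‖ ^ 2 - s ^ 2) ^ 2 / s ^ 2 := h4alg _ _ hs0 hc
        have : 0 ≤ τ * ‖p.2‖ ^ 2 := by positivity
        have h3 : τ / 8 * s ^ 2 ≤ 1 / 8 * s ^ 2 := by gcongr
        linarith
    linarith
  have hnb : ∀ᶠ q in 𝓝 p, q ∈ K := by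
    have o1 : IsOpen {q : Euc n × Euc n | ρ < ‖q.1 - xs‖ ∧ ‖q.1 - xs‖ < 1 / 2 ∧ ‖q.2‖ < 2 * s} :=
      (isOpen_lt continuous_const n1).inter ((isOpen_lt n1 continuous_const).inter (isOpen_lt n2 continuous_const))
    filter_upwards [o1.mem_nhds ⟨hb3, hb1, hb2⟩] with q hq
    exact ⟨hq.1.le, hq.2.1.le, hq.2.2.le⟩
  obtain ⟨m1, m2, m3⟩ := hmem p hp
  obtain ⟨A, Ap, Am, a1, a2, a3, a4, a5, a6, a7, a8⟩ := hopf_max (xs := xs) (x := p.1) (y := p.2) (t := t) (s := s) (b := b) (α := α) hu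
    (by linarith) hs0 m1 m2 m3 hp.2.2 (by
      filter_upwards [hnb] with q hq using isMaxOn_iff.1 hpm _ hq)
  have hfin := key A Ap Am _ _ _ ε (p.1 - xs) b _ a1 a2 a3 a4 a5 a6 (hf _ m1) (hf _ m2) (hf _ m3) hε1 hp.1 hbp hbb0
    (Real.exp_pos _) (hem1 _) a7 (fun ξ => (a8 ξ).trans (by gcongr))
  have : e1 ≤ Real.exp (-α * ‖p.1 - xs‖ ^ 2) := hem _ _ (norm_nonneg _) hp.2.1
  have := mulL this hbp.le
  linarith
theorem Flat.iter {ε0 δ0 μ C : ℝ} (I : Imp n ε0 δ0 μ C) (hn : n ≠ 0) {U : Set (Euc n)} {u f : Euc n → ℝ} {x0 : Euc n} {N : Mat n} {r δ : ℝ}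
    (hs : Sol U u f) (F : Flat U u f x0 N r δ) (hδ : 0 < δ) (hδ0 : δ ≤ δ0) (hC : 4 * C * δ ≤ 1) (J : ℕ)
    (hf : ∀ y ∈ U, |f y - f x0| ≤ ε0 * (δ / 2 ^ J) * f x0) (j : ℕ) (hj : j ≤ J) :
    ∃ N' : Mat n, Flat U u f x0 N' (μ ^ j * r) (δ / 2 ^ j) ∧ ∀ v, qf N' v ≤ (1 + 4 * C * δ * (1 - 1 / 2 ^ j)) * qf N v := by
  have hC0 := I.c0
  have hr := F.rpos
  have hf0 : 0 < f x0 := hs.fpos x0 (by simpa using F.sub 0 (by rw [qf_zero]; positivity))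
  induction j with
  | zero => exact ⟨N, by simpa using F, fun v => by simp⟩
  | succ j ih =>
    obtain ⟨N1, F1, h1⟩ := ih (by omega)
    have hp : (1 : ℝ) ≤ 2 ^ j := one_le_pow₀ (by norm_num)
    have hpJ : (2 : ℝ) ^ j ≤ 2 ^ J := pow_le_pow_right₀ (by norm_num) (by omega)
    have hdj : δ / 2 ^ j ≤ δ := div_le_self hδ.le hp
    obtain ⟨N2, F2, h2⟩ := F1.step I hn hs (by positivity) (hdj.trans hδ0) (fun y hy => by
      refine (hf _ (F1.sub y hy)).trans ?_
      have := I.e0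
      gcongr)
    refine ⟨N2, ?_, fun v => ?_⟩
    · convert F2 using 1
      · rw [pow_succ]; ring
      · rw [pow_succ]; field_simp
    · have h3 := (abs_le.1 (h2 v)).2
      have h4 := h1 v
      have h5 : 0 ≤ qf N v := by
        by_cases hv : v = 0
        · rw [hv, qf_zero]
        · exact (((posDef_iff_qf N).1 F.pd).2 v hv).le
      set s : ℝ := 1 / 2 ^ j with hs1
      have hs0 : 0 < s := by positivity
      have hs2 : s ≤ 1 := by rw [hs1, div_le_one (by positivity)]; exact hp
      have e1 : (1 : ℝ) / 2 ^ (j + 1) = s / 2 := by rw [hs1, pow_succ]; field_simp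
      have e2 : δ / 2 ^ j = δ * s := by rw [hs1]; ring
      rw [e1]; rw [e2] at h3
      have a1 : qf N2 v ≤ (1 + C * (δ * s)) * qf N1 v := by linarith
      have a2 : (1 + C * (δ * s)) * qf N1 v ≤ (1 + C * (δ * s)) * ((1 + 4 * C * δ * (1 - s)) * qf N v) := by gcongr
      refine (a1.trans a2).trans ?_
      rw [← mul_assoc]
      refine mulR ?_ h5
      have a3 : 4 * C * δ * (1 - s) ≤ 1 := by
        have : 4 * C * δ * (1 - s) ≤ 4 * C * δ * 1 := by gcongr; linarith
        linarith
      have a4 : 0 ≤ C * (δ * s) := by positivity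
      nlinarith [mulL a3 a4]

set_option maxHeartbeats 800000 in
theorem flatC11 {ε0 δ0 μ C : ℝ} (I : Imp n ε0 δ0 μ C) (hn : n ≠ 0) {w : Euc n → ℝ} {r R δ : ℝ} {xs : Euc n}
    (hw : Lim R w) (hr : 0 < r) (hr1 : r ≤ 1) (hR : ‖xs‖ + r ≤ R) (hδ : 0 < δ) (hδ0 : 8 * δ ≤ δ0) (hC : 32 * C * δ ≤ 1)
    (hfl : ∃ (q : Euc n) (k : ℝ), ∀ y, ‖y‖ < r → |w (xs + y) - (⟪q, y⟫ + k) - ‖y‖ ^ 2 / 2| ≤ δ * r ^ 2)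
    {x y : Euc n} (hx : ‖x - xs‖ ≤ r / 8) (hy : ‖y‖ ≤ r / 8) :
    sd w x y ≤ (1 + (64 * C + 128 / μ ^ 2 + 6) * δ) * ‖y‖ ^ 2 := by
  have hC0 := I.c0
  have hm0 := I.m0
  have hm1 := I.m1
  by_cases hy0 : y = 0
  · subst hy0; simp [sd]; linarith
  have yp : 0 < ‖y‖ := norm_pos_iff.2 hy0
  obtain ⟨q, k, hq⟩ := hfl
  -- choose the number of steps
  have hex : ∃ j : ℕ, μ ^ j * (r / 2) ≤ 2 * ‖y‖ := by
    obtain ⟨j, hj⟩ := exists_pow_lt_of_lt_one (show 0 < 2 * ‖y‖ by positivity) (show μ < 1 by linarith)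
    refine ⟨j, ?_⟩
    have : 0 < μ ^ j := by positivity
    nlinarith
  classical
  obtain ⟨J, hJ1, hJ2⟩ : ∃ J : ℕ, 2 * ‖y‖ < μ ^ J * (r / 2) ∧ μ ^ (J + 1) * (r / 2) ≤ 2 * ‖y‖ := by
    have h1 := Nat.find_spec hex
    have h2 : Nat.find hex ≠ 0 := fun h => by
      rw [h] at h1; simp at h1; linarith
    obtain ⟨J, hJ⟩ := Nat.exists_eq_succ_of_ne_zero h2
    have h3 := Nat.find_min hex (m := J) (by omega)
    rw [hJ] at h1
    exact ⟨J, not_le.1 h3, h1⟩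
  have hP : (0 : ℝ) < 2 ^ J := by positivity
  have he0 := I.e0
  have he1 := I.e1
  have hd1 := I.d1
  set ε : ℝ := min (min (1 / 9) (ε0 * (8 * δ / 2 ^ J) / 4)) (min (δ * r ^ 2 / 4) (δ * ‖y‖ ^ 2 / 4)) with hε
  have hε0 : 0 < ε := by rw [hε]; positivity
  have hε1 : ε ≤ 1 / 9 := (min_le_left _ _).trans (min_le_left _ _)
  have hε2 : ε ≤ ε0 * (8 * δ / 2 ^ J) / 4 := (min_le_left _ _).trans (min_le_right _ _)
  have hε3 : ε ≤ δ * r ^ 2 / 4 := (min_le_right _ _).trans (min_le_left _ _)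
  have hε4 : ε ≤ δ * ‖y‖ ^ 2 / 4 := (min_le_right _ _).trans (min_le_right _ _)
  have hε5 : ε ≤ 2 * δ := by
    have h1 : (8 * δ / 2 ^ J) ≤ 8 * δ := div_le_self (by positivity) (one_le_pow₀ (by norm_num))
    have h2 : ε0 * (8 * δ / 2 ^ J) ≤ 1 * (8 * δ) := by gcongr
    linarith
  obtain ⟨u, f, hs, hf, hu⟩ := hw ε hε0
  have hxb : ∀ z, ‖z‖ < 7 * r / 8 → x + z ∈ ball (0 : Euc n) R := fun z hz => by
    rw [mem_ball_zero_iff]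
    calc ‖x + z‖ = ‖xs + (x - xs) + z‖ := by congr 1; abel
      _ ≤ ‖xs‖ + ‖x - xs‖ + ‖z‖ := norm_add₃_le
      _ < R := by linarith
  have hxm : x ∈ ball (0 : Euc n) R := by simpa using hxb 0 (by simp; positivity)
  have hfx := abs_le.1 (hf x hxm)
  have hball : ∀ z, qf (f x • (1 : Mat n)) z < (r / 2) ^ 2 → ‖z‖ < 3 * r / 4 := fun z hz => by
    rw [qf_smul, qf_one] at hz
    have : 4 / 9 * ‖z‖ ^ 2 < (r / 2) ^ 2 := by nlinarith [sq_nonneg ‖z‖]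
    by_contra hcon
    push Not at hcon
    have : (3 * r / 4) ^ 2 ≤ ‖z‖ ^ 2 := by gcongr
    nlinarith
  have F : Flat (ball 0 R) u f x (f x • (1 : Mat n)) (r / 2) (8 * δ) := by
    refine ⟨by positivity, PosDef.one.smul (by linarith), by rw [det_smul]; simp, fun z hz => hxb z (by linarith [hball z hz]), ?_⟩
    refine ⟨q + (x - xs), ⟪q, x - xs⟫ + k + ‖x - xs‖ ^ 2 / 2, fun z hz => ?_⟩
    have hz1 := hball z hz
    have h1 := hu _ (hxb z (by linarith))
    have h2 := hq (x - xs + z) (by linarith [norm_add_le (x - xs) z])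
    rw [show xs + (x - xs + z) = x + z by abel] at h2
    rw [qf_smul, qf_one]
    have h3 : ‖x - xs + z‖ ^ 2 = ‖x - xs‖ ^ 2 + 2 * ⟪x - xs, z⟫ + ‖z‖ ^ 2 := norm_add_sq_real _ _
    rw [h3, inner_add_right] at h2
    rw [inner_add_left]
    have h4 : |(f x - 1) * ‖z‖ ^ 2 / 2| ≤ ε := by
      rw [abs_div, abs_mul, abs_of_nonneg (sq_nonneg ‖z‖), abs_two]
      have : ‖z‖ ^ 2 ≤ 1 := by
        have : ‖z‖ ≤ 1 := by linarith
        nlinarith [norm_nonneg z]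
      have := mul_le_mul (hf x hxm) this (sq_nonneg _) hε0.le
      linarith
    rw [abs_le] at h1 h2 h4 ⊢
    constructor <;> linarith
  have key := F.iter I hn hs (by positivity) hδ0 (by linarith) J (fun z hz => by
    have h1 := abs_le.1 (hf z hz)
    have h2 : |f z - f x| ≤ 2 * ε := by rw [abs_le]; constructor <;> linarith
    refine h2.trans ?_
    have : ε0 * (8 * δ / 2 ^ J) * (1 / 2) ≤ ε0 * (8 * δ / 2 ^ J) * f x := by
      apply mulL (by linarith) (by positivity)
    linarith) J le_rfl
  obtain ⟨N, FN, hN⟩ := key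
  have hNv : ∀ v, qf N v ≤ (1 + 32 * C * δ) * ((1 + ε) * ‖v‖ ^ 2) := fun v => by
    refine (hN v).trans ?_
    rw [qf_smul, qf_one]
    have a1 : (1 : ℝ) + 4 * C * (8 * δ) * (1 - 1 / 2 ^ J) ≤ 1 + 32 * C * δ := by
      have : (0 : ℝ) ≤ 4 * C * (8 * δ) * (1 / 2 ^ J) := by positivity
      linarith
    have a2 : f x * ‖v‖ ^ 2 ≤ (1 + ε) * ‖v‖ ^ 2 := by
      apply mulR (by linarith) (sq_nonneg _)
    have a3 : 0 ≤ f x * ‖v‖ ^ 2 := mul_nonneg (by linarith) (sq_nonneg _)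
    calc _ ≤ (1 + 32 * C * δ) * (f x * ‖v‖ ^ 2) := mulR a1 a3
      _ ≤ _ := mulL a2 (by positivity)
  have hyN : qf N y < (μ ^ J * (r / 2)) ^ 2 := by
    have h1 := hNv y
    have h2 : (1 + 32 * C * δ) * ((1 + ε) * ‖y‖ ^ 2) ≤ 2 * (2 * ‖y‖ ^ 2) := by
      gcongr <;> linarith
    have h3 : (2 * ‖y‖) ^ 2 < (μ ^ J * (r / 2)) ^ 2 := by gcongr
    nlinarith
  obtain ⟨q', k', hest⟩ := FN.est
  have e1 := abs_le.1 (hest y hyN)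
  have e2 := abs_le.1 (hest (-y) (by rwa [qf_neg_vec]))
  have e3 := abs_le.1 (hest 0 (by rw [qf_zero]; have := FN.rpos; positivity))
  rw [qf_neg_vec, inner_neg_right] at e2
  rw [qf_zero, inner_zero_right] at e3
  have hsdu : sd u x y ≤ qf N y + 4 * (8 * δ / 2 ^ J * (μ ^ J * (r / 2)) ^ 2) := by
    unfold sd
    rw [sub_eq_add_neg x y]
    simp only [add_zero] at e3
    linarith
  have hcl := sd_close hu (x := x) (y := y) (by
    have := hxb 0
    calc ‖x‖ + ‖y‖ ≤ ‖xs‖ + ‖x - xs‖ + ‖y‖ := by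
          have : ‖x‖ ≤ ‖xs‖ + ‖x - xs‖ := by
            calc ‖x‖ = ‖xs + (x - xs)‖ := by congr 1; abel
              _ ≤ _ := norm_add_le _ _
          linarith
      _ < R := by linarith)
  have hsdw : sd w x y ≤ sd u x y + 4 * ε := by
    have := abs_le.1 hcl; linarith
  have hb : 8 * δ / 2 ^ J * (μ ^ J * (r / 2)) ^ 2 ≤ 8 * δ * (4 / μ ^ 2 * ‖y‖ ^ 2) := by
    have h1 : 8 * δ / 2 ^ J ≤ 8 * δ := div_le_self (by positivity) (one_le_pow₀ (by norm_num))
    have h2 : (μ ^ J * (r / 2)) ^ 2 ≤ 4 / μ ^ 2 * ‖y‖ ^ 2 := by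
      have h3 : μ ^ J * (r / 2) ≤ 2 * ‖y‖ / μ := by
        rw [le_div_iff₀ hm0]
        calc _ = μ ^ (J + 1) * (r / 2) := by rw [pow_succ]; ring
          _ ≤ _ := hJ2
      calc (μ ^ J * (r / 2)) ^ 2 ≤ (2 * ‖y‖ / μ) ^ 2 := by gcongr
        _ = _ := by ring
    gcongr
  have hfin : (1 + 32 * C * δ) * ((1 + ε) * ‖y‖ ^ 2) ≤ (1 + 64 * C * δ + 2 * δ + 0) * ‖y‖ ^ 2 := by
    rw [← mul_assoc]
    apply mulR _ (sq_nonneg _)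
    have h0 : 0 ≤ 32 * C * δ := by positivity
    have : (32 * C * δ) * ε ≤ 32 * C * δ * 1 := by gcongr; linarith
    nlinarith
  have := hNv y
  calc sd w x y ≤ (1 + 64 * C * δ + 2 * δ + 0) * ‖y‖ ^ 2 + 4 * (8 * δ * (4 / μ ^ 2 * ‖y‖ ^ 2)) + 4 * (δ * ‖y‖ ^ 2 / 4) := by linarith
    _ = (1 + (64 * C + 128 / μ ^ 2 + 3) * δ) * ‖y‖ ^ 2 := by ring
    _ ≤ _ := by gcongr; norm_num
set_option maxHeartbeats 800000 in
/-- strong minimum principle -/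
theorem smp (hn : n ≠ 0) {w : Euc n → ℝ} {R k : ℝ} {q : Euc n} (hw : Lim R w) (hc : ContinuousOn w (ball 0 R))
    (hz : ∀ x ∈ ball (0 : Euc n) R, w x ≤ ‖x‖ ^ 2 / 2 - (⟪q, x⟫ + k)) (h0 : w 0 = -k)
    {p : Euc n} (hp : ‖p‖ < R / 4) : w p = ‖p‖ ^ 2 / 2 - (⟪q, p⟫ + k) := by
  by_contra hne
  have hpR : p ∈ ball (0 : Euc n) R := by
    rw [mem_ball_zero_iff]; linarith [norm_nonneg p]
  have hp0 : p ≠ 0 := fun h => hne (by rw [h, h0]; simp)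
  have pp : 0 < ‖p‖ := norm_pos_iff.2 hp0
  set z : Euc n → ℝ := fun x => ‖x‖ ^ 2 / 2 - (⟪q, x⟫ + k) - w x with hzd
  have hzp : 0 < z p := by
    have := lt_of_le_of_ne (hz p hpR) hne
    simp only [hzd]; linarith
  have hzc : ContinuousOn z (ball 0 R) := by
    apply ContinuousOn.sub _ hc
    fun_prop
  obtain ⟨σ, hσ0, hσ1, hσ⟩ : ∃ σ > 0, σ ≤ ‖p‖ / 2 ∧ ∀ x, ‖x - p‖ < σ → z p / 2 < z x := by
    have h1 := (hzc.continuousAt (isOpen_ball.mem_nhds hpR)).eventually (lt_mem_nhds (show z p / 2 < z p by linarith))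
    obtain ⟨s, hs, hs1⟩ := Metric.eventually_nhds_iff.1 h1
    refine ⟨min s (‖p‖ / 2), by positivity, min_le_right _ _, fun x hx => hs1 ?_⟩
    rw [dist_eq_norm]; exact hx.trans_le (min_le_left _ _)
  have hn0 : (0 : ℝ) < n := by exact_mod_cast Nat.pos_of_ne_zero hn
  set m := z p / 2 with hm
  have hm0 : 0 < m := by positivity
  set α : ℝ := n / σ ^ 2 with hα
  have hα0 : 0 < α := by positivity
  set K0 := Real.exp (-α * (2 * ‖p‖) ^ 2) with hK
  have hK0 : 0 < K0 := Real.exp_pos _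
  set φ0 := Real.exp (-α * ‖(0 : Euc n) - p‖ ^ 2) - K0 with hφ0
  have hφp : 0 < φ0 := by
    rw [hφ0, hK, sub_pos]
    apply Real.exp_lt_exp.2
    rw [zero_sub, norm_neg]
    have : 0 < α * ‖p‖ ^ 2 := by positivity
    nlinarith
  set c := m / 2 with hcm
  have hc0 : 0 < c := by positivity
  set ε := min (min (1 / 2) (m / 8)) (min (c * φ0 / 4) (c * K0 * α)) with hε
  have hε0 : 0 < ε := by rw [hε]; positivity
  have hε1 : ε ≤ 1 / 2 := (min_le_left _ _).trans (min_le_left _ _)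
  have hε2 : ε ≤ m / 8 := (min_le_left _ _).trans (min_le_right _ _)
  have hε3 : ε ≤ c * φ0 / 4 := (min_le_right _ _).trans (min_le_left _ _)
  have hε4 : ε ≤ c * K0 * α := (min_le_right _ _).trans (min_le_right _ _)
  obtain ⟨u, f, hs, hf, hu⟩ := hw ε hε0
  set b : Euc n → ℝ := fun x => ‖x‖ ^ 2 / 2 - (⟪q, x⟫ + k) - c * (Real.exp (-α * ‖x - p‖ ^ 2) - K0) with hb
  have hbc : Continuous b := by simp only [hb]; fun_prop
  have hsub : closedBall p (2 * ‖p‖) ⊆ ball (0 : Euc n) R := fun x hx => by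
    rw [mem_ball_zero_iff]
    rw [mem_closedBall_iff_norm] at hx
    have : ‖x‖ ≤ ‖x - p‖ + ‖p‖ := by simpa using norm_add_le (x - p) p
    linarith
  have hcont : ContinuousOn (fun x => u x - b x) (closedBall p (2 * ‖p‖)) :=
    (hs.cont.mono hsub).sub hbc.continuousOn
  obtain ⟨y, hy, hmax⟩ := (isCompact_closedBall p (2 * ‖p‖)).exists_isMaxOn ⟨p, by simp⟩ hcont
  have hmax := isMaxOn_iff.1 hmax
  have h0m : (0 : Euc n) ∈ closedBall p (2 * ‖p‖) := by
    rw [mem_closedBall_iff_norm, zero_sub, norm_neg]; linarith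
  have hval := hmax 0 h0m
  have hu0 := abs_le.1 (hu 0 (hsub h0m))
  have huy := abs_le.1 (hu y (hsub hy))
  have hzy := hz y (hsub hy)
  have v0 : c * φ0 - ε ≤ u 0 - b 0 := by
    simp only [hb]; rw [← hφ0]; simp only [norm_zero, inner_zero_right]; rw [h0] at hu0; linarith
  have ey1 : Real.exp (-α * ‖y - p‖ ^ 2) ≤ 1 := by
    rw [Real.exp_le_one_iff]; nlinarith [sq_nonneg ‖y - p‖]
  have hy1 : σ ≤ ‖y - p‖ := by
    by_contra hcon
    push Not at hcon
    have h1 := hσ y hcon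
    have h2 : u y - b y ≤ ε - z y + c * (Real.exp (-α * ‖y - p‖ ^ 2) - K0) := by
      simp only [hb, hzd]; linarith
    have h3 : c * (Real.exp (-α * ‖y - p‖ ^ 2) - K0) ≤ c * 1 := by gcongr; linarith
    have h4 : 0 < c * φ0 := by positivity
    linarith
  have hy2 : ‖y - p‖ < 2 * ‖p‖ := by
    refine lt_of_le_of_ne (by rwa [mem_closedBall_iff_norm] at hy) fun hcon => ?_
    have h2 : u y - b y ≤ ε := by
      simp only [hb]; rw [hcon, ← hK]; linarith
    have h4 : 0 < c * φ0 := by positivity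
    linarith
  obtain ⟨H, hH1, hH2, hH3⟩ := hs.touch' (hsub hy) (b := b) (by
    filter_upwards [isOpen_ball.mem_nhds (show y ∈ ball p (2 * ‖p‖) by rwa [mem_ball_iff_norm])] with x hx
    exact hmax x (ball_subset_closedBall hx))
  set e := Real.exp (-α * ‖y - p‖ ^ 2) with he
  have hKe : K0 ≤ e := by
    apply Real.exp_le_exp.2
    have : ‖y - p‖ ^ 2 ≤ (2 * ‖p‖) ^ 2 := by gcongr
    nlinarith
  have hqf : ∀ v, qf H v ≤ qf ((1 + c * e * (2 * α)) • (1 : Mat n) - (c * e * (4 * α ^ 2)) • vecMulVec (y - p).ofLp (y - p).ofLp) v := by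
    intro v
    have e1 := P2.comp (F := Real.exp) (P2_exp _) ((P2_normsq (y - p) v).const_mul (-α))
    have e2 := (((P2_normsq y v).const_mul (1 / 2)).sub (Pea_affine q k y v)).sub ((e1.sub (P2_const K0)).const_mul c)
    have e3 := hH3 v _ _ ((e2.congr' (ψ := fun t => b (y + t • v)) (Eventually.of_forall fun t => by
      simp only [hb]
      rw [show y + t • v - p = y - p + t • v by abel]; ring)).of_eq (by simp only [hb]; ring) rfl rfl)
    rw [qf_sub, qf_smul, qf_smul, qf_one, qf_vec]
    refine e3.trans (le_of_eq ?_)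
    have : qf (0 : Mat n) v = 0 := qf_zero_mat v
    rw [this]
    ring_nf
    simp only [he]
    ring_nf
  have htr := trace_mul_mono (C := 1) PosSemidef.one hqf
  rw [Matrix.one_mul, Matrix.mul_sub, trace_sub, Matrix.mul_smul, Matrix.mul_smul, trace_smul, trace_smul, trace_vec, Matrix.one_mul, trace_one, qf_one, Fintype.card_fin] at htr
  have hfy := abs_le.1 (hf y (hsub hy))
  have ham := amgm_pd hH1 (hs.fpos y (hsub hy)) hH2
  have h1 : n * (1 - ε) ≤ n * f y := by gcongr; linarith
  simp only [smul_eq_mul] at htr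
  have h5 : n * 1 ≤ α * ‖y - p‖ ^ 2 := by
    have : (n : ℝ) = α * σ ^ 2 := by rw [hα]; field_simp
    rw [mul_one, this]; gcongr
  have h6 : c * e * (4 * α) * (n * 1) ≤ c * e * (4 * α) * (α * ‖y - p‖ ^ 2) := by gcongr
  have h7 : c * K0 * α ≤ c * e * α := by gcongr
  have h8 : 0 < n * (c * e * α) := by positivity
  have h9 : n * ε ≤ n * (c * e * α) := by gcongr; linarith
  linarith
theorem Lim.convexOn {r : ℝ} {w : Euc n → ℝ} (h : Lim r w) : ConvexOn ℝ (ball 0 r) w := by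
  refine ⟨convex_ball _ _, fun x hx y hy a b ha hb hab => ?_⟩
  refine le_of_forall_pos_le_add fun ε hε => ?_
  obtain ⟨u, f, h1, h2, h3⟩ := h (ε / 2) (by positivity)
  have e1 := h1.cvx.2 hx hy ha hb hab
  have e2 := abs_le.1 (h3 x hx)
  have e3 := abs_le.1 (h3 y hy)
  have e4 := abs_le.1 (h3 _ (convex_ball (0 : Euc n) r hx hy ha hb hab))
  simp only [smul_eq_mul] at e1 ⊢
  have e5 : a * u x ≤ a * (w x + ε / 2) := by gcongr; linarith
  have e6 : b * u y ≤ b * (w y + ε / 2) := by gcongr; linarith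
  have e7 : a * (ε / 2) + b * (ε / 2) = ε / 2 := by rw [← add_mul, hab, one_mul]
  linarith

theorem Lim.cont {r : ℝ} {w : Euc n → ℝ} (h : Lim r w) : ContinuousOn w (ball 0 r) :=
  h.convexOn.continuousOn isOpen_ball

theorem Lim.affine {r r' : ℝ} {w : Euc n → ℝ} (h : Lim r w) (hn : n ≠ 0) {L : Mat n} (hL : IsUnit L) (q : Euc n) (k : ℝ) {c d : ℝ}
    (hc : 0 < c) (hd : 0 < d) (hcd : c * d = 1) (hdd : d ^ n = L.det ^ 2) (hr : ∀ x, ‖x‖ < r' → ‖app L x‖ < r) :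
    Lim r' (fun x => c * w (app L x) + (⟪q, x⟫ + k)) := by
  intro ε hε
  obtain ⟨u, f, h1, h2, h3⟩ := h (min ε (ε / c)) (by positivity)
  have h4 := h1.affine hn hL 0 q k hc hd hdd
  have hb : ∀ x ∈ ball (0 : Euc n) r', app L x ∈ ball (0 : Euc n) r := fun x hx => by
    rw [mem_ball_zero_iff] at hx ⊢; exact hr x hx
  refine ⟨_, _, h4.mono isOpen_ball (convex_ball _ _) (fun x hx => by
    simpa using hr x (by simpa using hx)), fun x hx => ?_, fun x hx => ?_⟩
  · rw [hcd, one_mul, add_zero]; exact (h2 _ (hb x hx)).trans (min_le_left _ _)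
  · have := (h3 _ (hb x hx)).trans (min_le_right _ _)
    rw [add_zero, show c * u (app L x) + (⟪q, x⟫ + k) - (c * w (app L x) + (⟪q, x⟫ + k)) = c * (u (app L x) - w (app L x)) by ring, abs_mul, abs_of_pos hc]
    rw [le_div_iff₀ hc] at this; linarith

theorem Lim.of_close {r : ℝ} {w : Euc n → ℝ} (h : ∀ ε > 0, ∃ w', Lim r w' ∧ ∀ x ∈ ball (0 : Euc n) r, |w' x - w x| ≤ ε) : Lim r w := by
  intro ε hε
  obtain ⟨w', h1, h2⟩ := h (ε / 2) (by positivity)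
  obtain ⟨u, f, e1, e2, e3⟩ := h1 (ε / 2) (by positivity)
  refine ⟨u, f, e1, fun x hx => (e2 x hx).trans (by linarith), fun x hx => ?_⟩
  have a1 := abs_le.1 (e3 x hx)
  have a2 := abs_le.1 (h2 x hx)
  rw [abs_le]; constructor <;> linarith

/-- pointwise convergence of equi-Lipschitz functions is uniform -/
theorem unif_of_lip {ι : Type*} {F : Filter ι} {g : ι → Euc n → ℝ} {g0 : Euc n → ℝ} {R K : ℝ} (hK : 0 < K)
    (hl : ∀ᶠ j in F, ∀ x y : Euc n, ‖x‖ ≤ R → ‖y‖ ≤ R → |g j x - g j y| ≤ K * ‖x - y‖)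
    (hp : ∀ x : Euc n, ‖x‖ ≤ R → Tendsto (fun j => g j x) F (𝓝 (g0 x))) [F.NeBot] {ε : ℝ} (hε : 0 < ε) :
    ∀ᶠ j in F, ∀ x : Euc n, ‖x‖ ≤ R → |g j x - g0 x| ≤ ε := by
  have hl0 : ∀ x y : Euc n, ‖x‖ ≤ R → ‖y‖ ≤ R → |g0 x - g0 y| ≤ K * ‖x - y‖ := fun x y hx hy =>
    le_of_tendsto (((hp x hx).sub (hp y hy)).abs) (hl.mono fun j hj => hj x y hx hy)
  obtain ⟨t, ht1, ht2, ht3⟩ := _root_.finite_cover_balls_of_compact (isCompact_closedBall (0 : Euc n) R) (show 0 < ε / (3 * K) by positivity)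
  have h1 : ∀ᶠ j in F, ∀ x ∈ t, |g j x - g0 x| ≤ ε / 3 := by
    rw [Filter.eventually_all_finite ht2]
    intro x hx
    have := (hp x (by simpa using ht1 hx)).eventually (Metric.closedBall_mem_nhds _ (show 0 < ε / 3 by positivity))
    filter_upwards [this] with j hj
    simpa [Real.dist_eq] using hj
  filter_upwards [h1, hl] with j hj1 hj2 x hx
  have hxm := ht3 (show x ∈ closedBall (0 : Euc n) R by simpa using hx)
  simp only [Set.mem_iUnion, exists_prop] at hxm
  obtain ⟨y, hy, hxy⟩ := hxm
  rw [mem_ball_iff_norm] at hxy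
  have hyR : ‖y‖ ≤ R := by simpa using ht1 hy
  have a1 := abs_le.1 (hj2 x y hx hyR)
  have a2 := abs_le.1 (hl0 x y hx hyR)
  have a3 := abs_le.1 (hj1 y hy)
  have a4 : K * ‖x - y‖ ≤ ε / 3 := by
    calc _ ≤ K * (ε / (3 * K)) := by gcongr
      _ = _ := by field_simp
  rw [abs_le]; constructor <;> linarith

theorem Lim.subgrad {r : ℝ} {w : Euc n → ℝ} (h : Lim r w) {x : Euc n} (hx : ‖x‖ < r) :
    ∃ p : Euc n, ∀ y, ‖x + y‖ < r → w x + ⟪p, y⟫ ≤ w (x + y) := by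
  have hxb : x ∈ ball (0 : Euc n) r := by simpa using hx
  set s := (r - ‖x‖) / 2 with hs
  have hs0 : 0 < s := by rw [hs]; linarith
  have hsub : ∀ y, ‖y‖ ≤ s → x + y ∈ ball (0 : Euc n) r := fun y hy => by
    rw [mem_ball_zero_iff]; linarith [norm_add_le x y]
  obtain ⟨M, hM⟩ := (isCompact_closedBall x s).exists_bound_of_continuousOn (f := w) (h.cont.mono (fun z hz => by
    have := hsub (z - x) (mem_closedBall_iff_norm.1 hz)
    simpa using this))
  have key : ∀ j : ℕ, ∃ g : Euc n, ‖g‖ ≤ (2 * M + 2) / s ∧ ∀ y, ‖x + y‖ < r → w x + ⟪g, y⟫ ≤ w (x + y) + 2 / (j + 1) := fun j => by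
    obtain ⟨u, f, h1, h2, h3⟩ := h (1 / (j + 1)) (by positivity)
    obtain ⟨g, H, hg, -, -⟩ := h1.pea x hxb
    have h4 : ∀ y, ‖x + y‖ < r → w x + ⟪g, y⟫ ≤ w (x + y) + 2 / (j + 1) := fun y hy => by
      have hyb : x + y ∈ ball (0 : Euc n) r := by simpa using hy
      have a0 := Pea.tangent h1.cvx hg hxb hyb
      have a1 := abs_le.1 (h3 x hxb)
      have a2 := abs_le.1 (h3 _ hyb)
      have : (2 : ℝ) / (j + 1) = 1 / (j + 1) + 1 / (j + 1) := by ring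
      rw [add_sub_cancel_left] at a0
      linarith
    refine ⟨g, ?_, h4⟩
    rcases eq_or_ne g 0 with rfl | hg0
    · have : 0 ≤ M := (norm_nonneg _).trans (hM x (by simp [hs0.le]))
      rw [norm_zero]; positivity
    have gp : 0 < ‖g‖ := norm_pos_iff.2 hg0
    have hn1 : ‖(s / ‖g‖) • g‖ ≤ s := by
      rw [norm_smul, Real.norm_of_nonneg (by positivity)]; field_simp; exact le_rfl
    have a1 := h4 ((s / ‖g‖) • g) (by simpa using hsub _ hn1)
    rw [inner_smul_right, real_inner_self_eq_norm_sq] at a1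
    have a2 := abs_le.1 (hM x (by simp [hs0.le]))
    have a3 := abs_le.1 (hM (x + (s / ‖g‖) • g) (by rw [mem_closedBall_iff_norm]; simpa using hn1))
    have a4 : s / ‖g‖ * ‖g‖ ^ 2 = ‖g‖ * s := by field_simp
    have a5 : (2 : ℝ) / (j + 1) ≤ 2 := div_le_self (by norm_num) (by linarith [Nat.cast_nonneg (α := ℝ) j])
    rw [le_div_iff₀ hs0]
    linarith
  choose g hg1 hg2 using key
  obtain ⟨p, -, φ, hφ, hlim⟩ := (isCompact_closedBall (0 : Euc n) ((2 * M + 2) / s)).tendsto_subseq (x := g) (fun j => by simpa using hg1 j)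
  refine ⟨p, fun y hy => ?_⟩
  have t1 : Tendsto (fun j => w x + ⟪g (φ j), y⟫) atTop (𝓝 (w x + ⟪p, y⟫)) :=
    tendsto_const_nhds.add (hlim.inner tendsto_const_nhds)
  have t2 : Tendsto (fun j : ℕ => w (x + y) + 2 / (((φ j : ℕ) : ℝ) + 1)) atTop (𝓝 (w (x + y) + 0)) := by
    refine tendsto_const_nhds.add ?_
    have := (tendsto_one_div_add_atTop_nhds_zero_nat (𝕜 := ℝ)).const_mul 2 |>.comp hφ.tendsto_atTop
    refine this.congr' ?_ |>.trans (by simp)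
    exact Eventually.of_forall fun j => by simp; ring
  have := le_of_tendsto_of_tendsto' t1 t2 (fun j => hg2 (φ j) y hy)
  simpa using this
theorem peano_pt {w : Euc n → ℝ} {Λ η : ℝ} (hΛ : 0 < Λ) (hw : ∀ R, Lim R w) (hsd : ∀ x y, sd w x y ≤ Λ * ‖y‖ ^ 2) (hη : 0 < η) :
    ∃ xs : Euc n, ‖xs‖ < η ∧ ∃ (Q : Mat n) (g : Euc n), Qᵀ = Q ∧ ∀ τ > 0, ∃ s > 0, ∀ y : Euc n, ‖y‖ ≤ s →
      |w (xs + y) - w xs - ⟪g, y⟫ - qf Q y / 2| ≤ τ * ‖y‖ ^ 2 := by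
  have hp : ∀ x : Euc n, ∃ p : Euc n, ∀ y, w x + ⟪p, y⟫ ≤ w (x + y) ∧ w (x + y) ≤ w x + ⟪p, y⟫ + Λ * ‖y‖ ^ 2 := fun x => by
    have key : ∀ R : ℕ, ∃ p : Euc n, ‖x‖ + R + 1 > 0 ∧ ∀ y, ‖y‖ ≤ R → w x + ⟪p, y⟫ ≤ w (x + y) := fun R => by
      obtain ⟨p, hp⟩ := (hw (‖x‖ + R + 1)).subgrad (x := x) (by linarith [Nat.cast_nonneg (α := ℝ) R])
      exact ⟨p, by positivity, fun y hy => hp y (by linarith [norm_add_le x y])⟩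
    choose p hp0 hp using key
    have hup : ∀ R : ℕ, ∀ y, ‖y‖ ≤ R → w (x + y) ≤ w x + ⟪p R, y⟫ + Λ * ‖y‖ ^ 2 := fun R y hy => by
      have h1 := hp R (-y) (by simpa using hy)
      have h2 := hsd x y
      rw [inner_neg_right, ← sub_eq_add_neg x y] at h1
      unfold sd at h2; linarith
    -- all subgradients coincide
    have huniq : ∀ R : ℕ, 1 ≤ R → p R = p 1 := fun R hR => by
      by_contra hne
      have hd : 0 < ‖p R - p 1‖ := norm_pos_iff.2 (sub_ne_zero.2 hne)
      set d := p R - p 1 with hd'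
      set t := min (1 / ‖d‖) (1 / (2 * Λ)) with ht
      have ht0 : 0 < t := by positivity
      have ht1 : t * ‖d‖ ≤ 1 := by
        calc _ ≤ 1 / ‖d‖ * ‖d‖ := by gcongr; exact min_le_left _ _
          _ = 1 := by field_simp
      have ht2 : Λ * t ≤ 1 / 2 := by
        calc _ ≤ Λ * (1 / (2 * Λ)) := by gcongr; exact min_le_right _ _
          _ = 1 / 2 := by field_simp
      have hnt : ‖t • d‖ = t * ‖d‖ := by rw [norm_smul, Real.norm_of_nonneg ht0.le]
      have hR' : (1 : ℝ) ≤ R := by exact_mod_cast hR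
      have a1 := hp R (t • d) (by rw [hnt]; linarith)
      have a2 := hup 1 (t • d) (by rw [hnt]; simpa using ht1)
      have a3 : ⟪p R, t • d⟫ - ⟪p 1, t • d⟫ = t * ‖d‖ ^ 2 := by
        rw [← inner_sub_left, ← hd', inner_smul_right, real_inner_self_eq_norm_sq]
      rw [hnt] at a2
      have a4 : Λ * (t * ‖d‖) ^ 2 = (Λ * t) * (t * ‖d‖ ^ 2) := by ring
      have a5 : (Λ * t) * (t * ‖d‖ ^ 2) ≤ 1 / 2 * (t * ‖d‖ ^ 2) := by gcongr
      have a6 : 0 < t * ‖d‖ ^ 2 := by positivity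
      linarith
    refine ⟨p 1, fun y => ?_⟩
    obtain ⟨R, hR⟩ := exists_nat_ge ‖y‖
    have hy : ‖y‖ ≤ ((max R 1 : ℕ) : ℝ) := hR.trans (by exact_mod_cast le_max_left _ _)
    have h1 := hp _ y hy
    have h2 := hup _ y hy
    rw [huniq _ (le_max_right _ _)] at h1 h2
    exact ⟨h1, h2⟩
  choose p hp using hp
  have hlip : ∀ x y : Euc n, ‖p (x + y) - p x‖ ≤ 4 * Λ * ‖y‖ := fun x y => by
    rcases eq_or_ne (p (x + y) - p x) 0 with h0 | h0
    · rw [h0, norm_zero]; positivity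
    set d := p (x + y) - p x with hd
    have dp : 0 < ‖d‖ := norm_pos_iff.2 h0
    set z : Euc n := (‖y‖ / ‖d‖) • d with hz
    have hzn : ‖z‖ = ‖y‖ := by
      rw [hz, norm_smul, Real.norm_of_nonneg (by positivity)]; field_simp
    have a1 := (hp (x + y) z).1
    have a2 := (hp x y).1
    have a3 := (hp x (y + z)).2
    rw [← add_assoc, inner_add_right] at a3
    have a4 : ⟪p (x + y), z⟫ - ⟪p x, z⟫ = ‖y‖ * ‖d‖ := by
      rw [← inner_sub_left, ← hd, hz, inner_smul_right, real_inner_self_eq_norm_sq]; field_simp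
    have a5 : ‖y + z‖ ^ 2 ≤ (2 * ‖y‖) ^ 2 := by
      have := norm_add_le y z; rw [hzn] at this
      gcongr; linarith
    have a6 : Λ * ‖y + z‖ ^ 2 ≤ Λ * (2 * ‖y‖) ^ 2 := by gcongr
    rcases eq_or_ne y 0 with rfl | hy
    · simp [hd] at h0
    have yp : 0 < ‖y‖ := norm_pos_iff.2 hy
    have : ‖y‖ * ‖d‖ ≤ ‖y‖ * (4 * Λ * ‖y‖) := by nlinarith
    exact le_of_mul_le_mul_left this yp
  have hL : LipschitzWith (Real.toNNReal (4 * Λ)) p := by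
    refine LipschitzWith.of_dist_le_mul fun x y => ?_
    have := hlip y (x - y)
    rw [add_sub_cancel] at this
    rw [Real.coe_toNNReal _ (by positivity), dist_eq_norm, dist_eq_norm]; exact this
  obtain ⟨xs, hxs, hxd⟩ : ∃ xs : Euc n, ‖xs‖ < η ∧ DifferentiableAt ℝ p xs := by
    by_contra hcon
    push Not at hcon
    have hae := hL.ae_differentiableAt (μ := (volume : Measure (Euc n)))
    have hnull : (volume : Measure (Euc n)) (ball 0 η) = 0 := by
      refine measure_mono_null (fun x hx => ?_) (ae_iff.1 hae)
      exact hcon x (by simpa using hx)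
    exact (Metric.measure_ball_pos volume (0 : Euc n) hη).ne' hnull
  set D := fderiv ℝ p xs with hD
  set M : Mat n := Matrix.toEuclideanLin.symm D.toLinearMap with hM
  have hMD : ∀ y, app M y = D y := fun y => by
    have : Matrix.toEuclideanLin M = D.toLinearMap := by rw [hM]; simp
    have h2 := congrArg (fun l => l y) this
    exact h2
  set Q : Mat n := (1 / 2 : ℝ) • (M + Mᵀ) with hQ
  have hQq : ∀ y, qf Q y = ⟪D y, y⟫ := fun y => by
    rw [hQ, qf_smul, qf_add, qf_eq_inner, qf_eq_inner, inner_app Mᵀ, transpose_transpose, hMD, real_inner_comm]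
    ring
  refine ⟨xs, hxs, Q, p xs, by rw [hQ, transpose_smul, transpose_add, transpose_transpose, add_comm], fun τ hτ => ?_⟩
  have hdo := hxd.hasFDerivAt.isLittleO
  have hev := (hasFDerivAt_iff_isLittleO_nhds_zero.1 hxd.hasFDerivAt).def hτ
  obtain ⟨s, hs, hs1⟩ := Metric.eventually_nhds_iff.1 hev
  refine ⟨s / 2, by positivity, fun y hy => ?_⟩
  have hwd : ∀ x, HasFDerivAt w (innerSL ℝ (p x)) x := fun x => by
    rw [hasFDerivAt_iff_isLittleO_nhds_zero]
    have h1 : (fun h : Euc n => w (x + h) - w x - innerSL ℝ (p x) h) =O[𝓝 0] fun h : Euc n => ‖h‖ ^ 2 := by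
      refine IsBigO.of_bound Λ (Eventually.of_forall fun h => ?_)
      have := hp x h
      rw [innerSL_apply_apply, Real.norm_eq_abs, Real.norm_of_nonneg (sq_nonneg _), abs_le]
      have : 0 ≤ Λ * ‖h‖ ^ 2 := by positivity
      constructor <;> linarith
    exact h1.trans_isLittleO (isLittleO_norm_pow_id one_lt_two)
  have hder : ∀ t : ℝ, HasDerivAt (fun t : ℝ => w (xs + t • y) - t * ⟪p xs, y⟫ - t ^ 2 / 2 * qf Q y) (⟪p (xs + t • y), y⟫ - ⟪p xs, y⟫ - t * qf Q y) t := fun t => by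
    have h1 : HasDerivAt (fun t : ℝ => xs + t • y) y t := by
      simpa using ((hasDerivAt_id t).smul_const y).const_add xs
    have h2 := (hwd (xs + t • y)).comp_hasDerivAt t h1
    have h3 := (h2.sub ((hasDerivAt_id t).mul_const ⟪p xs, y⟫)).sub ((((hasDerivAt_id t).pow 2).div_const 2).mul_const (qf Q y))
    refine h3.congr_deriv ?_
    simp
  have hmv := norm_image_sub_le_of_norm_deriv_le_segment_01' (f := fun t : ℝ => w (xs + t • y) - t * ⟪p xs, y⟫ - t ^ 2 / 2 * qf Q y) (C := τ * ‖y‖ ^ 2)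
    (fun t ht => (hder t).hasDerivWithinAt) (fun t ht => by
      have hty : ‖t • y‖ ≤ ‖y‖ := by
        rw [norm_smul, Real.norm_of_nonneg ht.1]
        nlinarith [norm_nonneg y, ht.2]
      have h1 := hs1 (y := t • y) (by rw [dist_zero_right]; linarith)
      have e : ⟪p (xs + t • y), y⟫ - ⟪p xs, y⟫ - t * qf Q y = ⟪p (xs + t • y) - p xs - D (t • y), y⟫ := by
        rw [inner_sub_left, inner_sub_left, hQq, map_smul, inner_smul_left]; simp
      rw [e]
      refine (norm_inner_le_norm _ _).trans ?_
      calc _ ≤ τ * ‖t • y‖ * ‖y‖ := by gcongr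
        _ ≤ τ * ‖y‖ * ‖y‖ := by gcongr
        _ = _ := by ring)
  simp only [one_smul, zero_smul, add_zero, Real.norm_eq_abs] at hmv
  refine le_trans (le_of_eq ?_) hmv
  congr 1; ring

theorem det_shift_tendsto (Q : Mat n) (a : ℝ) : Tendsto (fun τ : ℝ => (Q + (a * τ) • (1 : Mat n)).det) (𝓝[>] 0) (𝓝 Q.det) := by
  have : Continuous (fun τ : ℝ => (Q + (a * τ) • (1 : Mat n)).det) := by
    apply Continuous.matrix_det
    fun_prop
  have h := (this.tendsto 0).mono_left (nhdsWithin_le_nhds (s := Set.Ioi 0))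
  simpa using h

theorem qf_add_vec {Q : Mat n} (hQ : Qᵀ = Q) (a b : Euc n) : qf Q (a + b) = qf Q a + 2 * ⟪b, app Q a⟫ + qf Q b := by
  have h : ⟪a, app Q b⟫ = ⟪b, app Q a⟫ := by rw [inner_app, hQ, real_inner_comm]
  rw [qf_eq_inner, app_add, inner_add_left, inner_add_right, inner_add_right, h, qf_eq_inner, qf_eq_inner]; ring

theorem Pea_quad (Q : Mat n) (g xs : Euc n) (k a : ℝ) (z v : Euc n) (hQ : Qᵀ = Q) :
    P2 (fun t : ℝ => k + ⟪g, z + t • v - xs⟫ + qf Q (z + t • v - xs) / 2 + a * ‖z + t • v - xs‖ ^ 2)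
      (k + ⟪g, z - xs⟫ + qf Q (z - xs) / 2 + a * ‖z - xs‖ ^ 2) (⟪g, v⟫ + ⟪v, app Q (z - xs)⟫ + a * (2 * ⟪z - xs, v⟫)) (qf (Q + (2 * a) • (1 : Mat n)) v) := by
  refine (P2_quad (k + ⟪g, z - xs⟫ + qf Q (z - xs) / 2 + a * ‖z - xs‖ ^ 2) (⟪g, v⟫ + ⟪v, app Q (z - xs)⟫ + a * (2 * ⟪z - xs, v⟫)) (qf (Q + (2 * a) • (1 : Mat n)) v)).congr' (Eventually.of_forall fun t => ?_)
  simp only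
  rw [show z + t • v - xs = (z - xs) + t • v by abel, norm_add_sq_real, qf_add, qf_smul, qf_one]
  have e : qf Q (z - xs + t • v) = qf Q (z - xs) + 2 * t * ⟪v, app Q (z - xs)⟫ + t ^ 2 * qf Q v := by
    rw [qf_add_vec hQ, qf_smul_vec, inner_smul_left]; simp; ring
  rw [e, norm_smul, inner_smul_right, inner_add_right, inner_smul_right, mul_pow, Real.norm_eq_abs, sq_abs]; ring

/-- touching from above near a Peano point -/
theorem peano_above {w : Euc n → ℝ} (hw : ∀ R, Lim R w) {xs g : Euc n} {Q : Mat n} (hQ : Qᵀ = Q)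
    (hpe : ∀ τ > 0, ∃ s > 0, ∀ y : Euc n, ‖y‖ ≤ s → |w (xs + y) - w xs - ⟪g, y⟫ - qf Q y / 2| ≤ τ * ‖y‖ ^ 2) {τ : ℝ} (hτ : 0 < τ) (sgn : ℝ) (hsgn : sgn = 1 ∨ sgn = -1) :
    ∃ (H : Mat n) (f : ℝ), H.PosDef ∧ |f - 1| ≤ τ ∧ 0 < f ∧ H.det = f ^ n ∧ ∀ v, sgn * qf H v ≤ sgn * qf Q v + 4 * τ * ‖v‖ ^ 2 := by
  obtain ⟨s, hs, hs1⟩ := hpe τ hτ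
  obtain ⟨u, f, h1, h2, h3⟩ := hw (‖xs‖ + s + 1) (min τ (τ * s ^ 2 / 4)) (by positivity)
  have hsub : closedBall xs s ⊆ ball (0 : Euc n) (‖xs‖ + s + 1) := fun x hx => by
    rw [mem_ball_zero_iff]
    rw [mem_closedBall_iff_norm] at hx
    have : ‖x‖ ≤ ‖x - xs‖ + ‖xs‖ := by simpa using norm_add_le (x - xs) xs
    linarith
  have hs2 : sgn * sgn = 1 := by rcases hsgn with h | h <;> rw [h] <;> norm_num
  set b : Euc n → ℝ := fun x => w xs + ⟪g, x - xs⟫ + qf Q (x - xs) / 2 + (sgn * (2 * τ)) * ‖x - xs‖ ^ 2 with hb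
  have hqc := qf_cont Q
  have hbc : Continuous b := by
    have : Continuous fun x => qf Q (x - xs) := hqc.comp (continuous_id.sub continuous_const)
    simp only [hb]; fun_prop
  have hcont : ContinuousOn (fun x => sgn * (u x - b x)) (closedBall xs s) :=
    continuousOn_const.mul ((h1.cont.mono hsub).sub hbc.continuousOn)
  obtain ⟨y, hy, hmax⟩ := (isCompact_closedBall xs s).exists_isMaxOn ⟨xs, by simp [hs.le]⟩ hcont
  have hmax := isMaxOn_iff.1 hmax
  have hyn := mem_closedBall_iff_norm.1 hy
  have hin : ‖y - xs‖ < s := by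
    refine lt_of_le_of_ne hyn fun hcon => ?_
    have hv := hmax xs (by simp [hs.le])
    have a1 := abs_le.1 ((h3 xs (hsub (by simp [hs.le]))).trans (min_le_right _ _))
    have a2 := abs_le.1 ((h3 y (hsub hy)).trans (min_le_right _ _))
    have a3 := abs_le.1 (hs1 (y - xs) hyn)
    rw [add_sub_cancel, hcon] at a3
    simp only [hb, sub_self, inner_zero_right, qf_zero, norm_zero] at hv
    rw [hcon] at hv
    have : 0 < τ * s ^ 2 := by positivity
    rcases hsgn with h | h <;> rw [h] at hv <;> linarith
  have hnear : ∀ᶠ x in 𝓝 y, sgn * (u x - b x) ≤ sgn * (u y - b y) := by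
    filter_upwards [isOpen_ball.mem_nhds (show y ∈ ball xs s by rwa [mem_ball_iff_norm])] with x hx
    exact hmax x (ball_subset_closedBall hx)
  have hfy := (h2 y (hsub hy)).trans (min_le_left _ _)
  rcases hsgn with h | h
  · obtain ⟨H, hH1, hH2, hH3⟩ := h1.touch' (hsub hy) (b := b) (by simpa [h] using hnear)
    refine ⟨H, f y, hH1, hfy, h1.fpos _ (hsub hy), hH2, fun v => ?_⟩
    have := hH3 v _ _ (Pea_quad Q g xs (w xs) _ y v hQ)
    rw [qf_add, qf_smul, qf_one, h] at this
    rw [h]; linarith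
  · obtain ⟨H, hH1, hH2, hH3⟩ := h1.touch (hsub hy) (b := b) (by
      filter_upwards [hnear] with x hx
      rw [h] at hx; linarith)
    refine ⟨H, f y, hH1, hfy, h1.fpos _ (hsub hy), hH2, fun v => ?_⟩
    have := hH3 v _ _ (Pea_quad Q g xs (w xs) _ y v hQ)
    rw [qf_add, qf_smul, qf_one, h] at this
    rw [h]; linarith

theorem peano_det (hn : n ≠ 0) {w : Euc n → ℝ} {Λ : ℝ} (hw : ∀ R, Lim R w) (hsd : ∀ x y, sd w x y ≤ Λ * ‖y‖ ^ 2) {xs g : Euc n} {Q : Mat n} (hQ : Qᵀ = Q)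
    (hpe : ∀ τ > 0, ∃ s > 0, ∀ y : Euc n, ‖y‖ ≤ s → |w (xs + y) - w xs - ⟪g, y⟫ - qf Q y / 2| ≤ τ * ‖y‖ ^ 2) :
    Q.PosDef ∧ Q.det = 1 ∧ ∀ v, qf Q v ≤ Λ * ‖v‖ ^ 2 := by
  have hup : ∀ v, qf Q v ≤ Λ * ‖v‖ ^ 2 := fun v => by
    refine le_of_forall_pos_le_add fun ε hε => ?_
    rcases eq_or_ne v 0 with rfl | hv
    · simp [qf_zero]; exact hε.le
    have vp : 0 < ‖v‖ := norm_pos_iff.2 hv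
    obtain ⟨s, hs, hs1⟩ := hpe (ε / (2 * ‖v‖ ^ 2)) (by positivity)
    set t := s / ‖v‖ with ht
    have htp : 0 < t := by positivity
    have htn : ‖t • v‖ = s := by rw [norm_smul, Real.norm_of_nonneg htp.le, ht]; field_simp
    have a1 := abs_le.1 (hs1 (t • v) htn.le)
    have a2 := abs_le.1 (hs1 (-(t • v)) (by rw [norm_neg]; exact htn.le))
    have a3 := hsd xs (t • v)
    unfold sd at a3
    rw [← sub_eq_add_neg, inner_neg_right, qf_neg_vec, norm_neg] at a2
    rw [qf_smul_vec] at a1 a2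
    have e1 : ‖t • v‖ ^ 2 = t ^ 2 * ‖v‖ ^ 2 := by rw [norm_smul, mul_pow, Real.norm_eq_abs, sq_abs]
    rw [e1] at a1 a2 a3
    have e2 : ε / (2 * ‖v‖ ^ 2) * (t ^ 2 * ‖v‖ ^ 2) = t ^ 2 * (ε / 2) := by field_simp
    rw [e2] at a1 a2
    have : t ^ 2 * qf Q v ≤ t ^ 2 * (Λ * ‖v‖ ^ 2 + ε) := by linarith
    exact le_of_mul_le_mul_left this (by positivity)
  have hpos : ∀ v, 0 ≤ qf Q v := fun v => by
    have : ∀ τ > 0, 0 ≤ qf Q v + τ * (4 * ‖v‖ ^ 2) := fun τ hτ => by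
      obtain ⟨H, f, hH, -, -, -, h5⟩ := peano_above hw hQ hpe hτ 1 (Or.inl rfl)
      have := h5 v
      have h6 := ((posSemidef_iff_qf H).1 hH.posSemidef).2 v
      linarith
    refine le_of_forall_pos_le_add fun ε hε => ?_
    have h1 := this (ε / (4 * ‖v‖ ^ 2 + 1)) (by positivity)
    have h2 : ε / (4 * ‖v‖ ^ 2 + 1) * (4 * ‖v‖ ^ 2) ≤ ε := by
      rw [div_mul_eq_mul_div, div_le_iff₀ (by positivity)]; nlinarith
    linarith
  have hsymm : ∀ a : ℝ, (Q + a • (1 : Mat n))ᵀ = Q + a • (1 : Mat n) := fun a => by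
    rw [transpose_add, transpose_smul, transpose_one, hQ]
  have t1 : Tendsto (fun τ : ℝ => (1 - τ) ^ n) (𝓝[>] 0) (𝓝 1) := by
    have : Continuous (fun τ : ℝ => (1 - τ) ^ n) := by fun_prop
    simpa using (this.tendsto 0).mono_left (nhdsWithin_le_nhds (s := Set.Ioi 0))
  have t2 : Tendsto (fun τ : ℝ => (1 + τ) ^ n) (𝓝[>] 0) (𝓝 1) := by
    have : Continuous (fun τ : ℝ => (1 + τ) ^ n) := by fun_prop
    simpa using (this.tendsto 0).mono_left (nhdsWithin_le_nhds (s := Set.Ioi 0))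
  have hd1 : 1 ≤ Q.det := by
    refine le_of_tendsto_of_tendsto t1 (det_shift_tendsto Q 4) ?_
    filter_upwards [Ioo_mem_nhdsGT (show (0 : ℝ) < 1 by norm_num)] with τ hτ
    obtain ⟨H, f, hH, hf, hf0, hd, h5⟩ := peano_above hw hQ hpe hτ.1 1 (Or.inl rfl)
    have hle : ∀ v, qf H v ≤ qf (Q + (4 * τ) • (1 : Mat n)) v := fun v => by
      rw [qf_add, qf_smul, qf_one]; linarith [h5 v]
    have hpd : (Q + (4 * τ) • (1 : Mat n)).PosDef := by
      rw [posDef_iff_qf]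
      exact ⟨hsymm _, fun v hv => (((posDef_iff_qf H).1 hH).2 v hv).trans_le (hle v)⟩
    have := det_mono hH hpd hle
    rw [hd] at this
    refine le_trans ?_ this
    have := abs_le.1 hf
    exact pow_le_pow_left₀ (by linarith [hτ.2]) (by linarith) n
  have hQp : Q.PosDef := by
    have hps : Q.PosSemidef := (posSemidef_iff_qf Q).2 ⟨hQ, hpos⟩
    exact hps.posDef_iff_isUnit.2 ((isUnit_iff_isUnit_det _).2 (isUnit_iff_ne_zero.2 (by linarith)))
  have hΛ : ∃ T > 0, ∀ v, qf Q v ≤ T * ‖v‖ ^ 2 := ⟨max Λ 1, by positivity, fun v => (hup v).trans (by gcongr; exact le_max_left _ _)⟩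
  obtain ⟨T, hT, hTv⟩ := hΛ
  have hlow := pd_lower hQp hT one_pos hTv hd1
  set m := 1 / T ^ (n - 1) with hm
  have hm0 : 0 < m := by positivity
  refine ⟨hQp, le_antisymm ?_ hd1, hup⟩
  refine le_of_tendsto_of_tendsto (det_shift_tendsto Q (-4)) t2 ?_
  filter_upwards [Ioo_mem_nhdsGT (show (0 : ℝ) < m / 8 by positivity)] with τ hτ
  obtain ⟨H, f, hH, hf, hf0, hd, h5⟩ := peano_above hw hQ hpe hτ.1 (-1) (Or.inr rfl)
  have hle : ∀ v, qf (Q + (-4 * τ) • (1 : Mat n)) v ≤ qf H v := fun v => by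
    rw [qf_add, qf_smul, qf_one]; linarith [h5 v]
  have hpd : (Q + (-4 * τ) • (1 : Mat n)).PosDef := by
    rw [posDef_iff_qf]
    refine ⟨hsymm _, fun v hv => ?_⟩
    rw [qf_add, qf_smul, qf_one]
    have vp : 0 < ‖v‖ ^ 2 := by positivity
    have := hlow v
    have h8 : 4 * τ * ‖v‖ ^ 2 < m * ‖v‖ ^ 2 := by
      apply mul_lt_mul_of_pos_right _ vp
      linarith [hτ.2]
    linarith
  have := det_mono hpd hH hle
  rw [hd] at this
  refine this.trans ?_
  have := abs_le.1 hf
  exact pow_le_pow_left₀ hf0.le (by linarith) n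
/-- blow-up -/
def blw (w : Euc n → ℝ) (p : Euc n) (s : ℝ) (x : Euc n) : ℝ := 1 / s ^ 2 * w (s • x) + (⟪-(1 / s) • p, x⟫ + -(w 0 / s ^ 2))

theorem app_smul_one (s : ℝ) (x : Euc n) : app (s • (1 : Mat n)) x = s • x := by
  rw [app_smul_mat, app_one]

theorem Lim.blw (hn : n ≠ 0) {w : Euc n → ℝ} {r s R : ℝ} (h : Lim r w) (p : Euc n) (hs : 0 < s) (hR : s * R ≤ r) : Lim R (blw w p s) := by
  have := h.affine hn (L := s • (1 : Mat n)) (r' := R) ?_ (-(1 / s) • p) (-(w 0 / s ^ 2)) (c := 1 / s ^ 2) (d := s ^ 2) (by positivity) (by positivity) (by field_simp) ?_ ?_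
  · simp only [app_smul_one] at this; exact this
  · rw [isUnit_iff_isUnit_det, det_smul, det_one, mul_one, isUnit_iff_ne_zero]; positivity
  · rw [det_smul, det_one, Fintype.card_fin]; ring
  · intro x hx
    rw [app_smul_one, norm_smul, Real.norm_of_nonneg hs.le]
    exact lt_of_lt_of_le (mul_lt_mul_of_pos_left hx hs) hR

theorem sd_blw (w : Euc n → ℝ) (p : Euc n) (s : ℝ) (x y : Euc n) : sd (blw w p s) x y = 1 / s ^ 2 * sd w (s • x) (s • y) := by
  unfold sd blw
  rw [smul_add, smul_sub, inner_add_right, inner_sub_right]; ring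

theorem sd_blw_le {w : Euc n → ℝ} {r Λ s : ℝ} (hsd : ∀ x y : Euc n, ‖x‖ + ‖y‖ < r → sd w x y ≤ Λ * ‖y‖ ^ 2) (p : Euc n) (hs : 0 < s)
    {x y : Euc n} (h : s * (‖x‖ + ‖y‖) < r) : sd (blw w p s) x y ≤ Λ * ‖y‖ ^ 2 := by
  rw [sd_blw]
  have := hsd (s • x) (s • y) (by rw [norm_smul, norm_smul, Real.norm_of_nonneg hs.le]; linarith)
  rw [norm_smul, Real.norm_of_nonneg hs.le] at this
  calc 1 / s ^ 2 * sd w (s • x) (s • y) ≤ 1 / s ^ 2 * (Λ * (s * ‖y‖) ^ 2) := by gcongr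
    _ = _ := by field_simp

theorem blow (hn : n ≠ 0) {w : Euc n → ℝ} {r Λ : ℝ} (hr : 0 < r) (hΛ : 0 < Λ) (hw : Lim r w) (hsd : ∀ x y : Euc n, ‖x‖ + ‖y‖ < r → sd w x y ≤ Λ * ‖y‖ ^ 2) :
    ∃ (p : Euc n) (w0 : Euc n → ℝ), (∀ R, Lim R w0) ∧ (∀ x y, sd w0 x y ≤ Λ * ‖y‖ ^ 2) ∧ (∀ x, 0 ≤ w0 x ∧ w0 x ≤ Λ * ‖x‖ ^ 2) ∧
      ∀ ε > 0, ∀ R s0 : ℝ, 0 < s0 → ∃ s, 0 < s ∧ s < s0 ∧ ∀ x : Euc n, ‖x‖ ≤ R → |blw w p s x - w0 x| ≤ ε := by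
  obtain ⟨p, hp⟩ := hw.subgrad (x := 0) (by simpa using hr)
  simp only [zero_add] at hp
  have hb : ∀ s > 0, ∀ x : Euc n, s * ‖x‖ < r → 0 ≤ blw w p s x ∧ blw w p s x ≤ Λ * ‖x‖ ^ 2 := fun s hs x hx => by
    have hsx : ‖s • x‖ < r := by rwa [norm_smul, Real.norm_of_nonneg hs.le]
    have a1 := hp (s • x) hsx
    have a2 := hp (-(s • x)) (by rwa [norm_neg])
    have a3 := hsd 0 (s • x) (by simpa using hsx)
    unfold sd at a3
    rw [zero_add, zero_sub] at a3
    rw [inner_neg_right] at a2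
    have e : blw w p s x = 1 / s ^ 2 * (w (s • x) - w 0 - ⟪p, s • x⟫) := by
      unfold blw; rw [inner_smul_left, inner_smul_right]; simp; field_simp; ring
    rw [e]
    constructor
    · apply mul_nonneg (by positivity); linarith
    · calc _ ≤ 1 / s ^ 2 * (Λ * ‖s • x‖ ^ 2) := by gcongr; linarith
        _ = _ := by rw [norm_smul, Real.norm_of_nonneg hs.le]; field_simp
  set sq : ℕ → ℝ := fun j => 1 / (j + 1) with hsq
  have sqp : ∀ j, 0 < sq j := fun j => by simp only [hsq]; positivity
  set F : Ultrafilter ℕ := hyperfilter ℕ with hF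
  have hFt : Tendsto sq F (𝓝 0) := tendsto_one_div_add_atTop_nhds_zero_nat.mono_left (by
    rw [hF, ← Nat.cofinite_eq_atTop]; exact hyperfilter_le_cofinite)
  have hsmall : ∀ c : ℝ, ∀ b > 0, ∀ᶠ j in (F : Filter ℕ), sq j * c < b := fun c b hb => by
    have := hFt.mul_const c
    rw [zero_mul] at this
    exact this.eventually (gt_mem_nhds hb)
  have hlim : ∀ x : Euc n, ∃ l, Tendsto (fun j => blw w p (sq j) x) F (𝓝 l) := fun x => by
    have h1 : ∀ᶠ j in (F : Filter ℕ), blw w p (sq j) x ∈ Set.Icc 0 (Λ * ‖x‖ ^ 2) := by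
      filter_upwards [hsmall ‖x‖ r hr] with j hj
      exact hb _ (sqp j) x hj
    obtain ⟨l, -, hl⟩ := (isCompact_Icc (a := (0 : ℝ)) (b := Λ * ‖x‖ ^ 2)).ultrafilter_le_nhds (F.map fun j => blw w p (sq j) x) (by
      rw [Filter.le_principal_iff]; exact h1)
    exact ⟨l, hl⟩
  choose w0 hw0 using hlim
  have hbd : ∀ x, 0 ≤ w0 x ∧ w0 x ≤ Λ * ‖x‖ ^ 2 := fun x => by
    constructor
    · refine ge_of_tendsto (hw0 x) ?_
      filter_upwards [hsmall ‖x‖ r hr] with j hj using (hb _ (sqp j) x hj).1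
    · refine le_of_tendsto (hw0 x) ?_
      filter_upwards [hsmall ‖x‖ r hr] with j hj using (hb _ (sqp j) x hj).2
  have hun : ∀ R ε : ℝ, 0 < ε → ∀ᶠ j in (F : Filter ℕ), ∀ x : Euc n, ‖x‖ ≤ R → |blw w p (sq j) x - w0 x| ≤ ε := fun R ε hε => by
    set B := |R| + 1 with hB
    have hB0 : 0 < B := by positivity
    refine unif_of_lip (K := 2 * (Λ * (2 * B) ^ 2) / B) (by positivity) ?_ (fun x _ => hw0 x) hε
    filter_upwards [hsmall (2 * B) r hr] with j hj
    have hcv := (hw.blw hn p (sqp j) (R := 2 * B) hj.le).convexOn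
    have hl := hcv.lipschitzOnWith_of_abs_le (r := 2 * B) (ε := B) (M := Λ * (2 * B) ^ 2) hB0 (fun a ha => by
      rw [dist_zero_right] at ha
      have := hb _ (sqp j) a (lt_of_lt_of_le (mul_lt_mul_of_pos_left ha (sqp j)) hj.le)
      rw [abs_of_nonneg this.1]
      refine this.2.trans ?_
      gcongr)
    intro x y hx hy
    have hx' : x ∈ ball (0 : Euc n) (2 * B - B) := by
      rw [mem_ball_zero_iff]; linarith [le_abs_self R]
    have hy' : y ∈ ball (0 : Euc n) (2 * B - B) := by
      rw [mem_ball_zero_iff]; linarith [le_abs_self R]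
    have := hl.dist_le_mul x hx' y hy'
    rw [Real.coe_toNNReal _ (by positivity), Real.dist_eq, dist_eq_norm] at this
    exact this
  refine ⟨p, w0, fun R => Lim.of_close fun ε hε => ?_, fun x y => ?_, hbd, fun ε hε R s0 hs0 => ?_⟩
  · obtain ⟨j, h1, h2⟩ := ((hun R ε hε).and (hsmall R r hr)).exists
    exact ⟨_, hw.blw hn p (sqp j) h2.le, fun x hx => h1 x (by simpa using (mem_ball_zero_iff.1 hx).le)⟩
  · have ht : Tendsto (fun j => sd (blw w p (sq j)) x y) F (𝓝 (sd w0 x y)) := by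
      unfold sd
      exact ((hw0 _).add (hw0 _)).sub ((hw0 _).const_mul 2)
    refine le_of_tendsto ht ?_
    filter_upwards [hsmall (‖x‖ + ‖y‖) r hr] with j hj using sd_blw_le hsd p (sqp j) hj
  · obtain ⟨j, h1, h2⟩ := ((hun R ε hε).and (hsmall 1 s0 hs0)).exists
    exact ⟨sq j, sqp j, by linarith, h1⟩
theorem sd_comp_app (w : Euc n → ℝ) (L : Mat n) (x y : Euc n) : sd (fun z => w (app L z)) x y = sd w (app L x) (app L y) := by
  unfold sd; simp only [app_add, app_sub]

/-- the blow-up limit at a point with optimal upper bound is quadratic -/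
theorem quad_of_sd (hn : n ≠ 0) {w : Euc n → ℝ} {Λ : ℝ} (hΛ : 0 ≤ Λ) (hw : ∀ R, Lim R w) (hsd : ∀ x y, sd w x y ≤ ‖y‖ ^ 2)
    (hb : ∀ x, 0 ≤ w x ∧ w x ≤ Λ * ‖x‖ ^ 2) (x : Euc n) : w x = ‖x‖ ^ 2 / 2 := by
  have h0 : w 0 = 0 := le_antisymm (by simpa using (hb 0).2) (hb 0).1
  have hk : ∀ k : ℕ, ∀ x, w x ≤ (1 / 2 + Λ / 2 ^ k) * ‖x‖ ^ 2 := fun k => by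
    induction k with
    | zero => intro x; refine (hb x).2.trans ?_; simp; nlinarith [sq_nonneg ‖x‖]
    | succ k ih =>
      intro x
      have h1 := hsd ((1 / 2 : ℝ) • x) ((1 / 2 : ℝ) • x)
      have h2 := ih ((1 / 2 : ℝ) • x)
      unfold sd at h1
      rw [← add_smul, sub_self, h0] at h1
      have hn2 : ‖(1 / 2 : ℝ) • x‖ ^ 2 = ‖x‖ ^ 2 / 4 := by rw [norm_smul, mul_pow]; norm_num; ring
      rw [hn2] at h1 h2
      norm_num at h1
      have e : (1 / 2 + Λ / 2 ^ (k + 1)) * ‖x‖ ^ 2 = 2 * ((1 / 2 + Λ / 2 ^ k) * (‖x‖ ^ 2 / 4)) + ‖x‖ ^ 2 / 4 := by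
        rw [pow_succ]; field_simp; ring
      norm_num at h2
      norm_num at e
      rw [e]; linarith
  have hle : ∀ x, w x ≤ ‖x‖ ^ 2 / 2 := fun x => by
    have ht : Tendsto (fun k : ℕ => (1 / 2 + Λ / 2 ^ k) * ‖x‖ ^ 2) atTop (𝓝 ((1 / 2 + 0) * ‖x‖ ^ 2)) := by
      refine (tendsto_const_nhds.add ?_).mul_const _
      exact tendsto_const_nhds.div_atTop (tendsto_pow_atTop_atTop_of_one_lt (by norm_num))
    have := ge_of_tendsto' ht (fun k => hk k x)
    linarith
  have := smp hn (q := 0) (k := 0) (hw (4 * (‖x‖ + 1))) (hw _).cont (fun y _ => by simpa using hle y) (by simpa using h0) (p := x) (by linarith)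
  simpa using this

set_option maxHeartbeats 1000000 in
/-- improvement of the upper bound -/
theorem sup_improve {ε0 δ0 μ C : ℝ} (I : Imp n ε0 δ0 μ C) (hn : n ≠ 0) {W W0 : Euc n → ℝ} {r Λ : ℝ} {ξ g : Euc n} {P : Euc n} (hr : 0 < r) (hw : Lim r W)
    (hW0 : ∀ R, Lim R W0) (hsd : ∀ x y : Euc n, ‖x‖ + ‖y‖ < r → sd W x y ≤ Λ * ‖y‖ ^ 2)
    (hcl : ∀ ε > 0, ∀ R s0 : ℝ, 0 < s0 → ∃ s, 0 < s ∧ s < s0 ∧ ∀ x : Euc n, ‖x‖ ≤ R → |blw W P s x - W0 x| ≤ ε)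
    (hξ : ‖ξ‖ < 1 / 8) (hpe : ∀ τ > 0, ∃ s > 0, ∀ y : Euc n, ‖y‖ ≤ s → |W0 (ξ + y) - W0 ξ - ⟪g, y⟫ - ‖y‖ ^ 2 / 2| ≤ τ * ‖y‖ ^ 2) :
    ∀ t > 1, ∃ r' > 0, ∀ x y : Euc n, ‖x‖ + ‖y‖ < r' → sd W x y ≤ t * ‖y‖ ^ 2 := by
  set T : Set ℝ := {t | 1 ≤ t ∧ ∃ r' > 0, ∀ x y : Euc n, ‖x‖ + ‖y‖ < r' → sd W x y ≤ t * ‖y‖ ^ 2} with hT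
  have hTn : T.Nonempty := ⟨max Λ 1, le_max_right _ _, r, hr, fun x y h => (hsd x y h).trans (by gcongr; exact le_max_left _ _)⟩
  have hTb : BddBelow T := ⟨1, fun t ht => ht.1⟩
  set t0 := sInf T with ht0
  have h10 : 1 ≤ t0 := le_csInf hTn fun t ht => ht.1
  rcases h10.eq_or_lt with h1 | h1
  · intro t ht
    obtain ⟨t', ht', hlt⟩ := exists_lt_of_csInf_lt hTn (show sInf T < t by rw [← ht0, ← h1]; exact ht)
    obtain ⟨r', hr', h⟩ := ht'.2
    exact ⟨r', hr', fun x y hxy => (h x y hxy).trans (by gcongr)⟩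
  exfalso
  have hC0 := I.c0
  have hm0 := I.m0
  have hd0 := I.d0
  set B := 64 * C + 128 / μ ^ 2 + 6 with hB
  have hB0 : 0 < B := by positivity
  set δ := min (min (δ0 / 8) (1 / (32 * C))) ((t0 - 1) / 2 / B) with hδ
  have ht1 : 0 < t0 - 1 := by linarith
  have hδ0 : 0 < δ := by positivity
  have hδ1 : 8 * δ ≤ δ0 := by
    have : δ ≤ δ0 / 8 := (min_le_left _ _).trans (min_le_left _ _)
    linarith
  have hδ2 : 32 * C * δ ≤ 1 := by
    have : δ ≤ 1 / (32 * C) := (min_le_left _ _).trans (min_le_right _ _)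
    rw [le_div_iff₀ (by positivity)] at this; linarith
  have hδ3 : B * δ ≤ (t0 - 1) / 2 := by
    have : δ ≤ (t0 - 1) / 2 / B := min_le_right _ _
    rw [le_div_iff₀ hB0] at this; linarith
  obtain ⟨s1, hs1, hs1'⟩ := hpe (δ / 2) (by positivity)
  set r1 := min s1 1 with hr1
  have hr10 : 0 < r1 := by positivity
  have hr11 : r1 ≤ 1 := min_le_right _ _
  set τ := min ((t0 - 1) / 2) 1 with hτ
  have hτ0 : 0 < τ := by positivity
  obtain ⟨c, hc, hhopf⟩ := hopf hn (T := t0 + 1) (τ := τ) (ρ := r1 / 8) (by linarith) hτ0 (min_le_right _ _) (by positivity) (by linarith)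
  obtain ⟨t, ht, htlt⟩ := exists_lt_of_csInf_lt hTn (show sInf T < t0 + min c 1 by rw [← ht0]; have : 0 < min c 1 := by positivity
                                                                                   linarith)
  have htlt1 : t < t0 + c := htlt.trans_le (by linarith [min_le_left c 1])
  have htlt2 : t ≤ t0 + 1 := (htlt.trans_le (by linarith [min_le_right c 1])).le
  have htt0 : t0 ≤ t := csInf_le hTb ht
  obtain ⟨ht1', r', hr', hTr⟩ := ht
  obtain ⟨s, hs, hs', hss⟩ := hcl (δ * r1 ^ 2 / 2) (by positivity) 2 (min (r / 2) (r' / 2)) (by positivity)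
  have hsr : s * 2 ≤ r := by linarith [min_le_left (r / 2) (r' / 2)]
  have hsr' : s * 2 ≤ r' := by linarith [min_le_right (r / 2) (r' / 2)]
  have hLW := hw.blw hn P hs (R := 2) hsr
  have hsdW : ∀ x y : Euc n, ‖x‖ + ‖y‖ < 2 → sd (blw W P s) x y ≤ t * ‖y‖ ^ 2 := fun x y hxy =>
    sd_blw_le hTr P hs (by nlinarith)
  have hres := hhopf (blw W P s) t ξ hLW ht1' htlt2 hξ hsdW (fun x y hx hy => by
    have := flatC11 I hn hLW hr10 hr11 (xs := ξ) (by linarith) hδ0 hδ1 hδ2 ⟨g, W0 ξ, fun y hy => by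
      have a1 := abs_le.1 (hs1' y (hy.le.trans (min_le_left _ _)))
      have a2 := abs_le.1 (hss (ξ + y) (by linarith [norm_add_le ξ y]))
      have a3 : δ / 2 * ‖y‖ ^ 2 ≤ δ / 2 * r1 ^ 2 := by gcongr
      rw [abs_le]; constructor <;> linarith⟩ (x := x) (y := y) (by linarith) (by linarith)
    refine this.trans ?_
    gcongr
    have : τ ≤ (t0 - 1) / 2 := min_le_left _ _
    linarith)
  have hmem : max (t - c) 1 ∈ T := by
    refine ⟨le_max_right _ _, s * (min (1 / 8) (r1 / 8 / 4)), by positivity, fun x y hxy => ?_⟩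
    have e1 : x = s • ((1 / s) • x) := by rw [smul_smul]; field_simp; simp
    have e2 : y = s • ((1 / s) • y) := by rw [smul_smul]; field_simp; simp
    have nx : ‖(1 / s) • x‖ = ‖x‖ / s := by rw [norm_smul, Real.norm_of_nonneg (by positivity)]; ring
    have ny : ‖(1 / s) • y‖ = ‖y‖ / s := by rw [norm_smul, Real.norm_of_nonneg (by positivity)]; ring
    have hm1 : s * (min (1 / 8) (r1 / 8 / 4)) ≤ s * (1 / 8) := by gcongr; exact min_le_left _ _
    have hm2 : s * (min (1 / 8) (r1 / 8 / 4)) ≤ s * (r1 / 8 / 4) := by gcongr; exact min_le_right _ _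
    have := hres ((1 / s) • x) ((1 / s) • y) (by rw [nx, div_lt_iff₀ hs]; linarith [norm_nonneg y]) (by rw [ny, div_lt_iff₀ hs]; linarith [norm_nonneg x])
    rw [sd_blw, ← e1, ← e2, ny] at this
    have h2 : sd W x y ≤ (t - c) * ‖y‖ ^ 2 := by
      have h3 := mulL this (show 0 ≤ s ^ 2 by positivity)
      have e3 : s ^ 2 * (1 / s ^ 2 * sd W x y) = sd W x y := by field_simp
      have e4 : s ^ 2 * ((t - c) * (‖y‖ / s) ^ 2) = (t - c) * ‖y‖ ^ 2 := by field_simp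
      rw [e3, e4] at h3; exact h3
    exact h2.trans (by gcongr; exact le_max_left _ _)
  have := csInf_le hTb hmem
  rw [← ht0] at this
  exact absurd this (not_le.2 (max_lt (by linarith) h1))
/-- a limit of solutions with bounded second differences is asymptotically quadratic at the origin (along scales) -/
theorem lemA {ε0 δ0 μ C : ℝ} (I : Imp n ε0 δ0 μ C) (hn : n ≠ 0) {w : Euc n → ℝ} {r Λ : ℝ} (hr : 0 < r) (hΛ : 1 ≤ Λ) (hw : Lim r w)
    (hsd : ∀ x y : Euc n, ‖x‖ + ‖y‖ < r → sd w x y ≤ Λ * ‖y‖ ^ 2) {δ B s1 : ℝ} (hδ : 0 < δ) (hs1 : 0 < s1) :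
    ∃ s, 0 < s ∧ s < s1 ∧ ∃ Q : Mat n, Q.PosDef ∧ Q.det = 1 ∧ (∀ v, qf Q v ≤ Λ * ‖v‖ ^ 2) ∧
      ∃ (q : Euc n) (k : ℝ), ∀ x : Euc n, ‖x‖ ≤ B → |w (s • x) - (⟪q, x⟫ + k) - s ^ 2 / 2 * qf Q x| ≤ δ * s ^ 2 := by
  have hΛ0 : 0 < Λ := by linarith
  obtain ⟨p, w0, hL0, hsd0, hb0, hcl⟩ := blow hn hr hΛ0 hw hsd
  obtain ⟨xs, hxs, Q, g, hQs, hpe⟩ := peano_pt hΛ0 hL0 hsd0 (η := 1 / (8 * Λ)) (by positivity)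
  obtain ⟨hQ, hQd, hQu⟩ := peano_det hn hL0 hsd0 hQs hpe
  obtain ⟨L, hL, hLQ⟩ := exists_normalise hQ
  have hLd : L.det ^ 2 = 1 := by
    have := congrArg Matrix.det hLQ
    rw [det_mul, det_mul, det_transpose, hQd, det_one] at this
    linarith
  have hq : ∀ x, qf Q (app L x) = ‖x‖ ^ 2 := fun x => by rw [← qf_conj, hLQ, qf_one]
  set κ := Λ ^ (n - 1) with hκ
  have hκ1 : 1 ≤ κ := one_le_pow₀ hΛ
  have hκ0 : 0 < κ := by linarith
  have hLn : ∀ x, ‖app L x‖ ≤ κ * ‖x‖ := fun x => by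
    have h1 := pd_lower hQ hΛ0 one_pos hQu hQd.ge (app L x)
    rw [hq, ← hκ, div_mul_eq_mul_div, one_mul, div_le_iff₀ hκ0] at h1
    refine abs_le_of_sq_le_sq' ?_ (by positivity) |>.2
    rw [mul_pow]
    calc _ ≤ ‖x‖ ^ 2 * κ := h1
      _ ≤ ‖x‖ ^ 2 * κ ^ 2 := by gcongr; nlinarith
      _ = _ := by ring
  set ξ := app L⁻¹ xs with hξ
  have hξx : app L ξ = xs := app_app_inv hL xs
  have hξn : ‖ξ‖ < 1 / 8 := by
    refine (abs_lt_of_sq_lt_sq' ?_ (by norm_num)).2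
    have h1 := hQu xs
    rw [← hξx, hq, hξx] at h1
    have h2 : ‖xs‖ ^ 2 < (1 / (8 * Λ)) ^ 2 := by gcongr
    have h3 : Λ * (1 / (8 * Λ)) ^ 2 ≤ (1 / 8) ^ 2 := by
      rw [show Λ * (1 / (8 * Λ)) ^ 2 = 1 / 64 / Λ by field_simp; norm_num, div_le_iff₀ hΛ0]; linarith
    have := mul_lt_mul_of_pos_left h2 hΛ0
    linarith
  set W : Euc n → ℝ := fun x => w (app L x) with hW
  set W0 : Euc n → ℝ := fun x => w0 (app L x) with hW0
  have hlin : ∀ {r r' : ℝ} {w : Euc n → ℝ}, Lim r w → κ * r' ≤ r → Lim r' (fun x => w (app L x)) := fun {r r' w} h hr => by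
    have := h.affine hn hL (r' := r') 0 0 (c := 1) (d := 1) one_pos one_pos (one_mul 1) (by rw [hLd, one_pow]) (fun x hx =>
      lt_of_le_of_lt (hLn x) (lt_of_lt_of_le (mul_lt_mul_of_pos_left hx hκ0) hr))
    simpa using this
  have hWl : Lim (r / κ) W := hlin hw (by rw [mul_div_cancel₀ _ hκ0.ne'])
  have hW0l : ∀ R, Lim R W0 := fun R => hlin (hL0 (κ * R)) le_rfl
  have hWsd : ∀ x y : Euc n, ‖x‖ + ‖y‖ < r / κ → sd W x y ≤ Λ * κ ^ 2 * ‖y‖ ^ 2 := fun x y h => by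
    rw [hW, sd_comp_app]
    rw [lt_div_iff₀ hκ0] at h
    refine (hsd _ _ (by linarith [hLn x, hLn y])).trans ?_
    rw [mul_assoc, ← mul_pow]; gcongr; exact hLn y
  have hblw : ∀ s x, blw W (app Lᵀ p) s x = blw w p s (app L x) := fun s x => by
    simp only [blw, hW, app_smul, inner_smul_left, ← inner_app, app_zero]
  have hWcl : ∀ ε > 0, ∀ R s0 : ℝ, 0 < s0 → ∃ s, 0 < s ∧ s < s0 ∧ ∀ x : Euc n, ‖x‖ ≤ R → |blw W (app Lᵀ p) s x - W0 x| ≤ ε := fun ε hε R s0 hs0 => by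
    obtain ⟨s, h1, h2, h3⟩ := hcl ε hε (κ * R) s0 hs0
    refine ⟨s, h1, h2, fun x hx => ?_⟩
    rw [hblw]
    exact h3 _ ((hLn x).trans (by gcongr))
  have himp := sup_improve I hn (div_pos hr hκ0) hWl hW0l hWsd hWcl hξn (g := app Lᵀ g) (fun τ hτ => by
    obtain ⟨s, hs, h⟩ := hpe (τ / κ ^ 2) (by positivity)
    refine ⟨s / κ, by positivity, fun y hy => ?_⟩
    rw [le_div_iff₀ hκ0] at hy
    have := h (app L y) (by linarith [hLn y])
    rw [hq] at this
    simp only [hW0, app_add, hξx, ← inner_app]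
    refine this.trans ?_
    rw [div_mul_eq_mul_div, div_le_iff₀ (by positivity), mul_assoc, mul_comm (‖y‖ ^ 2), ← mul_pow]
    gcongr; exact hLn y)
  have hsdW0 : ∀ x y, sd W0 x y ≤ ‖y‖ ^ 2 := fun x y => by
    refine le_of_forall_pos_le_add fun η hη => ?_
    set t := 1 + η / (2 * (‖y‖ ^ 2 + 1)) with ht
    obtain ⟨r', hr', h⟩ := himp t (by rw [ht]; have : 0 < η / (2 * (‖y‖ ^ 2 + 1)) := by positivity
                                      linarith)
    obtain ⟨s, h1, h2, h3⟩ := hWcl (η / 8) (by positivity) (‖x‖ + ‖y‖) (r' / (‖x‖ + ‖y‖ + 1)) (by positivity)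
    rw [lt_div_iff₀ (by positivity)] at h2
    have h4 := sd_blw_le h (app Lᵀ p) h1 (x := x) (y := y) (by nlinarith)
    have a1 := abs_le.1 (h3 (x + y) (norm_add_le _ _))
    have a2 := abs_le.1 (h3 (x - y) (norm_sub_le _ _))
    have a3 := abs_le.1 (h3 x (by linarith [norm_nonneg y]))
    have h5 : t * ‖y‖ ^ 2 ≤ ‖y‖ ^ 2 + η / 2 := by
      have : η / (2 * (‖y‖ ^ 2 + 1)) * ‖y‖ ^ 2 ≤ η / 2 := by
        rw [div_mul_eq_mul_div, div_le_iff₀ (by positivity)]; linarith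
      rw [ht, add_mul, one_mul]; linarith
    unfold sd at h4 ⊢
    linarith
  have hquad := quad_of_sd hn (Λ := Λ * κ ^ 2) (by positivity) hW0l hsdW0 (fun x => ⟨(hb0 _).1, (hb0 _).2.trans (by
    rw [mul_assoc, ← mul_pow]; gcongr; exact hLn x)⟩)
  obtain ⟨s, h1, h2, h3⟩ := hcl δ hδ B s1 hs1
  refine ⟨s, h1, h2, Q, hQ, hQd, hQu, s • p, w 0, fun x hx => ?_⟩
  have h4 := h3 x hx
  have h5 : w0 x = qf Q x / 2 := by
    have := hquad (app L⁻¹ x)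
    simp only [hW0] at this
    rw [← hq, app_app_inv hL] at this
    exact this
  have e : w (s • x) - (⟪s • p, x⟫ + w 0) - s ^ 2 / 2 * qf Q x = s ^ 2 * (blw w p s x - w0 x) := by
    rw [h5]; unfold blw; rw [inner_smul_left, inner_smul_left]; simp; field_simp; ring
  rw [e, abs_mul, abs_of_pos (by positivity), mul_comm]
  gcongr
/-- initial flatness by compactness -/
theorem begin_flat {ε0 δ0 μ C : ℝ} (I : Imp n ε0 δ0 μ C) (hn : n ≠ 0) {Λ Cb δ : ℝ} (hΛ : 1 ≤ Λ) (hCb : 0 < Cb) (hδ : 0 < δ) :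
    ∃ h r0 : ℝ, 0 < h ∧ h ≤ 1 / 2 ∧ 0 < r0 ∧ ∀ u f : Euc n → ℝ, Sol (ball 0 1) u f → (∀ x ∈ ball (0 : Euc n) 1, |f x - 1| ≤ h ^ 2) →
      (∀ x ∈ ball (0 : Euc n) 1, |u x| ≤ Cb) → (∀ x y : Euc n, ‖x‖ + ‖y‖ < 1 / 4 → sd u x y ≤ Λ * (h + ‖y‖) ^ 2) →
      ∃ (r : ℝ) (N : Mat n), r0 ≤ r ∧ r ≤ 1 ∧ (∀ v, qf N v ≤ 2 * Λ * ‖v‖ ^ 2) ∧ Flat (ball 0 1) u f 0 N r δ := by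
  have hΛ0 : 0 < Λ := by linarith
  by_contra! hcon
  set hk : ℕ → ℝ := fun k => 1 / (k + 1) / 2 with hhk
  have hkp : ∀ k, 0 < hk k := fun k => by simp only [hhk]; positivity
  have hk2 : ∀ k, hk k ≤ 1 / 2 := fun k => by
    simp only [hhk]
    have : (1 : ℝ) / (k + 1) ≤ 1 := by rw [div_le_one (by positivity)]; linarith [Nat.cast_nonneg (α := ℝ) k]
    linarith
  choose u f hs hf hu hsd hno using fun k => hcon (hk k) (hk k) (hkp k) (hk2 k) (hkp k)
  set F : Ultrafilter ℕ := hyperfilter ℕ with hF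
  have hFt : Tendsto hk F (𝓝 0) := by
    have := (tendsto_one_div_add_atTop_nhds_zero_nat (𝕜 := ℝ)).mono_left (show (F : Filter ℕ) ≤ atTop by
      rw [hF, ← Nat.cofinite_eq_atTop]; exact hyperfilter_le_cofinite)
    simpa [hhk] using this.div_const 2
  have hlim : ∀ x : Euc n, ∃ l, ‖x‖ < 1 → Tendsto (fun j => u j x) F (𝓝 l) := fun x => by
    by_cases hx : ‖x‖ < 1
    · obtain ⟨l, -, hl⟩ := (isCompact_Icc (a := -Cb) (b := Cb)).ultrafilter_le_nhds (F.map fun j => u j x) (by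
        rw [Filter.le_principal_iff]
        exact Filter.mem_map.2 (Filter.univ_mem' fun j => abs_le.1 (hu j x (mem_ball_zero_iff.2 hx))))
      exact ⟨l, fun _ => hl⟩
    · exact ⟨0, fun h => (hx h).elim⟩
  choose w hw using hlim
  have hun : ∀ ε > 0, ∀ᶠ j in (F : Filter ℕ), ∀ x : Euc n, ‖x‖ ≤ 1 / 2 → |u j x - w x| ≤ ε := fun ε hε => by
    refine unif_of_lip (K := 2 * Cb / (1 / 4)) (by positivity) ?_ (fun x hx => hw x (by linarith)) hε
    refine Filter.univ_mem' fun j => ?_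
    have hl := ((hs j).cvx).lipschitzOnWith_of_abs_le (ε := 1 / 4) (by norm_num) (fun a ha => hu j a ha)
    intro x y hx hy
    have := hl.dist_le_mul x (by rw [mem_ball_zero_iff]; linarith) y (by rw [mem_ball_zero_iff]; linarith)
    rw [Real.coe_toNNReal _ (by positivity), Real.dist_eq, dist_eq_norm] at this
    exact this
  have hev : ∀ c > 0, ∀ᶠ j in (F : Filter ℕ), hk j < c := fun c hc => hFt.eventually (gt_mem_nhds hc)
  have hsub : ball (0 : Euc n) (1 / 4) ⊆ ball 0 1 := ball_subset_ball (by norm_num)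
  have hwl : Lim (1 / 4) w := fun ε hε => by
    obtain ⟨j, h1, h2⟩ := ((hun ε hε).and (hev (min ε 1) (by positivity))).exists
    refine ⟨u j, f j, (hs j).mono isOpen_ball (convex_ball _ _) hsub, fun x hx => (hf j x (hsub hx)).trans ?_, fun x hx => h1 x ?_⟩
    · have := lt_min_iff.1 h2
      nlinarith [hkp j]
    · rw [mem_ball_zero_iff] at hx; linarith
  have hwsd : ∀ x y : Euc n, ‖x‖ + ‖y‖ < 1 / 4 → sd w x y ≤ Λ * ‖y‖ ^ 2 := fun x y h => by
    have ht : Tendsto (fun j => sd (u j) x y) F (𝓝 (sd w x y)) := by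
      unfold sd
      exact ((hw _ (by linarith [norm_add_le x y])).add (hw _ (by linarith [norm_sub_le x y]))).sub ((hw _ (by linarith [norm_nonneg y])).const_mul 2)
    have ht2 : Tendsto (fun j => Λ * (hk j + ‖y‖) ^ 2) F (𝓝 (Λ * (0 + ‖y‖) ^ 2)) := ((hFt.add_const _).pow 2).const_mul Λ
    rw [zero_add] at ht2
    exact le_of_tendsto_of_tendsto' ht ht2 fun j => hsd j x y h
  set κ := Λ ^ (n - 1) with hκ
  have hκ1 : 1 ≤ κ := one_le_pow₀ hΛ
  have hκ0 : 0 < κ := by linarith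
  set B := 2 * κ with hB
  obtain ⟨s, hs0, hs1, Q, hQ, hQd, hQu, q, k, hest⟩ := lemA I hn (by norm_num : (0 : ℝ) < 1 / 4) hΛ hwl hwsd (δ := δ / 4) (B := B) (s1 := 1 / (4 * B)) (by positivity) (by positivity)
  rw [lt_div_iff₀ (by positivity)] at hs1
  have hsle : s ≤ 1 := by nlinarith
  obtain ⟨j, ⟨h1, h2⟩, h3⟩ := (((hun (δ / 4 * s ^ 2) (by positivity)).and (hev s hs0)).and (hev (min (δ / 2) 1) (by positivity))).exists
  have h3' := lt_min_iff.1 h3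
  have hf0 := abs_le.1 (hf j 0 (by simp))
  have hsq : hk j ^ 2 ≤ 1 / 2 ∧ hk j ^ 2 ≤ δ / 2 := ⟨by nlinarith [hkp j, hk2 j], by nlinarith [hkp j, hk2 j]⟩
  have hN : ∀ y, qf (f j 0 • Q) y < s ^ 2 → qf Q y ≤ 2 * s ^ 2 ∧ ‖(1 / s) • y‖ ≤ B ∧ ‖y‖ ≤ 1 / 4 := fun y hy => by
    rw [qf_smul] at hy
    have hl := pd_lower hQ hΛ0 one_pos hQu hQd.ge y
    rw [← hκ] at hl
    have hq0 : 0 ≤ qf Q y := le_trans (by positivity) hl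
    have a1 : qf Q y ≤ 2 * s ^ 2 := by nlinarith
    rw [div_mul_eq_mul_div, one_mul, div_le_iff₀ hκ0] at hl
    have a2 : ‖y‖ ≤ s * B := by
      refine (abs_le_of_sq_le_sq' ?_ (by positivity)).2
      calc ‖y‖ ^ 2 ≤ 2 * s ^ 2 * κ := hl.trans (by gcongr)
        _ ≤ 4 * s ^ 2 * κ ^ 2 := by nlinarith [mul_pos (pow_pos hs0 2) hκ0]
        _ = _ := by rw [hB]; ring
    refine ⟨a1, ?_, by linarith⟩
    rw [norm_smul, Real.norm_of_nonneg (by positivity), div_mul_eq_mul_div, one_mul, div_le_iff₀ hs0]; linarith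
  refine hno j s (f j 0 • Q) h2.le hsle (fun v => ?_) ⟨hs0, ?_, ?_, fun y hy => ?_, (1 / s) • q, k, fun y hy => ?_⟩
  · rw [qf_smul]
    have := hQu v
    have hq0 : 0 ≤ qf Q v := le_trans (by positivity) (pd_lower hQ hΛ0 one_pos hQu hQd.ge v)
    nlinarith
  · exact hQ.smul (by linarith)
  · rw [det_smul, hQd]; simp
  · rw [zero_add, mem_ball_zero_iff]; linarith [(hN y hy).2.2]
  · obtain ⟨b1, b2, b3⟩ := hN y hy
    have c1 := hest ((1 / s) • y) b2
    rw [smul_smul, mul_one_div_cancel hs0.ne', one_smul, inner_smul_right, qf_smul_vec] at c1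
    have c2 := abs_le.1 (h1 y (by linarith))
    have hq0 : 0 ≤ qf Q y := le_trans (by positivity) (pd_lower hQ hΛ0 one_pos hQu hQd.ge y)
    have e : s ^ 2 / 2 * ((1 / s) ^ 2 * qf Q y) = qf Q y / 2 := by field_simp
    rw [e] at c1
    have c1' := abs_le.1 c1
    rw [zero_add, qf_smul, inner_smul_left]
    have c3 : |(f j 0 - 1) * qf Q y / 2| ≤ δ / 2 * s ^ 2 := by
      rw [abs_div, abs_mul, abs_of_nonneg hq0, abs_two]
      have := mul_le_mul ((hf j 0 (by simp)).trans hsq.2) b1 hq0 (by positivity)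
      linarith
    have c3' := abs_le.1 c3
    simp only [conj_trivial]
    rw [abs_le]; constructor <;> linarith
theorem Flat.mono {U V : Set (Euc n)} {u f : Euc n → ℝ} {x0 : Euc n} {N : Mat n} {r δ δ' : ℝ} (F : Flat U u f x0 N r δ) (h : U ⊆ V) (hδ : δ ≤ δ') :
    Flat V u f x0 N r δ' := by
  obtain ⟨q, k, he⟩ := F.est
  exact ⟨F.rpos, F.pd, F.det, fun y hy => h (F.sub y hy), q, k, fun y hy => (he y hy).trans (by gcongr)⟩

theorem Flat.affine {U V : Set (Euc n)} {u f : Euc n → ℝ} {x0 : Euc n} {N : Mat n} {r δ : ℝ} {L : Mat n} (hL : IsUnit L) {b q : Euc n} {k c d : ℝ} (hc : 0 < c)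
    (hdd : d ^ n = L.det ^ 2) (hV : ∀ x ∈ V, app L x + b ∈ U)
    (F : Flat V (fun x => c * u (app L x + b) + (⟪q, x⟫ + k)) (fun x => c * d * f (app L x + b)) x0 N r δ) :
    Flat U u f (app L x0 + b) (c⁻¹ • (L⁻¹ᵀ * N * L⁻¹)) (r / √c) δ := by
  obtain ⟨q', k', he⟩ := F.est
  have hL' : IsUnit L⁻¹ := (isUnit_nonsing_inv_iff).2 hL
  have hsc : 0 < √c := Real.sqrt_pos.2 hc
  have hqf : ∀ y, qf (c⁻¹ • (L⁻¹ᵀ * N * L⁻¹)) y = c⁻¹ * qf N (app L⁻¹ y) := fun y => by rw [qf_smul, qf_conj]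
  have hq : ∀ y, qf (c⁻¹ • (L⁻¹ᵀ * N * L⁻¹)) y < (r / √c) ^ 2 → qf N (app L⁻¹ y) < r ^ 2 := fun y hy => by
    rw [hqf, div_pow, Real.sq_sqrt hc.le, inv_mul_eq_div] at hy
    exact (div_lt_div_iff_of_pos_right hc).1 hy
  have hz : ∀ y, app L (x0 + app L⁻¹ y) + b = app L x0 + b + y := fun y => by
    rw [app_add, app_app_inv hL]; abel
  refine ⟨div_pos F.rpos hsc, (posDef_conj F.pd hL').smul (by positivity), ?_, fun y hy => ?_, app L⁻¹ᵀ (c⁻¹ • (q' - q)), c⁻¹ * (k' - ⟪q, x0⟫ - k), fun y hy => ?_⟩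
  · have hd0 : L.det ≠ 0 := (isUnit_iff_ne_zero).1 ((isUnit_iff_isUnit_det _).1 hL)
    rw [det_smul, det_mul, det_mul, det_transpose, F.det, det_nonsing_inv, Ring.inverse_eq_inv', Fintype.card_fin, mul_pow, mul_pow, hdd]
    field_simp
    rw [← mul_pow, one_div_mul_cancel hc.ne', one_pow, one_mul]
  · have := hV _ (F.sub _ (hq y hy))
    rwa [hz] at this
  · have := he _ (hq y hy)
    simp only [hz] at this
    rw [hqf, ← inner_app, inner_smul_left, div_pow, Real.sq_sqrt hc.le]
    rw [inner_add_right] at this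
    simp only [conj_trivial, inner_sub_left]
    have e : u (app L x0 + b + y) - (c⁻¹ * (⟪q', app L⁻¹ y⟫ - ⟪q, app L⁻¹ y⟫) + c⁻¹ * (k' - ⟪q, x0⟫ - k)) - c⁻¹ * qf N (app L⁻¹ y) / 2 =
      (c * u (app L x0 + b + y) + (⟪q, x0⟫ + ⟪q, app L⁻¹ y⟫ + k) - (⟪q', app L⁻¹ y⟫ + k') - qf N (app L⁻¹ y) / 2) / c := by
      field_simp; ring
    rw [e, abs_div, abs_of_pos hc, mul_div_assoc']
    gcongr

/-- sublevels stay away from the boundary -/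
theorem sec_dist (hn : 2 ≤ n) {R : ℝ} (hR : 1 ≤ R) : ∃ C : ℝ, 0 < C ∧
    ∀ (S : Set (Euc n)) (u f : Euc n → ℝ) (f1 t : ℝ), Sec S u f → S ⊆ ball 0 R → (∀ x ∈ S, f x < f1) → 0 < t → 
      ∀ z ∈ S, u z ≤ -t → ∀ z', z' ∉ S → (t / (C * f1)) ^ n ≤ ‖z' - z‖ := by
  obtain ⟨C, hC, hb⟩ := Sec.barrier hn hR
  refine ⟨C, hC, fun S u f f1 t hS hSR hf ht z hz hu z' hz' => ?_⟩
  obtain ⟨φ, hφ⟩ := geometric_hahn_banach_open_point hS.cvx.1 hS.isOpen hz'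
  set ν0 := (InnerProductSpace.toDual ℝ (Euc n)).symm φ with hν0
  have hφe : ∀ x, φ x = ⟪ν0, x⟫ := fun x => by rw [hν0, InnerProductSpace.toDual_symm_apply]
  have hν : ν0 ≠ 0 := fun h => by
    have := hφ z hz
    rw [hφe, hφe, h, inner_zero_left, inner_zero_left] at this; exact lt_irrefl _ this
  have hνn : 0 < ‖ν0‖ := norm_pos_iff.2 hν
  have hlt : ∀ x ∈ S, ⟪(1 / ‖ν0‖) • ν0, x⟫ < ⟪(1 / ‖ν0‖) • ν0, z'⟫ := fun x hx => by
    have := hφ x hx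
    rw [hφe, hφe] at this
    simp only [inner_smul_left, conj_trivial]
    exact mul_lt_mul_of_pos_left this (by positivity)
  have hν1 : ‖(1 / ‖ν0‖) • ν0‖ = 1 := by rw [norm_smul, Real.norm_of_nonneg (by positivity)]; field_simp
  have hf1 : 0 < f1 := (hS.fpos z hz).trans (hf z hz)
  have h1 := hb S u f f1 _ _ hS hSR hf hν1 hlt z hz
  rw [← inner_sub_right] at h1
  have h0 : 0 ≤ ⟪(1 / ‖ν0‖) • ν0, z' - z⟫ := by rw [inner_sub_right]; linarith [hlt z hz]
  have h2 : ⟪(1 / ‖ν0‖) • ν0, z' - z⟫ ≤ ‖z' - z‖ := by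
    have := real_inner_le_norm ((1 / ‖ν0‖) • ν0) (z' - z)
    rwa [hν1, one_mul] at this
  refine le_trans ?_ h2
  have h3 : t / (C * f1) ≤ ⟪(1 / ‖ν0‖) • ν0, z' - z⟫ ^ ((n : ℝ)⁻¹) := by
    rw [div_le_iff₀ (by positivity)]; linarith
  calc _ ≤ (⟪(1 / ‖ν0‖) • ν0, z' - z⟫ ^ ((n : ℝ)⁻¹)) ^ n := by gcongr
    _ = _ := Real.rpow_inv_natCast_pow h0 (by omega)

/-- sub-section -/
theorem Sec.cut {S : Set (Euc n)} {u f : Euc n → ℝ} (h : Sec S u f) {t : ℝ} (ht : 0 < t) : Sec {z ∈ S | u z < -t} (fun z => u z + t) f := by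
  have hcS : {z ∈ S | u z < -t} ⊆ S := fun z hz => hz.1
  have ho : IsOpen {z ∈ S | u z < -t} := h.toSol.cont.isOpen_inter_preimage h.isOpen isOpen_Iio
  have hcv : Convex ℝ {z ∈ S | u z < -t} := h.cvx.convex_lt _
  have h2 : Sol {z ∈ S | u z < -t} u f := h.toSol.mono ho hcv hcS
  have h3 : ConvexOn ℝ {z ∈ S | u z < -t} (fun z => u z + t) := h2.cvx.add_const t
  have hcl : ∀ x ∈ closure {z ∈ S | u z < -t}, x ∈ closure S ∧ u x ≤ -t := fun x hx => by
    refine ⟨closure_mono hcS hx, ?_⟩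
    exact le_on_closure (f := u) (g := fun _ => -t) (fun z hz => hz.2.le) (h.contc.mono (closure_mono hcS)) continuousOn_const hx
  refine ⟨⟨ho, h3, h2.fpos, fun p hp => ?_⟩, h.bdd.subset hcS, (h.contc.mono (closure_mono hcS)).add continuousOn_const, fun x hx => ?_⟩
  · obtain ⟨g, H, hP, hr⟩ := h2.pea p hp
    refine ⟨g, H, ?_, hr⟩
    have := hP.add (Pea_affine (0 : Euc n) t p)
    simpa using this
  · rw [frontier, ho.interior_eq] at hx
    obtain ⟨a1, a2⟩ := hcl x hx.1
    by_cases hxS : x ∈ S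
    · have : ¬ u x < -t := fun h' => hx.2 ⟨hxS, h'⟩
      linarith
    · have := h.zero x (by rw [frontier, h.isOpen.interior_eq]; exact ⟨a1, hxS⟩)
      linarith
set_option maxHeartbeats 1000000 in
/-- the minimum point of a normalised section is flat -/
theorem sec_flat {ε0 δ0 μ C : ℝ} (I : Imp n ε0 δ0 μ C) (hn : 2 ≤ n) {R : ℝ} (hR : 1 ≤ R) : ∃ h r0 Λ : ℝ, 0 < h ∧ 0 < r0 ∧ 1 ≤ Λ ∧
    ∀ (S : Set (Euc n)) (u f : Euc n → ℝ) (x0 : Euc n), Sec S u f → ball 0 1 ⊆ S → S ⊆ ball 0 R → (∀ x ∈ S, |f x - 1| ≤ h) →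
      x0 ∈ S → (∀ z ∈ S, u x0 ≤ u z) → ∃ (r : ℝ) (N : Mat n), r0 ≤ r ∧ r ≤ 1 ∧ (∀ v, qf N v ≤ Λ * ‖v‖ ^ 2) ∧ Flat S u f x0 N r δ0 := by
  have hn0 : n ≠ 0 := by omega
  obtain ⟨Cd, hCd, hdist⟩ := sec_dist hn hR
  set c := (1 / 16 / (Cd * 2)) ^ n with hc
  have hc0 : 0 < c := by positivity
  set G := R + 4 * R ^ 2 / c with hG
  have hRG : R ≤ G := by rw [hG]; linarith [show 0 < 4 * R ^ 2 / c by positivity]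
  have hG1 : 1 ≤ G := hR.trans hRG
  have hG0 : 0 < G := by linarith
  set ρ := 1 / 32 / (8 * (n + 4 + 1) * G) with hρ
  have hρ0 : 0 < ρ := by positivity
  have hρG : ρ ≤ 1 / 32 / G := by
    rw [hρ]; gcongr
    nlinarith [Nat.cast_nonneg (α := ℝ) n]
  have hρ1 : ρ ≤ 1 / 32 := hρG.trans (div_le_self (by norm_num) hG1)
  set Λ := 1 + |pogK n R G| * 32 ^ (n + 4) with hΛ
  have hΛ1 : 1 ≤ Λ := by rw [hΛ]; linarith [show 0 ≤ |pogK n R G| * 32 ^ (n + 4) by positivity]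
  obtain ⟨h, r0, hh0, hh1, hr0, hstart⟩ := begin_flat I hn0 (Cb := R ^ 2 / ρ ^ 2) hΛ1 (by positivity) I.d0
  refine ⟨(ρ * h) ^ 2, ρ * r0, 2 * Λ, by positivity, by positivity, by linarith, fun S u f x0 hS hB hSR hf hx0 hmin => ?_⟩
  have hρh : ρ * h ≤ 1 / 64 := by nlinarith
  have hρh0 : 0 < ρ * h := by positivity
  have hf' : ∀ x ∈ S, |f x - 1| ≤ 1 / 2 := fun x hx => (hf x hx).trans (by nlinarith)
  have hlow : ∀ x ∈ closure S, -R ^ 2 ≤ u x := fun x hx => by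
    have := hS.lower hSR (f1 := 2) (fun x hx => by linarith [(abs_le.1 (hf' x hx)).2]) hn0 x hx
    linarith [sq_nonneg ‖x‖]
  have hnp := hS.nonpos hn0
  have hu0 : u x0 ≤ -(1 / 8) := by
    have := hS.upper (f0 := 1 / 4) (by norm_num) hB (fun x hx => by linarith [(abs_le.1 (hf' x hx)).1]) hn0 0 (by simp)
    rw [norm_zero] at this
    linarith [hmin 0 (hB (by simp))]
  set S' := {z ∈ S | u z < -(1 / 16)} with hS'
  have hcut : Sec S' (fun z => u z + 1 / 16) f := hS.cut (by norm_num)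
  have hball : ∀ x ∈ S', ball x c ⊆ S := fun x hx z hz => by
    by_contra hzS
    have := hdist S u f 2 (1 / 16) hS hSR (fun x hx => by linarith [(abs_le.1 (hf' x hx)).2]) (by norm_num) x hx.1 hx.2.le z hzS
    rw [mem_ball, dist_eq_norm] at hz
    linarith
  have hMb : ∀ x ∈ S, |u x| ≤ R ^ 2 := fun x hx => by
    rw [abs_le]; exact ⟨hlow x (subset_closure hx), by linarith [hnp x (subset_closure hx), sq_nonneg R]⟩
  have hlip : ∀ x ∈ S', ∀ y ∈ S', |u x + 1 / 16 - (u y + 1 / 16)| ≤ G * ‖x - y‖ := fun x hx y hy => by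
    have e : u x + 1 / 16 - (u y + 1 / 16) = u x - u y := by ring
    rw [e]
    have hle : 4 * R ^ 2 / c * ‖x - y‖ ≤ G * ‖x - y‖ := by gcongr; linarith
    refine le_trans ?_ hle
    by_cases hxy : ‖x - y‖ < c / 2
    · have hl := ((hS.cvx).subset (hball x hx) (convex_ball x c)).lipschitzOnWith_of_abs_le (ε := c / 2) (M := R ^ 2) (by positivity) (fun a ha => hMb a (hball x hx ha))
      have := hl.dist_le_mul x (by simpa using hc0) y (by rw [mem_ball, dist_comm, dist_eq_norm]; linarith)
      rw [Real.coe_toNNReal _ (by positivity), Real.dist_eq, dist_eq_norm] at this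
      refine this.trans (le_of_eq ?_)
      field_simp; ring
    · have a1 := abs_le.1 (hMb x hx.1)
      have a2 := abs_le.1 (hMb y hy.1)
      calc |u x - u y| ≤ 2 * R ^ 2 := by rw [abs_le]; constructor <;> linarith
        _ = 4 * R ^ 2 / c * (c / 2) := by field_simp; ring
        _ ≤ _ := by gcongr; linarith
  have hx0' : x0 ∈ S' := ⟨hx0, by linarith⟩
  have hnear : ∀ z, ‖z - x0‖ ≤ 1 / 32 / G → z ∈ S' ∧ u z + 1 / 16 ≤ -(1 / 32) := fun z hz => by
    have hz1 : z ∈ S' := hcut.ball_sub hG0 hlip hx0' (lt_of_le_of_lt hz (by gcongr; linarith))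
    have := hlip z hz1 x0 hx0'
    rw [le_div_iff₀ hG0] at hz
    exact ⟨hz1, by linarith [(abs_le.1 this).2]⟩
  have hpog : ∀ z y : Euc n, ‖z - x0‖ ≤ ρ → ‖y‖ ≤ ρ → sd u z y ≤ Λ * (ρ * h + ‖y‖) ^ 2 := fun z y hz hy => by
    obtain ⟨hz1, hz2⟩ := hnear z (hz.trans hρG)
    have := pog_global hn hR hG1 hρh0 (by nlinarith) hcut (fun x hx => hSR hx.1) hlip (fun x hx => hf x hx.1) (fun x hx => by
      have a1 := hlow x (subset_closure hx.1)
      have a2 : R ^ 2 * 1 ≤ G * R := by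
        nlinarith
      linarith [show 0 ≤ G * R by positivity]) hz1 (y := y) (hy.trans (by rw [hρ]; gcongr; linarith))
    have e : sd (fun z => u z + 1 / 16) z y = sd u z y := by unfold sd; ring
    rw [e] at this
    by_cases hs : sd u z y ≤ 0
    · exact hs.trans (by positivity)
    push Not at hs
    have h32 : (1 / 32 : ℝ) ^ (n + 4) ≤ (-(u z + 1 / 16)) ^ (n + 4) := by gcongr; linarith
    have h6 : sd u z y * (1 / 32 : ℝ) ^ (n + 4) ≤ |pogK n R G| * (ρ * h + ‖y‖) ^ 2 := 
      (mulL h32 hs.le).trans (this.trans (by gcongr; exact le_abs_self _))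
    calc sd u z y = sd u z y * (1 / 32 : ℝ) ^ (n + 4) * 32 ^ (n + 4) := by
          rw [mul_assoc, ← mul_pow]; norm_num
      _ ≤ |pogK n R G| * (ρ * h + ‖y‖) ^ 2 * 32 ^ (n + 4) := by gcongr
      _ ≤ Λ * (ρ * h + ‖y‖) ^ 2 := by rw [hΛ]; nlinarith [sq_nonneg (ρ * h + ‖y‖)]
  set L : Mat n := ρ • (1 : Mat n) with hL
  have hLu : IsUnit L := by
    rw [isUnit_iff_isUnit_det, hL, det_smul, det_one, mul_one]
    exact (isUnit_iff_ne_zero).2 (by positivity)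
  have hdd : (ρ ^ 2) ^ n = L.det ^ 2 := by rw [hL, det_smul, det_one]; simp; ring
  have hin : ∀ x : Euc n, ‖x‖ < 1 → app L x + x0 ∈ S ∧ ‖app L x + x0 - x0‖ ≤ ρ := fun x hx => by
    have : ‖app L x + x0 - x0‖ ≤ ρ := by
      rw [hL, app_smul_one, add_sub_cancel_right, norm_smul, Real.norm_of_nonneg hρ0.le]; nlinarith
    exact ⟨(hnear _ (this.trans hρG)).1.1, this⟩
  have hsol := (hS.toSol.affine hn0 hLu x0 0 0 (c := 1 / ρ ^ 2) (d := ρ ^ 2) (by positivity) (by positivity) hdd).mono (V := ball 0 1) isOpen_ball (convex_ball _ _)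
    (fun x hx => (hin x (mem_ball_zero_iff.1 hx)).1)
  have hcd : 1 / ρ ^ 2 * ρ ^ 2 = 1 := by field_simp
  obtain ⟨r, N, hr, hr1, hN, hF⟩ := hstart _ _ hsol (fun x hx => by
      have := hf _ (hin x (mem_ball_zero_iff.1 hx)).1
      rw [hcd, one_mul]
      refine this.trans ?_
      gcongr
      nlinarith) (fun x hx => by
      have := hMb _ (hin x (mem_ball_zero_iff.1 hx)).1
      simp only [inner_zero_left, add_zero]
      rw [abs_mul, abs_of_pos (by positivity), one_div_mul_eq_div]
      gcongr) (fun x y hxy => by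
      have h1 := hpog (app L x + x0) (app L y) (hin x (by linarith [norm_nonneg y])).2 (by
        rw [hL, app_smul_one, norm_smul, Real.norm_of_nonneg hρ0.le]; nlinarith [norm_nonneg x])
      rw [show ‖app L y‖ = ρ * ‖y‖ by rw [hL, app_smul_one, norm_smul, Real.norm_of_nonneg hρ0.le]] at h1
      have e : sd (fun x => 1 / ρ ^ 2 * u (app L x + x0) + (⟪(0 : Euc n), x⟫ + 0)) x y = 1 / ρ ^ 2 * sd u (app L x + x0) (app L y) := by
        unfold sd
        simp only [inner_zero_left, app_add, app_sub]
        rw [show app L x + app L y + x0 = app L x + x0 + app L y by abel, show app L x - app L y + x0 = app L x + x0 - app L y by abel]; ring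
      rw [e]
      calc _ ≤ 1 / ρ ^ 2 * (Λ * (ρ * h + ρ * ‖y‖) ^ 2) := by gcongr
        _ = _ := by field_simp)
  have hF' := hF.affine hLu (by positivity) hdd (fun x hx => (hin x (mem_ball_zero_iff.1 hx)).1)
  have e0 : app L 0 + x0 = x0 := by rw [app_zero, zero_add]
  have hLi : ∀ v, app L⁻¹ v = ρ⁻¹ • v := fun v => by
    have h1 := app_inv_app hLu (ρ⁻¹ • v)
    rwa [hL, app_smul_one, smul_smul, mul_inv_cancel₀ hρ0.ne', one_smul] at h1
  rw [e0] at hF'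
  have er : r / √(1 / ρ ^ 2) = ρ * r := by
    rw [Real.sqrt_div zero_le_one, Real.sqrt_one, Real.sqrt_sq hρ0.le]; field_simp
  rw [er] at hF'
  refine ⟨ρ * r, _, by gcongr, by nlinarith, fun v => ?_, hF'⟩
  rw [qf_smul, qf_conj, hLi, qf_smul_vec]
  calc _ = qf N v := by field_simp
    _ ≤ _ := hN v
/-- gradient difference on the half ellipsoid -/
theorem Flat.grad {U : Set (Euc n)} {u f : Euc n → ℝ} {x0 : Euc n} {N : Mat n} {r δ : ℝ} (F : Flat U u f x0 N r δ) (hδ : δ ≤ 1) (hs : Sol U u f) {p p' : Euc n} {H H' : Mat n}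
    {y : Euc n} (hp : Pea u x0 p H) (hp' : Pea u (x0 + y) p' H') (hy : qf N y < r ^ 2 / 4) {Λ : ℝ} (hΛ : 0 < Λ) (hN : ∀ v, qf N v ≤ Λ * ‖v‖ ^ 2) :
    ‖p - p'‖ ≤ 12 * (r * √Λ) := by
  obtain ⟨q, k, he⟩ := F.est
  have hr := F.rpos
  have hN0 : ∀ v, 0 ≤ qf N v := fun v => by
    by_cases hv : v = 0
    · rw [hv, qf_zero]
    · exact (((posDef_iff_qf N).1 F.pd).2 v hv).le
  have key : ∀ (z g : Euc n) (H : Mat n), qf N z < r ^ 2 / 4 → Pea u (x0 + z) g H → ∀ e, qf N e ≤ r ^ 2 / 4 → ⟪g - q, e⟫ ≤ 3 * r ^ 2 := fun z g H hz hg e he' => by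
    have hpar : qf N (z + e) + qf N (z - e) = 2 * qf N z + 2 * qf N e := by
      rw [sub_eq_add_neg]
      simp only [qf_eq_inner, app_add, app_neg, inner_add_left, inner_add_right, inner_neg_left, inner_neg_right]; ring
    have hze : qf N (z + e) < r ^ 2 := by linarith [hN0 (z - e)]
    have hz' : qf N z < r ^ 2 := by nlinarith
    have a1 := abs_le.1 (he _ hze)
    have a2 := abs_le.1 (he _ hz')
    have a3 := Pea.tangent hs.cvx hg (F.sub z hz') (F.sub _ hze)
    rw [show x0 + (z + e) - (x0 + z) = e by abel] at a3
    rw [inner_add_right] at a1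
    rw [inner_sub_left]
    have a4 : δ * r ^ 2 ≤ r ^ 2 := by nlinarith [sq_nonneg r]
    linarith [hN0 z]
  by_cases h0 : p - p' = 0
  · rw [h0, norm_zero]; positivity
  have hpn : 0 < ‖p - p'‖ := norm_pos_iff.2 h0
  have hsΛ : 0 < √Λ := Real.sqrt_pos.2 hΛ
  set e := (r / (2 * √Λ) / ‖p - p'‖) • (p - p') with he'
  have hee : qf N e ≤ r ^ 2 / 4 := by
    refine (hN e).trans (le_of_eq ?_)
    rw [he', norm_smul, Real.norm_of_nonneg (by positivity), div_mul_cancel₀ _ hpn.ne', div_pow, mul_pow, Real.sq_sqrt hΛ.le]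
    field_simp; norm_num
  have b1 := key 0 p H (by rw [qf_zero]; positivity) (by rwa [add_zero]) e hee
  have b2 := key y p' H' hy hp' (-e) (by rwa [qf_neg_vec])
  have b3 : ⟪p - p', e⟫ ≤ 6 * r ^ 2 := by
    rw [inner_neg_right] at b2
    rw [inner_sub_left] at b1 b2 ⊢
    linarith
  rw [he', inner_smul_right, real_inner_self_eq_norm_sq] at b3
  have b4 : r / (2 * √Λ) * ‖p - p'‖ ≤ 6 * r ^ 2 := by
    refine le_trans (le_of_eq ?_) b3; field_simp
  rw [div_mul_eq_mul_div, div_le_iff₀ (by positivity)] at b4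
  have b5 : r * ‖p - p'‖ ≤ r * (12 * (r * √Λ)) := by linarith
  exact le_of_mul_le_mul_left b5 hr

set_option maxHeartbeats 1000000 in
/-- main iteration -/
theorem iterate {ε0 δ0 μ C : ℝ} (I : Imp n ε0 δ0 μ C) (hn : n ≠ 0) {U : Set (Euc n)} {u f : Euc n → ℝ} {x0 : Euc n} {N : Mat n} {r Λ q0 : ℝ}
    (hs : Sol U u f) (hf1 : 1 ≤ f x0) (F : Flat U u f x0 N r δ0) (hΛ : 0 < Λ) (hq0 : 0 < q0) (hN : ∀ v, qf N v ≤ Λ * ‖v‖ ^ 2)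
    (hNl : ∀ v, r ^ 2 * ‖v‖ ^ 2 ≤ qf N v * q0 ^ 2) {m : ℕ → ℝ} (hm0 : ∀ j, 0 ≤ m j) (hm1 : ∀ j, m j ≤ ε0 * δ0)
    (hm : ∀ j y, ‖y‖ ≤ q0 / 2 ^ j → x0 + y ∈ U → |f (x0 + y) - f x0| ≤ m j) {p p' : Euc n} {H H' : Mat n}
    {y : Euc n} (hp : Pea u x0 p H) (hp' : Pea u (x0 + y) p' H') (hy : qf N y < r ^ 2 / 4) (hy0 : y ≠ 0) :
    ∃ k : ℕ, ‖y‖ ≤ q0 / 2 ^ k ∧ ‖p - p'‖ ≤ 72 / μ * Λ * Real.exp (2 * C / ε0 * ∑ j ∈ Finset.range k, m (j + 1)) * ‖y‖ := by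
  have hr := F.rpos
  have hμ := I.m0
  have hC := I.c0
  have hε := I.e0
  by_contra! hcon
  set A : ℕ → ℝ := fun k => 2 * δ0 + 2 / ε0 * ∑ j ∈ Finset.range k, m (j + 1) with hA
  have main : ∀ k : ℕ, ∃ (N' : Mat n) (δ : ℝ), 0 < δ ∧ δ ≤ δ0 ∧ m k ≤ ε0 * δ ∧ Flat U u f x0 N' (μ ^ k * r) δ ∧
      (∀ v, (μ ^ k * r) ^ 2 * ‖v‖ ^ 2 ≤ qf N' v * (q0 / 2 ^ k) ^ 2) ∧ (∀ v, qf N' v ≤ Λ * Real.exp (C * (A k - 2 * δ)) * ‖v‖ ^ 2) ∧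
      qf N' y < (μ ^ k * r) ^ 2 / 4 := fun k => by
    induction k with
    | zero =>
      refine ⟨N, δ0, I.d0, le_rfl, hm1 0, by simpa using F, by simpa using hNl, fun v => ?_, by simpa using hy⟩
      have : A 0 - 2 * δ0 = 0 := by simp [hA]
      rw [this, mul_zero, Real.exp_zero, mul_one]; exact hN v
    | succ k ih =>
      obtain ⟨N', δ, hδ, hδ0, hmk, hF, hl, hu, hyk⟩ := ih
      set rk := μ ^ k * r with hrk
      have hrk0 : 0 < rk := by positivity
      have hCδ : C * δ ≤ 1 / 4 := le_trans (by gcongr) I.cd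
      have hyq : ‖y‖ ≤ q0 / 2 ^ k := by
        have h1 := hl y
        have h2 : rk ^ 2 * ‖y‖ ^ 2 ≤ rk ^ 2 * (q0 / 2 ^ k) ^ 2 := by nlinarith [sq_nonneg (q0 / 2 ^ k), sq_nonneg rk]
        exact (abs_le_of_sq_le_sq' (le_of_mul_le_mul_left h2 (by positivity)) (by positivity)).2
      obtain ⟨N1, hF1, hN1⟩ := hF.step I hn hs hδ hδ0 (fun z hz => by
        have hz1 : ‖z‖ ≤ q0 / 2 ^ k := by
          have h2 : rk ^ 2 * ‖z‖ ^ 2 ≤ rk ^ 2 * (q0 / 2 ^ k) ^ 2 := (hl z).trans (by gcongr)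
          exact (abs_le_of_sq_le_sq' (le_of_mul_le_mul_left h2 (by positivity)) (by positivity)).2
        have h3 := hm k z hz1 (hF.sub z hz)
        have h4 : ε0 * δ * 1 ≤ ε0 * δ * f x0 := by gcongr
        linarith)
      set δ1 := max (δ / 2) (m (k + 1) / ε0) with hδ1
      have hδ10 : 0 < δ1 := lt_max_of_lt_left (by positivity)
      have hδ11 : δ1 ≤ δ0 := max_le (by linarith) (by rw [div_le_iff₀ hε, mul_comm]; exact hm1 _)
      have hδ12 : 2 * δ1 ≤ δ + 2 * (m (k + 1) / ε0) := by
        have : δ1 ≤ δ / 2 + m (k + 1) / ε0 := max_le (by linarith [div_nonneg (hm0 (k + 1)) hε.le]) (by linarith)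
        linarith
      have hu1 : ∀ v, qf N1 v ≤ Λ * Real.exp (C * (A (k + 1) - 2 * δ1)) * ‖v‖ ^ 2 := fun v => by
        have h1 := (abs_le.1 (hN1 v)).2
        have h2 := hu v
        have h3 : 1 + C * δ ≤ Real.exp (C * δ) := by linarith [Real.add_one_le_exp (C * δ)]
        have h4 : A (k + 1) = A k + 2 * (m (k + 1) / ε0) := by simp only [hA, Finset.sum_range_succ]; ring
        calc qf N1 v ≤ (1 + C * δ) * qf N' v := by linarith
          _ ≤ (1 + C * δ) * (Λ * Real.exp (C * (A k - 2 * δ)) * ‖v‖ ^ 2) := by gcongr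
          _ ≤ Real.exp (C * δ) * (Λ * Real.exp (C * (A k - 2 * δ)) * ‖v‖ ^ 2) := by gcongr
          _ = Λ * Real.exp (C * δ + C * (A k - 2 * δ)) * ‖v‖ ^ 2 := by rw [Real.exp_add]; ring
          _ ≤ _ := by
            gcongr
            rw [← mul_add]; gcongr
            linarith
      have er : μ ^ (k + 1) * r = μ * rk := by rw [hrk]; ring
      rw [er]
      refine ⟨N1, δ1, hδ10, hδ11, ?_, hF1.mono (le_refl _) (le_max_left _ _), fun v => ?_, hu1, ?_⟩
      · have : m (k + 1) / ε0 ≤ δ1 := le_max_right _ _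
        rw [div_le_iff₀ hε] at this; linarith
      · have h1 := (abs_le.1 (hN1 v)).1
        have h2 := hl v
        have h0 : 0 ≤ qf N' v := by
          by_contra hneg
          push Not at hneg
          have := mul_neg_of_neg_of_pos hneg (show 0 < (q0 / 2 ^ k) ^ 2 by positivity)
          linarith [show 0 ≤ rk ^ 2 * ‖v‖ ^ 2 by positivity]
        have h3 : 3 / 4 * qf N' v ≤ qf N1 v := by nlinarith
        have h4 : (q0 / 2 ^ (k + 1)) ^ 2 = (q0 / 2 ^ k) ^ 2 / 4 := by rw [pow_succ (2 : ℝ) k, ← div_div, div_pow _ (2 : ℝ)]; norm_num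
        have h5 : μ ^ 2 ≤ 3 / 16 := by nlinarith [I.m1]
        rw [h4]
        calc (μ * rk) ^ 2 * ‖v‖ ^ 2 = μ ^ 2 * (rk ^ 2 * ‖v‖ ^ 2) := by ring
          _ ≤ 3 / 16 * (rk ^ 2 * ‖v‖ ^ 2) := by gcongr
          _ ≤ 3 / 16 * (qf N' v * (q0 / 2 ^ k) ^ 2) := by gcongr
          _ = 3 / 4 * qf N' v * ((q0 / 2 ^ k) ^ 2 / 4) := by ring
          _ ≤ _ := by gcongr
      · by_contra hny
        push Not at hny
        refine absurd (hcon k hyq) (not_lt.2 ?_)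
        set E := Λ * Real.exp (C * (A (k + 1))) with hE
        have hE0 : 0 < E := by positivity
        have hAm : A k ≤ A (k + 1) := by
          have : A (k + 1) = A k + 2 / ε0 * m (k + 1) := by simp only [hA, Finset.sum_range_succ]; ring
          rw [this]; linarith [mul_nonneg (by positivity : 0 ≤ 2 / ε0) (hm0 (k + 1))]
        have hN'E : ∀ v, qf N' v ≤ E * ‖v‖ ^ 2 := fun v => (hu v).trans (by
          rw [hE]; gcongr; linarith)
        have hN1E : qf N1 y ≤ E * ‖y‖ ^ 2 := (hu1 y).trans (by rw [hE]; gcongr; linarith)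
        have h1 := hF.grad (hδ0.trans I.d1) hs hp hp' hyk hE0 hN'E
        have h2 : (μ * rk) ≤ 2 * (√E * ‖y‖) := by
          refine (abs_le_of_sq_le_sq' ?_ (by positivity)).2
          rw [mul_pow 2, mul_pow (√E), Real.sq_sqrt hE0.le]
          linarith
        have h3 : μ * (rk * √E) ≤ 2 * (E * ‖y‖) := by
          calc μ * (rk * √E) = (μ * rk) * √E := by ring
            _ ≤ 2 * (√E * ‖y‖) * √E := by gcongr
            _ = 2 * (√E * √E * ‖y‖) := by ring
            _ = _ := by rw [Real.mul_self_sqrt hE0.le]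
        have h4 : E ≤ 3 * (Λ * Real.exp (2 * C / ε0 * ∑ j ∈ Finset.range k, m (j + 1))) := by
          have e1 : C * A (k + 1) ≤ 1 + 2 * C / ε0 * ∑ j ∈ Finset.range k, m (j + 1) := by
            have : A (k + 1) ≤ 4 * δ0 + 2 / ε0 * ∑ j ∈ Finset.range k, m (j + 1) := by
              simp only [hA, Finset.sum_range_succ]
              have : 2 / ε0 * m (k + 1) ≤ 2 / ε0 * (ε0 * δ0) := by gcongr; exact hm1 _
              rw [show 2 / ε0 * (ε0 * δ0) = 2 * δ0 by field_simp] at this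
              rw [mul_add]; linarith
            have h6 := mulL this hC.le
            have h7 : C * (2 / ε0 * ∑ j ∈ Finset.range k, m (j + 1)) = 2 * C / ε0 * ∑ j ∈ Finset.range k, m (j + 1) := by ring
            rw [mul_add C (4 * δ0), h7] at h6
            linarith [I.cd]
          have e2 : Real.exp (C * A (k + 1)) ≤ 3 * Real.exp (2 * C / ε0 * ∑ j ∈ Finset.range k, m (j + 1)) := by
            refine (Real.exp_le_exp.2 e1).trans ?_
            rw [Real.exp_add]; gcongr; linarith [Real.exp_one_lt_d9]
          rw [hE]; nlinarith
        rw [show 72 / μ * Λ * Real.exp (2 * C / ε0 * ∑ j ∈ Finset.range k, m (j + 1)) * ‖y‖ = 72 * Λ * Real.exp (2 * C / ε0 * ∑ j ∈ Finset.range k, m (j + 1)) * ‖y‖ / μ by ring,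
          le_div_iff₀ hμ]
        have h8 : E * ‖y‖ ≤ 3 * (Λ * Real.exp (2 * C / ε0 * ∑ j ∈ Finset.range k, m (j + 1))) * ‖y‖ := by gcongr
        have h9 := mulR h1 hμ.le
        linarith
  have hy1 : 0 < ‖y‖ := norm_pos_iff.2 hy0
  obtain ⟨k, hk⟩ := pow_unbounded_of_one_lt (q0 / ‖y‖) (one_lt_two : (1 : ℝ) < 2)
  obtain ⟨N', δ, -, -, -, hF, hl, -, hyk⟩ := main k
  have h1 := hl y
  have h2 : (μ ^ k * r) ^ 2 * ‖y‖ ^ 2 ≤ (μ ^ k * r) ^ 2 * (q0 / 2 ^ k) ^ 2 := h1.trans (by gcongr; nlinarith [sq_nonneg (μ ^ k * r)])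
  have h3 := (abs_le_of_sq_le_sq' (le_of_mul_le_mul_left h2 (by have := hF.rpos; positivity)) (by positivity)).2
  rw [div_lt_iff₀ hy1] at hk
  rw [le_div_iff₀ (by positivity)] at h3
  linarith
/-- classical solutions are solutions -/
theorem sol_of_C2 {Ω : Set (Euc n)} {v f : Euc n → ℝ} (ho : IsOpen Ω) (hv : ContDiffOn ℝ 2 v Ω) (hc : ConvexOn ℝ Ω v) (hd : ∀ z ∈ Ω, hessDet v z = f z ^ n)
    (hf : ∀ z ∈ Ω, 0 < f z) : Sol Ω v f ∧ ∀ p ∈ Ω, ∃ H, Pea v p (gradient v p) H := by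
  have hP : ∀ p ∈ Ω, Pea v p (gradient v p) (hessianMatrix v p) ∧ (hessianMatrix v p)ᵀ = hessianMatrix v p := fun p hp => by
    have hat : ∀ z ∈ Ω, ContDiffAt ℝ 2 v z := fun z hz => hv.contDiffAt (ho.mem_nhds hz)
    have hdiff : ∀ z ∈ Ω, DifferentiableAt ℝ v z := fun z hz => (hat z hz).differentiableAt (by norm_num)
    have hd2 : DifferentiableAt ℝ (fderiv ℝ v) p := ((hat p hp).fderiv_right (m := 1) (by norm_num)).differentiableAt (by norm_num)
    have hq : ∀ w : Euc n, qf (hessianMatrix v p) w = fderiv ℝ (fderiv ℝ v) p w w := fun w => by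
      have hw : w = ∑ i, w i • EuclideanSpace.single i (1 : ℝ) := by
        have := (EuclideanSpace.basisFun (Fin n) ℝ).sum_repr w
        simpa using this.symm
      conv_rhs => rw [hw]
      simp only [map_sum, map_smul, ContinuousLinearMap.sum_apply, ContinuousLinearMap.smul_apply, smul_eq_mul]
      simp only [qf, dotProduct, mulVec, hessianMatrix, of_apply, iteratedFDeriv_two_apply, Finset.mul_sum]
      simp only [Matrix.cons_val_zero, Matrix.cons_val_one]
      rw [Finset.sum_comm]
      refine Finset.sum_congr rfl fun i _ => Finset.sum_congr rfl fun j _ => ?_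
      ring
    constructor
    · intro w
      have hline : ∀ t : ℝ, HasDerivAt (fun t : ℝ => p + t • w) w t := fun t => by
        simpa using ((hasDerivAt_id t).smul_const w).const_add p
      have hmem : ∀ᶠ t in 𝓝 (0 : ℝ), p + t • w ∈ Ω := (line_tendsto p w).eventually (ho.mem_nhds hp)
      have h1 : ∀ᶠ t in 𝓝 (0 : ℝ), HasDerivAt (fun t => v (p + t • w)) (fderiv ℝ v (p + t • w) w) t := by
        filter_upwards [hmem] with t ht
        exact (hdiff _ ht).hasFDerivAt.comp_hasDerivAt t (hline t)
      have h2 : HasDerivAt (fun t : ℝ => fderiv ℝ v (p + t • w) w) (fderiv ℝ (fderiv ℝ v) p w w) 0 := by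
        have h3 : HasFDerivAt (fderiv ℝ v) (fderiv ℝ (fderiv ℝ v) p) (p + (0 : ℝ) • w) := by
          rw [zero_smul, add_zero]; exact hd2.hasFDerivAt
        have h4 := h3.comp_hasDerivAt (0 : ℝ) (hline 0)
        simpa using h4.clm_apply (hasDerivAt_const (0 : ℝ) w)
      have := P2_of_deriv h1 h2
      refine this.of_eq (by simp) ?_ (hq w).symm
      rw [zero_smul, add_zero, gradient, InnerProductSpace.toDual_symm_apply]
    · have hs : IsSymmSndFDerivAt ℝ v p := (hat p hp).isSymmSndFDerivAt (by simp)
      ext i j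
      simp only [transpose_apply, hessianMatrix, of_apply, iteratedFDeriv_two_apply]
      exact hs _ _
  refine ⟨⟨ho, hc, hf, fun p hp => ⟨_, _, (hP p hp).1, ?_, hd p hp⟩⟩, fun p hp => ⟨_, (hP p hp).1⟩⟩
  have hps : (hessianMatrix v p).PosSemidef := (posSemidef_iff_qf _).2 ⟨(hP p hp).2, fun w => by
    have h1 := ((hP p hp).1 w).sub (P2_quad (v p) ⟪gradient v p, w⟫ 0)
    have := (h1.min (by
      filter_upwards [(line_tendsto p w).eventually (ho.mem_nhds hp)] with t ht
      have := Pea.tangent hc (hP p hp).1 hp ht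
      rw [add_sub_cancel_left, inner_smul_right] at this
      linarith)).2
    linarith⟩
  refine hps.posDef_iff_det_ne_zero.2 ?_
  have := hd p hp
  unfold hessDet at this
  rw [this]
  exact (pow_pos (hf p hp) n).ne'
theorem john (hn : n ≠ 0) : ∃ R : ℝ, 1 ≤ R ∧ ∀ S : Set (Euc n), IsOpen S → Convex ℝ S → Bornology.IsBounded S → S.Nonempty →
    ∃ (L : Mat n) (b : Euc n), IsUnit L ∧ ball 0 1 ⊆ {x | app L x + b ∈ S} ∧ {x | app L x + b ∈ S} ⊆ ball 0 R := by
  have hn1 : (1 : ℝ) ≤ n := by exact_mod_cast Nat.one_le_iff_ne_zero.2 hn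
  have hn0 : (0 : ℝ) < n := by linarith
  refine ⟨n * (2 * n + 1) + 1, by nlinarith, fun S ho hc hb hne => ?_⟩
  let M : (Fin (n + 1) → Euc n) → Mat n := fun p => Matrix.of fun i j => (p j.succ - p 0) i
  have hcont : Continuous fun p => |(M p).det| := by
    refine continuous_abs.comp (Continuous.matrix_det ?_)
    refine continuous_matrix fun i j => ?_
    simp only [M, of_apply]
    fun_prop
  have hK : IsCompact (Set.pi Set.univ fun _ : Fin (n + 1) => closure S) := isCompact_univ_pi fun _ => hb.isCompact_closure
  obtain ⟨s0, hs0⟩ := hne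
  obtain ⟨p, hp, hmax⟩ := hK.exists_isMaxOn ⟨fun _ => s0, fun _ _ => subset_closure hs0⟩ hcont.continuousOn
  have hpS : ∀ i, p i ∈ closure S := fun i => hp i trivial
  have hdet : (M p).det ≠ 0 := by
    obtain ⟨ε, hε, hball⟩ := Metric.isOpen_iff.1 ho s0 hs0
    let p' : Fin (n + 1) → Euc n := Fin.cons s0 fun j => s0 + EuclideanSpace.single j (ε / 2)
    have h1 : M p' = (ε / 2) • (1 : Mat n) := by
      ext i j
      simp [M, p', Matrix.one_apply]
    have h2 := hmax (a := p') (fun i _ => subset_closure (by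
      refine Fin.cases hs0 (fun j => hball ?_) i
      simp [p', abs_of_pos hε, hε]))
    have h2 : |(M p').det| ≤ |(M p).det| := h2
    rw [h1, det_smul, det_one, mul_one] at h2
    exact abs_pos.1 ((abs_pos.2 (by positivity)).trans_le h2)
  have hL0 : IsUnit (M p) := (isUnit_iff_isUnit_det _).2 (isUnit_iff_ne_zero.2 hdet)
  have hcoord : ∀ y : Euc n, app (M p) y + p 0 ∈ closure S → ∀ j, |y j| ≤ 1 := fun y hy j => by
    have h2 := hmax (a := Function.update p j.succ (app (M p) y + p 0)) (fun i _ => by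
      by_cases h : i = j.succ
      · rw [h, Function.update_self]; exact hy
      · rw [Function.update_of_ne h]; exact hpS i)
    have h2 : |(M (Function.update p j.succ (app (M p) y + p 0))).det| ≤ |(M p).det| := h2
    have h3 : M (Function.update p j.succ (app (M p) y + p 0)) = (M p).updateCol j (M p *ᵥ y.ofLp) := by
      ext i k
      by_cases h : k = j
      · subst h
        simp [M, app, Function.update_of_ne (Fin.succ_ne_zero k).symm]
      · rw [updateCol_ne h]
        simp [M, Function.update_of_ne (Fin.succ_ne_zero j).symm, Function.update_of_ne (fun h' => h (Fin.succ_injective _ h'))]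
    rw [h3, ← cramer_apply] at h2
    have h4 : cramer (M p) (M p *ᵥ y.ofLp) = (M p).det • y.ofLp := by
      rw [cramer_eq_adjugate_mulVec, mulVec_mulVec, adjugate_mul, smul_mulVec, one_mulVec]
    rw [h4, Pi.smul_apply, smul_eq_mul, abs_mul] at h2
    have : 0 < |(M p).det| := abs_pos.2 hdet
    exact le_of_mul_le_mul_left (by linarith) this
  have hsimp : ∀ y : Euc n, (∀ j, 0 ≤ y j) → ∑ j, y j ≤ 1 → app (M p) y + p 0 ∈ closure S := fun y h0 h1 => by
    have e : app (M p) y + p 0 = ∑ i : Fin (n + 1), (Fin.cons (1 - ∑ j, y j) (fun j => y j) : Fin (n + 1) → ℝ) i • p i := by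
      rw [Fin.sum_univ_succ]
      simp only [Fin.cons_zero, Fin.cons_succ]
      ext i
      simp [app, M, mulVec, dotProduct, sub_mul, Finset.sum_mul]
      simp only [mul_comm]
      ring
    rw [e]
    refine hc.closure.sum_mem (fun i _ => ?_) ?_ fun i _ => hpS i
    · refine Fin.cases ?_ (fun j => ?_) i
      · simpa using h1
      · simpa using h0 j
    · rw [Fin.sum_univ_succ]; simp
  let t : ℝ := 1 / (2 * n)
  have ht : 0 < t := by positivity
  let w : Euc n := WithLp.toLp 2 fun _ => t
  have hB : ∀ y : Euc n, ‖y‖ < t → app (M p) (y + w) + p 0 ∈ S := fun y hy => by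
    have h1 : (fun y => app (M p) (y + w) + p 0) '' ball 0 t ⊆ closure S := by
      rintro _ ⟨z, hz, rfl⟩
      have hz' : ∀ j, |z j| ≤ t := fun j => (PiLp.norm_apply_le z j).trans (mem_ball_zero_iff.1 hz).le
      refine hsimp _ (fun j => ?_) ?_
      · have := abs_le.1 (hz' j); simp [w]; linarith
      · calc ∑ j, (z + w) j ≤ ∑ j : Fin n, 2 * t := Finset.sum_le_sum fun j _ => by
              have := abs_le.1 (hz' j); simp [w]; linarith
          _ = 1 := by simp [t]; field_simp
    have hopen : IsOpen ((fun y => app (M p) (y + w) + p 0) '' ball 0 t) := by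
      have : ((fun y => app (M p) (y + w) + p 0) '' ball 0 t) = (fun z => app (M p)⁻¹ (z - p 0) - w) ⁻¹' ball 0 t := by
        ext z
        constructor
        · rintro ⟨y, hy, rfl⟩
          simpa [app_inv_app hL0] using hy
        · intro hz
          exact ⟨_, hz, by simp [app_app_inv hL0]⟩
      rw [this]
      exact isOpen_ball.preimage (((app_cont _).comp (by fun_prop)).sub continuous_const)
    have h2 := interior_maximal h1 hopen
    have h3 : interior (closure S) = S := by
      rw [hc.interior_closure_eq_interior_of_nonempty_interior (by rw [ho.interior_eq]; exact ⟨s0, hs0⟩), ho.interior_eq]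
    rw [h3] at h2
    exact h2 ⟨y, mem_ball_zero_iff.2 hy, rfl⟩
  have he : ∀ x, app (t • M p) x + (app (M p) w + p 0) = app (M p) (t • x + w) + p 0 := fun x => by
    rw [app_smul_mat, app_add, app_smul]; abel
  refine ⟨t • M p, app (M p) w + p 0, ?_, fun x hx => ?_, fun x hx => ?_⟩
  · rw [isUnit_iff_isUnit_det, det_smul, isUnit_iff_ne_zero]
    exact mul_ne_zero (by positivity) hdet
  · show _ ∈ S
    rw [he]
    refine hB _ ?_
    rw [norm_smul, Real.norm_of_nonneg ht.le]
    have := mem_ball_zero_iff.1 hx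
    nlinarith
  · have hx : app (t • M p) x + (app (M p) w + p 0) ∈ S := hx
    rw [he] at hx
    have h1 := hcoord _ (subset_closure hx)
    have h2 : ∀ j, |x j| ≤ 2 * n + 1 := fun j => by
      have h3 := h1 j
      have h4 : (t • x + w) j = t * (x j + 1) := by simp [w]; ring
      rw [h4, abs_mul, abs_of_pos ht] at h3
      have h5 : |x j + 1| ≤ 2 * n := by
        have : t * (2 * n) = 1 := by simp only [t]; field_simp
        exact le_of_mul_le_mul_left (h3.trans_eq this.symm) ht
      rw [abs_le] at h5 ⊢
      constructor <;> linarith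
    rw [mem_ball_zero_iff]
    have h6 : ‖x‖ ^ 2 ≤ (n * (2 * n + 1) : ℝ) ^ 2 := by
      rw [EuclideanSpace.norm_sq_eq]
      calc ∑ j, ‖x j‖ ^ 2 ≤ ∑ j : Fin n, (2 * n + 1 : ℝ) ^ 2 := Finset.sum_le_sum fun j _ => by
            have := h2 j
            rw [Real.norm_eq_abs]; gcongr
        _ = n * (2 * n + 1) ^ 2 := by simp
        _ ≤ _ := by rw [mul_pow]; gcongr; nlinarith
    have := (abs_le_of_sq_le_sq' h6 (by positivity)).2
    linarith
theorem Sol.tilt {U : Set (Euc n)} {u f : Euc n → ℝ} (h : Sol U u f) (hn : n ≠ 0) (q : Euc n) (k : ℝ) : Sol U (fun x => u x + (⟪q, x⟫ + k)) f := by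
  have := h.affine hn (L := 1) isUnit_one 0 q k (c := 1) (d := 1) one_pos one_pos (by simp)
  simpa [app_one] using this

theorem sec_mk {U : Set (Euc n)} {w f : Euc n → ℝ} (h : Sol U w f) (hb : Bornology.IsBounded U) (hc : ContinuousOn w (closure U)) (hp : ∀ z ∈ frontier U, 0 < w z) :
    Sec {z ∈ U | w z < 0} w f := by
  have hcS : {z ∈ U | w z < 0} ⊆ U := fun z hz => hz.1
  have ho : IsOpen {z ∈ U | w z < 0} := h.cont.isOpen_inter_preimage h.isOpen isOpen_Iio
  refine ⟨h.mono ho (h.cvx.convex_lt _) hcS, hb.subset hcS, hc.mono (closure_mono hcS), fun x hx => ?_⟩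
  rw [frontier, ho.interior_eq] at hx
  have h1 := closure_mono hcS hx.1
  have h2 : w x ≤ 0 := le_on_closure (f := w) (g := fun _ => 0) (fun z hz => hz.2.le) (hc.mono (closure_mono hcS)) continuousOn_const hx.1
  by_cases hxS : x ∈ U
  · exact le_antisymm h2 (not_lt.1 fun h' => hx.2 ⟨hxS, h'⟩)
  · have := hp x (by rw [frontier, h.isOpen.interior_eq]; exact ⟨h1, hxS⟩)
    linarith

/-- normalised sections -/
theorem Sec.normalise (hn : n ≠ 0) : ∃ R : ℝ, 1 ≤ R ∧ ∀ (S : Set (Euc n)) (u f : Euc n → ℝ) (l : ℝ), Sec S u f → S.Nonempty → 0 < l →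
    ∃ (L : Mat n) (b : Euc n) (c d : ℝ), IsUnit L ∧ 0 < c ∧ d ^ n = L.det ^ 2 ∧ c * d = l ∧ ball 0 1 ⊆ {x | app L x + b ∈ S} ∧
      {x | app L x + b ∈ S} ⊆ ball 0 R ∧ Sec {x | app L x + b ∈ S} (fun x => c * u (app L x + b)) (fun x => l * f (app L x + b)) := by
  obtain ⟨R, hR, hj⟩ := john hn
  refine ⟨R, hR, fun S u f l hS hne hl => ?_⟩
  obtain ⟨L, b, hL, h1, h2⟩ := hj S hS.isOpen hS.cvx.1 hS.bdd hne
  have hd0 : L.det ≠ 0 := (isUnit_iff_ne_zero).1 ((isUnit_iff_isUnit_det _).1 hL)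
  have hd2 : 0 < L.det ^ 2 := by positivity
  set d : ℝ := (L.det ^ 2) ^ ((n : ℝ)⁻¹)
  have hd : 0 < d := by positivity
  have hdd : d ^ n = L.det ^ 2 := Real.rpow_inv_natCast_pow hd2.le hn
  have hcd : l / d * d = l := by field_simp
  have hcont : Continuous (fun x => app L x + b) := (app_cont L).add continuous_const
  have hcl : ∀ x ∈ closure {x | app L x + b ∈ S}, app L x + b ∈ closure S := fun x hx => hcont.closure_preimage_subset S hx
  have h3 := hS.toSol.affine hn hL b 0 0 (c := l / d) (by positivity) hd hdd
  simp only [inner_zero_left, add_zero, hcd] at h3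
  refine ⟨L, b, l / d, d, hL, by positivity, hdd, hcd, h1, h2, ⟨h3, isBounded_ball.subset h2, ?_, fun x hx => ?_⟩⟩
  · exact continuousOn_const.mul (hS.contc.comp hcont.continuousOn hcl)
  · rw [frontier, h3.isOpen.interior_eq] at hx
    rw [hS.zero _ (by rw [frontier, hS.isOpen.interior_eq]; exact ⟨hcl x hx.1, hx.2⟩), mul_zero]

/-- the global setting -/
structure Dom (Ω : Set (Euc n)) (v f : Euc n → ℝ) (F : ℝ) : Prop extends Sec Ω v f where
  b1 : ball 0 1 ⊆ Ω
  bn : Ω ⊆ ball 0 (n : ℝ)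
  f1 : ∀ z ∈ Ω, 1 ≤ f z
  fF : ∀ z ∈ Ω, f z < F

theorem innerSet_ball {Ω : Set (Euc n)} (ho : IsOpen Ω) {ρ : ℝ} {x z : Euc n} (hx : x ∈ innerSet Ω ρ) (hz : ‖z - x‖ ≤ ρ) : z ∈ Ω := by
  by_contra hzS
  obtain ⟨w, hw, hws⟩ := exists_frontier_seg ho hx.1 hzS
  have h1 := Metric.infDist_le_dist_of_mem (x := x) hw
  have h2 := hx.2
  obtain ⟨a, b, ha, hb, hab, rfl⟩ := hws
  have e : x - (a • x + b • z) = b • (x - z) := by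
    have : a = 1 - b := by linarith
    rw [this, sub_smul, smul_sub, one_smul]; abel
  rw [dist_eq_norm, e, norm_smul, Real.norm_of_nonneg hb, norm_sub_rev] at h1
  nlinarith [norm_nonneg (z - x)]

/-- tangent excess -/
def gap (v : Euc n → ℝ) (x p z : Euc n) : ℝ := v z + (⟪-p, z⟫ + (⟪p, x⟫ - v x))

theorem gap_self (v : Euc n → ℝ) (x p : Euc n) : gap v x p x = 0 := by simp [gap]; ring

theorem Dom.basic {Ω : Set (Euc n)} {v f : Euc n → ℝ} {F : ℝ} (D : Dom Ω v f F) (hn : n ≠ 0) :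
    (1 < F) ∧ (∀ z ∈ Ω, v z ≤ 0) ∧ (∀ z ∈ closure Ω, -(F / 2 * n ^ 2) ≤ v z) ∧ v 0 ≤ - (1 / 4) := by
  have h0 : (0 : Euc n) ∈ Ω := D.b1 (by simp)
  have hF : 1 < F := (D.f1 0 h0).trans_lt (D.fF 0 h0)
  refine ⟨hF, fun z hz => D.toSec.nonpos hn z (subset_closure hz), fun z hz => ?_, ?_⟩
  · have := D.toSec.lower D.bn D.fF hn z hz
    have : 0 ≤ F / 2 * ‖z‖ ^ 2 := by positivity
    linarith
  · have := D.toSec.upper (f0 := 1 / 2) (by norm_num) D.b1 (fun z hz => by linarith [D.f1 z hz]) hn 0 (by simp)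
    simp at this; linarith

theorem Dom.pt {Ω : Set (Euc n)} {v f : Euc n → ℝ} {F ρ : ℝ} (D : Dom Ω v f F) (hn : n ≠ 0) (hρ : 0 < ρ) {x p : Euc n} {H : Mat n} (hx : x ∈ innerSet Ω ρ)
    (hP : Pea v x p H) : v x ≤ - (ρ / (4 * (n + ρ))) ∧ ‖p‖ * ρ ≤ F / 2 * n ^ 2 ∧ (∀ z ∈ closure Ω, 0 ≤ gap v x p z) ∧ 
      (∀ z, ‖z - x‖ ≤ ρ → gap v x p z ≤ F * n ^ 2) := by
  obtain ⟨hF, hv0, hvl, hv1⟩ := D.basic hn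
  have hn0 : (0 : ℝ) < n := by exact_mod_cast Nat.pos_of_ne_zero hn
  have hxn : ‖x‖ < n := mem_ball_zero_iff.1 (D.bn hx.1)
  have hgap : ∀ z ∈ Ω, 0 ≤ gap v x p z := fun z hz => by
    have := hP.tangent D.cvx hx.1 hz
    rw [inner_sub_right] at this
    rw [gap, inner_neg_left]; linarith
  have hp : ‖p‖ * ρ ≤ F / 2 * n ^ 2 := by
    by_cases hp0 : p = 0
    · rw [hp0, norm_zero, zero_mul]; positivity
    have hpn : 0 < ‖p‖ := norm_pos_iff.2 hp0
    have h1 : x + (ρ / ‖p‖) • p ∈ Ω := innerSet_ball D.isOpen hx (by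
      rw [add_sub_cancel_left, norm_smul, Real.norm_of_nonneg (by positivity), div_mul_cancel₀ _ hpn.ne'])
    have h2 := hP.tangent D.cvx hx.1 h1
    rw [add_sub_cancel_left, inner_smul_right, real_inner_self_eq_norm_sq] at h2
    have h3 : ρ / ‖p‖ * ‖p‖ ^ 2 = ‖p‖ * ρ := by field_simp
    linarith [hv0 _ h1, hvl x (subset_closure hx.1)]
  refine ⟨?_, hp, fun z hz => ?_, fun z hz => ?_⟩
  · have h1 : (1 + ρ / n) • x ∈ Ω := innerSet_ball D.isOpen hx (by
      rw [add_smul, one_smul, add_sub_cancel_left, norm_smul, Real.norm_of_nonneg (by positivity), div_mul_eq_mul_div, div_le_iff₀ hn0]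
      nlinarith)
    have h2 := D.cvx.2 h1 (D.b1 (by simp) : (0 : Euc n) ∈ Ω) (by positivity : 0 ≤ (n : ℝ) / (n + ρ)) (by positivity : 0 ≤ ρ / (n + ρ)) (by field_simp)
    have e : ((n : ℝ) / (n + ρ)) • (1 + ρ / n) • x + (ρ / (n + ρ)) • (0 : Euc n) = x := by
      rw [smul_zero, add_zero, smul_smul]
      have : (n : ℝ) / (n + ρ) * (1 + ρ / n) = 1 := by field_simp
      rw [this, one_smul]
    rw [e, smul_eq_mul, smul_eq_mul] at h2
    have h3 : (n : ℝ) / (n + ρ) * v ((1 + ρ / n) • x) ≤ 0 := mul_nonpos_of_nonneg_of_nonpos (by positivity) (hv0 _ h1)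
    have h4 : ρ / (n + ρ) * v 0 ≤ ρ / (n + ρ) * (-(1 / 4)) := mulL hv1 (by positivity)
    have h5 : ρ / (n + ρ) * (-(1 / 4)) = -(ρ / (4 * (n + ρ))) := by field_simp
    linarith
  · exact le_on_closure (f := fun _ => (0 : ℝ)) (g := gap v x p) hgap continuousOn_const (D.contc.add (by fun_prop)) hz
  · have h1 := innerSet_ball D.isOpen hx hz
    have h2 := (abs_le.1 (abs_real_inner_le_norm p (z - x))).1
    have h3 : ‖p‖ * ‖z - x‖ ≤ ‖p‖ * ρ := by gcongr
    rw [inner_sub_right] at h2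
    rw [gap, inner_neg_left]
    linarith [hv0 _ h1, hvl x (subset_closure hx.1)]
/-- deep points are uniformly interior -/
theorem deep (hn : 2 ≤ n) {F : ℝ} (hF : 0 < F) : ∃ θ : ℝ, 0 < θ ∧ θ ≤ 1 ∧ ∀ (S : Set (Euc n)) (u f : Euc n → ℝ) (z y : Euc n), Sec S u f → (∀ x ∈ S, 1 ≤ f x) →
    (∀ x ∈ S, f x < F) → z ∈ S → y ∈ S → (∀ x ∈ S, u z ≤ u x / 4) → z + θ • (z - y) ∈ S := by
  have hn0 : n ≠ 0 := by omega
  obtain ⟨R, hR, hnorm⟩ := Sec.normalise hn0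
  obtain ⟨C, hC, hd⟩ := sec_dist hn hR
  set c1 : ℝ := (1 / 16 / (C * F)) ^ n with hc1
  have hc1p : 0 < c1 := by positivity
  refine ⟨min 1 (c1 / (2 * R)), by positivity, min_le_left _ _, fun S u f z y hS hf1 hfF hz hy hu => ?_⟩
  set θ := min 1 (c1 / (2 * R))
  have hθ : 0 < θ := by positivity
  obtain ⟨L, b, c, d, hL, hc, -, -, h1, h2, h3⟩ := hnorm S u f 1 hS ⟨z, hz⟩ one_pos
  by_contra hcon
  have hb : b ∈ S := by
    have : app L 0 + b ∈ S := h1 (by simp)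
    rwa [app_zero, zero_add] at this
  have h4 := h3.upper (f0 := 1 / 2) (by norm_num) h1 (fun x hx => by rw [one_mul]; linarith [hf1 _ hx]) hn0 0 (by simp)
  rw [app_zero, zero_add, norm_zero] at h4
  have e : ∀ w, app L (app L⁻¹ (w - b)) + b = w := fun w => by rw [app_app_inv hL]; abel
  have m : ∀ w, w ∈ S ↔ app L⁻¹ (w - b) ∈ {x | app L x + b ∈ S} := fun w => by rw [Set.mem_setOf_eq, e]
  have h5 := hd _ _ _ F (1 / 16) h3 h2 (fun x hx => by rw [one_mul]; exact hfF _ hx) (by norm_num) _ ((m z).1 hz) (by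
    rw [e]
    have := mulL (hu b hb) hc.le
    linarith) _ (fun h => hcon ((m _).2 h))
  rw [← app_sub, ← hc1] at h5
  have e2 : z + θ • (z - y) - b - (z - b) = θ • ((z - b) - (y - b)) := by rw [sub_sub_sub_cancel_right, sub_sub_sub_cancel_right]; abel
  rw [e2, app_smul, app_sub, norm_smul, Real.norm_of_nonneg hθ.le] at h5
  have h6 := norm_sub_le (app L⁻¹ (z - b)) (app L⁻¹ (y - b))
  have h7 := mem_ball_zero_iff.1 (h2 ((m z).1 hz))
  have h8 := mem_ball_zero_iff.1 (h2 ((m y).1 hy))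
  have h9 : θ * (2 * R) ≤ c1 := by
    rw [← le_div_iff₀ (by positivity)]; exact min_le_right _ _
  nlinarith

set_option maxHeartbeats 1000000 in
/-- quantitative strict convexity -/
theorem strict (hn : 2 ≤ n) {F ρ : ℝ} (hF : 0 < F) (hρ : 0 < ρ) : ∃ h0 : ℝ, 0 < h0 ∧ h0 ≤ 1 ∧ ∀ (Ω : Set (Euc n)) (v f : Euc n → ℝ) (x p : Euc n) (H : Mat n),
    Dom Ω v f F → x ∈ innerSet Ω ρ → Pea v x p H → ∀ z ∈ frontier Ω, h0 < gap v x p z := by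
  have hn0 : n ≠ 0 := by omega
  have hnp : (0 : ℝ) < n := by exact_mod_cast Nat.pos_of_ne_zero hn0
  obtain ⟨θ, hθ, hθ1, hdeep⟩ := deep hn hF
  set c0 : ℝ := ρ / (4 * (n + ρ)) with hc0
  have hc0p : 0 < c0 := by positivity
  have hc01 : c0 ≤ 1 := by rw [hc0, div_le_one (by positivity)]; linarith
  set V : ℝ := F / 2 * n ^ 2
  set M : ℝ := V + 2 * n * (V / ρ) with hM
  set ε : ℝ := θ * (c0 / 4) with hε
  have hεp : 0 < ε := by positivity
  have hεc : ε ≤ c0 / 4 := by nlinarith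
  obtain ⟨J, hJ⟩ := exists_nat_gt (M / ε)
  rw [div_lt_iff₀ hεp] at hJ
  have h2J : (1 : ℝ) ≤ 2 ^ J := one_le_pow₀ (by norm_num)
  refine ⟨c0 / (8 * 2 ^ J), by positivity, by rw [div_le_one (by positivity)]; linarith, fun Ω v f x p H D hx hP z hz => ?_⟩
  obtain ⟨q1, q2, q3, -⟩ := D.pt hn0 hρ hx hP
  have hvl := (D.basic hn0).2.2.1 x (subset_closure hx.1)
  set l : Euc n → ℝ := fun y => ⟪p, y⟫ + (v x - ⟪p, x⟫) with hl
  have hgl : ∀ y, gap v x p y = v y - l y := fun y => by simp only [gap, hl, inner_neg_left]; ring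
  have hlx : l x = v x := by simp only [hl]; ring
  set w : ℝ → Euc n → ℝ := fun s y => v y + (⟪(s - 1) • p, y⟫ + ((1 - s) * (⟪p, x⟫ - v x) + s * (c0 / 2))) with hw
  have hwe : ∀ s y, w s y = gap v x p y + s * (l y + c0 / 2) := fun s y => by
    simp only [hw, hgl, hl, inner_smul_left, conj_trivial]; ring
  have hfr : ∀ s, 0 < s → s ≤ 1 → ∀ y ∈ frontier Ω, 0 < w s y := fun s h0 h1 y hy => by
    have a1 := q3 y (frontier_subset_closure hy)
    have a2 := hgl y
    rw [D.zero y hy] at a2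
    have a3 : l y = - gap v x p y := by linarith
    rw [hwe, a3]
    nlinarith [mul_nonneg (sub_nonneg.2 h1) a1, mul_pos h0 hc0p]
  have hcw : ∀ s, ContinuousOn (w s) (closure Ω) := fun s => D.contc.add (by fun_prop)
  set T : ℝ → Set (Euc n) := fun s => {y ∈ Ω | w s y < 0} with hT
  have hsec : ∀ s, 0 < s → s ≤ 1 → Sec (T s) (w s) f := fun s h0 h1 => sec_mk (D.toSol.tilt hn0 _ _) D.bdd (hcw s) (hfr s h0 h1)
  have hlM : ∀ y ∈ Ω, -M ≤ l y := fun y hy => by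
    have a1 := (abs_le.1 (abs_real_inner_le_norm p (y - x))).1
    have a2 : ‖y - x‖ ≤ 2 * n := by
      linarith [norm_sub_le y x, mem_ball_zero_iff.1 (D.bn hy), mem_ball_zero_iff.1 (D.bn hx.1)]
    have a3 : ‖p‖ ≤ V / ρ := by rw [le_div_iff₀ hρ]; exact q2
    have a4 : ‖p‖ * ‖y - x‖ ≤ V / ρ * (2 * n) := mul_le_mul a3 a2 (norm_nonneg _) ((norm_nonneg _).trans a3)
    rw [inner_sub_right] at a1
    have a5 : -V ≤ v x := hvl
    simp only [hl]; rw [hM]; linarith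
  have hxT : ∀ s, 0 < s → x ∈ T s := fun s h0 => ⟨hx.1, by rw [hwe, gap_self, hlx]; nlinarith⟩
  set σ : ℕ → ℝ := fun i => 2 ^ i / 2 ^ J with hσ
  have hσp : ∀ i, 0 < σ i := fun i => by positivity
  have hσ2 : ∀ i, σ (i + 1) = 2 * σ i := fun i => by simp only [hσ, pow_succ]; ring
  have hgood : ∃ i < J, ∃ a ∈ T (σ i), l a ≤ -c0 ∧ ∀ y ∈ T (σ (i + 1)), l a - ε < l y := by
    by_contra hcon
    push Not at hcon
    have : ∀ i ≤ J, ∃ a ∈ T (σ i), l a ≤ -c0 - i * ε := by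
      intro i
      induction i with
      | zero => exact fun _ => ⟨x, hxT _ (hσp 0), by rw [hlx]; push_cast; linarith⟩
      | succ i ih =>
        intro hi
        obtain ⟨a, ha, hla⟩ := ih (by omega)
        have : 0 ≤ i * ε := by positivity
        obtain ⟨y, hy, hly⟩ := hcon i (by omega) a ha (by linarith)
        exact ⟨y, hy, by push_cast; linarith⟩
    obtain ⟨a, ha, hla⟩ := this J le_rfl
    linarith [hlM a ha.1]
  obtain ⟨i, hiJ, a, ha, hla, hlow⟩ := hgood
  set s := σ (i + 1) with hs
  have hsi : σ i = s / 2 := by rw [hs, hσ2]; ring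
  have hs0 : 0 < s := hσp _
  have hs1 : s ≤ 1 := by
    rw [hs]; simp only [hσ]
    rw [div_le_one (by positivity)]
    exact pow_le_pow_right₀ (by norm_num) hiJ
  have hsl : 1 / 2 ^ J ≤ s := by
    rw [hs]; simp only [hσ]
    gcongr; exact one_le_pow₀ (by norm_num)
  have hS := hsec s hs0 hs1
  have hwa : w s a < s / 2 * (l a + c0 / 2) := by
    have := ha.2
    rw [hsi, hwe] at this
    rw [hwe]; linarith
  have haT : a ∈ T s := ⟨ha.1, by nlinarith⟩
  have htop : ∀ y ∈ T s, l y ≤ -(3 / 4 * c0) := fun y hy => by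
    have h1 := hdeep _ _ _ a y hS (fun b hb => D.f1 b hb.1) (fun b hb => D.fF b hb.1) haT hy fun b hb => by
      have b1 := hlow b hb
      have b2 := q3 b (subset_closure hb.1)
      rw [hwe s b]
      nlinarith
    have h2 := hlow _ h1
    simp only [hl, inner_add_right, inner_smul_right, inner_sub_right] at h2
    have h3 : l y < l a + c0 / 4 := by
      simp only [hl]
      rw [hε] at h2
      by_contra hh
      push Not at hh
      have := mulL hh hθ.le
      nlinarith
    linarith
  have hsub : ∀ b ∈ Ω, gap v x p b < s * (c0 / 4) → b ∈ T s := fun b hb hg => by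
    by_contra hbT
    obtain ⟨y, hy, hys⟩ := exists_frontier_seg hS.isOpen (hxT s hs0) hbT
    have h1 : y ∈ {y ∈ Ω | gap v x p y < s * (c0 / 4)} := by
      refine (((D.toSol.tilt hn0 (-p) (⟪p, x⟫ - v x)).cvx.convex_lt _).segment_subset ⟨hx.1, ?_⟩ ⟨hb, hg⟩) hys
      have := gap_self v x p
      simp only [gap] at this
      rw [this]; positivity
    have h2 := hS.zero y hy
    have h3 : l y ≤ -(3 / 4 * c0) := le_on_closure (f := l) (g := fun _ => -(3 / 4 * c0)) htop (by fun_prop) continuousOn_const (frontier_subset_closure hy)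
    rw [hwe] at h2
    nlinarith [h1.2]
  by_contra hcon
  push Not at hcon
  have hlt : gap v x p z < s * (c0 / 4) := by
    have : c0 / (8 * 2 ^ J) = 1 / 2 ^ J * (c0 / 8) := by field_simp
    nlinarith
  have hcl : z ∈ closure Ω := frontier_subset_closure hz
  have hne : (𝓝[Ω] z).NeBot := mem_closure_iff_nhdsWithin_neBot.1 hcl
  have hgc : ContinuousOn (gap v x p) (closure Ω) := D.contc.add (by fun_prop)
  have h1 := ((hgc z hcl).mono subset_closure).eventually (gt_mem_nhds hlt)
  have h2 : w s z ≤ 0 := le_of_tendsto ((hcw s z hcl).mono subset_closure) (by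
    filter_upwards [h1, self_mem_nhdsWithin] with b hb1 hb2
    exact (hsub b hb2 hb1).2.le)
  linarith [hfr s hs0 hs1 z hz]
def gph (v : Euc n → ℝ) (x p : Euc n) (h : ℝ) (z : Euc n) : ℝ := v z + (⟪-p, z⟫ + (⟪p, x⟫ - v x - h))

theorem gph_eq (v : Euc n → ℝ) (x p : Euc n) (h : ℝ) (z : Euc n) : gph v x p h z = gap v x p z - h := by rw [gph, gap]; ring

/-- sections of size `q` -/
theorem small_sec (hn : 2 ≤ n) {F : ℝ} (hF : 0 < F) : ∃ m : ℕ, ∀ ρ : ℝ, 0 < ρ → ∃ c : ℝ, 0 < c ∧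
    ∀ (Ω : Set (Euc n)) (v f : Euc n → ℝ) (x p : Euc n) (H : Mat n) (q : ℝ), Dom Ω v f F → x ∈ innerSet Ω ρ → Pea v x p H → 0 < q → q ≤ ρ →
      ∃ h, c * q ^ m ≤ h ∧ 0 < h ∧ h ≤ 1 ∧ Sec {z ∈ Ω | gph v x p h z < 0} (gph v x p h) f ∧ ∀ z ∈ Ω, gph v x p h z < 0 → ‖z - x‖ < q := by
  have hn0 : n ≠ 0 := by omega
  obtain ⟨θ, hθ, hθ1, hdeep⟩ := deep hn hF
  obtain ⟨m, hm⟩ := exists_nat_ge (1 / θ)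
  have hm2 : 2 ≤ (1 + θ) ^ m := by
    have := one_add_mul_le_pow (by linarith : (-2 : ℝ) ≤ θ) m
    rw [div_le_iff₀ hθ] at hm
    linarith
  refine ⟨m, fun ρ hρ => ?_⟩
  obtain ⟨h0, hh0, hh1, hst⟩ := strict hn hF hρ
  refine ⟨h0 / (2 * (2 * n + ρ) ^ m), by positivity, fun Ω v f x p H q D hx hP hq hqρ => ?_⟩
  obtain ⟨-, -, q3, -⟩ := D.pt hn0 hρ hx hP
  have hsec : ∀ h, h ≤ h0 → Sec {z ∈ Ω | gph v x p h z < 0} (gph v x p h) f := fun h hh =>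
    sec_mk (D.toSol.tilt hn0 _ _) D.bdd (D.contc.add (by fun_prop)) fun z hz => by
      rw [gph_eq]; linarith [hst Ω v f x p H D hx hP z hz]
  have hX : 1 ≤ (2 * n + ρ) / q := by rw [le_div_iff₀ hq]; linarith [show (0 : ℝ) ≤ n from n.cast_nonneg]
  obtain ⟨k, hk1, hk2⟩ := exists_nat_pow_near hX (by linarith : 1 < 1 + θ)
  have h2k : (2 : ℝ) ^ k ≤ ((2 * n + ρ) / q) ^ m := by
    calc (2 : ℝ) ^ k ≤ ((1 + θ) ^ m) ^ k := by gcongr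
      _ = ((1 + θ) ^ k) ^ m := by rw [← pow_mul, ← pow_mul, mul_comm]
      _ ≤ _ := by gcongr
  have hshr : ∀ j : ℕ, ∀ y ∈ Ω, gph v x p (h0 / 2 ^ j) y < 0 → x + (1 + θ) ^ j • (y - x) ∈ Ω := by
    intro j
    induction j with
    | zero => intro y hy _; simpa using hy
    | succ j ih =>
      intro y hy hg
      have hj : h0 / 2 ^ j ≤ h0 := div_le_self hh0.le (one_le_pow₀ (by norm_num))
      have hjp : 0 < h0 / 2 ^ j := by positivity
      have e : h0 / 2 ^ (j + 1) = h0 / 2 ^ j / 2 := by rw [pow_succ]; field_simp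
      rw [e, gph_eq] at hg
      have h1 := hdeep _ _ _ y x (hsec _ hj) (fun b hb => D.f1 b hb.1) (fun b hb => D.fF b hb.1) ⟨hy, by rw [gph_eq]; linarith⟩
        ⟨hx.1, by rw [gph_eq, gap_self]; linarith⟩ fun b hb => by
          rw [gph_eq, gph_eq]
          linarith [q3 b (subset_closure hb.1)]
      have h2 := ih _ h1.1 h1.2
      have e2 : (1 + θ) ^ j • (y + θ • (y - x) - x) = (1 + θ) ^ (j + 1) • (y - x) := by
        rw [pow_succ, mul_smul, add_smul, one_smul]; congr 1; abel
      rwa [e2] at h2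
  refine ⟨h0 / 2 ^ (k + 1), ?_, by positivity, (div_le_self hh0.le (one_le_pow₀ (by norm_num))).trans hh1, hsec _ (div_le_self hh0.le (one_le_pow₀ (by norm_num))), fun z hz hg => ?_⟩
  · rw [div_pow, le_div_iff₀ (by positivity)] at h2k
    rw [pow_succ, div_mul_eq_mul_div, div_le_div_iff₀ (by positivity) (by positivity)]
    nlinarith
  · have h1 := mem_ball_zero_iff.1 (D.bn (hshr _ z hz hg))
    have h2 := mem_ball_zero_iff.1 (D.bn hx.1)
    have h3 : (1 + θ) ^ (k + 1) * ‖z - x‖ < 2 * n := by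
      have := norm_sub_le (x + (1 + θ) ^ (k + 1) • (z - x)) x
      rw [add_sub_cancel_left, norm_smul, Real.norm_of_nonneg (by positivity)] at this
      linarith
    rw [div_lt_iff₀ hq] at hk2
    have : 0 < (1 + θ) ^ (k + 1) := by positivity
    by_contra hcon
    push Not at hcon
    have := mulL hcon this.le
    linarith

set_option maxHeartbeats 1000000 in
/-- initial flatness -/
theorem start_flat {ε0 δ0 μ C : ℝ} (I : Imp n ε0 δ0 μ C) (hn : 2 ≤ n) : ∃ e : ℝ, 0 < e ∧ ∀ F : ℝ, 0 < F → ∃ m : ℕ, ∀ ρ : ℝ, 0 < ρ → ∃ K : ℝ, 1 ≤ K ∧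
    ∀ (Ω : Set (Euc n)) (v f : Euc n → ℝ) (x p : Euc n) (H : Mat n) (q : ℝ), Dom Ω v f F → x ∈ innerSet Ω ρ → Pea v x p H → 0 < q → q ≤ ρ →
      (∀ z ∈ Ω, ‖z - x‖ < q → |f z - f x| ≤ e) → ∃ (N : Mat n) (r : ℝ), Flat Ω v f x N r δ0 ∧ (∀ y, qf N y ≤ K * q⁻¹ ^ m * ‖y‖ ^ 2) ∧
        1 ≤ K * q⁻¹ ^ m * r ^ 2 ∧ ∀ y, r ^ 2 * ‖y‖ ^ 2 ≤ qf N y * q ^ 2 := by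
  have hn0 : n ≠ 0 := by omega
  obtain ⟨R, hR, hnorm⟩ := Sec.normalise hn0
  obtain ⟨e, r0, Λ, he, hr0, hΛ, hflat⟩ := sec_flat I hn hR
  refine ⟨min e (1 / 3), by positivity, fun F hF => ?_⟩
  obtain ⟨m, hm⟩ := small_sec hn hF
  refine ⟨m * 2, fun ρ hρ => ?_⟩
  obtain ⟨c1, hc1, hsm⟩ := hm ρ hρ
  set V : ℝ := F * n ^ 2 + 1 with hV
  have hV1 : 1 ≤ V := by rw [hV]; linarith [show 0 ≤ F * n ^ 2 by positivity]
  set B : ℝ := 4 * Λ * (2 * R * (2 * V / ρ)) ^ 2 + R ^ 2 / r0 ^ 2 with hB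
  have hBp : 0 ≤ B := by positivity
  refine ⟨B / c1 ^ 2 + 1, by linarith [show 0 ≤ B / c1 ^ 2 by positivity], fun Ω v f x p H q D hx hP hq hqρ hosc => ?_⟩
  obtain ⟨-, -, q3, q4⟩ := D.pt hn0 hρ hx hP
  obtain ⟨h, hhl, hh, hh1, hS, hSq⟩ := hsm Ω v f x p H q D hx hP hq hqρ
  set S := {z ∈ Ω | gph v x p h z < 0} with hSdef
  have hgx : gph v x p h x = -h := by rw [gph_eq, gap_self, zero_sub]
  have hxS : x ∈ S := ⟨hx.1, by rw [hgx]; linarith⟩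
  have hK : B / h ^ 2 ≤ (B / c1 ^ 2 + 1) * q⁻¹ ^ (m * 2) := by
    have h1 : (c1 * q ^ m) ^ 2 ≤ h ^ 2 := by gcongr
    calc B / h ^ 2 ≤ B / (c1 * q ^ m) ^ 2 := by gcongr
      _ = B / c1 ^ 2 * q⁻¹ ^ (m * 2) := by rw [pow_mul, inv_pow]; field_simp
      _ ≤ _ := by gcongr; linarith
  have hfx : 1 ≤ f x := D.f1 x hx.1
  obtain ⟨L, b, c, d, hL, hc, hdd, hcd, h1, h2, h3⟩ := hnorm S _ f (1 / f x) hS ⟨x, hxS⟩ (by positivity)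
  have e1 : ∀ w, app L (app L⁻¹ (w - b)) + b = w := fun w => by rw [app_app_inv hL]; abel
  have hm1 : ∀ w ∈ S, app L⁻¹ (w - b) ∈ {x | app L x + b ∈ S} := fun w hw => by rw [Set.mem_setOf_eq, e1]; exact hw
  have hf : ∀ y ∈ {x | app L x + b ∈ S}, |1 / f x * f (app L y + b) - 1| ≤ min e (1 / 3) := fun y hy => by
    have a1 := hosc _ hy.1 (hSq _ hy.1 hy.2)
    have a2 : 1 / f x * f (app L y + b) - 1 = (f (app L y + b) - f x) / f x := by field_simp
    rw [a2, abs_div, abs_of_pos (by linarith : 0 < f x)]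
    exact (div_le_self (abs_nonneg _) hfx).trans a1
  have hf3 := fun y hy => abs_le.1 ((hf y hy).trans (min_le_right _ _))
  set x0 := app L⁻¹ (x - b)
  have hu0 := h3.upper (f0 := 1 / 2) (by norm_num) h1 (fun y hy => by linarith [(hf3 y hy).1]) hn0 0 (by simp)
  have hmin : ∀ z ∈ {x | app L x + b ∈ S}, c * gph v x p h (app L x0 + b) ≤ c * gph v x p h (app L z + b) := fun z hz => by
    rw [e1, hgx, gph_eq]
    have := q3 _ (subset_closure hz.1)
    gcongr; linarith
  have hul := h3.lower h2 (f1 := 2) (fun y hy => by linarith [(hf3 y hy).2]) hn0 x0 (subset_closure (hm1 x hxS))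
  have hch1 : 1 / 4 ≤ c * h := by
    have := hmin 0 (h1 (by simp))
    rw [e1, hgx] at this
    rw [norm_zero] at hu0
    linarith
  have hch2 : c * h ≤ R ^ 2 := by
    rw [e1, hgx] at hul
    linarith [sq_nonneg ‖x0‖]
  obtain ⟨r, N, hr1, hr2, hN, F1⟩ := hflat _ _ _ x0 h3 h1 h2 (fun y hy => (hf y hy).trans (min_le_left _ _)) (hm1 x hxS) hmin
  have hr : 0 < r := by linarith
  have F2 := Flat.affine (U := S) (u := gph v x p h) (f := f) (q := 0) (k := 0) hL hc hdd (fun _ h => h) (by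
    simp only [inner_zero_left, add_zero, hcd]; exact F1)
  rw [e1] at F2
  have hsub := F2.sub
  obtain ⟨q', k', hest⟩ := F2.est
  have hqf : ∀ y, qf (c⁻¹ • (L⁻¹ᵀ * N * L⁻¹)) y = c⁻¹ * qf N (app L⁻¹ y) := fun y => by rw [qf_smul, qf_conj]
  have hr2 : (r / √c) ^ 2 = r ^ 2 / c := by rw [div_pow, Real.sq_sqrt hc.le]
  refine ⟨_, _, ⟨F2.rpos, F2.pd, F2.det, fun y hy => (hsub y hy).1, q' + p, k' - (⟪p, x⟫ - v x - h) + ⟪p, x⟫, fun y hy => ?_⟩, fun y => ?_, ?_, fun y => ?_⟩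
  · refine le_of_eq_of_le ?_ (hest y hy)
    rw [gph, inner_add_left, inner_neg_left, inner_add_right]
    congr 1; ring
  · set κ : ℝ := ρ * (h / (2 * V)) with hκ
    have hκp : 0 < κ := by positivity
    have ht1 : h / (2 * V) ≤ 1 := by rw [div_le_one (by positivity)]; linarith
    have hball : ∀ w, ‖w‖ ≤ ρ → x + (h / (2 * V)) • w ∈ S := fun w hw => by
      have hwx : ‖x + w - x‖ ≤ ρ := by rwa [add_sub_cancel_left]
      have a1 := q4 _ hwx
      have a2 : x + w ∈ Ω := innerSet_ball D.isOpen hx hwx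
      have a3 := (D.toSol.tilt hn0 (-p) (⟪p, x⟫ - v x)).cvx.2 hx.1 a2 (sub_nonneg.2 ht1) (by positivity : 0 ≤ h / (2 * V)) (by ring)
      have a4 : (1 - h / (2 * V)) • x + (h / (2 * V)) • (x + w) = x + (h / (2 * V)) • w := by
        rw [sub_smul, one_smul, smul_add]; abel
      rw [a4] at a3
      have a5 : gap v x p (x + (h / (2 * V)) • w) ≤ (1 - h / (2 * V)) * gap v x p x + (h / (2 * V)) * gap v x p (x + w) := a3
      have a6 : x + (h / (2 * V)) • w ∈ Ω := a4 ▸ D.cvx.1 hx.1 a2 (sub_nonneg.2 ht1) (by positivity : 0 ≤ h / (2 * V)) (by ring)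
      refine ⟨a6, ?_⟩
      rw [gap_self, mul_zero, zero_add] at a5
      have a7 : h / (2 * V) * gap v x p (x + w) ≤ h / (2 * V) * V := mulL (by linarith) (by positivity)
      have a8 : h / (2 * V) * V = h / 2 := by field_simp
      rw [gph_eq]; linarith
    have hLi : ‖app L⁻¹ y‖ ≤ 2 * R * (2 * V / ρ) / h * ‖y‖ := by
      by_cases hy : y = 0
      · rw [hy, app_zero, norm_zero, mul_zero]
      have hyp : 0 < ‖y‖ := norm_pos_iff.2 hy
      have b1 := mem_ball_zero_iff.1 (h2 (hm1 _ (hball ((ρ / ‖y‖) • y) (by rw [norm_smul, Real.norm_of_nonneg (by positivity), div_mul_cancel₀ _ hyp.ne']))))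
      have b2 := mem_ball_zero_iff.1 (h2 (hm1 x hxS))
      have b3 := norm_sub_le (app L⁻¹ (x + (h / (2 * V)) • (ρ / ‖y‖) • y - b)) (app L⁻¹ (x - b))
      have e3 : app L⁻¹ (x + (h / (2 * V)) • (ρ / ‖y‖) • y - b) - app L⁻¹ (x - b) = (h / (2 * V) * (ρ / ‖y‖)) • app L⁻¹ y := by
        rw [← app_sub, sub_sub_sub_cancel_right, add_sub_cancel_left, smul_smul, app_smul]
      rw [e3, norm_smul, Real.norm_of_nonneg (by positivity)] at b3
      have b4 : h / (2 * V) * (ρ / ‖y‖) * ‖app L⁻¹ y‖ ≤ 2 * R := by linarith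
      have b5 : 2 * R * (2 * V / ρ) / h * ‖y‖ = 2 * R / (h / (2 * V) * (ρ / ‖y‖)) := by field_simp
      rw [b5, le_div_iff₀ (by positivity)]; linarith
    have hci : c⁻¹ ≤ 4 := by
      rw [inv_le_comm₀ hc (by norm_num)]; nlinarith
    rw [hqf]
    calc c⁻¹ * qf N (app L⁻¹ y) ≤ c⁻¹ * (Λ * ‖app L⁻¹ y‖ ^ 2) := by gcongr; exact hN _
      _ ≤ 4 * (Λ * (2 * R * (2 * V / ρ) / h * ‖y‖) ^ 2) := by gcongr
      _ = 4 * Λ * (2 * R * (2 * V / ρ)) ^ 2 / h ^ 2 * ‖y‖ ^ 2 := by rw [mul_pow, div_pow]; ring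
      _ ≤ B / h ^ 2 * ‖y‖ ^ 2 := by gcongr; rw [hB]; linarith [show 0 ≤ R ^ 2 / r0 ^ 2 by positivity]
      _ ≤ _ := by gcongr
  · rw [hr2]
    have b1 : 1 ≤ B / h ^ 2 * (r ^ 2 / c) := by
      have b2 : R ^ 2 ≤ B * r ^ 2 := by
        calc R ^ 2 = R ^ 2 / r0 ^ 2 * r0 ^ 2 := by field_simp
          _ ≤ B * r ^ 2 := by gcongr; rw [hB]; linarith [show 0 ≤ 4 * Λ * (2 * R * (2 * V / ρ)) ^ 2 by positivity]
      rw [div_mul_div_comm, one_le_div (by positivity)]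
      nlinarith
    exact b1.trans (by gcongr)
  · by_contra hcon
    push Not at hcon
    by_cases hy : y = 0
    · rw [hy, qf_zero, norm_zero] at hcon; simp at hcon
    have hyp : 0 < ‖y‖ := norm_pos_iff.2 hy
    have b1 := hsub ((q / ‖y‖) • y) (by
      rw [qf_smul_vec, div_pow, div_mul_eq_mul_div, div_lt_iff₀ (by positivity)]; linarith)
    have b2 := hSq _ b1.1 b1.2
    rw [add_sub_cancel_left, norm_smul, Real.norm_of_nonneg (by positivity), div_mul_cancel₀ _ hyp.ne'] at b2
    exact lt_irrefl _ b2
theorem modCont_nonneg (f : Euc n → ℝ) (U : Set (Euc n)) (q : ℝ) : 0 ≤ modCont f U q :=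
  Real.sSup_nonneg (by rintro c ⟨x, _, y, _, _, rfl⟩; positivity)

theorem modCont_bdd {f : Euc n → ℝ} {U : Set (Euc n)} {F : ℝ} (h : ∀ z ∈ U, 1 ≤ f z ∧ f z ≤ F) (q : ℝ) :
    BddAbove {c : ℝ | ∃ x ∈ U, ∃ y ∈ U, dist x y ≤ q ∧ c = |f x - f y|} :=
  ⟨F, by
    rintro c ⟨x, hx, y, hy, _, rfl⟩
    have h1 := h x hx
    have h2 := h y hy
    exact abs_le.2 ⟨by linarith, by linarith⟩⟩

theorem le_modCont {f : Euc n → ℝ} {U : Set (Euc n)} {F q : ℝ} (h : ∀ z ∈ U, 1 ≤ f z ∧ f z ≤ F) {x y : Euc n} (hx : x ∈ U) (hy : y ∈ U) (hd : dist x y ≤ q) :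
    |f x - f y| ≤ modCont f U q := le_csSup (modCont_bdd h q) ⟨x, hx, y, hy, hd, rfl⟩

theorem modCont_mono {f : Euc n → ℝ} {U : Set (Euc n)} {F : ℝ} (h : ∀ z ∈ U, 1 ≤ f z ∧ f z ≤ F) : Monotone (modCont f U) := fun a b hab => by
  refine Real.sSup_le ?_ (modCont_nonneg f U b)
  rintro c ⟨x, hx, y, hy, hd, rfl⟩
  exact le_modCont h hx hy (hd.trans hab)

/-- dyadic sums are bounded by the Dini integral -/
theorem dini_sum {ω : ℝ → ℝ} (hω : Monotone ω) (h0 : ∀ q, 0 ≤ ω q) {q d : ℝ} (hq : 0 < q) (hd : 0 < d) {k : ℕ} (hk : d ≤ q / 2 ^ k) :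
    ∑ j ∈ Finset.range k, ω (q / 2 ^ (j + 1)) ≤ 2 * ∫ t in Set.Ioc d q, ω t / t := by
  have hIntble : ∀ a b, 0 < a → 0 < b → IntervalIntegrable (fun t => ω t / t) volume a b := fun a b ha hb => by
    have hpos : ∀ t ∈ Set.uIcc a b, 0 < t := fun t ht => (lt_min ha hb).trans_le ht.1
    exact (hω.intervalIntegrable).mul_continuousOn (g := fun t => t⁻¹) (continuousOn_inv₀.mono fun t ht => (hpos t ht).ne')
  have hmain : ∀ i : ℕ, ∑ j ∈ Finset.range i, ω (q / 2 ^ (j + 1)) ≤ 2 * ∫ t in (q / 2 ^ i)..q, ω t / t := by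
    intro i
    induction i with
    | zero => simp
    | succ i ih =>
      have e : q / 2 ^ i = 2 * (q / 2 ^ (i + 1)) := by rw [pow_succ]; field_simp
      set s := q / 2 ^ (i + 1) with hs
      have hsp : 0 < s := by positivity
      rw [e] at ih
      rw [Finset.sum_range_succ, ← intervalIntegral.integral_add_adjacent_intervals (hIntble s (2 * s) hsp (by positivity)) (hIntble (2 * s) q (by positivity) hq)]
      have h1 : ∫ t in s..(2 * s), ω s / (2 * s) ≤ ∫ t in s..(2 * s), ω t / t := by
        refine intervalIntegral.integral_mono_on (by linarith) (by simp) (hIntble s (2 * s) hsp (by positivity)) fun t ht => ?_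
        have : 0 < t := hsp.trans_le ht.1
        exact div_le_div₀ (h0 _) (hω ht.1) this ht.2
      rw [intervalIntegral.integral_const, smul_eq_mul] at h1
      have h2 : (2 * s - s) * (ω s / (2 * s)) = ω s / 2 := by field_simp; ring
      linarith
  have hkq : q / 2 ^ k ≤ q := div_le_self hq.le (one_le_pow₀ (by norm_num))
  refine (hmain k).trans ?_
  rw [intervalIntegral.integral_of_le hkq]
  refine mulL (setIntegral_mono_set ?_ ?_ (Set.Ioc_subset_Ioc_left hk).eventuallyLE) (by norm_num)
  · exact (intervalIntegrable_iff_integrableOn_Ioc_of_le (hk.trans hkq)).1 (hIntble d q hd hq)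
  · filter_upwards [ae_restrict_mem measurableSet_Ioc] with t ht
    exact div_nonneg (h0 t) (hd.trans ht.1).le
set_option maxHeartbeats 1000000 in
/-- Main theorem, first-derivative estimate: interior modulus-of-continuity estimate for
`D v` in terms of the modulus of continuity `ω_f` of the right-hand side. -/
theorem main_gradient_estimate (n : ℕ) (hn : 2 ≤ n) :
    ∃ Cmc β β₁ Cbar : ℝ, 0 < Cmc ∧ 0 < β ∧ 0 < β₁ ∧ 0 < Cbar ∧
      ∀ fmax : ℝ, ∃ a : ℝ, 0 < a ∧
        ∀ ρ : ℝ, 0 < ρ → ∃ K : ℝ, 0 < K ∧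
          ∀ (Ω : Set (Euc n)) (v f : Euc n → ℝ),
            IsOpen Ω → Convex ℝ Ω →
            Metric.ball 0 1 ⊆ Ω → Ω ⊆ Metric.ball 0 (n : ℝ) →
            ContDiffOn ℝ 2 v Ω → ContinuousOn v (closure Ω) → ConvexOn ℝ Ω v →
            (∀ z ∈ Ω, hessDet v z = f z ^ n) →
            (∀ z ∈ frontier Ω, v z = 0) →
            (∀ z ∈ Ω, 1 ≤ f z ∧ f z ≤ fmax) →
            ∀ qin : ℝ, 0 < qin → qin ≤ ρ →
              modCont f (innerSet Ω (ρ - qin)) qin ≤ Cmc →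
              ∀ Qin : ℝ, Qin = K * qin ^ (-a) →
                ∀ x ∈ innerSet Ω ρ, ∀ x' ∈ innerSet Ω ρ, x ≠ x' →
                  ∀ Ed : ℝ,
                    Ed = Real.exp
                        (β * ∫ q in Set.Ioc (Cbar * ‖x - x'‖) qin, modCont f Ω q / q) →
                    (Qin * ‖x - x'‖ < 1 →
                      ‖gradient v x - gradient v x'‖ / ‖x - x'‖ ≤
                        Qin * (Ed + Ed ^ β₁ * modCont f Ω (Qin * Ed * ‖x - x'‖))) ∧
                    (1 ≤ Qin * ‖x - x'‖ →
                      ‖gradient v x - gradient v x'‖ / ‖x - x'‖ ≤ Qin) := by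
  have hn0 : n ≠ 0 := by omega
  obtain ⟨ε0, δ0, μ, C, e0, e1, d0, d1, m0, m1, c0, cd, imp⟩ := improve hn0
  have I : Imp n ε0 δ0 μ C := ⟨e0, e1, d0, d1, m0, m1, c0, cd, imp⟩
  obtain ⟨e, he, hstart⟩ := start_flat I hn
  refine ⟨min e (min (ε0 * δ0) (ε0 / (8 * C))), 4 * C / ε0, 1, 1, by positivity, by positivity, one_pos, one_pos, fun fmax => ?_⟩
  set Cmc := min e (min (ε0 * δ0) (ε0 / (8 * C)))
  have hCm0 : 0 < Cmc := by positivity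
  have hCm1 : Cmc ≤ e := min_le_left _ _
  have hCm2 : Cmc ≤ ε0 * δ0 := (min_le_right _ _).trans (min_le_left _ _)
  have hCm3 : Cmc ≤ ε0 / (8 * C) := (min_le_right _ _).trans (min_le_right _ _)
  set F := |fmax| + 1 with hF
  obtain ⟨m, hm⟩ := hstart F (by positivity)
  refine ⟨((2 * m + 1 : ℕ) : ℝ), by positivity, fun ρ hρ => ?_⟩
  obtain ⟨K, hK1, hK⟩ := hm ρ hρ
  set G : ℝ := F / 2 * n ^ 2 / ρ with hG
  have hGp : 0 ≤ G := by positivity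
  refine ⟨(72 / μ + 4 * G) * K * ρ ^ (m + 1) + (72 / μ * K) ^ 2 * ρ ^ 2, by positivity, ?_⟩
  set K' := (72 / μ + 4 * G) * K * ρ ^ (m + 1) + (72 / μ * K) ^ 2 * ρ ^ 2 with hK'
  intro Ω v f ho hcv hb1 hbn hv2 hvc hcvx hdet hzero hf q hq hqρ hmc Q hQ x hx x' hx' hne Ed hEd
  obtain ⟨hsol, hpea⟩ := sol_of_C2 ho hv2 hcvx hdet (fun z hz => by linarith [(hf z hz).1])
  have D : Dom Ω v f F := ⟨⟨hsol, isBounded_ball.subset hbn, hvc, hzero⟩, hb1, hbn, fun z hz => (hf z hz).1,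
    fun z hz => by linarith [(hf z hz).2, le_abs_self fmax]⟩
  obtain ⟨H, hP⟩ := hpea x hx.1
  obtain ⟨H', hP'⟩ := hpea x' hx'.1
  set X := q⁻¹ with hX
  have hXp : 0 < X := by positivity
  have hXρ : 1 ≤ X * ρ := by rw [hX, inv_mul_eq_div, one_le_div hq]; exact hqρ
  have hQX : Q = K' * X ^ (2 * m + 1) := by rw [hQ, Real.rpow_neg hq.le, Real.rpow_natCast, hX, inv_pow]
  set Λ := K * X ^ m with hΛ
  have hΛp : 0 < Λ := by positivity
  have hQ1 : 72 / μ * Λ + 4 * G * Λ ≤ Q ∧ (72 / μ * Λ) ^ 2 * ρ ≤ Q := by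
    have a1 : (72 / μ + 4 * G) * K * X ^ m ≤ (72 / μ + 4 * G) * K * X ^ m * (X * ρ) ^ (m + 1) := le_mul_of_one_le_right (by positivity) (one_le_pow₀ hXρ)
    have a2 : (72 / μ * K * X ^ m) ^ 2 * ρ ≤ (72 / μ * K * X ^ m) ^ 2 * ρ * (X * ρ) := le_mul_of_one_le_right (by positivity) hXρ
    have a3 : Q = (72 / μ + 4 * G) * K * X ^ m * (X * ρ) ^ (m + 1) + (72 / μ * K * X ^ m) ^ 2 * ρ * (X * ρ) := by rw [hQX, hK']; ring
    have a4 : 0 ≤ (72 / μ + 4 * G) * K * X ^ m * (X * ρ) ^ (m + 1) := by positivity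
    have a5 : 0 ≤ (72 / μ * K * X ^ m) ^ 2 * ρ * (X * ρ) := by positivity
    have a6 : 72 / μ * Λ + 4 * G * Λ = (72 / μ + 4 * G) * K * X ^ m := by rw [hΛ]; ring
    have a7 : (72 / μ * Λ) ^ 2 * ρ = (72 / μ * K * X ^ m) ^ 2 * ρ := by rw [hΛ]; ring
    constructor <;> linarith
  obtain ⟨hQ1, hQ2⟩ := hQ1
  have hΛ1 : 0 < 72 / μ * Λ := by positivity
  have hΛ2 : 0 ≤ 4 * G * Λ := by positivity
  have hQp : 0 < Q := by linarith
  have hd : 0 < ‖x - x'‖ := norm_pos_iff.2 (sub_ne_zero.2 hne)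
  set d := ‖x - x'‖ with hdd
  have hloc : ∀ z ∈ Ω, ‖z - x‖ ≤ q → |f z - f x| ≤ Cmc := fun z hz hzx => by
    have h1 := Metric.infDist_le_infDist_add_dist (s := frontier Ω) (x := x) (y := z)
    have h2 := hx.2
    rw [dist_comm, dist_eq_norm] at h1
    exact (le_modCont (U := innerSet Ω (ρ - q)) (F := fmax) (fun w hw => hf w hw.1) ⟨hz, by linarith⟩ ⟨hx.1, by linarith⟩ (by rwa [dist_eq_norm])).trans hmc
  obtain ⟨N, r, FL, hN, hr1, hNl⟩ := hK Ω v f x _ H q D hx hP hq hqρ fun z hz hzx => (hloc z hz hzx.le).trans hCm1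
  set ω := modCont f Ω
  have hωm : Monotone ω := modCont_mono hf
  have hω0 : ∀ t, 0 ≤ ω t := modCont_nonneg f Ω
  rw [one_mul] at hEd
  have hEd1 : 1 ≤ Ed := by
    rw [hEd]
    refine Real.one_le_exp (mul_nonneg (by positivity) (setIntegral_nonneg measurableSet_Ioc fun t ht => div_nonneg (hω0 t) (hd.trans ht.1).le))
  have key : ‖gradient v x - gradient v x'‖ / d ≤ Q * Ed ∧ (1 ≤ Q * d → ‖gradient v x - gradient v x'‖ / d ≤ Q) := by
    by_cases hy : qf N (x' - x) < r ^ 2 / 4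
    · have hP2 : Pea v (x + (x' - x)) (gradient v x') H' := by rw [add_sub_cancel]; exact hP'
      obtain ⟨k, hk1, hk2⟩ := iterate I hn0 hsol (hf x hx.1).1 FL hΛp hq hN hNl (m := fun j => min (ω (q / 2 ^ j)) Cmc) (fun j => le_min (hω0 _) hCm0.le)
        (fun j => (min_le_right _ _).trans hCm2) (fun j y hy hyU => le_min (le_modCont hf hyU hx.1 (by rwa [dist_eq_norm, add_sub_cancel_left]))
          (hloc _ hyU (by rw [add_sub_cancel_left]; exact hy.trans (div_le_self hq.le (one_le_pow₀ (by norm_num)))))) hP hP2 hy (sub_ne_zero.2 hne.symm)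
      rw [norm_sub_rev x' x, ← hdd] at hk1 hk2
      rw [div_le_iff₀ hd, div_le_iff₀ hd]
      set Sg := ∑ j ∈ Finset.range k, min (ω (q / 2 ^ (j + 1))) Cmc
      have hbeta : 0 < 2 * C / ε0 := by positivity
      constructor
      · have h1 : Sg ≤ 2 * ∫ t in Set.Ioc d q, ω t / t := (Finset.sum_le_sum fun j _ => min_le_left _ _).trans (dini_sum hωm hω0 hq hd hk1)
        have h2 : Real.exp (2 * C / ε0 * Sg) ≤ Ed := by
          rw [hEd]
          refine Real.exp_le_exp.2 ((mulL h1 hbeta.le).trans_eq ?_)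
          ring
        refine hk2.trans (mulR ?_ hd.le)
        exact mul_le_mul (by linarith) h2 (Real.exp_pos _).le hQp.le
      · intro hQd
        have h1 : Sg ≤ k * (ε0 / (8 * C)) := by
          calc Sg ≤ ∑ j ∈ Finset.range k, ε0 / (8 * C) := Finset.sum_le_sum fun j _ => (min_le_right _ _).trans hCm3
            _ = _ := by simp
        have h2 : 2 * C / ε0 * Sg ≤ k * (1 / 4) := by
          refine (mulL h1 hbeta.le).trans_eq ?_
          field_simp; ring
        have h3 : Real.exp (2 * C / ε0 * Sg) ≤ Real.exp (1 / 4) ^ k := by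
          rw [← Real.exp_nat_mul]; exact Real.exp_le_exp.2 h2
        have h4 : Real.exp (1 / 4) ^ 2 ≤ 2 := by
          have a1 : (Real.exp (1 / 4) ^ 2) ^ 2 = Real.exp 1 := by rw [← pow_mul, ← Real.exp_nat_mul]; norm_num
          have a2 := Real.exp_one_lt_d9
          exact (abs_le_of_sq_le_sq' (by rw [a1]; linarith) (by norm_num)).2
        have h5 : (Real.exp (2 * C / ε0 * Sg)) ^ 2 ≤ ρ * Q := by
          calc (Real.exp (2 * C / ε0 * Sg)) ^ 2 ≤ (Real.exp (1 / 4) ^ k) ^ 2 := by gcongr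
            _ = (Real.exp (1 / 4) ^ 2) ^ k := by rw [← pow_mul, ← pow_mul, mul_comm]
            _ ≤ 2 ^ k := by gcongr
            _ ≤ q / d := by
              rw [le_div_iff₀ hd]
              rw [le_div_iff₀ (by positivity)] at hk1; linarith
            _ ≤ ρ * Q := by
              rw [div_le_iff₀ hd, mul_assoc]
              exact hqρ.trans (le_mul_of_one_le_right hρ.le hQd)
        have h6 : (72 / μ * Λ * Real.exp (2 * C / ε0 * Sg)) ^ 2 ≤ Q ^ 2 := by
          rw [mul_pow]
          calc _ ≤ (72 / μ * Λ) ^ 2 * (ρ * Q) := by gcongr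
            _ = (72 / μ * Λ) ^ 2 * ρ * Q := by ring
            _ ≤ Q * Q := by gcongr
            _ = _ := by ring
        exact hk2.trans (mulR (abs_le_of_sq_le_sq' h6 hQp.le).2 hd.le)
    · push Not at hy
      have h1 := hN (x' - x)
      rw [norm_sub_rev, ← hdd] at h1
      have h2 : (1 / 2) ^ 2 ≤ (Λ * d) ^ 2 := by
        have := mulL (hy.trans h1) hΛp.le
        nlinarith
      have h3 : 1 / 2 ≤ Λ * d := (abs_le_of_sq_le_sq' h2 (by positivity)).2
      have h4 : ∀ w ∈ innerSet Ω ρ, ‖gradient v w‖ ≤ G := fun w hw => by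
        obtain ⟨H2, hPw⟩ := hpea w hw.1
        rw [hG, le_div_iff₀ hρ]
        exact (D.pt hn0 hρ hw hPw).2.1
      have h5 : ‖gradient v x - gradient v x'‖ / d ≤ Q := by
        rw [div_le_iff₀ hd]
        have a1 := (norm_sub_le _ _).trans (add_le_add (h4 x hx) (h4 x' hx'))
        have a2 : G * (1 / 2) ≤ G * (Λ * d) := by gcongr
        have a3 : 4 * G * Λ * d ≤ Q * d := by gcongr; linarith
        linarith
      exact ⟨h5.trans (le_mul_of_one_le_right hQp.le hEd1), fun _ => h5⟩
  refine ⟨fun _ => key.1.trans ?_, key.2⟩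
  gcongr
  have := mul_nonneg (Real.rpow_nonneg (by linarith : 0 ≤ Ed) 1) (hω0 (Q * Ed * d))
  linarith
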